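/- Suppose L(T) → ∞ and L(T)/log T → 0 as T → ∞. Then for every real x, lim_{T→∞} (1/T)·∫_{{τ : S_{L(T)}(τ)/σ_{L(T)} < x}} w(τ/T) dτ = (1/√(2π))·∫_{−∞}^x e^{−u²/2} du; that is, with respect to the smooth probability averaging P_{w,T}, the normalized sum S_L/σ_L converges in distribution to a standard Gaussian. -/

import Mathlib

open MeasureTheory Filter

/-- `N(n) = ((n + √(n²−4))/2)²`, the norm of a hyperbolic class of trace `n`. -/
noncomputable def Nnorm (n : ℕ) : ℝ := (((n : ℝ) + Real.sqrt ((n : ℝ) ^ 2 - 4)) / 2) ^ 2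
/-- Value of the integral binary quadratic form `(a,b,c)` at `(x,y)`. -/
def formVal (f : ℤ × ℤ × ℤ) (x y : ℤ) : ℤ := f.1 * x ^ 2 + f.2.1 * x * y + f.2.2 * y ^ 2

/-- A form `ax² + bxy + cy²` is primitive if `gcd(a,b,c) = 1`. -/
def IsPrimitiveForm (f : ℤ × ℤ × ℤ) : Prop := Int.gcd f.1 (Int.gcd f.2.1 f.2.2) = 1

/-- Discriminant `b² − 4ac` of the form `(a,b,c)`. -/
def formDisc (f : ℤ × ℤ × ℤ) : ℤ := f.2.1 ^ 2 - 4 * f.1 * f.2.2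

/-- `SL(2,ℤ)`-equivalence of binary quadratic forms:
`Q'(x,y) = Q(αx + βy, γx + δy)` for some `[[α,β],[γ,δ]] ∈ SL(2,ℤ)`. -/
def formEquiv (f g : ℤ × ℤ × ℤ) : Prop :=
  ∃ M : Matrix.SpecialLinearGroup (Fin 2) ℤ,
    ∀ x y : ℤ, formVal g x y =
      formVal f (M.1 0 0 * x + M.1 0 1 * y) (M.1 1 0 * x + M.1 1 1 * y)

/-- The class number `h(d)`: the number of `SL(2,ℤ)`-equivalence classes of
primitive integral binary quadratic forms of discriminant `d`. -/
noncomputable def classNumber (d : ℤ) : ℕ :=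
  Nat.card (Quot (fun f g : {f : ℤ × ℤ × ℤ // IsPrimitiveForm f ∧ formDisc f = d} =>
    formEquiv f.1 g.1))
/-- `t_d`: the least `t ≥ 1` such that `t² − d u² = 4` has a solution with `u ≥ 1`. -/
noncomputable def td (d : ℤ) : ℕ :=
  sInf {t : ℕ | 0 < t ∧ ∃ u : ℕ, 0 < u ∧ (t : ℤ) ^ 2 - d * (u : ℤ) ^ 2 = 4}

/-- `u_d`: the positive `u` corresponding to `t_d`. -/
noncomputable def ud (d : ℤ) : ℕ :=
  sInf {u : ℕ | 0 < u ∧ (td d : ℤ) ^ 2 - d * (u : ℤ) ^ 2 = 4}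

/-- `ε_d = (t_d + u_d √d)/2`, the fundamental solution of `t² − d u² = 4`. -/
noncomputable def eps (d : ℤ) : ℝ := ((td d : ℝ) + (ud d : ℝ) * Real.sqrt (d : ℝ)) / 2
/-- `A(n) = Σ h(d)·log(ε_d)/(u·√d)`, summed over pairs `(d,u)` of positive integers with
`d ≡ 0, 1 (mod 4)` and `d·u² = n² − 4`. -/
noncomputable def ampA (n : ℕ) : ℝ :=
  ∑ p ∈ (Finset.range (n ^ 2) ×ˢ Finset.range (n ^ 2)).filter
      (fun p => 0 < p.1 ∧ 0 < p.2 ∧ (p.1 % 4 = 0 ∨ p.1 % 4 = 1) ∧ p.1 * p.2 ^ 2 = n ^ 2 - 4),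
    (classNumber (p.1 : ℤ) : ℝ) * Real.log (eps (p.1 : ℤ)) /
      ((p.2 : ℝ) * Real.sqrt (p.1 : ℝ))
/-- `κ = (1015/864)·∏_{p ≠ 2 prime} (1 + (p⁴ − 2p³ + 1)/(p² − 1)³)`. -/
noncomputable def kappa : ℝ :=
  (1015 / 864) * ∏' p : {p : ℕ // p.Prime ∧ p ≠ 2},
    (1 + ((p.1 : ℝ) ^ 4 - 2 * (p.1 : ℝ) ^ 3 + 1) / ((p.1 : ℝ) ^ 2 - 1) ^ 3)
/-- The hyperbolic-class sum
`S_L(τ) = (1/(πL)) Σ_{n>2} A(n)·g(log N(n)/(2πL))·2cos(τ·log N(n))`. -/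
noncomputable def SL (g : ℝ → ℝ) (L τ : ℝ) : ℝ :=
  (1 / (Real.pi * L)) * ∑' n : ℕ,
    if 2 < n then
      ampA n * g (Real.log (Nnorm n) / (2 * Real.pi * L)) *
        (2 * Real.cos (τ * Real.log (Nnorm n)))
    else 0
/-- `σ_L² = (2κ/(πL))·∫₀^∞ g(u)²·e^{πLu} du`. -/
noncomputable def sigmaSq (g : ℝ → ℝ) (L : ℝ) : ℝ :=
  (2 * kappa / (Real.pi * L)) * ∫ u in Set.Ioi (0 : ℝ), g u ^ 2 * Real.exp (Real.pi * L * u)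

namespace CMD
open Finset (Ioc range sum_congr mul_sum abs_sum_le_sum_abs sum_le_sum mem_Ioc mem_range mem_filter sum_range_succ)
open Real (exp)

open Topology in
/-- the hyperbolic sector -/
def sec (E : ℝ) : Set (Fin 2 → ℝ) := {x | 0 < x 0 ∧ x 0 ≤ x 1 ∧ x 1 < E * x 0}

lemma sec_le_frontier (E : ℝ) :
    volume (frontier {x : Fin 2 → ℝ | x ∈ sec E ∧ x 0 * x 1 ≤ 1}) = 0 := by
  set Z : Set (ℝ × ℝ) := {p | p.1 = 0 ∨ p.2 = p.1 ∨ p.2 = E * p.1 ∨ p.1 * p.2 = 1} with hZ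
  have hZm : MeasurableSet Z := by
    apply MeasurableSet.union (measurableSet_eq_fun (by fun_prop) (by fun_prop))
    apply MeasurableSet.union (measurableSet_eq_fun (by fun_prop) (by fun_prop))
    apply MeasurableSet.union (measurableSet_eq_fun (by fun_prop) (by fun_prop))
    exact (measurableSet_eq_fun (by fun_prop) (by fun_prop))
  have hZ0 : volume Z = 0 := by
    rw [Measure.volume_eq_prod, Measure.measure_prod_null hZm]
    have : ∀ᵐ x : ℝ, x ≠ 0 := by
      simp [ae_iff, measure_singleton]
    filter_upwards [this] with x hx
    have : Prod.mk x ⁻¹' Z ⊆ {x, E * x, x⁻¹} := by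
      intro y hy
      simp only [hZ, Set.mem_preimage, Set.mem_ofPred_eq] at hy
      rcases hy with h | h | h | h
      · exact absurd h hx
      · simp [h]
      · simp [h]
      · right; right; simp; field_simp; linarith
    exact measure_mono_null this (Set.Finite.measure_zero (by simp) _)
  have hpre : volume ((MeasurableEquiv.finTwoArrow (α := ℝ)) ⁻¹' Z) = 0 := by
    rw [(volume_preserving_finTwoArrow ℝ).measure_preimage hZm.nullMeasurableSet]
    exact hZ0
  refine measure_mono_null ?_ hpre
  have e : {x : Fin 2 → ℝ | x ∈ sec E ∧ x 0 * x 1 ≤ 1} =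
      (({x : Fin 2 → ℝ | (fun _ => (0:ℝ)) x < x 0} ∩ {x | x 0 ≤ x 1}) ∩ {x | x 1 < E * x 0}) ∩
        {x | x 0 * x 1 ≤ (fun _ => (1:ℝ)) x} := by
    ext x; simp [sec, and_assoc]
  rw [e]
  intro x hx
  simp only [Set.mem_preimage, hZ, MeasurableEquiv.finTwoArrow_apply, Set.mem_ofPred_eq]
  rcases frontier_inter_subset _ _ hx with ⟨h1, -⟩ | ⟨-, h1⟩
  · rcases frontier_inter_subset _ _ h1 with ⟨h2, -⟩ | ⟨-, h2⟩
    · rcases frontier_inter_subset _ _ h2 with ⟨h3, -⟩ | ⟨-, h3⟩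
      · left
        exact (frontier_lt_subset_eq (by fun_prop) (by fun_prop) h3).symm
      · right; left
        exact (frontier_le_subset_eq (by fun_prop) (by fun_prop) h3).symm
    · right; right; left
      exact (frontier_lt_subset_eq (by fun_prop) (by fun_prop) h2)
  · right; right; right
    exact (frontier_le_subset_eq (by fun_prop) (by fun_prop) h1)

lemma sec_meas (E : ℝ) : MeasurableSet {x : Fin 2 → ℝ | x ∈ sec E ∧ x 0 * x 1 ≤ 1} := by
  have e : {x : Fin 2 → ℝ | x ∈ sec E ∧ x 0 * x 1 ≤ 1} =
      (({x : Fin 2 → ℝ | 0 < x 0} ∩ {x | x 0 ≤ x 1}) ∩ {x | x 1 < E * x 0}) ∩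
        {x | x 0 * x 1 ≤ 1} := by
    ext x; simp [sec, and_assoc]
  rw [e]
  refine (((measurableSet_lt (by fun_prop) (by fun_prop)).inter
    (measurableSet_le (by fun_prop) (by fun_prop))).inter
    (measurableSet_lt (by fun_prop) (by fun_prop))).inter
    (measurableSet_le (by fun_prop) (by fun_prop))

lemma sec_volume (E : ℝ) (hE : 1 < E) :
    volume.real {x : Fin 2 → ℝ | x ∈ sec E ∧ x 0 * x 1 ≤ 1} = Real.log E / 2 := by
  have hE0 : 0 < E := by linarith
  set Z : Set (ℝ × ℝ) := {p | (0 < p.1 ∧ p.1 ≤ p.2 ∧ p.2 < E * p.1) ∧ p.1 * p.2 ≤ 1} with hZ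
  have hZm : MeasurableSet Z := by
    have e : Z = (({x : ℝ × ℝ | 0 < x.1} ∩ {x | x.1 ≤ x.2}) ∩ {x | x.2 < E * x.1}) ∩
        {x | x.1 * x.2 ≤ 1} := by
      ext x; simp [hZ, and_assoc]
    rw [e]
    refine (((measurableSet_lt (by fun_prop) (by fun_prop)).inter
      (measurableSet_le (by fun_prop) (by fun_prop))).inter
      (measurableSet_lt (by fun_prop) (by fun_prop))).inter
      (measurableSet_le (by fun_prop) (by fun_prop))
  have e : {x : Fin 2 → ℝ | x ∈ sec E ∧ x 0 * x 1 ≤ 1} =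
    (MeasurableEquiv.finTwoArrow (α := ℝ)) ⁻¹' Z := by
    ext x; simp [sec, hZ]
  set r := (Real.sqrt E)⁻¹ with hr
  have hs1 : 1 < Real.sqrt E := by
    rw [show (1:ℝ) = Real.sqrt 1 by simp]; exact Real.sqrt_lt_sqrt (by norm_num) hE
  have hss : Real.sqrt E * Real.sqrt E = E := Real.mul_self_sqrt hE0.le
  have hr0 : 0 < r := by positivity
  have hr1 : r < 1 := inv_lt_one_of_one_lt₀ hs1
  have hrE : E * r ^ 2 = 1 := by
    rw [hr]; field_simp; nlinarith
  set f : ℝ → ℝ := fun t => (if t ≤ r then (E - 1) * t else 1 / t - t) with hf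
  have hsec : ∀ t : ℝ, volume (Prod.mk t ⁻¹' Z) =
      (Set.Ioc (0:ℝ) 1).indicator (fun t => ENNReal.ofReal (f t)) t := by
    intro t
    by_cases ht : t ∈ Set.Ioc (0:ℝ) 1
    · rw [Set.indicator_of_mem ht]
      obtain ⟨h0, h1⟩ := ht
      simp only [hf]
      split_ifs with htr
      · have hle : E * t ^ 2 ≤ 1 := by
          rw [← hrE]; gcongr
        have : Prod.mk t ⁻¹' Z = Set.Ico t (E * t) := by
          ext y
          simp only [hZ, Set.mem_preimage, Set.mem_ofPred_eq, Set.mem_Ico]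
          constructor
          · tauto
          · intro h; refine ⟨⟨h0, h⟩, ?_⟩
            nlinarith [h.2]
        rw [this, Real.volume_Ico]; congr 1; ring
      · push Not at htr
        have hle : 1 < E * t ^ 2 := by
          rw [← hrE]; gcongr
        have : Prod.mk t ⁻¹' Z = Set.Icc t (1 / t) := by
          ext y
          simp only [hZ, Set.mem_preimage, Set.mem_ofPred_eq, Set.mem_Icc, le_div_iff₀ h0]
          constructor
          · intro h; exact ⟨h.1.2.1, by linarith [h.2]⟩
          · intro h; refine ⟨⟨h0, h.1, ?_⟩, by linarith [h.2]⟩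
            by_contra hc
            push Not at hc
            nlinarith [h.2]
        rw [this, Real.volume_Icc]
    · rw [Set.indicator_of_notMem ht]
      have : Prod.mk t ⁻¹' Z = ∅ := by
        ext y
        simp only [hZ, Set.mem_preimage, Set.mem_ofPred_eq, Set.mem_empty_iff_false, iff_false]
        rintro ⟨⟨h0, h1, -⟩, h2⟩
        apply ht
        refine ⟨h0, ?_⟩
        nlinarith
      rw [this]; simp
  have hfnn : ∀ t ∈ Set.Ioc (0:ℝ) 1, 0 ≤ f t := by
    intro t ⟨h0, h1⟩
    simp only [hf]
    split_ifs
    · have : 0 ≤ E - 1 := by linarith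
      positivity
    · have : 1 ≤ 1 / t := by rw [le_div_iff₀ h0]; linarith
      linarith
  have hI1 : IntervalIntegrable f volume 0 r := by
    have : IntervalIntegrable (fun t => (E - 1) * t) volume 0 r :=
      Continuous.intervalIntegrable (by fun_prop) _ _
    refine this.congr ?_
    rw [Set.uIoc_of_le hr0.le]
    intro t ht
    simp [hf, ht.2]
  have hI2 : IntervalIntegrable f volume r 1 := by
    have : IntervalIntegrable (fun t : ℝ => 1 / t - t) volume r 1 := by
      apply ContinuousOn.intervalIntegrable
      rw [Set.uIcc_of_le hr1.le]
      intro t ht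
      have : t ≠ 0 := by linarith [ht.1]
      fun_prop (disch := assumption)
    refine this.congr ?_
    rw [Set.uIoc_of_le hr1.le]
    intro t ht
    simp [hf, not_le.mpr ht.1]
  have hint : IntegrableOn f (Set.Ioc 0 1) := by
    rw [← intervalIntegrable_iff_integrableOn_Ioc_of_le zero_le_one]
    exact hI1.trans hI2
  rw [e, measureReal_def, (volume_preserving_finTwoArrow ℝ).measure_preimage hZm.nullMeasurableSet,
    Measure.volume_eq_prod, Measure.prod_apply hZm]
  simp_rw [hsec]
  rw [lintegral_indicator measurableSet_Ioc, ← ofReal_integral_eq_lintegral_ofReal hint]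
  · rw [ENNReal.toReal_ofReal (setIntegral_nonneg measurableSet_Ioc hfnn),
      ← intervalIntegral.integral_of_le zero_le_one,
      ← intervalIntegral.integral_add_adjacent_intervals hI1 hI2]
    have e1 : ∫ t in (0:ℝ)..r, f t = ∫ t in (0:ℝ)..r, (E - 1) * t := by
      apply intervalIntegral.integral_congr
      rw [Set.uIcc_of_le hr0.le]
      intro t ht
      simp [hf, ht.2]
    have e2 : ∫ t in r..1, f t = ∫ t in r..1, (1 / t - t) := by
      apply intervalIntegral.integral_congr_ae
      rw [Set.uIoc_of_le hr1.le]
      filter_upwards with t ht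
      simp [hf, not_le.mpr ht.1]
    rw [e1, e2, intervalIntegral.integral_sub, integral_one_div_of_pos hr0 one_pos]
    · have e3 : ∫ t in (0:ℝ)..r, (E - 1) * t = (E - 1) * (r ^ 2 / 2) := by
        rw [intervalIntegral.integral_const_mul, integral_id]; ring
      rw [e3, integral_id, hr, one_div, inv_inv, Real.log_sqrt hE0.le]
      rw [← hr]
      ring_nf
      nlinarith
    · apply ContinuousOn.intervalIntegrable
      rw [Set.uIcc_of_le hr1.le]
      intro t ht
      have : t ≠ 0 := by linarith [ht.1]
      fun_prop (disch := assumption)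
    · exact Continuous.intervalIntegrable (by fun_prop) _ _
  · filter_upwards [self_mem_ae_restrict measurableSet_Ioc] with t ht using hfnn t ht

/-- Lattice points in a hyperbolic sector. -/
lemma sector_count (a b c d : ℤ) (ha : 0 < a) (hd : b ^ 2 - 4 * a * c = d) (hd0 : 0 < d)
    (E : ℝ) (hE : 1 < E) :
    Tendsto (fun X : ℝ => (Nat.card {v : ℤ × ℤ |
      ((0:ℝ) < a * v.1 + (b - Real.sqrt d) / 2 * v.2 ∧
       (a * v.1 + (b - Real.sqrt d) / 2 * v.2 : ℝ) ≤ a * v.1 + (b + Real.sqrt d) / 2 * v.2 ∧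
       (a * v.1 + (b + Real.sqrt d) / 2 * v.2 : ℝ) <
         E * (a * v.1 + (b - Real.sqrt d) / 2 * v.2)) ∧
       (formVal (a, b, c) v.1 v.2 : ℝ) ≤ X} : ℝ) / X) atTop
      (nhds (Real.log E / (2 * Real.sqrt d))) := by
  have haR : (0:ℝ) < a := by exact_mod_cast ha
  have hdR : (0:ℝ) < d := by exact_mod_cast hd0
  have hsd : 0 < Real.sqrt d := Real.sqrt_pos.mpr hdR
  have hsq : Real.sqrt d * Real.sqrt d = d := Real.mul_self_sqrt hdR.le
  have hdR' : (b:ℝ) ^ 2 - 4 * a * c = d := by exact_mod_cast hd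
  let M : Matrix (Fin 2) (Fin 2) ℝ :=
    !![(a:ℝ), a; (b - Real.sqrt d) / 2, (b + Real.sqrt d) / 2]
  have hdet : M.det = a * Real.sqrt d := by
    simp [M, Matrix.det_fin_two]; ring
  have hunit : IsUnit M := by
    rw [Matrix.isUnit_iff_isUnit_det, hdet]; exact (mul_pos haR hsd).ne'.isUnit
  have hli : LinearIndependent ℝ M.row := Matrix.linearIndependent_rows_iff_isUnit.mpr hunit
  let B : Module.Basis (Fin 2) ℝ (Fin 2 → ℝ) :=
    basisOfLinearIndependentOfCardEqFinrank hli (by simp)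
  have hB : ⇑B = M.row := by simp [B]
  let Λ : Submodule ℤ (Fin 2 → ℝ) := Submodule.span ℤ (Set.range B)
  let bz : Module.Basis (Fin 2) ℤ Λ := B.restrictScalars ℤ
  have hcov : ZLattice.covolume Λ = a * Real.sqrt d := by
    rw [ZLattice.covolume_eq_det Λ bz]
    have : (Matrix.of ((↑) ∘ bz) : Matrix (Fin 2) (Fin 2) ℝ) = M := by
      ext i j
      have := Module.Basis.restrictScalars_apply ℤ B i
      simp only [Matrix.of_apply, Function.comp, bz]
      rw [this, hB]; rfl
    rw [this, hdet, abs_of_pos (mul_pos haR hsd)]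
  have key := ZLattice.covolume.tendsto_card_le_div (L := Λ) (X := sec E)
    (F := fun x => x 0 * x 1) ?_ ?_ ?_ (sec_meas E) (sec_le_frontier E)
  · rw [show {x : Fin 2 → ℝ | x ∈ sec E ∧ x 0 * x 1 ≤ 1} =
      {x ∈ sec E | x 0 * x 1 ≤ 1} from rfl] at *
    rw [sec_volume E hE, hcov] at key
    have hcomp : Tendsto (fun X : ℝ => a * X) atTop atTop :=
      tendsto_id.const_mul_atTop haR
    have key2 := (key.comp hcomp).const_mul (a:ℝ)
    have : (a:ℝ) * (Real.log E / 2 / (a * Real.sqrt d)) = Real.log E / (2 * Real.sqrt d) := by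
      field_simp
    rw [this] at key2
    refine key2.congr' ?_
    filter_upwards [eventually_gt_atTop 0] with X hX
    have : Nat.card ({x ∈ sec E | x 0 * x 1 ≤ a * X} ∩ Λ : Set (Fin 2 → ℝ)) =
      Nat.card {v : ℤ × ℤ |
      ((0:ℝ) < a * v.1 + (b - Real.sqrt d) / 2 * v.2 ∧
       (a * v.1 + (b - Real.sqrt d) / 2 * v.2 : ℝ) ≤ a * v.1 + (b + Real.sqrt d) / 2 * v.2 ∧
       (a * v.1 + (b + Real.sqrt d) / 2 * v.2 : ℝ) <
         E * (a * v.1 + (b - Real.sqrt d) / 2 * v.2)) ∧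
       (formVal (a, b, c) v.1 v.2 : ℝ) ≤ X} := by
      symm
      let φ : ℤ × ℤ → (Fin 2 → ℝ) := fun v => v.1 • M.row 0 + v.2 • M.row 1
      have hφ0 : ∀ v, φ v 0 = a * v.1 + (b - Real.sqrt d) / 2 * v.2 := by
        intro v; simp [φ, M]; ring
      have hφ1 : ∀ v, φ v 1 = a * v.1 + (b + Real.sqrt d) / 2 * v.2 := by
        intro v; simp [φ, M]; ring
      have hφinj : Function.Injective φ := by
        intro v w h
        have h0 := congrFun h 0
        have h1 := congrFun h 1
        rw [hφ0, hφ0] at h0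
        rw [hφ1, hφ1] at h1
        have h2 : (v.2 : ℝ) = w.2 := by
          have : Real.sqrt d * (v.2 : ℝ) = Real.sqrt d * w.2 := by linarith
          exact mul_left_cancel₀ hsd.ne' this
        have h3 : (v.1 : ℝ) = w.1 := by
          rw [h2] at h0
          have : (a:ℝ) * v.1 = a * w.1 := by linarith
          exact mul_left_cancel₀ haR.ne' this
        exact Prod.ext (by exact_mod_cast h3) (by exact_mod_cast h2)
      rw [← Nat.card_image_of_injective hφinj]
      congr 2
      ext x
      simp only [Set.mem_image, Set.mem_inter_iff, Set.mem_ofPred_eq, sec, SetLike.mem_coe]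
      have hQ : ∀ v : ℤ × ℤ, φ v 0 * φ v 1 = a * (formVal (a, b, c) v.1 v.2 : ℝ) := by
        intro v
        rw [hφ0, hφ1]; simp only [formVal]; push_cast
        have : Real.sqrt d ^ 2 = b ^ 2 - 4 * a * c := by rw [hdR', sq, hsq]
        ring_nf
        rw [this]; ring
      constructor
      · rintro ⟨v, ⟨h1, h2⟩, rfl⟩
        refine ⟨⟨?_, ?_⟩, ?_⟩
        · rw [hφ0, hφ1]; exact h1
        · rw [hQ]; gcongr
        · refine Submodule.add_mem _ (Submodule.smul_mem _ _ (Submodule.subset_span ⟨0, ?_⟩))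
            (Submodule.smul_mem _ _ (Submodule.subset_span ⟨1, ?_⟩)) <;> rw [hB]
      · rintro ⟨⟨h1, h2⟩, h3⟩
        obtain ⟨cc, hcc⟩ := (Submodule.mem_span_range_iff_exists_fun ℤ).mp h3
        have hx : φ (cc 0, cc 1) = x := by
          rw [← hcc, Fin.sum_univ_two, hB]
        refine ⟨(cc 0, cc 1), ⟨?_, ?_⟩, hx⟩
        · rw [← hx, hφ0, hφ1] at h1; exact h1
        · rw [← hx, hQ] at h2
          exact le_of_mul_le_mul_left h2 haR
    simp only [Function.comp]
    rw [this, ← mul_div_assoc, mul_div_mul_left _ _ haR.ne']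
  · rintro x r ⟨h1, h2, h3⟩ hr
    refine ⟨by simp; positivity, by simp; gcongr, ?_⟩
    simp only [Pi.smul_apply, smul_eq_mul]
    nlinarith
  · intro x r hr
    simp; ring
  · refine (Metric.isBounded_iff_subset_closedBall 0).mpr ⟨E + 1, ?_⟩
    rintro x ⟨⟨h1, h2, h3⟩, h4⟩
    have h5 : x 0 ≤ 1 := by nlinarith
    rw [mem_closedBall_zero_iff, pi_norm_le_iff_of_nonneg (by linarith)]
    intro i
    fin_cases i
    · simp [abs_of_pos h1]; linarith
    · simp only [Fin.mk_one, Fin.isValue, Real.norm_eq_abs, abs_of_pos (h1.trans_le h2)]; nlinarith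

abbrev SL2 := Matrix.SpecialLinearGroup (Fin 2) ℤ

def ap (M : SL2) (v : ℤ × ℤ) : ℤ × ℤ :=
  (M.1 0 0 * v.1 + M.1 0 1 * v.2, M.1 1 0 * v.1 + M.1 1 1 * v.2)

def act (f : ℤ × ℤ × ℤ) (M : SL2) : ℤ × ℤ × ℤ :=
  (formVal f (M.1 0 0) (M.1 1 0),
   2 * f.1 * M.1 0 0 * M.1 0 1 + f.2.1 * (M.1 0 0 * M.1 1 1 + M.1 0 1 * M.1 1 0)
     + 2 * f.2.2 * M.1 1 0 * M.1 1 1,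
   formVal f (M.1 0 1) (M.1 1 1))

lemma det1 (M : SL2) : M.1 0 0 * M.1 1 1 - M.1 0 1 * M.1 1 0 = 1 := by
  have := M.2; rwa [Matrix.det_fin_two] at this

lemma mul_entries (M N : SL2) (i j : Fin 2) :
    (M * N).1 i j = M.1 i 0 * N.1 0 j + M.1 i 1 * N.1 1 j := by
  show (M.1 * N.1) i j = _
  rw [Matrix.mul_apply, Fin.sum_univ_two]

lemma ap_mul (M N : SL2) (v : ℤ × ℤ) : ap (M * N) v = ap M (ap N v) := by
  simp only [ap, mul_entries]; ext <;> simp <;> ring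

@[simp] lemma ap_one (v : ℤ × ℤ) : ap 1 v = v := by simp [ap]

lemma val_act (f : ℤ × ℤ × ℤ) (M : SL2) (x y : ℤ) :
    formVal (act f M) x y = formVal f (M.1 0 0 * x + M.1 0 1 * y) (M.1 1 0 * x + M.1 1 1 * y) := by
  simp only [act, formVal]; ring

lemma val_act' (f : ℤ × ℤ × ℤ) (M : SL2) (v : ℤ × ℤ) :
    formVal (act f M) v.1 v.2 = formVal f (ap M v).1 (ap M v).2 := val_act f M _ _

lemma form_ext {f g : ℤ × ℤ × ℤ} (h : ∀ x y, formVal f x y = formVal g x y) : f = g := by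
  have h1 := h 1 0
  have h2 := h 0 1
  have h3 := h 1 1
  simp [formVal] at h1 h2 h3
  exact Prod.ext h1 (Prod.ext (by linarith) h2)

lemma equiv_iff {f g : ℤ × ℤ × ℤ} : formEquiv f g ↔ ∃ M : SL2, g = act f M := by
  constructor
  · rintro ⟨M, h⟩; exact ⟨M, form_ext fun x y => by rw [h, val_act]⟩
  · rintro ⟨M, rfl⟩; exact ⟨M, fun x y => val_act f M x y⟩

lemma act_mul (f : ℤ × ℤ × ℤ) (M N : SL2) : act f (M * N) = act (act f M) N := by
  apply form_ext; intro x y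
  rw [val_act, val_act, val_act]; simp only [mul_entries]; congr 1 <;> ring

@[simp] lemma act_one (f : ℤ × ℤ × ℤ) : act f 1 = f := by
  apply form_ext; intro x y; rw [val_act]; simp

lemma act_inv {f g : ℤ × ℤ × ℤ} {M : SL2} (h : g = act f M) : f = act g M⁻¹ := by
  rw [h, ← act_mul]; simp

lemma equiv_equivalence : Equivalence formEquiv where
  refl f := equiv_iff.2 ⟨1, by simp⟩
  symm := by
    intro f g h
    obtain ⟨M, h⟩ := equiv_iff.1 h
    exact equiv_iff.2 ⟨M⁻¹, act_inv h⟩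
  trans := by
    intro f g k h1 h2
    obtain ⟨M, rfl⟩ := equiv_iff.1 h1
    obtain ⟨N, rfl⟩ := equiv_iff.1 h2
    exact equiv_iff.2 ⟨M * N, by rw [act_mul]⟩

lemma disc_act (f : ℤ × ℤ × ℤ) (M : SL2) : formDisc (act f M) = formDisc f := by
  have h := det1 M
  simp only [formDisc, act, formVal]
  have : ∀ a b c p q r s : ℤ, (2*a*p*q + b*(p*s+q*r)+2*c*r*s)^2
      - 4*(a*p^2+b*p*r+c*r^2)*(a*q^2+b*q*s+c*s^2) = (b^2-4*a*c)*(p*s-q*r)^2 := by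
    intros; ring
  rw [this, h]; ring

/-- scaling -/
def scl (u : ℤ) (f : ℤ × ℤ × ℤ) : ℤ × ℤ × ℤ := (u * f.1, u * f.2.1, u * f.2.2)

lemma scl_act (u : ℤ) (f : ℤ × ℤ × ℤ) (M : SL2) : scl u (act f M) = act (scl u f) M := by
  simp only [scl, act, formVal]; ext <;> simp <;> ring

lemma scl_disc (u : ℤ) (f : ℤ × ℤ × ℤ) : formDisc (scl u f) = formDisc f * u ^ 2 := by
  simp only [scl, formDisc]; ring

lemma prim_dvd {f : ℤ × ℤ × ℤ} (hf : IsPrimitiveForm f) {k : ℤ} (h1 : k ∣ f.1) (h2 : k ∣ f.2.1)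
    (h3 : k ∣ f.2.2) : IsUnit k := by
  rw [IsPrimitiveForm] at hf
  have : k ∣ ((Int.gcd f.1 (Int.gcd f.2.1 f.2.2) : ℕ) : ℤ) :=
    Int.dvd_coe_gcd h1 (Int.dvd_coe_gcd h2 h3)
  rw [hf] at this
  exact isUnit_of_dvd_one (by simpa using this)

lemma prim_of {f : ℤ × ℤ × ℤ}
    (h : ∀ k : ℤ, k ∣ f.1 → k ∣ f.2.1 → k ∣ f.2.2 → IsUnit k) : IsPrimitiveForm f := by
  rw [IsPrimitiveForm]
  set G := Int.gcd f.1 (Int.gcd f.2.1 f.2.2)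
  have h1 : (G : ℤ) ∣ f.1 := Int.gcd_dvd_left _ _
  have h23 : (G : ℤ) ∣ (Int.gcd f.2.1 f.2.2 : ℤ) := Int.gcd_dvd_right _ _
  have := h G h1 (h23.trans (Int.gcd_dvd_left _ _)) (h23.trans (Int.gcd_dvd_right _ _))
  simpa [Int.isUnit_iff_natAbs_eq] using this

lemma dvd_act {k : ℤ} {f : ℤ × ℤ × ℤ} (M : SL2) (h1 : k ∣ f.1) (h2 : k ∣ f.2.1)
    (h3 : k ∣ f.2.2) : k ∣ (act f M).1 ∧ k ∣ (act f M).2.1 ∧ k ∣ (act f M).2.2 := by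
  obtain ⟨a, ha⟩ := h1
  obtain ⟨b, hb⟩ := h2
  obtain ⟨c, hc⟩ := h3
  have : f = scl k (a, b, c) := by
    simp [scl, ← ha, ← hb, ← hc]
  rw [this, ← scl_act]
  simp [scl]

lemma prim_act {f : ℤ × ℤ × ℤ} (hf : IsPrimitiveForm f) (M : SL2) : IsPrimitiveForm (act f M) := by
  apply prim_of
  intro k h1 h2 h3
  have := dvd_act M⁻¹ h1 h2 h3
  rw [← act_mul] at this
  simp only [mul_inv_cancel, act_one] at this
  exact prim_dvd hf this.1 this.2.1 this.2.2

/-- the shear -/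
def shear (j : ℤ) : SL2 := ⟨!![1, j; 0, 1], by simp [Matrix.det_fin_two]⟩

lemma act_shear (f : ℤ × ℤ × ℤ) (j : ℤ) :
    act f (shear j) = (f.1, f.2.1 + 2 * f.1 * j, f.1 * j ^ 2 + f.2.1 * j + f.2.2) := by
  simp [act, shear, formVal]; ring

lemma ap_shear (e j : ℤ) : ap (shear j) (e, 0) = (e, 0) := by simp [ap, shear]

def swp : SL2 := ⟨!![0, -1; 1, 0], by simp [Matrix.det_fin_two]⟩

lemma act_swp (f : ℤ × ℤ × ℤ) : act f swp = (f.2.2, -f.2.1, f.1) := by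
  simp [act, swp, formVal]

/-- forms of nonsquare discriminant have nonzero leading coefficient -/
lemma lead_ne {f : ℤ × ℤ × ℤ} (h : ¬ IsSquare (formDisc f)) : f.1 ≠ 0 := by
  intro h0; apply h; rw [formDisc, h0]; exact ⟨f.2.1, by ring⟩

lemma reduce (f : ℤ × ℤ × ℤ) (h : ¬ IsSquare (formDisc f)) :
    ∃ M : SL2, |(act f M).2.1| ≤ |(act f M).1| ∧ |(act f M).1| ≤ |(act f M).2.2| := by
  obtain ⟨M, hM⟩ := WellFounded.has_min (measure fun M : SL2 => ((act f M).1).natAbs).wf Set.univ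
    ⟨1, trivial⟩
  set g := act f M with hg
  have hdg : ¬ IsSquare (formDisc g) := by rwa [hg, disc_act]
  have ha := lead_ne hdg
  -- shift b
  have hpos : 0 < |g.1| := abs_pos.mpr ha
  obtain ⟨j, hj⟩ : ∃ j : ℤ, |g.2.1 + 2 * g.1 * j| ≤ |g.1| := by
    have e := Int.emod_add_mul_ediv (g.2.1 + |g.1|) (2 * g.1)
    have h1 := Int.emod_nonneg (g.2.1 + |g.1|) (show 2 * g.1 ≠ 0 by simpa using ha)
    have h2 := Int.emod_lt_abs (g.2.1 + |g.1|) (show 2 * g.1 ≠ 0 by simpa using ha)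
    rw [abs_mul, abs_two] at h2
    refine ⟨-((g.2.1 + |g.1|) / (2 * g.1)), ?_⟩
    rw [abs_le]
    constructor <;> nlinarith
  refine ⟨M * shear j, ?_, ?_⟩
  · rw [act_mul, ← hg, act_shear]; exact hj
  · have := hM.2 (M * shear j * swp) trivial
    simp only [measure, invImage, InvImage, not_lt, WellFoundedRelation.rel] at this
    rw [act_mul, act_swp] at this
    rw [act_mul, ← hg] at this ⊢
    rw [act_shear] at this ⊢
    simp only at this ⊢
    have h3 : g.1.natAbs ≤ (g.1 * j ^ 2 + g.2.1 * j + g.2.2).natAbs := by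
      exact this
    zify at h3
    exact h3

lemma reduced_bound {a b c d : ℤ} (hd : b ^ 2 - 4 * a * c = d) (h1 : |b| ≤ |a|) (h2 : |a| ≤ |c|)
    (hd0 : 0 < d) : |a| ≤ d ∧ |b| ≤ d ∧ |c| ≤ d ∧ a * c ≤ 0 := by
  have hb2 : b ^ 2 ≤ a ^ 2 := sq_le_sq.mpr h1
  have hac : a * c ≤ 0 := by
    by_contra hc
    push Not at hc
    have e : |a| * |c| = a * c := by rw [← abs_mul, abs_of_pos hc]
    have e2 : |a| * |a| = a ^ 2 := by rw [abs_mul_abs_self]; ring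
    nlinarith [abs_nonneg a]
  have e : |a| * |c| = -(a * c) := by rw [← abs_mul, abs_of_nonpos hac]
  have hd' : d = b ^ 2 + 4 * (|a| * |c|) := by rw [e, ← hd]; ring
  rcases eq_or_ne a 0 with rfl | ha
  · simp at h1 hb2; subst h1; simp at hd; omega
  · have : 1 ≤ |a| := Int.one_le_abs ha
    have hc1 : 1 ≤ |c| := this.trans h2
    have hcd : |c| ≤ d := by nlinarith [sq_nonneg b]
    exact ⟨h2.trans hcd, (h1.trans h2).trans hcd, hcd, hac⟩

abbrev PF (d : ℤ) := {f : ℤ × ℤ × ℤ // IsPrimitiveForm f ∧ formDisc f = d}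
abbrev Cls (d : ℤ) := Quot (fun f g : PF d => formEquiv f.1 g.1)

lemma cls_eq_iff {d : ℤ} (f g : PF d) :
    (Quot.mk _ f : Cls d) = Quot.mk _ g ↔ formEquiv f.1 g.1 := by
  have : Equivalence (fun f g : PF d => formEquiv f.1 g.1) :=
    ⟨fun f => equiv_equivalence.refl _, fun h => equiv_equivalence.symm h,
      fun h1 h2 => equiv_equivalence.trans h1 h2⟩
  exact this.quot_mk_eq_iff f g

lemma cls_finite {d : ℤ} (hd : 0 < d) (hsq : ¬ IsSquare d) : Finite (Cls d) := by
  let S : Set (PF d) := {f | |f.1.1| ≤ d ∧ |f.1.2.1| ≤ d ∧ |f.1.2.2| ≤ d}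
  have hS : S.Finite := by
    have : Set.InjOn (fun f : PF d => f.1) S := fun _ _ _ _ h => Subtype.ext h
    apply Set.Finite.of_finite_image _ this
    apply Set.Finite.subset ((Set.finite_Icc (-d) d).prod ((Set.finite_Icc (-d) d).prod
      (Set.finite_Icc (-d) d)))
    rintro _ ⟨f, ⟨h1, h2, h3⟩, rfl⟩
    exact ⟨abs_le.mp h1, abs_le.mp h2, abs_le.mp h3⟩
  have := hS.to_subtype
  apply Finite.of_surjective (fun f : S => (Quot.mk _ f.1 : Cls d))
  intro q
  induction q using Quot.ind with
  | mk f =>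
    obtain ⟨M, h1, h2⟩ := reduce f.1 (by rw [f.2.2]; exact hsq)
    have hdd : formDisc (act f.1 M) = d := by rw [disc_act, f.2.2]
    obtain ⟨b1, b2, b3, -⟩ := reduced_bound hdd h1 h2 hd
    refine ⟨⟨⟨act f.1 M, prim_act f.2.1 M, hdd⟩, b1, b2, b3⟩, ?_⟩
    refine (cls_eq_iff _ _).2 ?_
    exact equiv_equivalence.symm (equiv_iff.2 ⟨M, rfl⟩)

lemma cls_rep {d : ℤ} (hd : 0 < d) (hsq : ¬ IsSquare d) (q : Cls d) :
    ∃ f : PF d, 0 < f.1.1 ∧ Quot.mk _ f = q := by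
  induction q using Quot.ind with
  | mk f =>
    obtain ⟨M, h1, h2⟩ := reduce f.1 (by rw [f.2.2]; exact hsq)
    have hdd : formDisc (act f.1 M) = d := by rw [disc_act, f.2.2]
    obtain ⟨b1, b2, b3, b4⟩ := reduced_bound hdd h1 h2 hd
    have ha : (act f.1 M).1 ≠ 0 := lead_ne (by rw [hdd]; exact hsq)
    rcases lt_or_gt_of_ne ha with h | h
    · have hdd' : formDisc (act f.1 (M * swp)) = d := by rw [disc_act, f.2.2]
      refine ⟨⟨act f.1 (M * swp), prim_act f.2.1 _, hdd'⟩, ?_, ?_⟩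
      · have h3 : (act f.1 (M * swp)).1 ≠ 0 := lead_ne (by rw [hdd']; exact hsq)
        show 0 < (act f.1 (M * swp)).1
        rw [act_mul, act_swp] at h3 ⊢
        simp only at h3 ⊢
        rcases lt_or_gt_of_ne h3 with h4 | h4
        · nlinarith
        · exact h4
      · exact (cls_eq_iff _ _).2 (equiv_equivalence.symm (equiv_iff.2 ⟨_, rfl⟩))
    · refine ⟨⟨act f.1 M, prim_act f.2.1 M, hdd⟩, h, ?_⟩
      exact (cls_eq_iff _ _).2 (equiv_equivalence.symm (equiv_iff.2 ⟨_, rfl⟩))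

/-- there is a nontrivial solution of the Pell equation -/
def Pell (d : ℤ) : Prop := ∃ t u : ℕ, 0 < t ∧ 0 < u ∧ (t : ℤ) ^ 2 - d * (u : ℤ) ^ 2 = 4

lemma td_spec {d : ℤ} (h : Pell d) :
    0 < td d ∧ ∃ u : ℕ, 0 < u ∧ (td d : ℤ) ^ 2 - d * (u : ℤ) ^ 2 = 4 := by
  obtain ⟨t, u, h1, h2, h3⟩ := h
  exact Nat.sInf_mem (s := {t : ℕ | 0 < t ∧ ∃ u : ℕ, 0 < u ∧ (t : ℤ) ^ 2 - d * (u : ℤ) ^ 2 = 4})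
    ⟨t, h1, u, h2, h3⟩

lemma ud_spec {d : ℤ} (h : Pell d) : 0 < ud d ∧ (td d : ℤ) ^ 2 - d * (ud d : ℤ) ^ 2 = 4 := by
  obtain ⟨u, h2, h3⟩ := (td_spec h).2
  exact Nat.sInf_mem (s := {u : ℕ | 0 < u ∧ (td d : ℤ) ^ 2 - d * (u : ℤ) ^ 2 = 4}) ⟨u, h2, h3⟩

lemma sq_sqrt_d {d : ℤ} (hd : 0 < d) : √(d : ℝ) ^ 2 = d :=
  Real.sq_sqrt (by exact_mod_cast hd.le)

lemma eps_gt {d : ℤ} (hd : 0 < d) (h : Pell d) : 1 < eps d := by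
  obtain ⟨h1, h2⟩ := ud_spec h
  have h3 := (td_spec h).1
  have h2' : (td d : ℝ) ^ 2 - d * (ud d : ℝ) ^ 2 = 4 := by exact_mod_cast h2
  have hs : 0 < √(d : ℝ) := Real.sqrt_pos.2 (by exact_mod_cast hd)
  have hu : (0 : ℝ) < ud d := by exact_mod_cast h1
  have ht : (0 : ℝ) < td d := by exact_mod_cast h3
  have hd' : (0 : ℝ) < d := by exact_mod_cast hd
  have : (2 : ℝ) < td d := by nlinarith [mul_pos hd' (pow_pos hu 2)]
  rw [eps]
  nlinarith [mul_pos hu hs]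

lemma eps_min {d : ℤ} (hd : 0 < d) (h : Pell d) {t u : ℤ} (htu : t ^ 2 - d * u ^ 2 = 4)
    (hl : 1 < ((t : ℝ) + u * √(d : ℝ)) / 2) : eps d ≤ ((t : ℝ) + u * √(d : ℝ)) / 2 := by
  have hs : 0 < √(d : ℝ) := Real.sqrt_pos.2 (by exact_mod_cast hd)
  have hss := sq_sqrt_d hd
  have htu' : (t : ℝ) ^ 2 - d * (u : ℝ) ^ 2 = 4 := by exact_mod_cast htu
  have hprod : (((t : ℝ) + u * √(d : ℝ)) / 2) * (((t : ℝ) - u * √(d : ℝ)) / 2) = 1 := by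
    have : (((t : ℝ) + u * √(d : ℝ)) / 2) * (((t : ℝ) - u * √(d : ℝ)) / 2)
      = ((t : ℝ) ^ 2 - √(d : ℝ) ^ 2 * (u : ℝ) ^ 2) / 4 := by ring
    rw [this, hss, htu']; norm_num
  set lam := ((t : ℝ) + u * √(d : ℝ)) / 2 with hlam
  set mu := ((t : ℝ) - u * √(d : ℝ)) / 2 with hmu
  have hmu0 : 0 < mu := by
    by_contra hc; push Not at hc; nlinarith
  have hmu1 : mu < 1 := by
    by_contra hc; push Not at hc; nlinarith
  have ht : (0 : ℝ) < t := by
    have : (t : ℝ) = lam + mu := by rw [hlam, hmu]; ring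
    rw [this]; linarith
  have hu : (0 : ℝ) < u := by
    have : (u : ℝ) * √(d : ℝ) = lam - mu := by rw [hlam, hmu]; ring
    by_contra hc
    push Not at hc
    nlinarith
  have ht' : 0 < t := by exact_mod_cast ht
  have hu' : 0 < u := by exact_mod_cast hu
  have hmin : td d ≤ t.toNat := by
    apply Nat.sInf_le
    refine ⟨by omega, u.toNat, by omega, ?_⟩
    rw [Int.toNat_of_nonneg ht'.le, Int.toNat_of_nonneg hu'.le]; exact htu
  have hmin' : (td d : ℤ) ≤ t := by omega
  have hminR : (td d : ℝ) ≤ t := by exact_mod_cast hmin'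
  have h2 := (ud_spec h).2
  have hle : (ud d : ℤ) ≤ u := by
    by_contra hc
    push Not at hc
    have h4 : (td d : ℤ) ^ 2 ≤ t ^ 2 := by
      apply pow_le_pow_left₀ (by positivity) hmin'
    have h5 : u ^ 2 < (ud d : ℤ) ^ 2 := by
      apply pow_lt_pow_left₀ hc hu'.le (by norm_num)
    nlinarith
  have hleR : (ud d : ℝ) ≤ u := by exact_mod_cast hle
  rw [eps, hlam]
  nlinarith

/-- the linear factor of the form -/
noncomputable def xi (f : ℤ × ℤ × ℤ) (d : ℤ) (v : ℤ × ℤ) : ℝ :=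
  f.1 * v.1 + (f.2.1 + √(d : ℝ)) / 2 * v.2
/-- the conjugate linear factor of the form -/
noncomputable def xic (f : ℤ × ℤ × ℤ) (d : ℤ) (v : ℤ × ℤ) : ℝ :=
  f.1 * v.1 + (f.2.1 - √(d : ℝ)) / 2 * v.2

lemma xi_mul {f : ℤ × ℤ × ℤ} {d : ℤ} (hd : 0 < d) (hf : formDisc f = d) (v : ℤ × ℤ) :
    xi f d v * xic f d v = f.1 * (formVal f v.1 v.2 : ℝ) := by
  have hss := sq_sqrt_d hd
  have hf' : (f.2.1 : ℝ) ^ 2 - 4 * f.1 * f.2.2 = d := by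
    rw [← hf, formDisc]; push_cast; ring
  have : xi f d v * xic f d v = (f.1:ℝ)^2 * v.1^2 + f.1 * f.2.1 * v.1 * v.2
      + ((f.2.1:ℝ)^2 - √(d : ℝ)^2)/4 * v.2^2 := by
    simp only [xi, xic]; ring
  rw [this, hss, ← hf', formVal]; push_cast; ring

/-- fundamental sector -/
def Sect (f : ℤ × ℤ × ℤ) (d : ℤ) (v : ℤ × ℤ) : Prop :=
  0 < xic f d v ∧ xic f d v ≤ xi f d v ∧ xi f d v < eps d ^ 2 * xic f d v

lemma stab_form {f : ℤ × ℤ × ℤ} {d : ℤ} (hf : formDisc f = d) (hp : IsPrimitiveForm f)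
    (ha : f.1 ≠ 0) {M : SL2} (hM : act f M = f) :
    ∃ t u : ℤ, 2 * M.1 0 0 = t - f.2.1 * u ∧ M.1 0 1 = - f.2.2 * u ∧ M.1 1 0 = f.1 * u ∧
      2 * M.1 1 1 = t + f.2.1 * u ∧ t ^ 2 - d * u ^ 2 = 4 := by
  have hdet := det1 M
  obtain ⟨a, b, c⟩ := f
  simp only [act, formVal, Prod.mk.injEq] at hM
  obtain ⟨h1, h2, h3⟩ := hM
  simp only [formDisc] at hf
  simp only at ha ⊢
  generalize M.1 0 0 = p at *
  generalize M.1 0 1 = q at *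
  generalize M.1 1 0 = r at *
  generalize M.1 1 1 = s at *
  have e1 : 2 * (a * (s - p)) = 2 * (b * r) := by
    linear_combination (-2 * s) * h1 + r * h2 + (2 * a * p + b * r) * hdet
  have e2 : 2 * (a * q) = 2 * (- c * r) := by
    linear_combination -(2 * a * q + b * s) * hdet + s * h2 - 2 * r * h3
  have e1' : a * (s - p) = b * r := by linarith
  have e2' : a * q = - c * r := by linarith
  have hdvd : a ∣ r := by
    have h4 : a ∣ r * (Int.gcd a (Int.gcd b c) : ℕ) := by
      have hb : a ∣ r * b := ⟨s - p, by linarith⟩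
      have hc : a ∣ r * c := ⟨-q, by linarith⟩
      have hbc : a ∣ r * (Int.gcd b c : ℤ) := by
        rw [Int.gcd_eq_gcd_ab, mul_add, ← mul_assoc, ← mul_assoc]
        exact dvd_add (hb.mul_right _) (hc.mul_right _)
      rw [Int.gcd_eq_gcd_ab, mul_add, ← mul_assoc, ← mul_assoc]
      exact dvd_add ((Dvd.intro_left r rfl).mul_right _) (hbc.mul_right _)
    have hp' : Int.gcd a (Int.gcd b c) = 1 := hp
    rw [hp'] at h4
    simpa using h4
  obtain ⟨u, rfl⟩ := hdvd
  have e3 : s - p = b * u := by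
    apply mul_left_cancel₀ ha; linarith
  have e4 : q = -c * u := by
    apply mul_left_cancel₀ ha; linarith
  refine ⟨p + s, u, by linarith, e4, rfl, by linarith, ?_⟩
  have hs : s = p + b * u := by linarith
  subst e4 hs hf
  linear_combination 4 * hdet

lemma xi_act {f : ℤ × ℤ × ℤ} {d : ℤ} (hd : 0 < d) (hf : formDisc f = d) {M : SL2} {t u : ℤ}
    (h1 : 2 * M.1 0 0 = t - f.2.1 * u) (h2 : M.1 0 1 = - f.2.2 * u) (h3 : M.1 1 0 = f.1 * u)
    (h4 : 2 * M.1 1 1 = t + f.2.1 * u) (v : ℤ × ℤ) :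
    xi f d (ap M v) = (t + u * √(d : ℝ)) / 2 * xi f d v ∧
    xic f d (ap M v) = (t - u * √(d : ℝ)) / 2 * xic f d v := by
  have hss := sq_sqrt_d hd
  have hf' : (f.2.1 : ℝ) ^ 2 - 4 * f.1 * f.2.2 = d := by
    rw [← hf, formDisc]; push_cast; ring
  have h1' : 2 * (M.1 0 0 : ℝ) = t - f.2.1 * u := by exact_mod_cast h1
  have h4' : 2 * (M.1 1 1 : ℝ) = t + f.2.1 * u := by exact_mod_cast h4
  have h1'' : (M.1 0 0 : ℝ) = (t - f.2.1 * u) / 2 := by linarith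
  have h4'' : (M.1 1 1 : ℝ) = (t + f.2.1 * u) / 2 := by linarith
  have h2' : (M.1 0 1 : ℝ) = - f.2.2 * u := by exact_mod_cast h2
  have h3' : (M.1 1 0 : ℝ) = f.1 * u := by exact_mod_cast h3
  simp only [xi, xic, ap]
  push_cast
  rw [h1'', h2', h3', h4'']
  constructor <;> linear_combination (-u * v.2 / 4 : ℝ) * (hss.trans hf'.symm)

lemma lam_mul {d : ℤ} (hd : 0 < d) {t u : ℤ} (htu : t ^ 2 - d * u ^ 2 = 4) :
    (((t : ℝ) + u * √(d : ℝ)) / 2) * (((t : ℝ) - u * √(d : ℝ)) / 2) = 1 := by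
  have hss := sq_sqrt_d hd
  have htu' : (t : ℝ) ^ 2 - d * (u : ℝ) ^ 2 = 4 := by exact_mod_cast htu
  linear_combination (-(u:ℝ)^2/4) * hss + htu' / 4

lemma sect_unique {f : ℤ × ℤ × ℤ} {d : ℤ} (hd : 0 < d) (h : Pell d) (hf : formDisc f = d)
    (hp : IsPrimitiveForm f) (ha : f.1 ≠ 0) {M : SL2} (hM : act f M = f) {v : ℤ × ℤ}
    (h1 : Sect f d v) (h2 : Sect f d (ap M v)) : ap M v = v := by
  obtain ⟨t, u, m1, m2, m3, m4, htu⟩ := stab_form hf hp ha hM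
  obtain ⟨x1, x2⟩ := xi_act hd hf m1 m2 m3 m4 v
  have hprod := lam_mul hd htu
  have he := eps_gt hd h
  obtain ⟨a1, a2, a3⟩ := h1
  obtain ⟨b1, b2, b3⟩ := h2
  rw [x1] at b2 b3
  rw [x2] at b1 b2 b3
  have hs : 0 < √(d : ℝ) := Real.sqrt_pos.2 (by exact_mod_cast hd)
  have hmin : 1 < ((t : ℝ) + u * √(d : ℝ)) / 2 → eps d ≤ ((t : ℝ) + u * √(d : ℝ)) / 2 :=
    eps_min hd h htu
  have hmin' : 1 < ((t : ℝ) - u * √(d : ℝ)) / 2 → eps d ≤ ((t : ℝ) - u * √(d : ℝ)) / 2 := by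
    have := eps_min hd h (t := t) (u := -u) (by rw [← htu]; ring)
    push_cast at this
    intro h5
    have h6 := this (by convert h5 using 2; ring)
    convert h6 using 2; ring
  have hdiff : (u : ℝ) * √(d : ℝ) =
     ((t : ℝ) + u * √(d : ℝ)) / 2 - ((t : ℝ) - u * √(d : ℝ)) / 2 := by ring
  have hsum : (t : ℝ) =
     ((t : ℝ) + u * √(d : ℝ)) / 2 + ((t : ℝ) - u * √(d : ℝ)) / 2 := by ring
  set lam := ((t : ℝ) + u * √(d : ℝ)) / 2
  set mu := ((t : ℝ) - u * √(d : ℝ)) / 2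
  set X := xi f d v
  set Y := xic f d v
  have hmu : 0 < mu := by
    by_contra hc; push Not at hc; nlinarith
  have hlam : 0 < lam := by
    by_contra hc; push Not at hc; nlinarith
  have hX : 0 < X := by linarith
  have k1 : lam < eps d := by
    by_contra hc; push Not at hc
    -- lam X < eps^2 mu Y ≤ eps^2 mu X
    have h7 : lam * X < eps d ^ 2 * mu * X := by
      have : eps d ^ 2 * (mu * Y) ≤ eps d ^ 2 * (mu * X) := by gcongr
      linarith
    have h8 : lam < eps d ^ 2 * mu := lt_of_mul_lt_mul_right h7 hX.le
    have h9 : lam * lam < eps d ^ 2 := by nlinarith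
    nlinarith
  have k2 : mu < eps d := by
    by_contra hc; push Not at hc
    have h7 : mu * Y < eps d ^ 2 * lam * Y := by
      have : lam * X < lam * (eps d ^ 2 * Y) := by gcongr
      linarith
    have h8 : mu < eps d ^ 2 * lam := lt_of_mul_lt_mul_right h7 a1.le
    have h9 : mu * mu < eps d ^ 2 := by nlinarith
    nlinarith
  have l1 : lam ≤ 1 := by by_contra hc; push Not at hc; linarith [hmin hc]
  have l2 : mu ≤ 1 := by by_contra hc; push Not at hc; linarith [hmin' hc]
  have l3 : lam = 1 := by nlinarith
  have l4 : mu = 1 := by nlinarith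
  rw [l3, l4] at hdiff hsum
  have hu : u = 0 := by
    have : (u : ℝ) = 0 := by
      rcases mul_eq_zero.1 (hdiff.trans (sub_self 1)) with h | h
      · exact h
      · exact absurd h hs.ne'
    exact_mod_cast this
  have ht : t = 2 := by
    have : (t : ℝ) = 2 := by linarith
    exact_mod_cast this
  subst hu ht
  have q1 : M.1 0 0 = 1 := by linarith
  have q2 : M.1 1 1 = 1 := by linarith
  simp at m2 m3
  simp [ap, q1, q2, m2, m3]

lemma act_neg_one (f : ℤ × ℤ × ℤ) : act f (-1) = f := by
  apply form_ext; intro x y; rw [val_act]; simp [formVal]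

lemma act_zpow {f : ℤ × ℤ × ℤ} {M : SL2} (h : act f M = f) (k : ℤ) : act f (M ^ k) = f := by
  induction k using Int.induction_on with
  | zero => simp
  | succ i ih => rw [zpow_add_one, act_mul, ih, h]
  | pred i ih =>
    rw [zpow_sub_one, act_mul, ih]; exact (act_inv h.symm).symm

lemma stab_exists {f : ℤ × ℤ × ℤ} {d : ℤ} (hf : formDisc f = d) {t u : ℤ}
    (htu : t ^ 2 - d * u ^ 2 = 4) : ∃ M : SL2, 2 * M.1 0 0 = t - f.2.1 * u ∧
      M.1 0 1 = - f.2.2 * u ∧ M.1 1 0 = f.1 * u ∧ 2 * M.1 1 1 = t + f.2.1 * u ∧ act f M = f := by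
  obtain ⟨a, b, c⟩ := f
  simp only [formDisc] at hf
  have hpar : Even (t - b * u) := by
    have h1 : Even ((t - b * u) * (t + b * u)) := by
      refine ⟨2 - 2 * a * c * u ^ 2, ?_⟩
      rw [← hf] at htu
      linear_combination htu
    rcases Int.even_mul.1 h1 with h | h
    · exact h
    · have : t - b * u = t + b * u - 2 * (b * u) := by ring
      rw [this]; exact h.sub (even_two_mul _)
  obtain ⟨p, hp⟩ := hpar
  have hs : t + b * u = 2 * (p + b * u) := by linarith
  have ht : t = 2 * p + b * u := by linarith
  have hdet : p * (p + b * u) - (-c * u) * (a * u) = 1 := by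
    subst ht hf
    linarith
  refine ⟨⟨!![p, -c * u; a * u, p + b * u], by rw [Matrix.det_fin_two_of]; exact hdet⟩,
    ?_, ?_, ?_, ?_, ?_⟩
  · simp; linarith
  · simp
  · simp
  · simp; linarith
  · simp only [act, formVal, Matrix.of_apply, Matrix.cons_val', Matrix.cons_val_zero,
      Matrix.cons_val_one, Matrix.cons_val_fin_one]
    ext <;> simp only
    · linear_combination a * hdet
    · linear_combination b * hdet
    · linear_combination c * hdet

lemma sect_exists {f : ℤ × ℤ × ℤ} {d : ℤ} (hd : 0 < d) (h : Pell d) (hf : formDisc f = d)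
    (ha : 0 < f.1) {v : ℤ × ℤ} (hv : 0 < formVal f v.1 v.2) :
    ∃ M : SL2, act f M = f ∧ Sect f d (ap M v) := by
  have hxx := xi_mul hd hf v
  have hpos : 0 < xi f d v * xic f d v := by
    rw [hxx]; exact mul_pos (by exact_mod_cast ha) (by exact_mod_cast hv)
  obtain ⟨M1, hM1, h1, h2⟩ : ∃ M1 : SL2, act f M1 = f ∧ 0 < xi f d (ap M1 v) ∧
      0 < xic f d (ap M1 v) := by
    rcases pos_and_pos_or_neg_and_neg_of_mul_pos hpos with ⟨h1, h2⟩ | ⟨h1, h2⟩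
    · exact ⟨1, by simp, by simpa using h1, by simpa using h2⟩
    · refine ⟨-1, act_neg_one f, ?_, ?_⟩
      · have : xi f d (ap (-1) v) = - xi f d v := by simp [xi, ap]; ring
        linarith
      · have : xic f d (ap (-1) v) = - xic f d v := by simp [xic, ap]; ring
        linarith
  obtain ⟨M0, m1, m2, m3, m4, hM0⟩ := stab_exists hf (ud_spec h).2
  have he := eps_gt hd h
  have hstep := xi_act hd hf m1 m2 m3 m4
  have hprod := lam_mul hd (ud_spec h).2
  have hlam : (((td d : ℤ) : ℝ) + ((ud d : ℤ) : ℝ) * √(d : ℝ)) / 2 = eps d := by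
    rw [eps]; push_cast; rfl
  rw [hlam] at hprod
  have hmu : (((td d : ℤ) : ℝ) - ((ud d : ℤ) : ℝ) * √(d : ℝ)) / 2 = (eps d)⁻¹ :=
    eq_inv_of_mul_eq_one_right hprod
  rw [hlam, hmu] at hstep
  have he0 : eps d ≠ 0 := by linarith
  have hk : ∀ k : ℤ, ∀ w, xi f d (ap (M0 ^ k) w) = eps d ^ k * xi f d w ∧
      xic f d (ap (M0 ^ k) w) = (eps d ^ k)⁻¹ * xic f d w := by
    intro k
    induction k using Int.induction_on with
    | zero => intro w; simp
    | succ i ih =>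
      intro w
      rw [zpow_add_one, ap_mul, (ih _).1, (ih _).2, (hstep _).1, (hstep _).2, zpow_add_one₀ he0]
      constructor
      · ring
      · rw [mul_inv]; ring
    | pred i ih =>
      intro w
      have hs' := hstep (ap M0⁻¹ w)
      rw [← ap_mul] at hs'
      simp only [mul_inv_cancel, ap_one] at hs'
      have j1 : xi f d (ap M0⁻¹ w) = (eps d)⁻¹ * xi f d w := by
        rw [hs'.1]; field_simp
      have j2 : xic f d (ap M0⁻¹ w) = eps d * xic f d w := by
        rw [hs'.2]; field_simp
      rw [zpow_sub_one, ap_mul, (ih _).1, (ih _).2, j1, j2, zpow_sub_one₀ he0]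
      constructor
      · ring
      · rw [mul_inv, inv_inv]; ring
  set X := xi f d (ap M1 v)
  set Y := xic f d (ap M1 v)
  obtain ⟨k, hk1, hk2⟩ := exists_mem_Ico_zpow (x := X / Y) (y := eps d ^ 2) (div_pos h1 h2)
    (by nlinarith)
  refine ⟨M0 ^ (-k) * M1, by rw [act_mul, act_zpow hM0, hM1], ?_⟩
  rw [ap_mul]
  have hep : 0 < eps d ^ k := zpow_pos (by linarith) k
  obtain ⟨z1, z2⟩ := hk (-k) (ap M1 v)
  have e2 : (eps d ^ 2) ^ k = eps d ^ k * eps d ^ k := by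
    rw [← mul_zpow]; congr 1; ring
  rw [zpow_add_one₀ (by positivity), e2] at hk2
  rw [e2] at hk1
  rw [zpow_neg (eps d)] at z1 z2
  rw [inv_inv] at z2
  rw [le_div_iff₀ h2] at hk1
  rw [div_lt_iff₀ h2] at hk2
  refine ⟨?_, ?_, ?_⟩
  · rw [z2]; exact mul_pos hep h2
  · rw [z1, z2, inv_mul_eq_div, le_div_iff₀ hep]
    linarith
  · rw [z1, z2, inv_mul_eq_div, div_lt_iff₀ hep]
    linarith

lemma card_eq_of_rel {α β : Type*} (R : α → β → Prop) (h1 : ∀ b, ∃ a, R a b) (h2 : ∀ a, ∃ b, R a b)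
    (h3 : ∀ a a' b, R a b → R a' b → a = a') (h4 : ∀ a b b', R a b → R a b' → b = b') :
    Nonempty (α ≃ β) := by
  choose F hF using h2
  refine ⟨Equiv.ofBijective F ⟨fun a a' h => ?_, fun b => ?_⟩⟩
  · exact h3 a a' (F a) (hF a) (h ▸ hF a')
  · obtain ⟨a, ha⟩ := h1 b
    exact ⟨a, h4 a _ _ (hF a) ha⟩

/-- number of solutions of `x²+nx+1=0` modulo `m`. -/
def rho (n m : ℕ) : ℕ := ((range m).filter (fun x => m ∣ x ^ 2 + n * x + 1)).card

lemma reps_exist {d : ℤ} (hd : 0 < d) (hsq : ¬ IsSquare d) :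
    ∃ R : Finset (ℤ × ℤ × ℤ), R.card = classNumber d ∧
      (∀ f ∈ R, IsPrimitiveForm f ∧ formDisc f = d ∧ 0 < f.1) ∧
      (∀ g, IsPrimitiveForm g → formDisc g = d → ∃ f ∈ R, ∃ M : SL2, g = act f M) ∧
      (∀ f ∈ R, ∀ g ∈ R, (∃ M : SL2, g = act f M) → f = g) := by
  classical
  have := cls_finite hd hsq
  have := Fintype.ofFinite (Cls d)
  choose rep h1 h2 using cls_rep hd hsq
  have hinj : Function.Injective (fun q : Cls d => (rep q).1) := by
    intro q q' h
    rw [← h2 q, ← h2 q', Subtype.ext h]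
  refine ⟨Finset.univ.image (fun q : Cls d => (rep q).1), ?_, ?_, ?_, ?_⟩
  · rw [Finset.card_image_of_injective _ hinj, Finset.card_univ, ← Nat.card_eq_fintype_card]
    rfl
  · intro f hf
    obtain ⟨q, -, rfl⟩ := Finset.mem_image.1 hf
    exact ⟨(rep q).2.1, (rep q).2.2, h1 q⟩
  · intro g hg1 hg2
    refine ⟨_, Finset.mem_image.2 ⟨Quot.mk _ ⟨g, hg1, hg2⟩, Finset.mem_univ _, rfl⟩, ?_⟩
    exact equiv_iff.1 ((cls_eq_iff _ ⟨g, hg1, hg2⟩).1 (h2 _))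
  · intro f hf g hg hM
    obtain ⟨q, -, rfl⟩ := Finset.mem_image.1 hf
    obtain ⟨q', -, rfl⟩ := Finset.mem_image.1 hg
    have := (cls_eq_iff _ _).2 (equiv_iff.2 hM)
    rw [h2, h2] at this
    rw [this]

/-- pairs (d,u) -/
def prs (n : ℕ) : Finset (ℕ × ℕ) := (range (n ^ 2) ×ˢ range (n ^ 2)).filter
      (fun p => 0 < p.1 ∧ 0 < p.2 ∧ (p.1 % 4 = 0 ∨ p.1 % 4 = 1) ∧ p.1 * p.2 ^ 2 = n ^ 2 - 4)

lemma sq_sub_four_not_sq {n : ℕ} (hn : 2 < n) : ¬ IsSquare ((n : ℤ) ^ 2 - 4) := by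
  rintro ⟨r, hr⟩
  have hn' : (2 : ℤ) < n := by exact_mod_cast hn
  have h1 : |r| < n := by
    rw [← abs_of_pos (show (0:ℤ) < n by linarith)]
    apply sq_lt_sq.1; nlinarith
  have h2 : (n : ℤ) - 1 < |r| ∨ |r| ≤ n - 1 := lt_or_ge _ _
  have h3 : r * r = |r| * |r| := (abs_mul_abs_self r).symm
  rw [h3] at hr
  rcases h2 with h2 | h2
  · omega
  · nlinarith [abs_nonneg r]

lemma prs_mem {n : ℕ} (hn : 2 < n) {d u : ℕ} (h : (d, u) ∈ prs n) :
    0 < d ∧ 0 < u ∧ (d : ℤ) * (u : ℤ) ^ 2 = (n : ℤ) ^ 2 - 4 ∧ ¬ IsSquare (d : ℤ) ∧ Pell d := by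
  simp only [prs, mem_filter] at h
  obtain ⟨-, h1, h2, -, h3⟩ := h
  have h4 : (d : ℤ) * (u : ℤ) ^ 2 = (n : ℤ) ^ 2 - 4 := by
    have : 4 ≤ n ^ 2 := by nlinarith
    zify [this] at h3; exact h3
  refine ⟨h1, h2, h4, ?_, n, u, by omega, h2, by linarith⟩
  rintro ⟨r, hr⟩
  apply sq_sub_four_not_sq hn
  rw [← h4, hr]
  exact ⟨r * u, by ring⟩

lemma mem_prs {n : ℕ} (hn : 2 < n) {d u : ℕ} (hu : 0 < u)
    (h : (d : ℤ) * (u : ℤ) ^ 2 = (n : ℤ) ^ 2 - 4) (h4 : d % 4 = 0 ∨ d % 4 = 1) :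
    (d, u) ∈ prs n := by
  have h4' : 4 ≤ n ^ 2 := by nlinarith
  have h3 : d * u ^ 2 = n ^ 2 - 4 := by zify [h4']; exact h
  have h5 : 4 < n ^ 2 := by nlinarith
  have hd : 0 < d := by
    rcases Nat.eq_zero_or_pos d with rfl | hd
    · simp at h3; omega
    · exact hd
  simp only [prs, mem_filter, Finset.mem_product, mem_range]
  refine ⟨⟨?_, ?_⟩, hd, hu, h4, h3⟩
  · have : d * 1 ≤ d * u ^ 2 := Nat.mul_le_mul_left _ (Nat.one_le_pow _ _ hu)
    omega
  · have : 1 * u ^ 2 ≤ d * u ^ 2 := Nat.mul_le_mul_right _ hd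
    have : u ≤ u ^ 2 := Nat.le_self_pow (by norm_num) u
    omega

/-- the key relation -/
def Rel (n : ℕ) (e k x : ℕ) (u : ℕ) (f : ℤ × ℤ × ℤ) (v : ℤ × ℤ) : Prop :=
  ∃ (N : SL2) (y c : ℤ), (k : ℤ) ∣ y - x ∧ scl u (act f N) = ((k : ℤ), n + 2 * y, c) ∧ ap N (e, 0) = v

lemma col_unique {N N' : SL2} {e e' : ℕ} (he : 0 < e) (he' : 0 < e')
    (h : ap N (e, 0) = ap N' (e', 0)) : e = e' ∧ ∃ j, N' = N * shear j := by
  have d1 := det1 N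
  have d2 := det1 N'
  simp only [ap, mul_zero, add_zero, Prod.mk.injEq] at h
  obtain ⟨h1, h2⟩ := h
  have key : ∀ {N N' : SL2} {e e' : ℕ}, N.1 0 0 * (e:ℤ) = N'.1 0 0 * e' →
      N.1 1 0 * (e:ℤ) = N'.1 1 0 * e' → (e' : ℤ) ∣ e := by
    intro N N' e e' h1 h2
    have d1 := det1 N
    refine ⟨N'.1 0 0 * N.1 1 1 - N'.1 1 0 * N.1 0 1, ?_⟩
    linear_combination (-(e:ℤ)) * d1 + N.1 1 1 * h1 - N.1 0 1 * h2
  have e1 : e = e' := Nat.dvd_antisymm (by exact_mod_cast key h1.symm h2.symm)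
    (by exact_mod_cast key h1 h2)
  subst e1
  have he0 : (e : ℤ) ≠ 0 := by exact_mod_cast he.ne'
  have g1 := mul_right_cancel₀ he0 h1
  have g2 := mul_right_cancel₀ he0 h2
  refine ⟨rfl, N.1 1 1 * N'.1 0 1 - N.1 0 1 * N'.1 1 1, ?_⟩
  ext i k
  rw [mul_entries]
  fin_cases i <;> fin_cases k <;> simp [shear]
  · exact g1.symm
  · rw [← g1, ← g2] at d2
    linear_combination (-N'.1 0 1) * d1 + N.1 0 1 * d2
  · exact g2.symm
  · rw [← g1, ← g2] at d2
    linear_combination (-N'.1 1 1) * d1 + N.1 1 1 * d2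

lemma complete_col {p r : ℤ} (h : IsCoprime p r) : ∃ N : SL2, N.1 0 0 = p ∧ N.1 1 0 = r := by
  obtain ⟨a, b, hab⟩ := h
  exact ⟨⟨!![p, -b; r, a], by rw [Matrix.det_fin_two_of]; linarith⟩, by simp, by simp⟩

lemma val_e (f : ℤ × ℤ × ℤ) (e : ℤ) : formVal f e 0 = f.1 * e ^ 2 := by simp [formVal]

lemma rel_R1 {n : ℕ} {d u : ℕ} (hu : 0 < u)
    (hdu : (d : ℤ) * (u : ℤ) ^ 2 = (n : ℤ) ^ 2 - 4) {f : ℤ × ℤ × ℤ} (hf : formDisc f = d)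
    {v : ℤ × ℤ} (hv : 0 < formVal f v.1 v.2) :
    ∃ e k x : ℕ, 0 < e ∧ 0 < k ∧ x < k ∧ k ∣ x ^ 2 + n * x + 1 ∧ Rel n e k x u f v ∧
      ((e ^ 2 * k : ℕ) : ℤ) = u * formVal f v.1 v.2 := by
  set e := Int.gcd v.1 v.2 with he
  have he0 : 0 < e := by
    rcases Nat.eq_zero_or_pos e with h | h
    · rw [he, Int.gcd_eq_zero_iff] at h
      rw [h.1, h.2] at hv; simp [formVal] at hv
    · exact h
  obtain ⟨p, r, hpr, h1, h2⟩ := Int.exists_gcd_one (m := v.1) (n := v.2) he0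
  obtain ⟨N, hN1, hN2⟩ := complete_col (Int.isCoprime_iff_gcd_eq_one.2 hpr)
  have hap : ap N (e, 0) = v := by
    simp only [ap, hN1, hN2, mul_zero, add_zero]
    exact Prod.ext h1.symm h2.symm
  set g := scl u (act f N) with hg
  have hval : formVal f v.1 v.2 = (act f N).1 * (e : ℤ) ^ 2 := by
    rw [← hap, ← val_act', val_e]
  have he2 : (0 : ℤ) < (e : ℤ) ^ 2 := by positivity
  have hpos : 0 < (act f N).1 := by
    rw [hval] at hv; exact pos_of_mul_pos_left hv he2.le
  have hk : 0 < g.1 := mul_pos (by exact_mod_cast hu) hpos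
  have hdisc : g.2.1 ^ 2 - 4 * g.1 * g.2.2 = (n : ℤ) ^ 2 - 4 := by
    have : formDisc g = (n : ℤ) ^ 2 - 4 := by rw [hg, scl_disc, disc_act, hf, hdu]
    exact this
  have hpar : Even (g.2.1 - n) := by
    have h3 : Even ((g.2.1 - n) * (g.2.1 + n)) :=
      ⟨2 * g.1 * g.2.2 - 2, by linear_combination hdisc⟩
    rcases Int.even_mul.1 h3 with h | h
    · exact h
    · have : g.2.1 - n = g.2.1 + n - 2 * n := by ring
      rw [this]; exact h.sub (even_two_mul _)
  obtain ⟨y, hy⟩ := hpar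
  have hb : g.2.1 = n + 2 * y := by linarith
  have hyc : y ^ 2 + n * y + 1 = g.1 * g.2.2 := by
    rw [hb] at hdisc; linarith
  have hkn : ((g.1.toNat : ℕ) : ℤ) = g.1 := Int.toNat_of_nonneg hk.le
  have hxn : (((y % g.1).toNat : ℕ) : ℤ) = y % g.1 :=
    Int.toNat_of_nonneg (Int.emod_nonneg _ hk.ne')
  have hmod : g.1 ∣ y - y % g.1 := Int.dvd_self_sub_emod
  refine ⟨e, g.1.toNat, (y % g.1).toNat, he0, by omega, ?_, ?_, ?_, ?_⟩
  · have := Int.emod_lt_of_pos y hk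
    omega
  · zify
    rw [hkn, hxn]
    obtain ⟨m, hm⟩ := hmod
    have : y % g.1 = y - g.1 * m := by linarith
    rw [this]
    refine ⟨g.2.2 - m * (2 * y - g.1 * m + n), ?_⟩
    linear_combination hyc
  · refine ⟨N, y, g.2.2, ?_, ?_, hap⟩
    · rw [hkn, hxn]; exact hmod
    · rw [← hg, hkn, ← hb]
  · push_cast
    rw [hkn, hval, hg]; simp only [scl]; ring

lemma content {g : ℤ × ℤ × ℤ} (hg : 0 < g.1) : ∃ (u : ℕ) (g0 : ℤ × ℤ × ℤ), 0 < u ∧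
    IsPrimitiveForm g0 ∧ g = scl u g0 := by
  set u := Int.gcd g.1 (Int.gcd g.2.1 g.2.2) with hu
  have hu0 : 0 < u := by
    rcases Nat.eq_zero_or_pos u with h | h
    · rw [hu, Int.gcd_eq_zero_iff] at h; omega
    · exact h
  have h1 : (u : ℤ) ∣ g.1 := Int.gcd_dvd_left _ _
  have h23 : (u : ℤ) ∣ (Int.gcd g.2.1 g.2.2 : ℤ) := Int.gcd_dvd_right _ _
  obtain ⟨a, ha⟩ := h1
  obtain ⟨b, hb⟩ := h23.trans (Int.gcd_dvd_left _ _)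
  obtain ⟨c, hc⟩ := h23.trans (Int.gcd_dvd_right _ _)
  refine ⟨u, (a, b, c), hu0, ?_, ?_⟩
  · apply prim_of
    intro k k1 k2 k3
    have hk : (u : ℤ) * k ∣ u := by
      have z1 : (u:ℤ) * k ∣ g.1 := by rw [ha]; exact mul_dvd_mul_left _ k1
      have z2 : (u:ℤ) * k ∣ g.2.1 := by rw [hb]; exact mul_dvd_mul_left _ k2
      have z3 : (u:ℤ) * k ∣ g.2.2 := by rw [hc]; exact mul_dvd_mul_left _ k3
      exact Int.dvd_coe_gcd z1 (Int.dvd_coe_gcd z2 z3)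
    have hu' : (u : ℤ) ≠ 0 := by exact_mod_cast hu0.ne'
    obtain ⟨m, hm⟩ := hk
    have : k * m = 1 := by
      apply mul_left_cancel₀ hu'; linarith
    exact IsUnit.of_mul_eq_one _ this
  · simp [scl, ← ha, ← hb, ← hc]

lemma content_unique {f g : ℤ × ℤ × ℤ} {u u' : ℕ} (hu : 0 < u) (hu' : 0 < u')
    (hf : IsPrimitiveForm f) (hg : IsPrimitiveForm g) (h : scl u f = scl u' g) :
    u = u' ∧ f = g := by
  have key : ∀ {f g : ℤ × ℤ × ℤ} {u u' : ℕ}, IsPrimitiveForm f →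
      scl u f = scl u' g → (u' : ℤ) ∣ u := by
    intro f g u u' hf h
    simp only [scl, Prod.mk.injEq] at h
    have hf' : Int.gcd f.1 (Int.gcd f.2.1 f.2.2) = 1 := hf
    have h4 : (u' : ℤ) ∣ u * (Int.gcd f.1 (Int.gcd f.2.1 f.2.2) : ℕ) := by
      have ha : (u' : ℤ) ∣ u * f.1 := ⟨_, h.1⟩
      have hb : (u' : ℤ) ∣ u * f.2.1 := ⟨_, h.2.1⟩
      have hc : (u' : ℤ) ∣ u * f.2.2 := ⟨_, h.2.2⟩
      have hbc : (u' : ℤ) ∣ u * (Int.gcd f.2.1 f.2.2 : ℤ) := by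
        rw [Int.gcd_eq_gcd_ab, mul_add, ← mul_assoc, ← mul_assoc]
        exact dvd_add (hb.mul_right _) (hc.mul_right _)
      rw [Int.gcd_eq_gcd_ab, mul_add, ← mul_assoc, ← mul_assoc]
      exact dvd_add (ha.mul_right _) (hbc.mul_right _)
    rw [hf'] at h4
    simpa using h4
  have e : u = u' := Nat.dvd_antisymm (by exact_mod_cast key hg h.symm)
    (by exact_mod_cast key hf h)
  subst e
  have hu0 : (u : ℤ) ≠ 0 := by exact_mod_cast hu.ne'
  simp only [scl, Prod.mk.injEq] at h
  exact ⟨rfl, Prod.ext (mul_left_cancel₀ hu0 h.1) (Prod.ext (mul_left_cancel₀ hu0 h.2.1)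
    (mul_left_cancel₀ hu0 h.2.2))⟩

lemma rel_R2 {n : ℕ} (hn : 2 < n) (R : ℕ → Finset (ℤ × ℤ × ℤ))
    (hR2 : ∀ d u, (d, u) ∈ prs n → ∀ f ∈ R d, IsPrimitiveForm f ∧ formDisc f = d ∧ 0 < f.1)
    (hR3 : ∀ d u, (d, u) ∈ prs n →
      ∀ g, IsPrimitiveForm g → formDisc g = d → ∃ f ∈ R d, ∃ M : SL2, g = act f M)
    {e k x : ℕ} (he : 0 < e) (hk : 0 < k) (hx : k ∣ x ^ 2 + n * x + 1) :
    ∃ d u f v, (d, u) ∈ prs n ∧ f ∈ R d ∧ Sect f d v ∧ Rel n e k x u f v ∧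
      ((e ^ 2 * k : ℕ) : ℤ) = u * formVal f v.1 v.2 := by
  obtain ⟨c, hc⟩ := hx
  set g : ℤ × ℤ × ℤ := (k, n + 2 * x, c) with hg
  obtain ⟨u, g0, hu, hg0, hgg⟩ := content (g := g) (by simp [hg, hk])
  have hdg : formDisc g = (n : ℤ) ^ 2 - 4 := by
    simp only [hg, formDisc]
    zify at hc
    linear_combination (-4 : ℤ) * (-hc)
  have hdu : formDisc g0 * (u : ℤ) ^ 2 = (n : ℤ) ^ 2 - 4 := by rw [← hdg, hgg, scl_disc]
  have hn' : (2 : ℤ) < n := by exact_mod_cast hn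
  have hd0 : 0 < formDisc g0 := by
    have : 0 < formDisc g0 * (u : ℤ) ^ 2 := by rw [hdu]; nlinarith
    exact pos_of_mul_pos_left this (by positivity)
  obtain ⟨d, hd⟩ := Int.eq_ofNat_of_zero_le hd0.le
  have hd4 : d % 4 = 0 ∨ d % 4 = 1 := by
    have h1 : ((d : ℤ) % 4 = 0 ∨ (d : ℤ) % 4 = 1) := by
      rw [← hd, formDisc]
      rcases Int.even_or_odd' g0.2.1 with ⟨m, hm | hm⟩
      · left; rw [hm]; ring_nf; omega
      · right; rw [hm]; ring_nf; omega
    omega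
  rw [hd] at hdu
  have hmem := mem_prs hn hu hdu hd4
  obtain ⟨f, hf, N0, hN0⟩ := hR3 d u hmem g0 hg0 hd
  obtain ⟨p1, p2, p3⟩ := hR2 d u hmem f hf
  obtain ⟨q1, q2, q3, q4, q5⟩ := prs_mem hn hmem
  have hval : formVal f (ap N0 (e, 0)).1 (ap N0 (e, 0)).2 = g0.1 * (e : ℤ) ^ 2 := by
    rw [← val_act', ← hN0, val_e]
  have hkg : (k : ℤ) = u * g0.1 := by
    have := congrArg Prod.fst hgg; simpa [hg, scl] using this
  have hg01 : 0 < g0.1 := by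
    have : 0 < (u : ℤ) * g0.1 := by rw [← hkg]; exact_mod_cast hk
    exact pos_of_mul_pos_right this (by positivity)
  obtain ⟨M, hM1, hM2⟩ := sect_exists (by exact_mod_cast q1) q5 p2 p3 (v := ap N0 (e, 0))
    (by rw [hval]; positivity)
  refine ⟨d, u, f, ap M (ap N0 (e, 0)), hmem, hf, hM2, ⟨M * N0, x, c, by simp, ?_, ?_⟩, ?_⟩
  · rw [act_mul, hM1, ← hN0, ← hgg]
  · rw [ap_mul]
  · rw [← val_act', hM1, hval]; push_cast; rw [hkg]; ring

lemma rel_R3 {n e k x e' k' x' u : ℕ} {f : ℤ × ℤ × ℤ} {v : ℤ × ℤ} (he : 0 < e) (he' : 0 < e')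
    (hx : x < k) (hx' : x' < k') (h1 : Rel n e k x u f v) (h2 : Rel n e' k' x' u f v) :
    e = e' ∧ k = k' ∧ x = x' := by
  obtain ⟨N, y, c, a1, a2, a3⟩ := h1
  obtain ⟨N', y', c', b1, b2, b3⟩ := h2
  obtain ⟨h3, j, hj⟩ := col_unique he he' (a3.trans b3.symm)
  rw [hj, act_mul, scl_act, a2, act_shear] at b2
  simp only [Prod.mk.injEq] at b2
  obtain ⟨c1, c2, -⟩ := b2
  have hk : k = k' := by exact_mod_cast c1
  subst hk
  refine ⟨h3, rfl, ?_⟩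
  have : (k : ℤ) ∣ (x : ℤ) - x' := by
    have h5 : y' = y + k * j := by linarith
    have : (x : ℤ) - x' = (y' - x') - (y - x) - k * j := by rw [h5]; ring
    rw [this]
    exact dvd_sub (dvd_sub b1 a1) (Dvd.intro _ rfl)
  have h6 := Int.eq_zero_of_abs_lt_dvd this (by rw [abs_lt]; constructor <;> omega)
  omega

lemma rel_R4 {n : ℕ} (hn : 2 < n) (R : ℕ → Finset (ℤ × ℤ × ℤ))
    (hR2 : ∀ d u, (d, u) ∈ prs n → ∀ f ∈ R d, IsPrimitiveForm f ∧ formDisc f = d ∧ 0 < f.1)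
    (hR4 : ∀ d u, (d, u) ∈ prs n → ∀ f ∈ R d, ∀ g ∈ R d, (∃ M : SL2, g = act f M) → f = g)
    {e k x d u d' u' : ℕ} {f f' : ℤ × ℤ × ℤ} {v v' : ℤ × ℤ} (hk : 0 < k)
    (m1 : (d, u) ∈ prs n) (m2 : (d', u') ∈ prs n) (hf : f ∈ R d) (hf' : f' ∈ R d')
    (s1 : Sect f d v) (s2 : Sect f' d' v')
    (h1 : Rel n e k x u f v) (h2 : Rel n e k x u' f' v') :
    d = d' ∧ u = u' ∧ f = f' ∧ v = v' := by
  obtain ⟨N, y, c, a1, a2, a3⟩ := h1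
  obtain ⟨N', y', c', b1, b2, b3⟩ := h2
  obtain ⟨p1, p2, p3⟩ := hR2 d u m1 f hf
  obtain ⟨r1, r2, r3⟩ := hR2 d' u' m2 f' hf'
  obtain ⟨q1, q2, q3, q4, q5⟩ := prs_mem hn m1
  obtain ⟨t1, t2, t3, t4, t5⟩ := prs_mem hn m2
  have hdv : (k : ℤ) ∣ y' - y := by
    have : y' - y = (y' - x) - (y - x) := by ring
    rw [this]; exact dvd_sub b1 a1
  obtain ⟨j, hj⟩ := hdv
  have hscl : scl u (act f (N * shear j)) = scl u' (act f' N') := by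
    rw [act_mul, scl_act, a2, b2, act_shear]
    have D1 : formDisc (act ((k:ℤ), (n:ℤ) + 2 * y, c) (shear j)) = (n : ℤ) ^ 2 - 4 := by
      rw [disc_act, ← a2, scl_disc, disc_act, p2, q3]
    have D2 : formDisc ((k:ℤ), (n:ℤ) + 2 * y', c') = (n : ℤ) ^ 2 - 4 := by
      rw [← b2, scl_disc, disc_act, r2, t3]
    rw [act_shear] at D1
    simp only [formDisc] at D1 D2
    have hk0 : (k : ℤ) ≠ 0 := by exact_mod_cast hk.ne'
    have hb : (n : ℤ) + 2 * y + 2 * k * j = n + 2 * y' := by linarith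
    simp only [Prod.mk.injEq, true_and]
    refine ⟨hb, ?_⟩
    rw [hb] at D1
    apply mul_left_cancel₀ hk0
    linarith
  obtain ⟨hu, hff⟩ := content_unique q2 t2 (prim_act p1 _) (prim_act r1 _) hscl
  subst hu
  have hd : d = d' := by
    have h3 : formDisc f = formDisc f' := by
      rw [← disc_act f (N * shear j), hff, disc_act]
    rw [p2, r2] at h3; exact_mod_cast h3
  subst hd
  have hff' : f' = act f (N * shear j * N'⁻¹) := by
    rw [act_mul, hff, ← act_mul]; simp
  have e1 : f = f' := hR4 d u m1 f hf f' hf' ⟨_, hff'⟩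
  subst e1
  refine ⟨rfl, rfl, rfl, ?_⟩
  have hv : v = ap (N * shear j * N'⁻¹) v' := by
    rw [← b3, ← ap_mul, mul_assoc, inv_mul_cancel, mul_one, ap_mul, ap_shear, a3]
  rw [hv] at s1 ⊢
  exact sect_unique (by exact_mod_cast q1) q5 p2 p1 p3.ne' hff'.symm s2 s1

/-- left set -/
def LSet (n X : ℕ) : Finset (Σ _ : ℕ, Σ _ : ℕ, ℕ) :=
  (Finset.Icc 1 X).sigma fun e => (Finset.Icc 1 (X / e ^ 2)).sigma fun k =>
    (range k).filter (fun x => k ∣ x ^ 2 + n * x + 1)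

lemma LSet_card (n X : ℕ) : (LSet n X).card =
    ∑ e ∈ Finset.Icc 1 X, ∑ k ∈ Finset.Icc 1 (X / e ^ 2), rho n k := by
  simp only [LSet, Finset.card_sigma, rho]

lemma mem_LSet {n X e k x : ℕ} : (⟨e, k, x⟩ : Σ _ : ℕ, Σ _ : ℕ, ℕ) ∈ LSet n X ↔
    0 < e ∧ 0 < k ∧ e ^ 2 * k ≤ X ∧ x < k ∧ k ∣ x ^ 2 + n * x + 1 := by
  simp only [LSet, Finset.mem_sigma, Finset.mem_Icc, mem_filter, mem_range]
  constructor
  · rintro ⟨⟨h1, h2⟩, ⟨h3, h4⟩, h5, h6⟩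
    refine ⟨h1, h3, ?_, h5, h6⟩
    rw [Nat.le_div_iff_mul_le (by positivity)] at h4
    rw [mul_comm]; exact h4
  · rintro ⟨h1, h2, h3, h4, h5⟩
    refine ⟨⟨h1, ?_⟩, ⟨h2, ?_⟩, h4, h5⟩
    · calc e ≤ e ^ 2 * k := by nlinarith [Nat.mul_le_mul h1 h1, Nat.mul_le_mul (Nat.mul_le_mul h1 h1) h2]
        _ ≤ X := h3
    · rw [Nat.le_div_iff_mul_le (by positivity)]
      rw [mul_comm]; exact h3

theorem class_number_formula {n : ℕ} (hn : 2 < n) :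
    Tendsto (fun X : ℕ => (∑ e ∈ Finset.Icc 1 X, ∑ k ∈ Finset.Icc 1 (X / e ^ 2), (rho n k : ℝ)) / X)
      atTop (nhds (ampA n)) := by
  classical
  have hex : ∀ d : ℕ, ∃ R : Finset (ℤ × ℤ × ℤ), (0 < d → ¬ IsSquare (d : ℤ) →
      (R.card = classNumber d ∧
      (∀ f ∈ R, IsPrimitiveForm f ∧ formDisc f = d ∧ 0 < f.1) ∧
      (∀ g, IsPrimitiveForm g → formDisc g = d → ∃ f ∈ R, ∃ M : SL2, g = act f M) ∧
      (∀ f ∈ R, ∀ g ∈ R, (∃ M : SL2, g = act f M) → f = g))) := by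
    intro d
    by_cases h : 0 < d ∧ ¬ IsSquare (d : ℤ)
    · obtain ⟨R, hR⟩ := reps_exist (d := d) (by exact_mod_cast h.1) h.2
      exact ⟨R, fun _ _ => hR⟩
    · exact ⟨∅, fun h1 h2 => absurd ⟨h1, h2⟩ h⟩
  choose R hR using hex
  have hR' : ∀ d u, (d, u) ∈ prs n → _ := fun d u h =>
    hR d (prs_mem hn h).1 (prs_mem hn h).2.2.2.1
  let I := (prs n).sigma fun p => R p.1
  let B : ℕ → I → Type := fun X i => {v : ℤ × ℤ // Sect i.1.2 i.1.1.1 v ∧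
    (i.1.1.2 : ℤ) * formVal i.1.2 v.1 v.2 ≤ X}
  have heq : ∀ X : ℕ, Nonempty ((LSet n X) ≃ Σ i : I, B X i) := by
    intro X
    apply card_eq_of_rel (fun (a : LSet n X) (b : Σ i : I, B X i) =>
      Rel n a.1.1 a.1.2.1 a.1.2.2 b.1.1.1.2 b.1.1.2 b.2.1)
    · rintro ⟨⟨⟨⟨d, u⟩, f⟩, hi⟩, v, hv1, hv2⟩
      simp only at hv1 hv2
      obtain ⟨hm, hf⟩ := Finset.mem_sigma.1 hi
      simp only at hm hf
      obtain ⟨q1, q2, q3, q4, q5⟩ := prs_mem hn hm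
      obtain ⟨p1, p2, p3⟩ := (hR' d u hm).2.1 f hf
      have hx := xi_mul (by exact_mod_cast q1) p2 v
      have hpos : 0 < formVal f v.1 v.2 := by
        have h1 : 0 < xi f d v * xic f d v := mul_pos (hv1.1.trans_le hv1.2.1) hv1.1
        rw [hx] at h1
        have := pos_of_mul_pos_right h1 (by exact_mod_cast p3.le)
        exact_mod_cast this
      obtain ⟨e, k, x, h1, h2, h3, h4, h5, h6⟩ := rel_R1 q2 q3 p2 hpos
      refine ⟨⟨⟨e, k, x⟩, mem_LSet.2 ⟨h1, h2, ?_, h3, h4⟩⟩, h5⟩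
      zify at h6 ⊢
      rw [h6]; exact hv2
    · rintro ⟨⟨e, k, x⟩, h⟩
      obtain ⟨h1, h2, h3, h4, h5⟩ := mem_LSet.1 h
      obtain ⟨d, u, f, v, a1, a2, a3, a4, a5⟩ := rel_R2 hn R (fun d u h => (hR' d u h).2.1)
        (fun d u h => (hR' d u h).2.2.1) h1 h2 h5
      refine ⟨⟨⟨⟨(d, u), f⟩, Finset.mem_sigma.2 ⟨a1, a2⟩⟩, ⟨v, a3, ?_⟩⟩, a4⟩
      simp only
      rw [← a5]; exact_mod_cast h3
    · rintro ⟨⟨e, k, x⟩, h⟩ ⟨⟨e', k', x'⟩, h'⟩ b r1 r2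
      obtain ⟨h1, h2, h3, h4, h5⟩ := mem_LSet.1 h
      obtain ⟨h1', h2', h3', h4', h5'⟩ := mem_LSet.1 h'
      obtain ⟨rfl, rfl, rfl⟩ := rel_R3 h1 h1' h4 h4' r1 r2
      rfl
    · rintro ⟨⟨e, k, x⟩, h⟩ ⟨⟨⟨⟨d, u⟩, f⟩, hi⟩, v, hv1, hv2⟩ ⟨⟨⟨⟨d', u'⟩, f'⟩, hi'⟩, v', hv1', hv2'⟩ r1 r2
      obtain ⟨h1, h2, h3, h4, h5⟩ := mem_LSet.1 h
      obtain ⟨hm, hf⟩ := Finset.mem_sigma.1 hi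
      obtain ⟨hm', hf'⟩ := Finset.mem_sigma.1 hi'
      obtain ⟨rfl, rfl, rfl, rfl⟩ := rel_R4 hn R (fun d u h => (hR' d u h).2.1)
        (fun d u h => (hR' d u h).2.2.2) h2 hm hm' hf hf' hv1 hv1' r1 r2
      rfl
  have hcount : ∀ X : ℕ, (∑ e ∈ Finset.Icc 1 X, ∑ k ∈ Finset.Icc 1 (X / e ^ 2), (rho n k : ℝ))
      = ∑ i : I, (Nat.card (B X i) : ℝ) := by
    intro X
    obtain ⟨E⟩ := heq X
    have : Finite (Σ i : I, B X i) := Finite.of_equiv _ E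
    have hfin : ∀ i, Finite (B X i) := fun i =>
      Finite.of_injective (fun b => (⟨i, b⟩ : Σ i : I, B X i)) sigma_mk_injective
    have h1 := Nat.card_congr E
    rw [Nat.card_sigma, Nat.card_eq_fintype_card, Fintype.card_coe, LSet_card] at h1
    exact_mod_cast h1
  have hlim : ∀ i : I, Tendsto (fun X : ℕ => (Nat.card (B X i) : ℝ) / X) atTop
      (nhds (Real.log (eps i.1.1.1) / (i.1.1.2 * √(i.1.1.1 : ℝ)))) := by
    rintro ⟨⟨⟨d, u⟩, ⟨a, b, c⟩⟩, hi⟩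
    obtain ⟨hm, hf⟩ := Finset.mem_sigma.1 hi
    simp only at hm hf ⊢
    obtain ⟨q1, q2, q3, q4, q5⟩ := prs_mem hn hm
    obtain ⟨p1, p2, p3⟩ := (hR' d u hm).2.1 _ hf
    have hu : (0 : ℝ) < u := by exact_mod_cast q2
    have he := eps_gt (by exact_mod_cast q1) q5
    have hsc := sector_count a b c d p3 p2 (by exact_mod_cast q1) (eps d ^ 2) (by nlinarith)
    have ht : Tendsto (fun X : ℕ => (X : ℝ) / u) atTop atTop :=
      tendsto_natCast_atTop_atTop.atTop_div_const hu
    have h2 := (hsc.comp ht).div_const (u : ℝ)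
    have e1 : Real.log (eps d ^ 2) / (2 * √((d : ℤ) : ℝ)) / u = Real.log (eps d) / (u * √(d : ℝ)) := by
      rw [Real.log_pow, Int.cast_natCast]; push_cast
      have : 0 < √(d : ℝ) := Real.sqrt_pos.2 (by exact_mod_cast q1)
      field_simp
    rw [e1] at h2
    refine h2.congr fun X => ?_
    simp only [Function.comp]
    rw [div_div, div_mul_cancel₀ _ hu.ne']
    congr 2
    apply Nat.card_congr
    apply Equiv.subtypeEquivRight
    intro v
    simp only [Set.mem_ofPred_eq, Sect, xi, xic]
    rw [le_div_iff₀ hu]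
    have : (formVal (a, b, c) v.1 v.2 : ℝ) * u ≤ X ↔ (u : ℤ) * formVal (a, b, c) v.1 v.2 ≤ X := by
      rw [mul_comm]; norm_cast
    rw [this]
  have hsum := tendsto_finsetSum (Finset.univ : Finset I) (fun i _ => hlim i)
  have hfinal : ∑ i : I, Real.log (eps i.1.1.1) / (i.1.1.2 * √(i.1.1.1 : ℝ)) = ampA n := by
    rw [Finset.sum_coe_sort I (fun i => Real.log (eps i.1.1) / (i.1.2 * √(i.1.1 : ℝ)))]
    rw [Finset.sum_sigma]
    rw [ampA]
    refine sum_congr rfl fun p hp => ?_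
    simp only [Finset.sum_const, nsmul_eq_mul]
    rw [(hR' p.1 p.2 hp).1]
    ring
  rw [hfinal] at hsum
  refine hsum.congr fun X => ?_
  rw [hcount, Finset.sum_div]

lemma sum_range_shift {M : Type*} [AddCommGroup M] (f : ℕ → M) (m : ℕ) (hf : ∀ x, f (x + m) = f x) (t : ℕ) :
    ∑ x ∈ range m, f (x + t) = ∑ x ∈ range m, f x := by
  induction t with
  | zero => simp
  | succ t ih =>
    rw [← ih]
    have h1 := sum_range_succ (fun x => f (x + t)) m
    have h2 := Finset.sum_range_succ' (fun x => f (x + t)) m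
    rw [h1] at h2
    have h3 : f (m + t) = f (0 + t) := by rw [add_comm m t, hf, zero_add]
    rw [h3] at h2
    have := add_right_cancel h2
    rw [this]
    apply sum_congr rfl
    intro x _
    congr 1
    ring

lemma sum_range_periodic {M : Type*} [AddCommGroup M] (f : ℕ → M) (m : ℕ) (hf : ∀ x, f (x + m) = f x) (k : ℕ) :
    ∑ x ∈ range (m * k), f x = k • ∑ x ∈ range m, f x := by
  have hf' : ∀ k x, f (x + m * k) = f x := by
    intro k
    induction k with
    | zero => simp
    | succ k ih => intro x; rw [mul_add, mul_one, ← add_assoc, hf, ih]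
  induction k with
  | zero => simp
  | succ k ih =>
    rw [mul_add, mul_one, Finset.sum_range_add, ih, succ_nsmul]
    congr 1
    apply sum_congr rfl
    intro x _
    rw [add_comm, hf']

lemma card_filter_eq_sum (m : ℕ) (P : ℕ → Prop) [DecidablePred P] :
    (((range m).filter P).card : ℤ) = ∑ x ∈ range m, if P x then (1:ℤ) else 0 := by
  rw [Finset.card_filter]; push_cast; rfl

lemma card_shift (m : ℕ) (P Q : ℕ → Prop) [DecidablePred P] [DecidablePred Q] (hP : ∀ x, P (x + m) ↔ P x)
    (t : ℕ) (h : ∀ x, Q x ↔ P (x + t)) :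
    ((range m).filter Q).card = ((range m).filter P).card := by
  have h1 := card_filter_eq_sum m P
  have h2 := card_filter_eq_sum m Q
  have h3 := sum_range_shift (fun x => if P x then (1:ℤ) else 0) m (by intro x; simp [hP]) t
  simp only [h] at h2
  rw [h3, ← h1] at h2
  simp only [h]
  exact_mod_cast h2

lemma card_mult_shift (a k w : ℕ) (ha : 0 < a) :
    ((range (a * k)).filter (fun x => a ∣ x + w)).card = k := by
  have h0 : ((range a).filter (fun x => a ∣ x + w)).card = 1 := by
    rw [card_shift a (fun x => a ∣ x) _ (by simp) w (by simp)]
    rw [Finset.card_eq_one]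
    refine ⟨0, ?_⟩
    ext x
    simp only [mem_filter, mem_range, Finset.mem_singleton]
    constructor
    · rintro ⟨h1, h2⟩; exact Nat.eq_zero_of_dvd_of_lt h2 h1
    · rintro rfl; simp [ha]
  have h1 := card_filter_eq_sum (a * k) (fun x => a ∣ x + w)
  rw [sum_range_periodic _ a (by intro x; congr 1; rw [show x + a + w = a + (x + w) by ring]; simp), ← card_filter_eq_sum, h0] at h1
  simp at h1
  exact_mod_cast h1

lemma rho_mul {m k : ℕ} (h : Nat.Coprime m k) (n : ℕ) : rho n (m * k) = rho n m * rho n k := by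
  rcases Nat.eq_zero_or_pos m with rfl | hm
  · simp [rho]
  rcases Nat.eq_zero_or_pos k with rfl | hk
  · simp [rho]
  unfold rho
  rw [← Finset.card_product]
  have hper : ∀ a x : ℕ, a ∣ (x % a) ^ 2 + n * (x % a) + 1 ↔ a ∣ x ^ 2 + n * x + 1 := by
    intro a x
    have h1 : (x % a) ^ 2 + n * (x % a) + 1 ≡ x ^ 2 + n * x + 1 [MOD a] :=
      (((Nat.mod_modEq x a).pow 2).add ((Nat.mod_modEq x a).mul_left n)).add_right 1
    exact h1.dvd_iff (dvd_refl a)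
  apply Finset.card_bij (fun x _ => (x % m, x % k))
  · intro x hx
    simp only [mem_filter, mem_range, Finset.mem_product] at hx ⊢
    refine ⟨⟨Nat.mod_lt _ hm, ?_⟩, ⟨Nat.mod_lt _ hk, ?_⟩⟩
    · rw [hper]; exact (Dvd.intro _ rfl).trans hx.2
    · rw [hper]; exact (Dvd.intro_left _ rfl).trans hx.2
  · intro x hx y hy hxy
    simp only [mem_filter, mem_range, Prod.mk.injEq] at hx hy hxy
    have : x ≡ y [MOD (m * k)] := (Nat.modEq_and_modEq_iff_modEq_mul h).mp hxy
    exact this.eq_of_lt_of_lt hx.1 hy.1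
  · rintro ⟨u, v⟩ huv
    simp only [mem_filter, mem_range, Finset.mem_product] at huv
    obtain ⟨⟨hu1, hu2⟩, ⟨hv1, hv2⟩⟩ := huv
    obtain ⟨z, hz1, hz2⟩ := Nat.chineseRemainder h u v
    have e1 : (z % (m * k)) % m = u := by
      rw [Nat.mod_mul_right_mod]; exact Nat.mod_eq_of_modEq hz1 hu1
    have e2 : (z % (m * k)) % k = v := by
      rw [Nat.mod_mul_left_mod]; exact Nat.mod_eq_of_modEq hz2 hv1
    refine ⟨z % (m * k), ?_, by rw [e1, e2]⟩
    simp only [mem_filter, mem_range]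
    refine ⟨Nat.mod_lt _ (Nat.mul_pos hm hk), ?_⟩
    apply Nat.Coprime.mul_dvd_of_dvd_of_dvd h
    · rw [← hper, e1]; exact hu2
    · rw [← hper, e2]; exact hv2

lemma pow_dvd_right {p : ℕ} (hp : p.Prime) {i s a b : ℕ} (h : p ^ i ∣ a * b) (ha : ¬ p ^ (s + 1) ∣ a) :
    p ^ (i - s) ∣ b := by
  have ha0 : a ≠ 0 := by rintro rfl; simp at ha
  obtain ⟨t, a', h1, h2⟩ := Nat.exists_eq_pow_mul_and_not_dvd ha0 p hp.ne_one
  have hts : t ≤ s := by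
    by_contra hh
    push Not at hh
    exact ha (h2 ▸ Dvd.dvd.mul_right (pow_dvd_pow p hh) a')
  rcases Nat.lt_or_ge i t with hit | hit
  · rw [Nat.sub_eq_zero_of_le (by omega)]; simp
  have h3 : p ^ (i - t) ∣ a' * b := by
    have : p ^ t * p ^ (i - t) ∣ p ^ t * (a' * b) := by
      rw [← pow_add, Nat.add_sub_cancel' hit, ← mul_assoc, ← h2]; exact h
    exact (Nat.mul_dvd_mul_iff_left (pow_pos hp.pos t)).mp this
  have h4 : p ^ (i - t) ∣ b := by
    apply Nat.Coprime.dvd_of_dvd_mul_left _ h3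
    exact Nat.Coprime.pow_left _ ((Nat.Prime.coprime_iff_not_dvd hp).mpr h1)
  exact (pow_dvd_pow p (by omega)).trans h4

/-- `#{z mod p^i : p^i ∣ z(z+w)}`. -/
def cnt (p i w : ℕ) : ℕ := ((range (p ^ i)).filter (fun z => p ^ i ∣ z * (z + w))).card

lemma cnt_big {p : ℕ} (hp : p.Prime) {i w : ℕ} (h : p ^ ((i + 1) / 2) ∣ w) : cnt p i w = p ^ (i / 2) := by
  have h1 : ∀ z, p ^ i ∣ z * (z + w) ↔ p ^ ((i + 1) / 2) ∣ z + 0 := by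
    intro z
    rw [add_zero]
    constructor
    · intro hz
      rcases Nat.eq_zero_or_pos i with rfl | hi
      · simp
      by_contra hc
      obtain ⟨s, hs⟩ : ∃ s, (i + 1) / 2 = s + 1 := ⟨(i + 1) / 2 - 1, by omega⟩
      have := pow_dvd_right hp hz (hs ▸ hc)
      have h2 : p ^ ((i + 1) / 2) ∣ z + w := (pow_dvd_pow p (by omega)).trans this
      exact hc ((Nat.dvd_add_left h).mp h2)
    · intro hz
      have : p ^ ((i + 1) / 2 + (i + 1) / 2) ∣ z * (z + w) := by
        rw [pow_add]; exact mul_dvd_mul hz (dvd_add hz h)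
      exact (pow_dvd_pow p (by omega)).trans this
  unfold cnt
  simp only [h1]
  have : p ^ i = p ^ ((i + 1) / 2) * p ^ (i / 2) := by rw [← pow_add]; congr 1; omega
  rw [this]
  exact card_mult_shift _ _ 0 (pow_pos hp.pos _)

lemma cnt_small {p : ℕ} (hp : p.Prime) {i s w : ℕ} (h : p ^ s ∣ w) (h' : ¬ p ^ (s + 1) ∣ w) (hs : 2 * s < i) :
    cnt p i w = 2 * p ^ s := by
  have h1 : ∀ z, p ^ i ∣ z * (z + w) ↔ (p ^ (i - s) ∣ z + 0 ∨ p ^ (i - s) ∣ z + w) := by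
    intro z
    rw [add_zero]
    constructor
    · intro hz
      by_cases hc : p ^ (s + 1) ∣ z
      · left
        have : ¬ p ^ (s + 1) ∣ z + w := fun hh => h' ((Nat.dvd_add_right hc).mp hh)
        rw [mul_comm] at hz
        exact pow_dvd_right hp hz this
      · right; exact pow_dvd_right hp hz hc
    · have hsi : p ^ i = p ^ (i - s) * p ^ s := by rw [← pow_add]; congr 1; omega
      have hss : p ^ s ∣ p ^ (i - s) := pow_dvd_pow p (by omega)
      rw [hsi]
      rintro (hz | hz)
      · exact mul_dvd_mul hz (dvd_add (hss.trans hz) h)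
      · rw [mul_comm z]; exact mul_dvd_mul hz ((Nat.dvd_add_left h).mp (hss.trans hz))
  unfold cnt
  simp only [h1]
  rw [Finset.filter_or, Finset.card_union_of_disjoint]
  · have : p ^ i = p ^ (i - s) * p ^ s := by rw [← pow_add]; congr 1; omega
    rw [this, card_mult_shift _ _ 0 (pow_pos hp.pos _), card_mult_shift _ _ w (pow_pos hp.pos _)]; ring
  · rw [Finset.disjoint_filter]
    intro z _ hz1 hz2
    rw [add_zero] at hz1
    have := (Nat.dvd_add_right hz1).mp hz2
    exact h' ((pow_dvd_pow p (by omega)).trans this)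

lemma rho_of_root {n m y : ℕ} (hy : m ∣ y ^ 2 + n * y + 1) :
    rho n m = ((range m).filter (fun z => m ∣ z * (z + (2 * y + n)))).card := by
  unfold rho
  symm
  apply card_shift m (fun x => m ∣ x ^ 2 + n * x + 1) _ _ y
  · intro x
    rw [show (x + y) ^ 2 + n * (x + y) + 1 = x * (x + (2 * y + n)) + (y ^ 2 + n * y + 1) by ring]
    exact (Nat.dvd_add_left hy).symm
  · intro x
    rw [show (x + m) ^ 2 + n * (x + m) + 1 = m * (2 * x + m + n) + (x ^ 2 + n * x + 1) by ring]
    exact Nat.dvd_add_right (Dvd.intro _ rfl)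

lemma rho_root_or_zero (n m : ℕ) : rho n m = 0 ∨ ∃ y, m ∣ y ^ 2 + n * y + 1 := by
  rcases Nat.eq_zero_or_pos (rho n m) with h | h
  · exact Or.inl h
  · right
    obtain ⟨y, hy⟩ := Finset.card_pos.mp h
    exact ⟨y, (Finset.mem_filter.mp hy).2⟩

lemma cnt_le {p : ℕ} (hp : p.Prime) {i w : ℕ} : cnt p i w ≤ 2 * p ^ (i / 2) := by
  by_cases h : p ^ ((i + 1) / 2) ∣ w
  · rw [cnt_big hp h]; omega
  · have hw : w ≠ 0 := by rintro rfl; simp at h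
    obtain ⟨s, a', h1, h2⟩ := Nat.exists_eq_pow_mul_and_not_dvd hw p hp.ne_one
    have h3 : s < (i + 1) / 2 := by
      by_contra hh
      push Not at hh
      exact h (h2 ▸ Dvd.dvd.mul_right (pow_dvd_pow p hh) a')
    rw [cnt_small hp (s := s) (h2 ▸ Dvd.intro _ rfl) _ (by omega)]
    · exact Nat.mul_le_mul_left _ (Nat.pow_le_pow_right hp.pos (by omega))
    · intro hh
      rw [h2, pow_succ] at hh
      exact h1 ((Nat.mul_dvd_mul_iff_left (pow_pos hp.pos s)).mp hh)

lemma rho_pp_le {p : ℕ} (hp : p.Prime) (n i : ℕ) : rho n (p ^ i) ≤ 2 * p ^ (i / 2) := by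
  rcases rho_root_or_zero n (p ^ i) with h | ⟨y, hy⟩
  · rw [h]; exact Nat.zero_le _
  · rw [rho_of_root hy]; exact cnt_le hp

lemma rho_sq_le (n : ℕ) {m : ℕ} (hm : m ≠ 0) : (rho n m) ^ 2 ≤ m.divisors.card ^ 2 * m := by
  induction m using Nat.recOnPosPrimePosCoprime with
  | zero => exact absurd rfl hm
  | one => simp [rho]
  | prime_pow p i hp hi =>
    have h1 := rho_pp_le hp n i
    rw [Nat.divisors_prime_pow hp]
    simp only [Finset.card_map, Finset.card_range]
    have h2 : (p ^ (i / 2)) ^ 2 ≤ p ^ i := by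
      rw [← pow_mul]; exact Nat.pow_le_pow_right hp.pos (by omega)
    calc (rho n (p ^ i)) ^ 2 ≤ (2 * p ^ (i / 2)) ^ 2 := Nat.pow_le_pow_left h1 2
      _ = 2 ^ 2 * (p ^ (i / 2)) ^ 2 := by ring
      _ ≤ (i + 1) ^ 2 * p ^ i := Nat.mul_le_mul (Nat.pow_le_pow_left (by omega) 2) h2
  | coprime a b ha hb hab iha ihb =>
    rw [rho_mul hab, Nat.Coprime.card_divisors_mul hab]
    calc (rho n a * rho n b) ^ 2 = rho n a ^ 2 * rho n b ^ 2 := by ring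
      _ ≤ _ := Nat.mul_le_mul (iha (by omega)) (ihb (by omega))
      _ = _ := by ring

lemma hensel_root {p : ℕ} (hp : p.Prime) {n y : ℕ} (hy : p ∣ y ^ 2 + n * y + 1) (hw : ¬ p ∣ 2 * y + n) (i : ℕ) :
    ∃ y', p ^ (i + 1) ∣ y' ^ 2 + n * y' + 1 ∧ ¬ p ∣ 2 * y' + n := by
  induction i with
  | zero => exact ⟨y, by simpa using hy, hw⟩
  | succ i ih =>
    obtain ⟨y, ⟨t, ht⟩, h2⟩ := ih
    have : Fact p.Prime := ⟨hp⟩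
    have hu : ((2 * y + n : ℕ) : ZMod p) ≠ 0 := by
      rwa [Ne, ZMod.natCast_eq_zero_iff]
    obtain ⟨z, hz⟩ : ∃ z : ℕ, (z : ZMod p) = - t * ((2 * y + n : ℕ) : ZMod p)⁻¹ :=
      ⟨(- t * ((2 * y + n : ℕ) : ZMod p)⁻¹ : ZMod p).val, by simp⟩
    refine ⟨y + p ^ (i + 1) * z, ?_, ?_⟩
    · have h3 : (y + p ^ (i + 1) * z) ^ 2 + n * (y + p ^ (i + 1) * z) + 1 =
        p ^ (i + 1) * (t + (2 * y + n) * z + p * (p ^ i * z ^ 2)) := by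
        have : (y + p ^ (i + 1) * z) ^ 2 + n * (y + p ^ (i + 1) * z) + 1 = (y ^ 2 + n * y + 1) + p ^ (i + 1) * z * (2 * y + n) + (p ^ (i + 1)) ^ 2 * z ^ 2 := by ring
        rw [this, ht]; ring
      rw [h3, pow_succ p (i + 1)]
      apply Nat.mul_dvd_mul_left
      apply dvd_add _ (Dvd.intro _ rfl)
      rw [← ZMod.natCast_eq_zero_iff]
      push_cast at hz hu ⊢
      rw [hz]
      field_simp
      ring
    · intro hh
      apply h2
      rw [show 2 * (y + p ^ (i + 1) * z) + n = p * (2 * p ^ i * z) + (2 * y + n) by ring] at hh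
      exact (Nat.dvd_add_right (Dvd.intro _ rfl)).mp hh

lemma rho_good {p : ℕ} (hp : p.Prime) (hp2 : p ≠ 2) {n : ℕ} (hD : ¬ (p : ℤ) ∣ (n : ℤ) ^ 2 - 4) (i : ℕ) :
    (rho n (p ^ (i + 1)) : ℤ) = 1 + jacobiSym ((n : ℤ) ^ 2 - 4) p := by
  have : Fact p.Prime := ⟨hp⟩
  have hodd : Odd p := hp.odd_of_ne_two hp2
  have hid : ∀ y : ℕ, ((2 * y + n : ℕ) : ℤ) ^ 2 = 4 * ((y ^ 2 + n * y + 1 : ℕ) : ℤ) + ((n : ℤ) ^ 2 - 4) := by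
    intro y; push_cast; ring
  have hc : (n : ℤ) ^ 2 - 4 ≠ 0 := by rintro h; rw [h] at hD; simp at hD
  have hcop : Int.gcd ((n : ℤ) ^ 2 - 4) p = 1 := by
    rw [Int.gcd_comm]
    exact Int.isCoprime_iff_gcd_eq_one.mp ((Nat.prime_iff_prime_int.mp hp).coprime_iff_not_dvd.mpr hD)
  rcases jacobiSym.eq_one_or_neg_one hcop with hJ | hJ
  · obtain ⟨c, hc⟩ := ZMod.isSquare_of_jacobiSym_eq_one hJ
    have h2 : (2 : ZMod p) ≠ 0 := by
      have : ((2 : ℕ) : ZMod p) ≠ 0 := by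
        rw [Ne, ZMod.natCast_eq_zero_iff]
        intro h; exact hp2 ((Nat.prime_dvd_prime_iff_eq hp Nat.prime_two).mp h)
      simpa using this
    push_cast at hc
    set y : ℕ := ((c - n) * 2⁻¹ : ZMod p).val with hy
    have hy' : (y : ZMod p) = (c - n) * 2⁻¹ := by simp [hy]
    have hw : ((2 * y + n : ℕ) : ZMod p) = c := by
      push_cast; rw [hy']; field_simp; ring
    have hDz : ((n : ZMod p)) ^ 2 - 4 ≠ 0 := by
      intro h
      apply hD
      rw [← ZMod.intCast_zmod_eq_zero_iff_dvd]
      push_cast; exact h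
    have hw0 : ¬ p ∣ 2 * y + n := by
      rw [← ZMod.natCast_eq_zero_iff, hw]
      rintro rfl
      apply hDz; rw [hc]; ring
    have hroot : p ∣ y ^ 2 + n * y + 1 := by
      rw [← ZMod.natCast_eq_zero_iff]
      have h4 : (2 : ZMod p) ^ 2 * ((y ^ 2 + n * y + 1 : ℕ) : ZMod p) = 0 := by
        have : (2 : ZMod p) ^ 2 * ((y ^ 2 + n * y + 1 : ℕ) : ZMod p) = ((2 * y + n : ℕ) : ZMod p) ^ 2 - ((n : ZMod p) ^ 2 - 4) := by
          push_cast; ring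
        rw [this, hw, hc]; ring
      exact (mul_eq_zero.mp h4).resolve_left (pow_ne_zero 2 h2)
    obtain ⟨y', h5, h6⟩ := hensel_root hp hroot hw0 i
    rw [rho_of_root h5]
    have := cnt_small (i := i + 1) hp (s := 0) (w := 2 * y' + n) (by simp) (by simpa using h6) (by omega)
    unfold cnt at this
    rw [this, hJ]; norm_num
  · rw [hJ]
    rcases rho_root_or_zero n (p ^ (i + 1)) with h | ⟨y, hy⟩
    · rw [h]; norm_num
    · exfalso
      have hpy : p ∣ y ^ 2 + n * y + 1 := (dvd_pow_self p (by omega)).trans hy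
      have := ZMod.nonsquare_of_jacobiSym_eq_neg_one hJ
      apply this
      refine ⟨((2 * y + n : ℕ) : ZMod p), ?_⟩
      have h7 := congrArg (fun z : ℤ => (z : ZMod p)) (hid y)
      simp only [Int.cast_add, Int.cast_mul, Int.cast_pow, Int.cast_natCast, (ZMod.natCast_eq_zero_iff _ _).mpr hpy] at h7
      rw [← sq, h7]; push_cast; ring

open ArithmeticFunction

/-- arithmetic function version of rho -/
noncomputable def rhoA (n : ℕ) : ArithmeticFunction ℤ := ⟨fun m => rho n m, by simp [rho]⟩
noncomputable def aA (n : ℕ) : ArithmeticFunction ℤ := liouville * rhoA n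
noncomputable def JA (E : ℤ) : ArithmeticFunction ℤ := ⟨fun m => if Odd m then jacobiSym E m else 0, by simp⟩
noncomputable def muJ (E : ℤ) : ArithmeticFunction ℤ := pmul (moebius) (JA E)
noncomputable def bA (n : ℕ) : ArithmeticFunction ℤ := aA n * muJ ((n : ℤ) ^ 2 - 4)

@[simp] lemma rhoA_apply (n m : ℕ) : rhoA n m = rho n m := rfl
lemma JA_apply (E : ℤ) (m : ℕ) : JA E m = if Odd m then jacobiSym E m else 0 := rfl

lemma JA_mul (E : ℤ) (a b : ℕ) : JA E (a * b) = JA E a * JA E b := by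
  simp only [JA_apply, Nat.odd_mul]
  by_cases ha : Odd a <;> by_cases hb : Odd b <;> simp [ha, hb]
  apply jacobiSym.mul_right'
  · rintro rfl; simp at ha
  · rintro rfl; simp at hb

lemma JA_one (E : ℤ) : JA E 1 = 1 := by simp [JA_apply]

lemma JA_abs_le (E : ℤ) (m : ℕ) : |JA E m| ≤ 1 := by
  rw [JA_apply]
  split_ifs
  · rcases jacobiSym.trichotomy E m with h | h | h <;> simp [h]
  · simp

lemma JA_isMult (E : ℤ) : IsMultiplicative (JA E) := ⟨JA_one E, fun _ => JA_mul E _ _⟩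

lemma muJ_mul_JA (E : ℤ) : muJ E * JA E = 1 := by
  ext q
  rcases Nat.eq_zero_or_pos q with rfl | hq
  · simp
  rw [mul_apply]
  have h1 : ∀ x ∈ q.divisorsAntidiagonal, muJ E x.1 * JA E x.2 = JA E q * (moebius x.1 * ((zeta : ArithmeticFunction ℤ) x.2)) := by
    intro x hx
    rw [Nat.mem_divisorsAntidiagonal] at hx
    have hx2 : x.2 ≠ 0 := by rintro h; rw [h] at hx; simp at hx; omega
    rw [← hx.1, JA_mul, muJ, pmul_apply, natCoe_apply, zeta_apply_ne hx2]
    push_cast; ring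
  rw [sum_congr rfl h1, ← mul_sum, ← mul_apply, moebius_mul_coe_zeta]
  by_cases h : q = 1
  · subst h; simp [JA_one]
  · simp [one_apply_ne h]

lemma bA_mul_JA (n : ℕ) : bA n * JA ((n : ℤ) ^ 2 - 4) = aA n := by
  rw [bA, mul_assoc, muJ_mul_JA, mul_one]

lemma rhoA_isMult (n : ℕ) : IsMultiplicative (rhoA n) := by
  refine ⟨by simp [rho], fun {a b} h => ?_⟩
  simp only [rhoA_apply]; rw [rho_mul h]; push_cast; rfl

lemma aA_isMult (n : ℕ) : IsMultiplicative (aA n) := isMultiplicative_liouville.mul (rhoA_isMult n)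

lemma muJ_isMult (E : ℤ) : IsMultiplicative (muJ E) := isMultiplicative_moebius.pmul (JA_isMult E)

lemma bA_isMult (n : ℕ) : IsMultiplicative (bA n) := (aA_isMult n).mul (muJ_isMult _)

lemma mul_apply_pp (f g : ArithmeticFunction ℤ) {p : ℕ} (hp : p.Prime) (k : ℕ) :
    (f * g) (p ^ k) = ∑ x ∈ Finset.HasAntidiagonal.antidiagonal k, f (p ^ x.1) * g (p ^ x.2) := by
  rw [mul_apply, Nat.sum_divisorsAntidiagonal (fun a b => f a * g b), Nat.sum_divisors_prime_pow hp, Finset.Nat.sum_antidiagonal_eq_sum_range_succ (fun i j => f (p ^ i) * g (p ^ j))]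
  apply sum_congr rfl
  intro i hi
  rw [Nat.pow_div (by simp at hi; omega) hp.pos]

lemma aA_pp_succ (n : ℕ) {p : ℕ} (hp : p.Prime) (k : ℕ) :
    aA n (p ^ (k + 1)) = rho n (p ^ (k + 1)) - aA n (p ^ k) := by
  rw [aA, mul_apply_pp _ _ hp, mul_apply_pp _ _ hp, Finset.Nat.antidiagonal_succ, Finset.sum_cons, Finset.sum_map]
  simp only [pow_zero, liouville_apply_one, rhoA_apply, one_mul, Function.Embedding.prodMap, Function.Embedding.coeFn_mk, Prod.map_fst, Prod.map_snd, Function.Embedding.refl_apply]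
  rw [sub_eq_add_neg, ← Finset.sum_neg_distrib]
  congr 1
  apply sum_congr rfl
  intro x _
  simp only [Nat.succ_eq_add_one, pow_succ, liouville_apply_mul]
  rw [show liouville p = -1 by rw [liouville_apply hp.ne_zero, cardFactors_apply_prime hp]; norm_num]
  ring

lemma aA_one (n : ℕ) : aA n 1 = 1 := (aA_isMult n).1

lemma bA_pp_succ (n : ℕ) {p : ℕ} (hp : p.Prime) (k : ℕ) :
    bA n (p ^ (k + 1)) = aA n (p ^ (k + 1)) - JA ((n : ℤ) ^ 2 - 4) p * aA n (p ^ k) := by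
  rw [bA, mul_comm, mul_apply_pp _ _ hp, Finset.Nat.antidiagonal_succ, Finset.sum_cons, Finset.sum_map]
  simp only [pow_zero, Function.Embedding.prodMap, Function.Embedding.coeFn_mk, Prod.map_fst, Prod.map_snd, Function.Embedding.refl_apply, (muJ_isMult _).1, one_mul, sub_eq_add_neg]
  congr 1
  rw [Finset.sum_eq_single (0, k)]
  · simp [muJ, pmul_apply, moebius_apply_prime hp]
  · rintro ⟨i, j⟩ hij hne
    have hi : i ≠ 0 := by
      rintro rfl
      simp at hij; apply hne; rw [hij]
    simp only [muJ, pmul_apply]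
    rw [moebius_apply_prime_pow hp (by simp), if_neg (by simp; exact hi)]; simp
  · intro h; simp at h

lemma aA_good {p : ℕ} (hp : p.Prime) (hp2 : p ≠ 2) {n : ℕ} (hD : ¬ (p : ℤ) ∣ (n : ℤ) ^ 2 - 4) (k : ℕ) :
    aA n (p ^ k) = JA ((n : ℤ) ^ 2 - 4) p ^ k := by
  have hJ : JA ((n : ℤ) ^ 2 - 4) p = jacobiSym ((n : ℤ) ^ 2 - 4) p := by
    rw [JA_apply, if_pos (hp.odd_of_ne_two hp2)]
  have hcop : Int.gcd ((n : ℤ) ^ 2 - 4) p = 1 := by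
    rw [Int.gcd_comm]
    exact Int.isCoprime_iff_gcd_eq_one.mp ((Nat.prime_iff_prime_int.mp hp).coprime_iff_not_dvd.mpr hD)
  rw [hJ]
  induction k with
  | zero => simp [aA_one]
  | succ k ih =>
    rw [aA_pp_succ n hp, rho_good hp hp2 hD, ih]
    rcases jacobiSym.eq_one_or_neg_one hcop with hJ | hJ
    · simp [hJ]
    · rw [hJ, pow_succ]; ring

lemma bA_support {n s p : ℕ} (hp : p.Prime) (hps : p ∣ s) (hb : bA n s ≠ 0) : (p : ℤ) ∣ 2 * ((n : ℤ) ^ 2 - 4) := by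
  by_contra hc
  have hp2 : p ≠ 2 := by rintro rfl; exact hc (by simp)
  have hD : ¬ (p : ℤ) ∣ (n : ℤ) ^ 2 - 4 := fun h => hc (h.mul_left _)
  have hs : s ≠ 0 := by rintro rfl; simp at hb
  obtain ⟨k, s', h1, h2⟩ := Nat.exists_eq_pow_mul_and_not_dvd hs p hp.ne_one
  obtain ⟨j, rfl⟩ : ∃ j, k = j + 1 := by
    rcases k with _ | j
    · exfalso; simp at h2; subst h2; exact h1 hps
    · exact ⟨j, rfl⟩
  apply hb
  rw [h2, (bA_isMult n).2 (Nat.Coprime.pow_left _ ((Nat.Prime.coprime_iff_not_dvd hp).mpr h1)), bA_pp_succ n hp, aA_good hp hp2 hD, aA_good hp hp2 hD]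
  ring

/-- indicator of squares -/
noncomputable def sqA : ArithmeticFunction ℤ := by
  classical exact ⟨fun q => if q ≠ 0 ∧ IsSquare q then 1 else 0, by simp⟩

open Classical in
lemma sqA_apply (q : ℕ) : sqA q = if q ≠ 0 ∧ IsSquare q then 1 else 0 := by
  unfold sqA; simp only [coe_mk]

lemma sqA_isMult : IsMultiplicative sqA := by
  refine ⟨by simp [sqA_apply], fun {a b} h => ?_⟩
  have : (a * b ≠ 0 ∧ IsSquare (a * b)) ↔ ((a ≠ 0 ∧ IsSquare a) ∧ (b ≠ 0 ∧ IsSquare b)) := by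
    constructor
    · rintro ⟨h1, c, hc⟩
      rw [mul_ne_zero_iff] at h1
      have hg : ∀ x y : ℕ, x.Coprime y → x * y = c ^ 2 → IsSquare x := by
        intro x y hxy he
        obtain ⟨d, hd⟩ := exists_eq_pow_of_mul_eq_pow (show IsUnit (gcd x y) from Nat.isUnit_iff.mpr hxy) he
        exact ⟨d, by rw [hd, sq]⟩
      exact ⟨⟨h1.1, hg a b h (by rw [hc, sq])⟩, ⟨h1.2, hg b a h.symm (by rw [mul_comm, hc, sq])⟩⟩
    · rintro ⟨⟨h1, h2⟩, h3, h4⟩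
      exact ⟨mul_ne_zero h1 h3, h2.mul h4⟩
  simp only [sqA_apply, this]
  by_cases h1 : (a ≠ 0 ∧ IsSquare a) <;> by_cases h2 : (b ≠ 0 ∧ IsSquare b) <;> simp [h1, h2]

lemma zeta_mul_liouville : (zeta : ArithmeticFunction ℤ) * liouville = sqA := by
  rw [IsMultiplicative.eq_iff_eq_on_prime_powers _ (isMultiplicative_zeta.natCast.mul isMultiplicative_liouville) _ sqA_isMult]
  intro p k hp
  have h0 : sqA (p ^ k) = if Even k then 1 else 0 := by
    rw [sqA_apply]
    have : (p ^ k ≠ 0 ∧ IsSquare (p ^ k)) ↔ Even k := by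
      constructor
      · rintro ⟨_, c, hc⟩
        have := congrArg (fun m => m.factorization p) hc
        have hc0 : c ≠ 0 := by rintro rfl; simp at hc; exact hp.ne_zero hc.1
        simp [Nat.factorization_mul hc0 hc0, hp.factorization_self] at this
        exact ⟨_, this⟩
      · rintro ⟨c, rfl⟩
        exact ⟨pow_ne_zero _ hp.ne_zero, ⟨p ^ c, by rw [pow_add]⟩⟩
    simp only [this]
  rw [h0, coe_zeta_mul_apply, Nat.sum_divisors_prime_pow hp]
  have : ∀ i ∈ range (k + 1), liouville (p ^ i) = (-1) ^ i := by
    intro i _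
    rw [liouville_apply (pow_ne_zero _ hp.ne_zero), cardFactors_apply_prime_pow hp]
  rw [sum_congr rfl this, neg_one_geom_sum]
  by_cases hk : Even k <;> simp [hk, Nat.even_add_one]

lemma class_sum_eq (n X : ℕ) :
    (∑ e ∈ Finset.Icc 1 X, ∑ k ∈ Finset.Icc 1 (X / e ^ 2), (rho n k : ℤ)) =
      ∑ q ∈ Ioc 0 X, ((zeta : ArithmeticFunction ℤ) * aA n) q := by
  classical
  rw [aA, ← mul_assoc, zeta_mul_liouville, sum_Ioc_mul_eq_sum_sum]
  have h1 : ∀ q ∈ Ioc 0 X, sqA q * ∑ m ∈ Ioc 0 (X / q), rhoA n m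
      = if IsSquare q then ∑ m ∈ Ioc 0 (X / q), rhoA n m else 0 := by
    intro q hq
    rw [mem_Ioc] at hq
    rw [sqA_apply]
    have : q ≠ 0 := by omega
    simp [this]
  rw [sum_congr rfl h1, ← Finset.sum_filter]
  have h2 : (∑ e ∈ Finset.Icc 1 X, ∑ k ∈ Finset.Icc 1 (X / e ^ 2), (rho n k : ℤ)) =
      ∑ e ∈ (Finset.Icc 1 X).filter (fun e => e ^ 2 ≤ X), ∑ k ∈ Finset.Icc 1 (X / e ^ 2), (rho n k : ℤ) := by
    rw [Finset.sum_filter]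
    apply sum_congr rfl
    intro e _
    split_ifs with h
    · rfl
    · rw [Nat.div_eq_of_lt (by omega)]; simp
  rw [h2]
  apply Finset.sum_bij (fun e _ => e ^ 2)
  · intro e he
    simp only [mem_filter, Finset.mem_Icc, mem_Ioc] at he ⊢
    exact ⟨⟨pow_pos (by omega) 2, he.2⟩, ⟨e, sq e⟩⟩
  · intro a _ b _ hab
    exact Nat.pow_left_injective (by norm_num : 2 ≠ 0) hab
  · intro q hq
    simp only [mem_filter, mem_Ioc] at hq
    obtain ⟨⟨h3, h4⟩, e, rfl⟩ := hq
    have he : 0 < e := Nat.pos_of_ne_zero (by rintro rfl; simp at h3)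
    refine ⟨e, ?_, by ring⟩
    simp only [mem_filter, Finset.mem_Icc]
    exact ⟨⟨he, by nlinarith⟩, by rw [sq]; exact h4⟩
  · intro e _
    rfl

theorem divisor_bound {ε : ℝ} (hε : 0 < ε) :
    ∃ C : ℝ, 1 ≤ C ∧ ∀ n : ℕ, n ≠ 0 → (n.divisors.card : ℝ) ≤ C * (n : ℝ) ^ ε := by
  have hl2 : 0 < Real.log 2 := Real.log_pos (by norm_num)
  set C1 : ℝ := 1 + 1 / (ε * Real.log 2) with hC1
  have hC1' : 1 ≤ C1 := by rw [hC1]; have : 0 < 1 / (ε * Real.log 2) := by positivity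
                           linarith
  obtain ⟨P0, hP0⟩ := exists_nat_ge ((2 : ℝ) ^ (1 / ε))
  refine ⟨C1 ^ P0, one_le_pow₀ hC1', fun n hn => ?_⟩
  have hfac : (n : ℝ) ^ ε = ∏ p ∈ n.primeFactors, ((p : ℝ) ^ (n.factorization p)) ^ ε := by
    conv_lhs => rw [← Nat.prod_factorization_pow_eq_self hn]
    rw [Finsupp.prod, Nat.support_factorization]
    push_cast
    rw [← Real.finsetProd_rpow]
    intro i _; positivity
  rw [Nat.card_divisors hn, hfac]
  push_cast
  have hloc : ∀ p ∈ n.primeFactors, ((n.factorization p : ℝ) + 1) ≤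
      (if p < P0 then C1 else 1) * ((p : ℝ) ^ (n.factorization p)) ^ ε := by
    intro p hp
    have hp' := Nat.prime_of_mem_primeFactors hp
    have hp2 : (2 : ℝ) ≤ p := by exact_mod_cast hp'.two_le
    set k := n.factorization p
    have e1 : ((p : ℝ) ^ k) ^ ε = ((p : ℝ) ^ ε) ^ k := by
      rw [← Real.rpow_natCast, ← Real.rpow_natCast, ← Real.rpow_mul (by positivity), ← Real.rpow_mul (by positivity), mul_comm]
    rw [e1]
    split_ifs with h
    · have h1 : (2 : ℝ) ^ ε ≤ (p : ℝ) ^ ε := Real.rpow_le_rpow (by norm_num) hp2 hε.le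
      have h2 : 1 + ε * Real.log 2 ≤ (p : ℝ) ^ ε := by
        refine le_trans ?_ h1
        rw [Real.rpow_def_of_pos (by norm_num)]
        have := Real.add_one_le_exp (Real.log 2 * ε)
        linarith
      have h3 : 1 + (k : ℝ) * (ε * Real.log 2) ≤ ((p : ℝ) ^ ε) ^ k := by
        have hb := one_add_mul_le_pow (a := (p : ℝ) ^ ε - 1) (by have : (0:ℝ) ≤ (p:ℝ) ^ ε := by positivity
                                                                 linarith) k
        rw [add_sub_cancel] at hb
        have : (k : ℝ) * (ε * Real.log 2) ≤ k * ((p : ℝ) ^ ε - 1) :=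
          mul_le_mul_of_nonneg_left (by linarith) (by positivity)
        linarith
      calc (k : ℝ) + 1 ≤ C1 * (1 + (k : ℝ) * (ε * Real.log 2)) := by
            rw [hC1]
            have h4 : (1 + 1 / (ε * Real.log 2)) * (1 + (k : ℝ) * (ε * Real.log 2)) = 1 + k + (1 / (ε * Real.log 2) + k * (ε * Real.log 2)) := by
              field_simp; ring
            rw [h4]
            have : 0 ≤ 1 / (ε * Real.log 2) + k * (ε * Real.log 2) := by positivity
            linarith
        _ ≤ _ := mul_le_mul_of_nonneg_left h3 (by linarith)
    · rw [one_mul]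
      have h1 : (2 : ℝ) ≤ (p : ℝ) ^ ε := by
        have h5 : (2 : ℝ) ^ (1 / ε) ≤ p := hP0.trans (by exact_mod_cast (not_lt.mp h))
        calc (2 : ℝ) = ((2 : ℝ) ^ (1 / ε)) ^ ε := by
              rw [← Real.rpow_mul (by norm_num), one_div_mul_cancel hε.ne', Real.rpow_one]
          _ ≤ _ := Real.rpow_le_rpow (by positivity) h5 hε.le
      have h6 : ((k : ℝ) + 1) ≤ 2 ^ k := by
        have := Nat.lt_two_pow_self (n := k)
        exact_mod_cast this
      exact h6.trans (pow_le_pow_left₀ (by norm_num) h1 k)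
  calc ∏ p ∈ n.primeFactors, ((n.factorization p : ℝ) + 1)
      ≤ ∏ p ∈ n.primeFactors, ((if p < P0 then C1 else 1) * ((p : ℝ) ^ (n.factorization p)) ^ ε) :=
        Finset.prod_le_prod (fun i _ => by positivity) hloc
    _ = (∏ p ∈ n.primeFactors, (if p < P0 then C1 else 1)) * ∏ p ∈ n.primeFactors, ((p : ℝ) ^ (n.factorization p)) ^ ε :=
        Finset.prod_mul_distrib
    _ ≤ _ := by
        apply mul_le_mul_of_nonneg_right _ (Finset.prod_nonneg fun i _ => by positivity)
        rw [← Finset.prod_filter, Finset.prod_const]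
        apply pow_le_pow_right₀ hC1'
        calc _ ≤ (range P0).card := Finset.card_le_card (by intro p hp; simp at hp ⊢; exact hp.2)
          _ = P0 := by simp

lemma two_pow_omega_le {n : ℕ} (hn : n ≠ 0) : 2 ^ n.primeFactors.card ≤ n.divisors.card := by
  rw [Nat.card_divisors hn, ← Finset.prod_const]
  apply Finset.prod_le_prod' 
  intro p hp
  have := (Nat.prime_of_mem_primeFactors hp).factorization_pos_of_dvd hn (Nat.dvd_of_mem_primeFactors hp)
  omega

theorem pow_omega_bound {K ε : ℝ} (hK : 1 ≤ K) (hε : 0 < ε) :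
    ∃ C : ℝ, 1 ≤ C ∧ ∀ n : ℕ, n ≠ 0 → K ^ n.primeFactors.card ≤ C * (n : ℝ) ^ ε := by
  obtain ⟨j, hj⟩ := exists_nat_gt K
  have hj2 : K ≤ 2 ^ (j + 1) := hj.le.trans (by exact_mod_cast (Nat.lt_two_pow_self (n := j)).le.trans (Nat.pow_le_pow_right (by norm_num) (by omega)))
  obtain ⟨C, hC1, hC⟩ := divisor_bound (ε := ε / (j + 1)) (by positivity)
  refine ⟨C ^ (j + 1), one_le_pow₀ hC1, fun n hn => ?_⟩
  have h2 : ((2 : ℝ) ^ n.primeFactors.card) ≤ n.divisors.card := by exact_mod_cast two_pow_omega_le hn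
  calc K ^ n.primeFactors.card ≤ (2 ^ (j + 1)) ^ n.primeFactors.card := pow_le_pow_left₀ (by linarith) hj2 _
    _ = (2 ^ n.primeFactors.card) ^ (j + 1) := by rw [← pow_mul, ← pow_mul, mul_comm]
    _ ≤ (C * (n : ℝ) ^ (ε / (j + 1))) ^ (j + 1) := pow_le_pow_left₀ (by positivity) (h2.trans (hC n hn)) _
    _ = _ := by
      rw [mul_pow]
      congr 1
      rw [← Real.rpow_natCast, ← Real.rpow_mul (by positivity)]
      congr 1
      push_cast
      field_simp

lemma conv_abs_le (f g : ArithmeticFunction ℤ) {q : ℕ} {B : ℝ} (hB : 0 ≤ B) (hf : ∀ d, |f d| ≤ 1) (hg : ∀ d, d ∣ q → |(g d : ℝ)| ≤ B) :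
    |((f * g) q : ℝ)| ≤ q.divisors.card * B := by
  rw [mul_apply, Nat.sum_divisorsAntidiagonal (fun a b => f a * g b)]
  push_cast
  refine (abs_sum_le_sum_abs _ _).trans ?_
  rw [← nsmul_eq_mul]
  apply Finset.sum_le_card_nsmul
  intro d hd
  rw [abs_mul]
  have h1 : |(f d : ℝ)| ≤ 1 := by exact_mod_cast hf d
  have h2 := hg (q / d) (Nat.div_dvd_of_dvd (Nat.dvd_of_mem_divisors hd))
  calc _ ≤ 1 * B := mul_le_mul h1 h2 (abs_nonneg _) (by norm_num)
    _ = B := one_mul B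

lemma rho_le_sqrt (n : ℕ) {m : ℕ} (hm : m ≠ 0) : (rho n m : ℝ) ≤ m.divisors.card * Real.sqrt m := by
  have := rho_sq_le n hm
  have h : ((rho n m : ℝ)) ^ 2 ≤ (m.divisors.card * Real.sqrt m) ^ 2 := by
    rw [mul_pow, Real.sq_sqrt (by positivity)]
    exact_mod_cast this
  exact le_of_sq_le_sq h (by positivity) where
  le_of_sq_le_sq {a b : ℝ} (h : a ^ 2 ≤ b ^ 2) (hb : 0 ≤ b) : a ≤ b := by
    exact (abs_le_of_sq_le_sq' h hb).2

lemma liouville_abs (d : ℕ) : |liouville d| ≤ 1 := by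
  by_cases h : d = 0
  · simp [h]
  · rw [liouville_apply h]; simp

lemma aA_abs_le (n : ℕ) {q : ℕ} (hq : q ≠ 0) : |(aA n q : ℝ)| ≤ (q.divisors.card : ℝ) ^ 2 * Real.sqrt q := by
  have := conv_abs_le liouville (rhoA n) (q := q) (B := q.divisors.card * Real.sqrt q) (by positivity) liouville_abs ?_
  · rw [aA]; refine this.trans (le_of_eq (by ring))
  · intro d hd
    have hd0 : d ≠ 0 := by rintro rfl; exact hq (zero_dvd_iff.mp hd)
    simp only [rhoA_apply, Int.cast_natCast, Nat.abs_cast]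
    refine (rho_le_sqrt n hd0).trans ?_
    gcongr
    exact Nat.le_of_dvd (Nat.pos_of_ne_zero hq) hd

lemma muJ_abs (E : ℤ) (d : ℕ) : |muJ E d| ≤ 1 := by
  rw [muJ, pmul_apply, abs_mul]
  have h1 := abs_moebius_le_one (n := d)
  have h2 := JA_abs_le E d
  nlinarith [abs_nonneg (moebius d), abs_nonneg (JA E d)]

lemma bA_abs_le (n : ℕ) {q : ℕ} (hq : q ≠ 0) : |(bA n q : ℝ)| ≤ (q.divisors.card : ℝ) ^ 3 * Real.sqrt q := by
  have := conv_abs_le (muJ ((n : ℤ) ^ 2 - 4)) (aA n) (q := q) (B := (q.divisors.card : ℝ) ^ 2 * Real.sqrt q) (by positivity) (muJ_abs _) ?_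
  · rw [bA, mul_comm]; refine this.trans (le_of_eq (by ring))
  · intro d hd
    have hd0 : d ≠ 0 := by rintro rfl; exact hq (zero_dvd_iff.mp hd)
    refine (aA_abs_le n hd0).trans ?_
    gcongr
    exact Nat.le_of_dvd (Nat.pos_of_ne_zero hq) hd

lemma bA_pow_bound : ∃ C : ℝ, 1 ≤ C ∧ ∀ n q : ℕ, |(bA n q : ℝ)| ≤ C * (q : ℝ) ^ (5 / 8 : ℝ) := by
  obtain ⟨C, h1, h2⟩ := divisor_bound (ε := 1 / 24) (by norm_num)
  refine ⟨C ^ 3, one_le_pow₀ h1, fun n q => ?_⟩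
  by_cases hq : q = 0
  · subst hq; simp
  have hq0 : (0 : ℝ) < q := by positivity
  calc |(bA n q : ℝ)| ≤ (q.divisors.card : ℝ) ^ 3 * Real.sqrt q := bA_abs_le n hq
    _ ≤ (C * (q : ℝ) ^ (1 / 24 : ℝ)) ^ 3 * Real.sqrt q := by gcongr; exact h2 q hq
    _ = _ := by
      rw [mul_pow, Real.sqrt_eq_rpow, ← Real.rpow_natCast ((q : ℝ) ^ (1 / 24 : ℝ)), ← Real.rpow_mul hq0.le, mul_assoc, ← Real.rpow_add hq0]
      norm_num

/-- completely multiplicative `s ↦ s^(-σ)` -/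
noncomputable def powHom (σ : ℝ) (hσ : 0 < σ) : ℕ →* ℝ where
  toFun s := (s : ℝ) ^ (-σ)
  map_one' := by simp
  map_mul' a b := by push_cast; exact Real.mul_rpow (by positivity) (by positivity)

lemma bA_sum {ε : ℝ} (hε : 0 < ε) : ∃ C : ℝ, 1 ≤ C ∧ ∀ n : ℕ, 2 < n →
    Summable (fun s : ℕ => |(bA n s : ℝ)| * (s : ℝ) ^ (-(3 / 4) : ℝ)) ∧
    ∑' s : ℕ, |(bA n s : ℝ)| * (s : ℝ) ^ (-(3 / 4) : ℝ) ≤ C * (n : ℝ) ^ ε := by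
  obtain ⟨C0, hC0, hb⟩ := bA_pow_bound
  have hσ : (0 : ℝ) < 1 / 8 := by norm_num
  have hlt : ∀ p : ℕ, 2 ≤ p → (p : ℝ) ^ (-(1 / 8) : ℝ) ≤ (2 : ℝ) ^ (-(1 / 8) : ℝ) := by
    intro p hp
    exact Real.rpow_le_rpow_of_nonpos (by norm_num) (by exact_mod_cast hp) (by norm_num)
  have h2lt : (2 : ℝ) ^ (-(1 / 8) : ℝ) < 1 := Real.rpow_lt_one_of_one_lt_of_neg (by norm_num) (by norm_num)
  have h2pos : (0 : ℝ) < (2 : ℝ) ^ (-(1 / 8) : ℝ) := by positivity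
  set K : ℝ := (1 - (2 : ℝ) ^ (-(1 / 8) : ℝ))⁻¹ with hK
  have hK1 : 1 ≤ K := by
    rw [hK]; exact (one_le_inv₀ (by linarith)).mpr (by linarith)
  obtain ⟨C1, hC1, hw⟩ := pow_omega_bound hK1 (ε := ε / 2) (by positivity)
  refine ⟨C0 * (C1 * 2 ^ ε), ?_, fun n hn => ?_⟩
  · have : (1 : ℝ) ≤ 2 ^ ε := Real.one_le_rpow (by norm_num) hε.le
    have h3 : 1 ≤ C1 * 2 ^ ε := by nlinarith
    nlinarith
  set N : ℕ := 2 * (n ^ 2 - 4) with hN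
  have hn4 : 9 ≤ n ^ 2 := by nlinarith
  have hN0 : N ≠ 0 := by omega
  have hNi : (N : ℤ) = 2 * ((n : ℤ) ^ 2 - 4) := by rw [hN]; push_cast [Nat.cast_sub (show 4 ≤ n ^ 2 by omega)]; ring
  set S := N.primeFactors with hS
  obtain ⟨hs1, hs2⟩ := EulerProduct.summable_and_hasSum_factoredNumbers_prod_filter_prime_geometric (f := powHom (1 / 8) hσ)
    (by
      intro p hp
      have := hlt p hp.two_le
      have h0 : (0 : ℝ) ≤ (p : ℝ) ^ (-(1 / 8) : ℝ) := by positivity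
      show ‖(p : ℝ) ^ (-(1 / 8) : ℝ)‖ < 1
      rw [Real.norm_of_nonneg h0]; linarith) S
  have hind : ∀ s : ℕ, |(bA n s : ℝ)| * (s : ℝ) ^ (-(3 / 4) : ℝ) ≤
      C0 * (Set.indicator (Nat.factoredNumbers S) (fun s : ℕ => (s : ℝ) ^ (-(1 / 8) : ℝ))) s := by
    intro s
    by_cases hbs : bA n s = 0
    · rw [hbs]
      simp only [Int.cast_zero, abs_zero, zero_mul]
      apply mul_nonneg (by linarith)
      apply Set.indicator_nonneg; intro x _; positivity
    · have hs0 : s ≠ 0 := by rintro rfl; simp at hbs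
      have hsp : (0 : ℝ) < s := by positivity
      have hmem : s ∈ Nat.factoredNumbers S := by
        rw [Nat.mem_factoredNumbers_iff_primeFactors_subset]
        refine ⟨hs0, fun p hp => ?_⟩
        rw [Nat.mem_primeFactors] at hp
        rw [hS, Nat.mem_primeFactors]
        refine ⟨hp.1, ?_, hN0⟩
        have := bA_support hp.1 hp.2.1 hbs
        rw [← hNi] at this
        exact_mod_cast this
      rw [Set.indicator_of_mem hmem]
      calc |(bA n s : ℝ)| * (s : ℝ) ^ (-(3 / 4) : ℝ) ≤ (C0 * (s : ℝ) ^ (5 / 8 : ℝ)) * (s : ℝ) ^ (-(3 / 4) : ℝ) := by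
            gcongr; exact hb n s
        _ = _ := by rw [mul_assoc, ← Real.rpow_add hsp]; norm_num
  have hsI : HasSum (Set.indicator (Nat.factoredNumbers S) (fun s : ℕ => (s : ℝ) ^ (-(1 / 8) : ℝ)))
      (∏ p ∈ S with p.Prime, (1 - powHom (1 / 8) hσ p)⁻¹) := by
    rw [← hasSum_subtype_iff_indicator]; exact hs2
  have hsumm : Summable (fun s : ℕ => |(bA n s : ℝ)| * (s : ℝ) ^ (-(3 / 4) : ℝ)) :=
    Summable.of_nonneg_of_le (fun s => by positivity) hind (hsI.summable.mul_left C0)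
  refine ⟨hsumm, ?_⟩
  calc _ ≤ ∑' s, C0 * (Set.indicator (Nat.factoredNumbers S) (fun s : ℕ => (s : ℝ) ^ (-(1 / 8) : ℝ))) s :=
        hsumm.tsum_le_tsum hind (hsI.summable.mul_left C0)
    _ = C0 * ∏ p ∈ S with p.Prime, (1 - powHom (1 / 8) hσ p)⁻¹ := by rw [tsum_mul_left, hsI.tsum_eq]
    _ ≤ C0 * K ^ S.card := by
        apply mul_le_mul_of_nonneg_left _ (by linarith)
        have : S.filter Nat.Prime = S := by
          rw [Finset.filter_eq_self]; intro p hp; exact Nat.prime_of_mem_primeFactors hp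
        rw [this, ← Finset.prod_const]
        have hlt' : ∀ p ∈ S, 1 - (2 : ℝ) ^ (-(1 / 8) : ℝ) ≤ 1 - powHom (1 / 8) hσ p := by
          intro p hp
          have := hlt p (Nat.prime_of_mem_primeFactors hp).two_le
          show _ ≤ 1 - (p : ℝ) ^ (-(1 / 8) : ℝ)
          linarith
        apply Finset.prod_le_prod
        · intro p hp
          have := hlt' p hp
          exact inv_nonneg.mpr (by linarith)
        · intro p hp
          have := hlt' p hp
          exact inv_anti₀ (by linarith) this
    _ ≤ C0 * (C1 * (N : ℝ) ^ (ε / 2)) := by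
        apply mul_le_mul_of_nonneg_left (hw N hN0) (by linarith)
    _ ≤ C0 * (C1 * ((2 * n : ℝ) ^ 2) ^ (ε / 2)) := by
        gcongr
        have : N ≤ (2 * n) ^ 2 := by rw [hN, mul_pow]; omega
        exact_mod_cast this
    _ = _ := by
        rw [← Real.rpow_natCast, ← Real.rpow_mul (by positivity), Real.mul_rpow (by norm_num) (by positivity)]
        rw [show ((2 : ℕ) : ℝ) * (ε / 2) = ε by push_cast; ring]
        ring

lemma exists_odd_val {F : ℕ} (hF : Odd F) (hsq : ¬ IsSquare F) :
    ∃ p k F' : ℕ, p.Prime ∧ p ≠ 2 ∧ ¬ p ∣ F' ∧ F = p ^ (2 * k + 1) * F' := by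
  obtain ⟨a, b, h1, h2⟩ := Nat.sq_mul_squarefree F
  have hF0 : F ≠ 0 := by rintro rfl; simp at hF
  have ha : a ≠ 1 := by rintro rfl; apply hsq; exact ⟨b, by rw [← h1]; ring⟩
  obtain ⟨p, hp, hpa⟩ := Nat.exists_prime_and_dvd ha
  have hp2 : p ≠ 2 := by
    rintro rfl
    have : 2 ∣ F := hpa.trans (h1 ▸ Dvd.intro_left _ rfl)
    exact (Nat.not_even_iff_odd.mpr hF) (even_iff_two_dvd.mpr this)
  obtain ⟨a', rfl⟩ := hpa
  have hpa' : ¬ p ∣ a' := by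
    rintro ⟨c, rfl⟩
    have := h2 p ⟨c, by ring⟩
    exact hp.one_lt.ne' (Nat.isUnit_iff.mp this)
  have hb0 : b ≠ 0 := by rintro rfl; simp at h1; exact hF0 h1.symm
  obtain ⟨k, b', h3, h4⟩ := Nat.exists_eq_pow_mul_and_not_dvd hb0 p hp.ne_one
  refine ⟨p, k, b' ^ 2 * a', hp, hp2, ?_, ?_⟩
  · intro h
    rcases (hp.dvd_mul.mp h) with h | h
    · exact h3 (hp.dvd_of_dvd_pow h)
    · exact hpa' h
  · rw [← h1, h4]; ring

lemma exists_neg_one {E : ℕ} (hE : 0 < E) (hsq : ¬ IsSquare E) :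
    ∃ m : ℕ, Odd m ∧ jacobiSym E m = -1 := by
  obtain ⟨a, F, h1, h2⟩ := Nat.exists_eq_pow_mul_and_not_dvd hE.ne' 2 (by norm_num)
  have hF : Odd F := by rw [← Nat.not_even_iff_odd, even_iff_two_dvd]; exact h1
  have hred : ∀ m : ℕ, m % 4 = 1 → jacobiSym E m = jacobiSym 2 m ^ a * jacobiSym m F := by
    intro m hm
    rw [h2]; push_cast
    rw [jacobiSym.mul_left, jacobiSym.pow_left, jacobiSym.quadratic_reciprocity_one_mod_four' hF hm]
  by_cases hFs : IsSquare F
  · have hao : ¬ Even a := by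
      intro hae
      apply hsq; rw [h2]
      exact (Even.isSquare_pow hae 2).mul hFs
    obtain ⟨m, hm1, hm2⟩ := Nat.chineseRemainder (show Nat.Coprime 8 F from
      (Nat.Coprime.pow_left 3 (Nat.coprime_two_left.mpr hF) : Nat.Coprime (2 ^ 3) F)) 5 1
    have hm8 : m % 8 = 5 := hm1
    have hmo : Odd m := by rw [Nat.odd_iff]; omega
    refine ⟨m, hmo, ?_⟩
    rw [hred m (by omega), jacobiSym.at_two hmo, jacobiSym.mod_left, (by
      have : (m : ℤ) % F = 1 % F := by exact_mod_cast hm2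
      exact this : (m : ℤ) % F = 1 % F), ← jacobiSym.mod_left, jacobiSym.one_left]
    have : ((m : ℕ) : ZMod 8) = 5 := by
      have := (ZMod.natCast_eq_natCast_iff m 5 8).mpr hm1
      simpa using this
    rw [this]
    have h5 : ZMod.χ₈ 5 = -1 := by decide
    rw [h5, (Nat.not_even_iff_odd.mp hao).neg_one_pow]; norm_num
  · obtain ⟨p, k, F', hp, hp2, hpF, hFe⟩ := exists_odd_val hF hFs
    have : Fact p.Prime := ⟨hp⟩
    have hF'o : Odd F' := by rw [hFe, Nat.odd_mul] at hF; exact hF.2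
    obtain ⟨r, hr⟩ := FiniteField.exists_nonsquare (F := ZMod p) (by rw [ZMod.ringChar_zmod_n]; exact hp2)
    have hpodd := hp.odd_of_ne_two hp2
    obtain ⟨m, hm1, hm2⟩ := Nat.chineseRemainder (show Nat.Coprime (2 ^ 3 * F') p from
      Nat.Coprime.mul_left (Nat.Coprime.pow_left 3 (Nat.coprime_two_left.mpr hpodd))
        ((Nat.Prime.coprime_iff_not_dvd hp).mpr hpF).symm) 1 r.val
    have hm8 : m ≡ 1 [MOD 8] := hm1.of_mul_right F'
    have hmF : m ≡ 1 [MOD F'] := hm1.of_mul_left (2 ^ 3)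
    have hm8' : m % 8 = 1 := hm8
    have hmo : Odd m := by rw [Nat.odd_iff]; omega
    have hF'0 : F' ≠ 0 := by rintro rfl; simp at hF'o
    refine ⟨m, hmo, ?_⟩
    have e1 : jacobiSym m F' = 1 := by
      rw [jacobiSym.mod_left, (by
        have : (m : ℤ) % F' = 1 % F' := by exact_mod_cast hmF
        exact this : (m : ℤ) % F' = 1 % F'), ← jacobiSym.mod_left, jacobiSym.one_left]
    have e2 : jacobiSym m p = -1 := by
      rw [← jacobiSym.legendreSym.to_jacobiSym, legendreSym.eq_neg_one_iff]
      have : ((m : ℕ) : ZMod p) = r := by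
        have := (ZMod.natCast_eq_natCast_iff m r.val p).mpr hm2
        simpa using this
      push_cast
      rw [this]; exact hr
    have e3 : ((m : ℕ) : ZMod 8) = 1 := by
      have := (ZMod.natCast_eq_natCast_iff m 1 8).mpr hm8
      simpa using this
    rw [hred m (by omega), jacobiSym.at_two hmo, hFe, jacobiSym.mul_right' _ (pow_ne_zero _ hp.ne_zero) hF'0, jacobiSym.pow_right, e1, e2, e3]
    rw [Odd.neg_one_pow ⟨k, rfl⟩]; simp

lemma JA_period (E m : ℕ) : JA E (m + 4 * E) = JA E m := by
  have h : Odd (m + 4 * E) ↔ Odd m := by simp [Nat.odd_iff]; omega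
  simp only [JA_apply, h]
  split_ifs with ho
  · rw [jacobiSym.mod_right _ (h.mpr ho), jacobiSym.mod_right _ ho]
    simp
  · rfl

lemma JA_period_sum {E : ℕ} (hE : 0 < E) (hsq : ¬ IsSquare E) : ∑ m ∈ range (4 * E), JA E m = 0 := by
  obtain ⟨m0, ho, hm⟩ := exists_neg_one hE hsq
  set P := 4 * E with hP
  have hP0 : 0 < P := by omega
  have hJ0 : JA E m0 = -1 := by rw [JA_apply, if_pos ho, hm]
  have hcop : Nat.Coprime P m0 := by
    have h1 : Nat.Coprime E m0 := by
      have : jacobiSym E m0 ≠ 0 := by rw [hm]; norm_num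
      by_contra hc
      apply this
      rw [jacobiSym.eq_zero_iff]
      refine ⟨by rintro rfl; simp at ho, ?_⟩
      simpa using hc
    exact Nat.Coprime.mul_left (show Nat.Coprime (2 ^ 2) m0 from Nat.Coprime.pow_left 2 (Nat.coprime_two_left.mpr ho)) h1
  have hper : ∀ x, JA E (x % P) = JA E x := by
    intro x
    conv_rhs => rw [← Nat.mod_add_div x P]
    generalize x / P = k
    induction k with
    | zero => simp
    | succ k ih => rw [mul_add, mul_one, ← add_assoc, JA_period, ih]
  have himg : (range P).image (fun x => m0 * x % P) = range P := by
    apply Finset.eq_of_subset_of_card_le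
    · intro y hy
      simp only [Finset.mem_image, mem_range] at hy ⊢
      obtain ⟨x, _, rfl⟩ := hy
      exact Nat.mod_lt _ hP0
    · rw [Finset.card_image_of_injOn]
      intro x hx y hy hxy
      simp only [Finset.coe_range, Set.mem_Iio] at hx hy
      have : m0 * x ≡ m0 * y [MOD P] := hxy
      exact (Nat.ModEq.cancel_left_of_coprime hcop this).eq_of_lt_of_lt hx hy
  have hinj : Set.InjOn (fun x => m0 * x % P) (range P : Set ℕ) := by
    intro x hx y hy hxy
    simp only [Finset.coe_range, Set.mem_Iio] at hx hy
    have : m0 * x ≡ m0 * y [MOD P] := hxy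
    exact (Nat.ModEq.cancel_left_of_coprime hcop this).eq_of_lt_of_lt hx hy
  have : ∑ m ∈ range P, JA E m = - ∑ m ∈ range P, JA E m := by
    conv_lhs => rw [← himg, Finset.sum_image hinj]
    rw [← Finset.sum_neg_distrib]
    apply sum_congr rfl
    intro x _
    rw [hper, JA_mul, hJ0]; ring
  omega

lemma JA_sum_le {E : ℕ} (hE : 0 < E) (hsq : ¬ IsSquare E) (N : ℕ) :
    |∑ m ∈ Ioc 0 N, (JA E m : ℝ)| ≤ 4 * E := by
  have h0 : ∑ m ∈ Ioc 0 N, (JA E m : ℝ) = ∑ m ∈ range (N + 1), (JA E m : ℝ) := by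
    rw [Finset.range_eq_Ico, ← Finset.sum_Ioo_add_eq_sum_Ico (by omega)]
    simp
    rfl
  have hP0 : 0 < 4 * E := by omega
  rw [h0, ← Nat.div_add_mod (N + 1) (4 * E), Finset.sum_range_add]
  have h1 := sum_range_periodic (fun m => (JA E m)) (4 * E) (JA_period E) ((N + 1) / (4 * E))
  rw [JA_period_sum hE hsq, smul_zero] at h1
  have h1' : ∑ m ∈ range (4 * E * ((N + 1) / (4 * E))), (JA E m : ℝ) = 0 := by exact_mod_cast h1
  rw [h1', zero_add]
  refine (abs_sum_le_sum_abs _ _).trans ?_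
  have : ∀ x ∈ range ((N + 1) % (4 * E)), |(JA E (4 * E * ((N + 1) / (4 * E)) + x) : ℝ)| ≤ 1 := by
    intro x _; exact_mod_cast JA_abs_le E _
  refine (Finset.sum_le_card_nsmul _ _ _ this).trans ?_
  simp only [Finset.card_range, nsmul_eq_mul, mul_one]
  exact_mod_cast (Nat.mod_lt _ hP0).le

lemma abel_bound {f F : ℕ → ℝ} {B : ℝ} (hf : ∀ N, |∑ m ∈ Ioc 0 N, f m| ≤ B) (M : ℕ)
    (hF : ∀ m, M < m → F (m + 1) ≤ F m) (hF0 : ∀ m, M < m → 0 ≤ F m) (N : ℕ) (hN : M < N) :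
    |∑ m ∈ Ioc M N, f m * F m| ≤ 2 * B * F (M + 1) := by
  have hS : ∀ N, M ≤ N → |∑ m ∈ Ioc M N, f m| ≤ 2 * B := by
    intro N hN
    have : ∑ m ∈ Ioc M N, f m = ∑ m ∈ Ioc 0 N, f m - ∑ m ∈ Ioc 0 M, f m := by
      rw [← Finset.sum_Ioc_consecutive f (Nat.zero_le M) hN]; ring
    rw [this]
    refine (abs_sub _ _).trans ?_
    linarith [hf N, hf M]
  have key : ∀ N, M < N → |∑ m ∈ Ioc M N, f m * F m - (∑ m ∈ Ioc M N, f m) * F N| ≤ 2 * B * (F (M + 1) - F N) := by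
    intro N hN
    induction N, hN using Nat.le_induction with
    | base => simp
    | succ N hN ih =>
      have hMN : M ≤ N := by omega
      rw [Finset.sum_Ioc_succ_top hMN, Finset.sum_Ioc_succ_top hMN]
      have e : ∑ m ∈ Ioc M N, f m * F m + f (N + 1) * F (N + 1) - (∑ m ∈ Ioc M N, f m + f (N + 1)) * F (N + 1)
        = (∑ m ∈ Ioc M N, f m * F m - (∑ m ∈ Ioc M N, f m) * F N) + (∑ m ∈ Ioc M N, f m) * (F N - F (N + 1)) := by ring
      rw [e]
      refine (abs_add_le _ _).trans ?_
      rw [abs_mul, abs_of_nonneg (sub_nonneg.mpr (hF N (by omega)))]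
      have := mul_le_mul_of_nonneg_right (hS N hMN) (sub_nonneg.mpr (hF N (by omega)))
      linarith
  have h1 := key N hN
  have h2 : |(∑ m ∈ Ioc M N, f m) * F N| ≤ 2 * B * F N := by
    rw [abs_mul, abs_of_nonneg (hF0 N hN)]
    exact mul_le_mul_of_nonneg_right (hS N hN.le) (hF0 N hN)
  have h3 := abs_add_le (∑ m ∈ Ioc M N, f m * F m - (∑ m ∈ Ioc M N, f m) * F N) ((∑ m ∈ Ioc M N, f m) * F N)
  rw [sub_add_cancel] at h3
  linarith

lemma B_nonneg {f : ℕ → ℝ} {B : ℝ} (hf : ∀ N, |∑ m ∈ Ioc 0 N, f m| ≤ B) : 0 ≤ B :=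
  (abs_nonneg _).trans (hf 0)

lemma abel_inv {f : ℕ → ℝ} {B : ℝ} (hf : ∀ N, |∑ m ∈ Ioc 0 N, f m| ≤ B) (M N : ℕ) :
    |∑ m ∈ Ioc M N, f m / m| ≤ 2 * B / (M + 1) := by
  have hB := B_nonneg hf
  rcases Nat.lt_or_ge M N with h | h
  · have := abel_bound (F := fun m => 1 / (m : ℝ)) hf M (by
      intro m hm
      have : (0 : ℝ) < m := by exact_mod_cast (by omega : 0 < m)
      push_cast
      apply one_div_le_one_div_of_le this; linarith) (by intro m _; positivity) N h
    simp only [mul_one_div] at this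
    push_cast at this
    exact this
  · rw [Finset.Ioc_eq_empty (by omega)]; simp; positivity

lemma L_exists {f : ℕ → ℝ} {B : ℝ} (hf : ∀ N, |∑ m ∈ Ioc 0 N, f m| ≤ B) :
    ∃ L : ℝ, ∀ N : ℕ, |L - ∑ m ∈ Ioc 0 N, f m / m| ≤ 2 * B / (N + 1) := by
  have hB := B_nonneg hf
  have hd : ∀ M N : ℕ, M ≤ N → |∑ m ∈ Ioc 0 N, f m / m - ∑ m ∈ Ioc 0 M, f m / m| ≤ 2 * B / (M + 1) := by
    intro M N h
    rw [← Finset.sum_Ioc_consecutive _ (Nat.zero_le M) h, add_sub_cancel_left]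
    exact abel_inv hf M N
  have hc : CauchySeq (fun N : ℕ => ∑ m ∈ Ioc 0 N, f m / m) := by
    apply cauchySeq_of_le_tendsto_0' (fun M : ℕ => 2 * B / ((M : ℝ) + 1))
    · intro M N h
      rw [dist_comm, Real.dist_eq]; exact hd M N h
    · have := tendsto_one_div_add_atTop_nhds_zero_nat (𝕜 := ℝ)
      have := this.const_mul (2 * B)
      simpa [div_eq_mul_inv] using this
  obtain ⟨L, hL⟩ := cauchySeq_tendsto_of_complete hc
  refine ⟨L, fun N => ?_⟩
  have : Tendsto (fun N' : ℕ => |∑ m ∈ Ioc 0 N', f m / m - ∑ m ∈ Ioc 0 N, f m / m|) atTop (nhds |L - ∑ m ∈ Ioc 0 N, f m / m|) :=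
    (hL.sub_const _).abs
  apply le_of_tendsto this
  filter_upwards [eventually_ge_atTop N] with N' hN'
  exact hd N N' hN'

lemma W_bound {f : ℕ → ℝ} {B : ℝ} (hf : ∀ N, |∑ m ∈ Ioc 0 N, f m| ≤ B) (Y X : ℕ) :
    |∑ m ∈ Ioc Y X, f m * ((X / m : ℕ) : ℝ)| ≤ 2 * B * (X / (Y + 1)) := by
  have hB := B_nonneg hf
  rcases Nat.lt_or_ge Y X with h | h
  · refine (abel_bound (F := fun m => ((X / m : ℕ) : ℝ)) hf Y ?_ ?_ X h).trans ?_
    · intro m hm; exact_mod_cast Nat.div_le_div_left (by omega) (by omega)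
    · intro m _; positivity
    · apply mul_le_mul_of_nonneg_left _ (by positivity)
      have := Nat.cast_div_le (α := ℝ) (m := X) (n := Y + 1)
      push_cast at this; exact this
  · rw [Finset.Ioc_eq_empty (by omega)]; simp; positivity

lemma W_lim {f : ℕ → ℝ} {B L : ℝ} (hf1 : ∀ m, |f m| ≤ 1) (hf : ∀ N, |∑ m ∈ Ioc 0 N, f m| ≤ B)
    (hL : ∀ N : ℕ, |L - ∑ m ∈ Ioc 0 N, f m / m| ≤ 2 * B / (N + 1)) :
    Tendsto (fun X : ℕ => (∑ m ∈ Ioc 0 X, f m * ((X / m : ℕ) : ℝ)) / X) atTop (nhds L) := by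
  have hB := B_nonneg hf
  have key : ∀ X : ℕ, 0 < X → |(∑ m ∈ Ioc 0 X, f m * ((X / m : ℕ) : ℝ)) / X - L| ≤ (1 + 4 * B) / (Nat.sqrt X) := by
    intro X hX
    set Y := Nat.sqrt X with hY
    have hY0 : 0 < Y := Nat.sqrt_pos.mpr hX
    have hYX : Y ≤ X := Nat.sqrt_le_self X
    have hYY : Y * Y ≤ X := Nat.sqrt_le X
    have hXr : (0 : ℝ) < X := by exact_mod_cast hX
    have hYr : (0 : ℝ) < Y := by exact_mod_cast hY0
    rw [← Finset.sum_Ioc_consecutive _ (Nat.zero_le Y) hYX]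
    have h1 := W_bound hf Y X
    have h2 : |∑ m ∈ Ioc 0 Y, f m * ((X / m : ℕ) : ℝ) - X * ∑ m ∈ Ioc 0 Y, f m / m| ≤ Y := by
      rw [mul_sum, ← Finset.sum_sub_distrib]
      refine (abs_sum_le_sum_abs _ _).trans ?_
      have : ∀ m ∈ Ioc 0 Y, |f m * ((X / m : ℕ) : ℝ) - X * (f m / m)| ≤ 1 := by
        intro m hm
        rw [mem_Ioc] at hm
        have hm0 : (0 : ℝ) < m := by exact_mod_cast hm.1
        have e : f m * ((X / m : ℕ) : ℝ) - X * (f m / m) = f m * (((X / m : ℕ) : ℝ) - X / m) := by ring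
        rw [e, abs_mul]
        have h3 := Nat.cast_div_le (α := ℝ) (m := X) (n := m)
        have h4 : (X : ℝ) / m < ((X / m : ℕ) : ℝ) + 1 := by
          rw [div_lt_iff₀ hm0]
          have := Nat.lt_mul_div_succ X hm.1
          rw [mul_comm] at this
          exact_mod_cast this
        have h5 : |((X / m : ℕ) : ℝ) - X / m| ≤ 1 := by rw [abs_le]; constructor <;> linarith
        calc _ ≤ 1 * (1 : ℝ) := mul_le_mul (hf1 m) h5 (abs_nonneg _) (by norm_num)
          _ = 1 := by norm_num
      refine (Finset.sum_le_card_nsmul _ _ _ this).trans ?_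
      simp
    have h6 := hL Y
    have e : (∑ m ∈ Ioc 0 Y, f m * ((X / m : ℕ) : ℝ) + ∑ m ∈ Ioc Y X, f m * ((X / m : ℕ) : ℝ)) / X - L
      = (∑ m ∈ Ioc 0 Y, f m * ((X / m : ℕ) : ℝ) - X * ∑ m ∈ Ioc 0 Y, f m / m) / X
        + (∑ m ∈ Ioc Y X, f m * ((X / m : ℕ) : ℝ)) / X - (L - ∑ m ∈ Ioc 0 Y, f m / m) := by
      field_simp; ring
    rw [e]
    have a1 : |(∑ m ∈ Ioc 0 Y, f m * ((X / m : ℕ) : ℝ) - X * ∑ m ∈ Ioc 0 Y, f m / m) / X| ≤ 1 / Y := by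
      rw [abs_div, abs_of_pos hXr, div_le_div_iff₀ hXr hYr, one_mul]
      have : (Y : ℝ) * Y ≤ X := by exact_mod_cast hYY
      nlinarith
    have a2 : |(∑ m ∈ Ioc Y X, f m * ((X / m : ℕ) : ℝ)) / X| ≤ 2 * B / Y := by
      rw [abs_div, abs_of_pos hXr, div_le_div_iff₀ hXr hYr]
      calc _ ≤ 2 * B * (X / (Y + 1)) * Y := mul_le_mul_of_nonneg_right h1 hYr.le
        _ ≤ 2 * B * X := by
          have : (X : ℝ) / (Y + 1) * Y ≤ X := by
            rw [div_mul_eq_mul_div, div_le_iff₀ (by linarith)]; nlinarith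
          nlinarith
    have a3 : 2 * B / ((Y : ℝ) + 1) ≤ 2 * B / Y := by
      apply div_le_div_of_nonneg_left (by positivity) hYr (by linarith)
    have a4 : (1 + 4 * B) / (Y : ℝ) = 1 / Y + 2 * B / Y + 2 * B / Y := by ring
    rw [a4]
    refine (abs_sub _ _).trans ?_
    have := abs_add_le ((∑ m ∈ Ioc 0 Y, f m * ((X / m : ℕ) : ℝ) - X * ∑ m ∈ Ioc 0 Y, f m / m) / X)
        ((∑ m ∈ Ioc Y X, f m * ((X / m : ℕ) : ℝ)) / X)
    linarith
  rw [tendsto_iff_norm_sub_tendsto_zero]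
  have hlim : Tendsto (fun X : ℕ => (1 + 4 * B) / (Nat.sqrt X : ℝ)) atTop (nhds 0) := by
    apply Tendsto.const_div_atTop
    apply tendsto_natCast_atTop_atTop.comp
    apply tendsto_atTop_mono' atTop (f₁ := fun X => Nat.sqrt X) (Eventually.of_forall fun _ => le_refl _)
    exact tendsto_atTop_atTop.mpr fun b => ⟨b * b, fun a ha => Nat.le_sqrt.mpr ha⟩
  apply squeeze_zero' (Eventually.of_forall fun _ => norm_nonneg _) _ hlim
  filter_upwards [eventually_gt_atTop 0] with X hX
  rw [Real.norm_eq_abs]; exact key X hX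

noncomputable def fJ (n m : ℕ) : ℝ := (JA ((n : ℤ) ^ 2 - 4) m : ℝ)

lemma D_cast {n : ℕ} (hn : 2 < n) : ((n : ℤ) ^ 2 - 4) = ((n ^ 2 - 4 : ℕ) : ℤ) := by
  have : 4 ≤ n ^ 2 := by nlinarith
  push_cast [Nat.cast_sub this]; ring

lemma D_nsq {n : ℕ} (hn : 2 < n) : ¬ IsSquare (n ^ 2 - 4 : ℕ) := by
  intro h
  apply sq_sub_four_not_sq hn
  rw [D_cast hn]
  obtain ⟨r, hr⟩ := h
  exact ⟨(r : ℤ), by exact_mod_cast hr⟩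

lemma D_pos {n : ℕ} (hn : 2 < n) : 0 < n ^ 2 - 4 := by
  have : 9 ≤ n ^ 2 := by nlinarith
  omega

lemma fJ_abs (n m : ℕ) : |fJ n m| ≤ 1 := by unfold fJ; exact_mod_cast JA_abs_le _ m

lemma fJ_sum {n : ℕ} (hn : 2 < n) (N : ℕ) : |∑ m ∈ Ioc 0 N, fJ n m| ≤ 4 * (n : ℝ) ^ 2 := by
  unfold fJ
  rw [D_cast hn]
  refine (JA_sum_le (D_pos hn) (D_nsq hn) N).trans ?_
  have : ((n ^ 2 - 4 : ℕ) : ℝ) ≤ (n : ℝ) ^ 2 := by exact_mod_cast Nat.sub_le _ _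
  linarith

open Classical in
noncomputable def LJ (n : ℕ) : ℝ :=
  if h : ∃ L : ℝ, ∀ N : ℕ, |L - ∑ m ∈ Ioc 0 N, fJ n m / m| ≤ 2 * (4 * (n : ℝ) ^ 2) / (N + 1) then h.choose else 0

lemma LJ_spec {n : ℕ} (hn : 2 < n) (N : ℕ) :
    |LJ n - ∑ m ∈ Ioc 0 N, fJ n m / m| ≤ 2 * (4 * (n : ℝ) ^ 2) / (N + 1) := by
  have h := L_exists (fJ_sum hn)
  unfold LJ
  rw [dif_pos h]
  exact h.choose_spec N

lemma sum_inv_le (N : ℕ) : ∑ m ∈ Ioc 0 N, 1 / (m : ℝ) ≤ 1 + Real.log N := by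
  have h := harmonic_le_one_add_log N
  refine le_trans (le_of_eq ?_) h
  rw [harmonic_eq_sum_Icc]
  push_cast
  have : Ioc 0 N = Finset.Icc 1 N := by ext; simp [Nat.succ_le_iff]
  rw [this]
  simp

lemma fJ_head_le (n N : ℕ) : |∑ m ∈ Ioc 0 N, fJ n m / m| ≤ 1 + Real.log N := by
  refine (abs_sum_le_sum_abs _ _).trans ((sum_le_sum fun m _ => ?_).trans (sum_inv_le N))
  rw [abs_div, Nat.abs_cast]
  gcongr
  exact fJ_abs n m

/-- tail of the L-series -/
noncomputable def TJ (n N : ℕ) : ℝ := LJ n - ∑ m ∈ Ioc 0 N, fJ n m / m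

lemma LJ_le {n : ℕ} (hn : 2 < n) : |LJ n| ≤ 9 + 2 * Real.log n := by
  have h1 := LJ_spec hn (n ^ 2)
  have h2 := fJ_head_le n (n ^ 2)
  have h3 : 2 * (4 * (n : ℝ) ^ 2) / ((n ^ 2 : ℕ) + 1) ≤ 8 := by
    push_cast
    rw [div_le_iff₀ (by positivity)]; nlinarith
  have h4 : Real.log ((n ^ 2 : ℕ) : ℝ) = 2 * Real.log n := by push_cast; rw [Real.log_pow]; norm_num
  rw [h4] at h2
  have := abs_add_le (LJ n - ∑ m ∈ Ioc 0 (n ^ 2), fJ n m / m) (∑ m ∈ Ioc 0 (n ^ 2), fJ n m / m)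
  rw [sub_add_cancel] at this
  linarith

lemma TJ_le {n N : ℕ} (hn : 2 < n) : |TJ n N| ≤ 18 + 4 * Real.log n := by
  have hl : 0 ≤ Real.log n := Real.log_natCast_nonneg n
  rcases Nat.lt_or_ge N (n ^ 2) with h | h
  · unfold TJ
    have h1 := LJ_le hn
    have h2 := fJ_head_le n N
    have h4 : Real.log N ≤ 2 * Real.log n := by
      rcases Nat.eq_zero_or_pos N with rfl | hN
      · simp; positivity
      rw [show 2 * Real.log n = Real.log ((n : ℝ) ^ 2) by rw [Real.log_pow]; norm_num]
      exact Real.log_le_log (by exact_mod_cast hN) (by exact_mod_cast h.le)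
    have := abs_sub (LJ n) (∑ m ∈ Ioc 0 N, fJ n m / m)
    linarith
  · have h1 := LJ_spec hn N
    have h3 : 2 * (4 * (n : ℝ) ^ 2) / ((N : ℝ) + 1) ≤ 8 := by
      rw [div_le_iff₀ (by positivity)]
      have : (n : ℝ) ^ 2 ≤ N := by exact_mod_cast h
      nlinarith
    unfold TJ
    linarith

lemma log_le_pow {ε : ℝ} (hε : 0 < ε) {n : ℕ} (hn : 2 < n) : 18 + 4 * Real.log n ≤ (18 + 4 / ε) * (n : ℝ) ^ ε := by
  have h1 : Real.log n ≤ (n : ℝ) ^ ε / ε := Real.log_le_rpow_div (by positivity) hε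
  have h2 : (1 : ℝ) ≤ (n : ℝ) ^ ε := Real.one_le_rpow (by exact_mod_cast (by omega : 1 ≤ n)) hε.le
  have h3 : (18 + 4 / ε) * (n : ℝ) ^ ε = 18 * (n : ℝ) ^ ε + 4 * ((n : ℝ) ^ ε / ε) := by ring
  rw [h3]; linarith

lemma bA_inv_le (n s : ℕ) : |(bA n s : ℝ) / s| ≤ |(bA n s : ℝ)| * (s : ℝ) ^ (-(3 / 4) : ℝ) := by
  rcases Nat.eq_zero_or_pos s with rfl | hs
  · simp
  have hs1 : (1 : ℝ) ≤ s := by exact_mod_cast hs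
  rw [abs_div, Nat.abs_cast, div_eq_mul_inv]
  apply mul_le_mul_of_nonneg_left _ (abs_nonneg _)
  rw [← Real.rpow_neg_one]
  exact Real.rpow_le_rpow_of_exponent_le hs1 (by norm_num)

lemma bA_summable {n : ℕ} (hn : 2 < n) : Summable (fun s : ℕ => |(bA n s : ℝ) / s|) := by
  obtain ⟨C, _, h⟩ := bA_sum (ε := 1) one_pos
  exact Summable.of_nonneg_of_le (fun s => abs_nonneg _) (bA_inv_le n) (h n hn).1

theorem ampA_eq {n : ℕ} (hn : 2 < n) : ampA n = (∑' s : ℕ, (bA n s : ℝ) / s) * LJ n := by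
  have h1 := class_number_formula hn
  set W : ℕ → ℝ := fun X => ∑ m ∈ Ioc 0 X, fJ n m * ((X / m : ℕ) : ℝ) with hW
  have hWlim : Tendsto (fun X : ℕ => W X / X) atTop (nhds (LJ n)) := W_lim (fJ_abs n) (fJ_sum hn) (LJ_spec hn)
  have hWb : ∀ X : ℕ, |W X| ≤ 8 * (n : ℝ) ^ 2 * X := by
    intro X
    refine (W_bound (fJ_sum hn) 0 X).trans (le_of_eq ?_)
    push_cast; ring
  have h2 : ∀ X : ℕ, (∑ e ∈ Finset.Icc 1 X, ∑ k ∈ Finset.Icc 1 (X / e ^ 2), (rho n k : ℝ)) = ∑' s : ℕ, (bA n s : ℝ) * W (X / s) := by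
    intro X
    have h3 := class_sum_eq n X
    rw [← bA_mul_JA, mul_comm, mul_assoc, sum_Ioc_mul_eq_sum_sum] at h3
    have h4 : ∀ s ∈ Ioc 0 X, (bA n s) * ∑ m ∈ Ioc 0 (X / s), (JA ((n : ℤ) ^ 2 - 4) * (zeta : ArithmeticFunction ℤ)) m
        = bA n s * ∑ m ∈ Ioc 0 (X / s), JA ((n : ℤ) ^ 2 - 4) m * ((X / s / m : ℕ) : ℤ) := by
      intro s _
      rw [sum_Ioc_mul_zeta_eq_sum]
    rw [sum_congr rfl h4] at h3
    rw [tsum_eq_sum (s := Ioc 0 X)]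
    · simp only [hW, fJ]
      have h3' := congrArg (fun z : ℤ => (z : ℝ)) h3
      simp only [Int.cast_sum, Int.cast_mul, Int.cast_natCast] at h3'
      exact h3'
    · intro s hs
      simp only [mem_Ioc, not_and, not_le] at hs
      rcases Nat.eq_zero_or_pos s with rfl | h0
      · simp
      · rw [Nat.div_eq_of_lt (hs h0)]; simp [hW]
  have h5 : Tendsto (fun X : ℕ => ∑' s : ℕ, (bA n s : ℝ) * W (X / s) / X) atTop (nhds (∑' s : ℕ, (bA n s : ℝ) / s * LJ n)) := by
    apply tendsto_tsum_of_dominated_convergence (bound := fun s : ℕ => |(bA n s : ℝ) / s| * (8 * (n : ℝ) ^ 2))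
    · exact (bA_summable hn).mul_right _
    · intro s
      rcases Nat.eq_zero_or_pos s with rfl | h0
      · simp
      have hdiv : Tendsto (fun X : ℕ => X / s) atTop atTop := Nat.tendsto_div_const_atTop h0.ne'
      have hA := hWlim.comp hdiv
      have hB : Tendsto (fun X : ℕ => ((X / s : ℕ) : ℝ) / X) atTop (nhds (1 / s)) := by
        have h6 := (tendsto_nat_floor_mul_div_atTop (R := ℝ) (a := 1 / (s : ℝ)) (by positivity)).comp tendsto_natCast_atTop_atTop (α := ℕ)
        refine h6.congr ?_
        intro X
        simp only [Function.comp]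
        congr 2
        rw [one_div_mul_eq_div]
        exact Nat.floor_div_eq_div X s
      have := ((hA.mul hB).const_mul (bA n s : ℝ))
      refine (this.congr' ?_).trans (le_of_eq (by congr 1; ring))
      filter_upwards [eventually_ge_atTop s] with X hX
      have : ((X / s : ℕ) : ℝ) ≠ 0 := by
        exact_mod_cast (Nat.div_pos hX h0).ne'
      simp only [Function.comp]
      field_simp
    · filter_upwards [eventually_gt_atTop 0] with X hX s
      have hXr : (0 : ℝ) < X := by exact_mod_cast hX
      rw [Real.norm_eq_abs, abs_div, abs_mul, abs_div, Nat.abs_cast, Nat.abs_cast]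
      rw [div_le_iff₀ hXr]
      rcases Nat.eq_zero_or_pos s with rfl | h0
      · simp
      have h7 := Nat.cast_div_le (α := ℝ) (m := X) (n := s)
      calc |(bA n s : ℝ)| * |W (X / s)| ≤ |(bA n s : ℝ)| * (8 * (n : ℝ) ^ 2 * (X / s)) := by
            gcongr
            exact (hWb _).trans (by gcongr)
        _ = _ := by ring
  rw [tsum_mul_right] at h5
  refine tendsto_nhds_unique h1 (h5.congr ?_)
  intro X
  rw [h2, tsum_div_const]

/-- (I1) -/
theorem ampA_le {ε : ℝ} (hε : 0 < ε) : ∃ C : ℝ, 1 ≤ C ∧ ∀ n : ℕ, 2 < n → |ampA n| ≤ C * (n : ℝ) ^ ε := by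
  obtain ⟨C, hC, h⟩ := bA_sum (ε := ε / 2) (by positivity)
  have h0 : 0 < 4 / (ε / 2) := by positivity
  refine ⟨C * (18 + 4 / (ε / 2)), by nlinarith, fun n hn => ?_⟩
  have hn0 : (0 : ℝ) < n := by exact_mod_cast (by omega : 0 < n)
  rw [ampA_eq hn, abs_mul]
  have h1 : |∑' s : ℕ, (bA n s : ℝ) / s| ≤ C * (n : ℝ) ^ (ε / 2) := by
    have hs := bA_summable hn
    have := norm_tsum_le_tsum_norm (f := fun s : ℕ => (bA n s : ℝ) / s) hs
    simp only [Real.norm_eq_abs] at this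
    exact this.trans ((hs.tsum_le_tsum (bA_inv_le n) (h n hn).1).trans (h n hn).2)
  have h2 : |LJ n| ≤ (18 + 4 / (ε / 2)) * (n : ℝ) ^ (ε / 2) := by
    have := LJ_le hn
    have h3 := log_le_pow (ε := ε / 2) (by positivity) hn
    have : 0 ≤ Real.log n := Real.log_natCast_nonneg n
    linarith
  calc _ ≤ (C * (n : ℝ) ^ (ε / 2)) * ((18 + 4 / (ε / 2)) * (n : ℝ) ^ (ε / 2)) := mul_le_mul h1 h2 (abs_nonneg _) (by positivity)
    _ = C * (18 + 4 / (ε / 2)) * ((n : ℝ) ^ (ε / 2) * (n : ℝ) ^ (ε / 2)) := by ring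
    _ = _ := by rw [← Real.rpow_add hn0]; congr 2; ring

/-- short sum approximating `A` -/
noncomputable def A1 (n M : ℕ) : ℝ := ∑ q ∈ Ioc 0 M, (aA n q : ℝ) / q

lemma A1_eq (n M : ℕ) : A1 n M = ∑ s ∈ Ioc 0 M, (bA n s : ℝ) / s * ∑ m ∈ Ioc 0 (M / s), fJ n m / m := by
  set f : ArithmeticFunction ℝ := ⟨fun s => (bA n s : ℝ) / s, by simp⟩ with hf
  set g : ArithmeticFunction ℝ := ⟨fun s => fJ n s / s, by simp⟩ with hg
  have h := sum_Ioc_mul_eq_sum_sum f g M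
  have h2 : ∀ q ∈ Ioc 0 M, (f * g) q = (aA n q : ℝ) / q := by
    intro q hq
    rw [mem_Ioc] at hq
    rw [← bA_mul_JA, mul_apply, mul_apply]
    push_cast
    rw [Finset.sum_div]
    apply sum_congr rfl
    intro x hx
    rw [Nat.mem_divisorsAntidiagonal] at hx
    simp only [hf, hg, coe_mk, fJ]
    rw [← hx.1]
    push_cast
    rw [div_mul_div_comm]
  rw [A1, ← sum_congr rfl h2, h]
  rfl

lemma A_sub_A1 {n : ℕ} (hn : 2 < n) (M : ℕ) : ampA n - A1 n M = ∑' s : ℕ, (bA n s : ℝ) / s * TJ n (M / s) := by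
  have hs := (bA_summable hn).of_abs
  have e1 : A1 n M = ∑' s : ℕ, (bA n s : ℝ) / s * ∑ m ∈ Ioc 0 (M / s), fJ n m / m := by
    rw [A1_eq, tsum_eq_sum]
    intro s hs
    simp only [mem_Ioc, not_and, not_le] at hs
    rcases Nat.eq_zero_or_pos s with rfl | h0
    · simp
    · rw [Nat.div_eq_of_lt (hs h0)]; simp
  have s1 : Summable (fun s : ℕ => (bA n s : ℝ) / s * ∑ m ∈ Ioc 0 (M / s), fJ n m / m) := by
    apply summable_of_ne_finset_zero (s := Ioc 0 M)
    intro s hs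
    simp only [mem_Ioc, not_and, not_le] at hs
    rcases Nat.eq_zero_or_pos s with rfl | h0
    · simp
    · rw [Nat.div_eq_of_lt (hs h0)]; simp
  rw [ampA_eq hn, e1, ← tsum_mul_right, ← (hs.mul_right _).tsum_sub s1]
  congr 1; ext s; unfold TJ; ring

lemma doublingZ {a b s : ℤ} (ha : 3 ≤ a) (hab : a < b) (hs : 0 ≤ s) (h : (a ^ 2 - 4) * (b ^ 2 - 4) = s * s) : 2 * a < b := by
  have hpar : Even (a * b - s) := by
    have h1 : Even ((a * b) * (a * b) - s * s) := by
      rw [← h]; exact ⟨2 * (a ^ 2 + b ^ 2 - 4), by ring⟩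
    rw [Int.even_sub] at h1 ⊢
    rw [Int.even_mul (m := a * b), or_self, Int.even_mul (m := s), or_self] at h1
    exact h1
  obtain ⟨t, ht⟩ := hpar
  have hst : s = a * b - 2 * t := by linarith
  have hq : t * t - a * b * t + a ^ 2 + b ^ 2 - 4 = 0 := by
    rw [hst] at h; linarith
  have ht0 : 0 < t := by
    by_contra hc
    push Not at hc
    nlinarith [mul_nonneg (show 0 ≤ a by linarith) (show 0 ≤ b by linarith), mul_nonneg (mul_nonneg (show 0 ≤ a by linarith) (show 0 ≤ b by linarith)) (show 0 ≤ -t by linarith)]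
  have ht3 : 3 ≤ t := by
    by_contra hc
    push Not at hc
    have : t = 1 ∨ t = 2 := by omega
    rcases this with rfl | rfl
    · nlinarith [sq_nonneg (a - b)]
    · have h5 : (a - b) ^ 2 = 0 := by linarith
      have := pow_eq_zero_iff (two_ne_zero) |>.mp h5
      linarith
  have hq3 : 0 ≤ 9 - 3 * (a * b) + a ^ 2 + b ^ 2 - 4 := by
    have : (t - 3) * (a * b - t - 3) ≥ 0 := by
      apply mul_nonneg (by linarith)
      rcases eq_or_lt_of_le ht3 with h6 | h6
      · subst h6; nlinarith
      · have : a * b ≥ 2 * t := by linarith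
        linarith
    nlinarith
  by_contra hc
  push Not at hc
  nlinarith [mul_nonneg (show 0 ≤ b - a by linarith) (show 0 ≤ 2 * a - b by linarith)]

lemma doubling {n n' : ℕ} (hn : 2 < n) (hlt : n < n') (hsq : IsSquare ((n ^ 2 - 4) * (n' ^ 2 - 4) : ℕ)) : 2 * n < n' := by
  obtain ⟨r, hr⟩ := hsq
  have := doublingZ (a := n) (b := n') (s := r) (by exact_mod_cast hn) (by exact_mod_cast hlt) (by positivity) (by
    rw [D_cast hn, D_cast (n := n') (by omega)]; exact_mod_cast hr)
  exact_mod_cast this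

lemma isSquare_trans {a b c : ℕ} (hb : 0 < b) (h1 : IsSquare (a * b)) (h2 : IsSquare (b * c)) : IsSquare (a * c) := by
  obtain ⟨r, hr⟩ := h1
  obtain ⟨s, hs⟩ := h2
  have h : (a * c) * b ^ 2 = (r * s) ^ 2 := by nlinarith
  have hd : b ∣ r * s := by
    rw [← Nat.pow_dvd_pow_iff two_ne_zero]; exact ⟨a * c, by rw [← h]; ring⟩
  obtain ⟨q, hq⟩ := hd
  refine ⟨q, ?_⟩
  rw [hq] at h
  have hb2 : 0 < b ^ 2 := by positivity
  apply Nat.eq_of_mul_eq_mul_right hb2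
  rw [h]; ring

/-- few `n` share a field -/
lemma same_field_count (X : ℕ) {F : Finset ℕ} (hF : ∀ a ∈ F, 2 < a ∧ a ≤ X)
    (hsq : ∀ a ∈ F, ∀ b ∈ F, IsSquare ((a ^ 2 - 4) * (b ^ 2 - 4) : ℕ)) : F.card ≤ Nat.log 2 X + 1 := by
  have h := Finset.card_le_card_of_injOn (s := F) (t := range (Nat.log 2 X + 1)) (Nat.log 2) (by
      intro a ha
      simp only [Finset.coe_range, Set.mem_Iio]
      exact Nat.lt_succ_of_le (Nat.log_mono_right (hF a ha).2)) (by
      have key : ∀ a ∈ F, ∀ b ∈ F, a < b → Nat.log 2 a ≠ Nat.log 2 b := by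
        intro a ha b hb hlt heq
        have h1 := doubling (hF a ha).1 hlt (hsq a ha b hb)
        have h2 := Nat.pow_log_le_self 2 (x := a) (by have := (hF a ha).1; omega)
        have h3 := Nat.lt_pow_succ_log_self (b := 2) (by norm_num) b
        rw [← heq, pow_succ] at h3
        omega
      intro a ha b hb heq
      rcases lt_trichotomy a b with h | h | h
      · exact absurd heq (key a ha b hb h)
      · exact h
      · exact absurd heq.symm (key b hb a ha h))
  simpa using h

lemma duality {ι : Type*} (F : Finset ι) (I : Finset ℕ) (q c : ℕ → ℝ) (φ : ι → ℕ → ℝ) (hq : ∀ P, 0 ≤ q P) {R : ℝ} (hR : 0 ≤ R)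
    (hK : ∀ n ∈ F, ∑ n' ∈ F, |∑ P ∈ I, φ n P * φ n' P * q P| ≤ R) :
    ∑ n ∈ F, (∑ P ∈ I, c P * φ n P * q P) ^ 2 ≤ (∑ P ∈ I, c P ^ 2 * q P) * R := by
  set v : ι → ℝ := fun n => ∑ P ∈ I, c P * φ n P * q P with hv
  set S := ∑ n ∈ F, v n ^ 2 with hS
  have hS0 : 0 ≤ S := Finset.sum_nonneg fun _ _ => sq_nonneg _
  have hQ0 : 0 ≤ ∑ P ∈ I, c P ^ 2 * q P := Finset.sum_nonneg fun P _ => mul_nonneg (sq_nonneg _) (hq P)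
  have h1 : S = ∑ P ∈ I, (c P * √(q P)) * (√(q P) * ∑ n ∈ F, v n * φ n P) := by
    have : ∀ P ∈ I, (c P * √(q P)) * (√(q P) * ∑ n ∈ F, v n * φ n P) = ∑ n ∈ F, v n * (c P * φ n P * q P) := by
      intro P _
      rw [show (c P * √(q P)) * (√(q P) * ∑ n ∈ F, v n * φ n P) = c P * (√(q P) * √(q P)) * ∑ n ∈ F, v n * φ n P by ring, Real.mul_self_sqrt (hq P), mul_sum]
      exact sum_congr rfl fun _ _ => by ring
    rw [sum_congr rfl this, Finset.sum_comm]
    simp only [← mul_sum]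
    exact sum_congr rfl fun n _ => by rw [sq]
  have h2 := Finset.sum_mul_sq_le_sq_mul_sq I (fun P => c P * √(q P)) (fun P => √(q P) * ∑ n ∈ F, v n * φ n P)
  rw [← h1] at h2
  have h3 : ∑ P ∈ I, (c P * √(q P)) ^ 2 = ∑ P ∈ I, c P ^ 2 * q P :=
    sum_congr rfl fun P _ => by rw [mul_pow, Real.sq_sqrt (hq P)]
  have h4 : ∑ P ∈ I, (√(q P) * ∑ n ∈ F, v n * φ n P) ^ 2 = ∑ n ∈ F, ∑ n' ∈ F, v n * v n' * ∑ P ∈ I, φ n P * φ n' P * q P := by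
    have : ∀ P ∈ I, (√(q P) * ∑ n ∈ F, v n * φ n P) ^ 2 = ∑ n ∈ F, ∑ n' ∈ F, v n * v n' * (φ n P * φ n' P * q P) := by
      intro P _
      rw [mul_pow, Real.sq_sqrt (hq P), sq, Finset.sum_mul_sum, mul_sum]
      refine sum_congr rfl fun n _ => ?_
      rw [mul_sum]
      exact sum_congr rfl fun _ _ => by ring
    rw [sum_congr rfl this, Finset.sum_comm]
    refine sum_congr rfl fun n _ => ?_
    rw [Finset.sum_comm]
    exact sum_congr rfl fun n' _ => (mul_sum _ _ _).symm
  set K : ι → ι → ℝ := fun n n' => ∑ P ∈ I, φ n P * φ n' P * q P with hKd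
  have hKs : ∀ n n', K n n' = K n' n := fun n n' => sum_congr rfl fun _ _ => by ring
  have h5 : ∑ n ∈ F, ∑ n' ∈ F, v n * v n' * K n n' ≤ R * S := by
    have e1 : ∑ n ∈ F, ∑ n' ∈ F, v n ^ 2 * |K n n'| ≤ R * S := by
      rw [hS, mul_sum]
      refine sum_le_sum fun n hn => ?_
      rw [← mul_sum, mul_comm]
      exact mul_le_mul_of_nonneg_right (hK n hn) (sq_nonneg _)
    have e2 : ∑ n ∈ F, ∑ n' ∈ F, v n' ^ 2 * |K n n'| = ∑ n ∈ F, ∑ n' ∈ F, v n ^ 2 * |K n n'| := by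
      rw [Finset.sum_comm]
      exact sum_congr rfl fun n _ => sum_congr rfl fun n' _ => by rw [hKs]
    have e3 : ∑ n ∈ F, ∑ n' ∈ F, v n * v n' * K n n' ≤ ∑ n ∈ F, ∑ n' ∈ F, (v n ^ 2 * |K n n'| + v n' ^ 2 * |K n n'|) / 2 := by
      refine sum_le_sum fun n _ => sum_le_sum fun n' _ => ?_
      have f1 : v n * v n' * K n n' ≤ |v n * v n'| * |K n n'| := by rw [← abs_mul]; exact le_abs_self _
      have f2 : |v n * v n'| ≤ (v n ^ 2 + v n' ^ 2) / 2 := by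
        rw [abs_le]; constructor <;> nlinarith [sq_nonneg (v n + v n'), sq_nonneg (v n - v n')]
      nlinarith [abs_nonneg (K n n')]
    have e4 : ∑ n ∈ F, ∑ n' ∈ F, (v n ^ 2 * |K n n'| + v n' ^ 2 * |K n n'|) / 2
        = (∑ n ∈ F, ∑ n' ∈ F, v n ^ 2 * |K n n'| + ∑ n ∈ F, ∑ n' ∈ F, v n' ^ 2 * |K n n'|) / 2 := by
      simp only [add_div, Finset.sum_add_distrib, Finset.sum_div]
    rw [e4, e2] at e3
    linarith
  rw [h3, h4] at h2
  have h6 : S ^ 2 ≤ (∑ P ∈ I, c P ^ 2 * q P) * (R * S) := h2.trans (mul_le_mul_of_nonneg_left h5 hQ0)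
  rcases hS0.eq_or_lt with h | h
  · rw [← h]; positivity
  · nlinarith

/-- k-fold multiplicative coefficients -/
noncomputable def uV (N Z : ℕ) : ArithmeticFunction ℕ := ⟨fun m => if m ∈ Ioc N Z then 1 else 0, by simp⟩

lemma uV_apply (N Z m : ℕ) : uV N Z m = if m ∈ Ioc N Z then 1 else 0 := rfl

lemma cV_supp (N Z k : ℕ) : ∀ P, (uV N Z ^ k) P ≠ 0 → (N + 1) ^ k ≤ P ∧ P ≤ Z ^ k := by
  induction k with
  | zero =>
    intro P hP
    rw [pow_zero, one_apply] at hP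
    split_ifs at hP with h
    · simp [h]
    · exact absurd rfl hP
  | succ k ih =>
    intro P hP
    rw [pow_succ, mul_apply] at hP
    obtain ⟨x, hx, hne⟩ := Finset.exists_ne_zero_of_sum_ne_zero hP
    rw [Nat.mem_divisorsAntidiagonal] at hx
    obtain ⟨h1, h2⟩ := mul_ne_zero_iff.mp hne
    rw [uV_apply] at h2
    split_ifs at h2 with h
    · rw [mem_Ioc] at h
      have := ih _ h1
      rw [← hx.1, pow_succ, pow_succ]
      exact ⟨Nat.mul_le_mul this.1 h.1, Nat.mul_le_mul this.2 h.2⟩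
    · exact absurd rfl h2

lemma cV_le (N Z k : ℕ) (P : ℕ) : (uV N Z ^ k) P ≤ P.divisors.card ^ k := by
  induction k generalizing P with
  | zero =>
    rw [pow_zero, one_apply]; split_ifs <;> simp
  | succ k ih =>
    rw [pow_succ, mul_apply, pow_succ]
    calc _ ≤ ∑ x ∈ P.divisorsAntidiagonal, P.divisors.card ^ k := by
          refine sum_le_sum fun x hx => ?_
          rw [Nat.mem_divisorsAntidiagonal] at hx
          have h1 : uV N Z x.2 ≤ 1 := by rw [uV_apply]; split_ifs <;> simp
          have h2 : x.1.divisors.card ≤ P.divisors.card := Finset.card_le_card (Nat.divisors_subset_of_dvd hx.2 ⟨x.2, hx.1.symm⟩)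
          calc _ ≤ x.1.divisors.card ^ k * 1 := Nat.mul_le_mul (ih _) h1
            _ ≤ _ := by rw [mul_one]; exact Nat.pow_le_pow_left h2 k
      _ = _ := by
          rw [Finset.sum_const, smul_eq_mul, mul_comm, ← Nat.map_div_right_divisors, Finset.card_map]

lemma cV_expand (h : ℕ → ℝ) (h1 : h 1 = 1) (hm : ∀ a b, h (a * b) = h a * h b) (N k : ℕ) {Z : ℕ} (hZ : 0 < Z) :
    (∑ m ∈ Ioc N Z, h m) ^ k = ∑ P ∈ Ioc 0 (Z ^ k), ((uV N Z ^ k) P : ℝ) * h P := by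
  induction k with
  | zero =>
    have : Ioc 0 1 = {1} := rfl
    simp [this, h1]
  | succ k ih =>
    set F : ArithmeticFunction ℝ := ⟨fun P => ((uV N Z ^ k) P : ℝ) * h P, by simp⟩ with hF
    set G : ArithmeticFunction ℝ := ⟨fun P => (uV N Z P : ℝ) * h P, by simp⟩ with hG
    have e1 : ∀ P ∈ Ioc 0 (Z ^ (k + 1)), ((uV N Z ^ (k + 1)) P : ℝ) * h P = (F * G) P := by
      intro P _
      rw [pow_succ, mul_apply, mul_apply]
      push_cast
      rw [Finset.sum_mul]
      refine sum_congr rfl fun x hx => ?_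
      rw [Nat.mem_divisorsAntidiagonal] at hx
      simp only [hF, hG, coe_mk]
      rw [← hx.1, hm]; ring
    rw [sum_congr rfl e1, sum_Ioc_mul_eq_sum_sum, pow_succ, ih]
    have eG : ∀ B, Z ≤ B → ∑ m ∈ Ioc 0 B, G m = ∑ m ∈ Ioc N Z, h m := by
      intro B hB
      symm
      have e3 : ∀ m ∈ Ioc N Z, h m = G m := by
        intro m hm
        simp only [hG, coe_mk, uV_apply, if_pos hm]; simp
      rw [sum_congr rfl e3]
      apply Finset.sum_subset
      · intro m; simp only [mem_Ioc]; omega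
      · intro m _ hm
        simp only [hG, coe_mk, uV_apply, if_neg hm]; simp
    have e2 : ∀ P ∈ Ioc 0 (Z ^ (k + 1)), F P * ∑ m ∈ Ioc 0 (Z ^ (k + 1) / P), G m = F P * ∑ m ∈ Ioc N Z, h m := by
      intro P hP
      rw [mem_Ioc] at hP
      by_cases hz : (uV N Z ^ k) P = 0
      · simp [hF, hz]
      · rw [eG]
        rw [Nat.le_div_iff_mul_le hP.1, pow_succ, mul_comm]
        exact Nat.mul_le_mul_right _ (cV_supp N Z k P hz).2
    rw [sum_congr rfl e2, ← Finset.sum_mul]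
    congr 1
    apply Finset.sum_subset
    · apply Finset.Ioc_subset_Ioc_right
      exact Nat.pow_le_pow_right hZ (by omega)
    · intro P hP hP2
      simp only [mem_Ioc] at hP hP2
      by_cases hz : (uV N Z ^ k) P = 0
      · simp [hF, hz]
      · exact absurd ⟨hP.1, (cV_supp N Z k P hz).2⟩ hP2

noncomputable def VJ (n N Z : ℕ) : ℝ := ∑ m ∈ Ioc N Z, fJ n m / m

lemma JA_mul_left (E E' : ℤ) (m : ℕ) : JA (E * E') m = JA E m * JA E' m := by
  simp only [JA_apply]
  split_ifs
  · exact jacobiSym.mul_left _ _ _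
  · simp

lemma K_abs_le (n n' a b : ℕ) : |∑ P ∈ Ioc a b, fJ n P * fJ n' P * (1 / (P : ℝ))| ≤ 1 + Real.log b := by
  refine (abs_sum_le_sum_abs _ _).trans ?_
  refine le_trans (sum_le_sum (g := fun P : ℕ => 1 / (P : ℝ)) fun P _ => ?_) ((Finset.sum_le_sum_of_subset_of_nonneg (Finset.Ioc_subset_Ioc_left (Nat.zero_le a)) (fun _ _ _ => by positivity)).trans (sum_inv_le b))
  rw [abs_mul, abs_mul, abs_of_nonneg (show (0 : ℝ) ≤ 1 / (P : ℝ) by positivity)]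
  have := mul_le_one₀ (fJ_abs n P) (abs_nonneg _) (fJ_abs n' P)
  exact mul_le_of_le_one_left (by positivity) this

lemma K_off {n n' : ℕ} (hn : 2 < n) (hn' : 2 < n') (hsq : ¬ IsSquare ((n ^ 2 - 4) * (n' ^ 2 - 4) : ℕ)) (a b : ℕ) :
    |∑ P ∈ Ioc a b, fJ n P * fJ n' P * (1 / (P : ℝ))| ≤ 8 * (n : ℝ) ^ 2 * (n' : ℝ) ^ 2 / (a + 1) := by
  have h1 : ∀ P ∈ Ioc a b, fJ n P * fJ n' P * (1 / (P : ℝ)) = (JA (((n ^ 2 - 4) * (n' ^ 2 - 4) : ℕ) : ℤ) P : ℝ) / P := by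
    intro P _
    rw [Nat.cast_mul, JA_mul_left, fJ, fJ, D_cast hn, D_cast hn']
    push_cast; ring
  rw [sum_congr rfl h1]
  refine (abel_inv (JA_sum_le (Nat.mul_pos (D_pos hn) (D_pos hn')) hsq) a b).trans ?_
  apply div_le_div_of_nonneg_right _ (by positivity)
  push_cast
  have e1 : ((n ^ 2 - 4 : ℕ) : ℝ) ≤ (n : ℝ) ^ 2 := by exact_mod_cast Nat.sub_le _ _
  have e2 : ((n' ^ 2 - 4 : ℕ) : ℝ) ≤ (n' : ℝ) ^ 2 := by exact_mod_cast Nat.sub_le _ _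
  have := mul_le_mul e1 e2 (by positivity) (by positivity)
  linarith

lemma moment_raw (X N k : ℕ) {Z : ℕ} (hZ : 0 < Z) :
    ∑ n ∈ Ioc 2 X, VJ n N Z ^ (2 * k) ≤
      (∑ P ∈ Ioc 0 (Z ^ k), ((P.divisors.card : ℝ) ^ k) ^ 2 * (1 / (P : ℝ))) *
        ((Nat.log 2 X + 1) * (1 + Real.log (Z ^ k : ℕ)) + X * (8 * (X : ℝ) ^ 2 * (X : ℝ) ^ 2 / (N + 1) ^ k)) := by
  set a := (N + 1) ^ k - 1 with ha
  have ha1 : (a : ℝ) + 1 = (N + 1 : ℝ) ^ k := by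
    have : a + 1 = (N + 1) ^ k := Nat.sub_add_cancel (Nat.one_le_pow _ _ (by omega))
    exact_mod_cast this
  set c : ℕ → ℝ := fun P => ((uV N Z ^ k) P : ℝ) with hc
  have hsub : Ioc a (Z ^ k) ⊆ Ioc 0 (Z ^ k) := Finset.Ioc_subset_Ioc_left (Nat.zero_le a)
  have e1 : ∀ n ∈ Ioc 2 X, VJ n N Z ^ (2 * k) = (∑ P ∈ Ioc a (Z ^ k), c P * fJ n P * (1 / (P : ℝ))) ^ 2 := by
    intro n _
    rw [mul_comm 2 k, pow_mul, VJ, cV_expand (fun m => fJ n m / m) (by simp [fJ, JA_one]) (by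
      intro a b; simp only [fJ]; rw [JA_mul]; push_cast; rw [div_mul_div_comm]) N k hZ]
    congr 1
    symm
    refine (Finset.sum_subset hsub ?_).trans (sum_congr rfl fun P _ => by simp only [hc]; ring)
    intro P hP hP2
    have : (uV N Z ^ k) P = 0 := by
      by_contra h
      have h3 := cV_supp N Z k P h
      rw [mem_Ioc] at hP hP2
      exact hP2 ⟨by have := Nat.one_le_pow k (N + 1) (by omega); omega, hP.2⟩
    simp [hc, this]
  have hl : 0 ≤ Real.log (Z ^ k : ℕ) := Real.log_natCast_nonneg _
  have hl' : 0 ≤ (Nat.log 2 X + 1 : ℝ) * (1 + Real.log (Z ^ k : ℕ)) := by positivity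
  rw [sum_congr rfl e1]
  refine (duality (Ioc 2 X) (Ioc a (Z ^ k)) (fun P => 1 / (P : ℝ)) c (fun n P => fJ n P) (fun P => by positivity)
    (R := (Nat.log 2 X + 1) * (1 + Real.log (Z ^ k : ℕ)) + X * (8 * (X : ℝ) ^ 2 * (X : ℝ) ^ 2 / (N + 1) ^ k)) (by positivity) ?_).trans ?_
  · intro n hn
    rw [mem_Ioc] at hn
    classical
    rw [← Finset.sum_filter_add_sum_filter_not _ (fun n' => IsSquare ((n ^ 2 - 4) * (n' ^ 2 - 4) : ℕ))]
    apply add_le_add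
    · refine (Finset.sum_le_card_nsmul _ _ (1 + Real.log (Z ^ k : ℕ)) fun n' _ => K_abs_le n n' _ _).trans ?_
      rw [nsmul_eq_mul]
      have hcard := same_field_count X (F := (Ioc 2 X).filter (fun n' => IsSquare ((n ^ 2 - 4) * (n' ^ 2 - 4) : ℕ))) (by
        intro a ha; rw [mem_filter, mem_Ioc] at ha; exact ha.1) (by
        intro a ha b hb
        rw [mem_filter] at ha hb
        exact isSquare_trans (D_pos hn.1) (by rw [mul_comm]; exact ha.2) hb.2)
      apply mul_le_mul_of_nonneg_right _ (by positivity)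
      exact_mod_cast hcard
    · refine (Finset.sum_le_card_nsmul _ _ (8 * (X : ℝ) ^ 2 * (X : ℝ) ^ 2 / (N + 1) ^ k) fun n' hn' => ?_).trans ?_
      · rw [mem_filter, mem_Ioc] at hn'
        refine (K_off hn.1 hn'.1.1 hn'.2 _ _).trans ?_
        rw [ha1]
        have i1 : (n : ℝ) ≤ X := by exact_mod_cast hn.2
        have i2 : (n' : ℝ) ≤ X := by exact_mod_cast hn'.1.2
        gcongr
      · rw [nsmul_eq_mul]
        apply mul_le_mul_of_nonneg_right _ (by positivity)
        have := (Finset.card_filter_le (Ioc 2 X) (fun n' => ¬ IsSquare ((n ^ 2 - 4) * (n' ^ 2 - 4) : ℕ)))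
        rw [Nat.card_Ioc] at this
        exact_mod_cast this.trans (Nat.sub_le _ _)
  · apply mul_le_mul_of_nonneg_right _ (by positivity)
    refine (Finset.sum_le_sum_of_subset_of_nonneg hsub fun _ _ _ => by positivity).trans (sum_le_sum fun P _ => ?_)
    have : c P ≤ (P.divisors.card : ℝ) ^ k := by simp only [hc]; exact_mod_cast cV_le N Z k P
    have : 0 ≤ c P := by simp [hc]
    gcongr

lemma moment40 : ∃ C : ℝ, 0 ≤ C ∧ ∀ w : ℕ, 1 ≤ w → ∀ N : ℕ, w ^ 28 ≤ N →
    ∑ n ∈ Ioc 2 ((2 * w) ^ 96), VJ n N (w ^ 200) ^ 40 ≤ C * w := by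
  obtain ⟨C, hC, hdiv⟩ := divisor_bound (ε := 1 / 640000) (by norm_num)
  refine ⟨C ^ 40 * 16001 * (961 * 16001 + 8 * 2 ^ 480), by positivity, fun w hw N hN => ?_⟩
  have hw1 : (1 : ℝ) ≤ w := by exact_mod_cast hw
  have hw0 : (0 : ℝ) < w := by linarith
  set r : ℝ := (w : ℝ) ^ (1 / 4 : ℝ) with hr
  have hr1 : 1 ≤ r := Real.one_le_rpow hw1 (by norm_num)
  have hr4 : r ^ 4 = w := by
    rw [hr, ← Real.rpow_natCast, ← Real.rpow_mul hw0.le]; norm_num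
  have hl0 : 0 ≤ Real.log w := Real.log_nonneg hw1
  have hlog : Real.log w ≤ 4 * r := by
    have := Real.log_le_rpow_div (x := w) hw0.le (ε := 1 / 4) (by norm_num)
    rw [← hr] at this; linarith
  have hZ : 0 < w ^ 200 := by positivity
  refine (moment_raw ((2 * w) ^ 96) N 20 hZ).trans ?_
  have hY : Real.log ((w ^ 200) ^ 20 : ℕ) = 4000 * Real.log w := by
    rw [← pow_mul]; push_cast; rw [Real.log_pow]; norm_num
  have h1 : 1 + Real.log ((w ^ 200) ^ 20 : ℕ) ≤ 16001 * r := by rw [hY]; linarith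
  have h1' : 0 ≤ 1 + Real.log ((w ^ 200) ^ 20 : ℕ) := by rw [hY]; positivity
  have hQ : ∑ P ∈ Ioc 0 ((w ^ 200) ^ 20), ((P.divisors.card : ℝ) ^ 20) ^ 2 * (1 / (P : ℝ)) ≤ C ^ 40 * r * (16001 * r) := by
    calc _ ≤ ∑ P ∈ Ioc 0 ((w ^ 200) ^ 20), C ^ 40 * r * (1 / (P : ℝ)) := by
          refine sum_le_sum fun P hP => ?_
          rw [mem_Ioc] at hP
          apply mul_le_mul_of_nonneg_right _ (by positivity)
          have h2 := hdiv P (by omega)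
          have h3 : (P : ℝ) ≤ (w : ℝ) ^ 4000 := by
            have : P ≤ w ^ 4000 := by rw [show 4000 = 200 * 20 by norm_num, pow_mul]; exact hP.2
            exact_mod_cast this
          have h4 : ((P : ℝ) ^ (1 / 640000 : ℝ)) ^ 40 ≤ r := by
            calc ((P : ℝ) ^ (1 / 640000 : ℝ)) ^ 40 ≤ (((w : ℝ) ^ 4000) ^ (1 / 640000 : ℝ)) ^ 40 := by gcongr
              _ = r := by
                rw [hr, ← Real.rpow_natCast, ← Real.rpow_natCast, ← Real.rpow_mul hw0.le, ← Real.rpow_mul hw0.le]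
                norm_num
          rw [← pow_mul]
          calc (P.divisors.card : ℝ) ^ (20 * 2) ≤ (C * (P : ℝ) ^ (1 / 640000 : ℝ)) ^ (20 * 2) := by gcongr
            _ = C ^ 40 * ((P : ℝ) ^ (1 / 640000 : ℝ)) ^ 40 := by rw [mul_pow]
            _ ≤ _ := by gcongr
      _ ≤ _ := by
          rw [← mul_sum]
          exact mul_le_mul_of_nonneg_left ((sum_inv_le _).trans h1) (by positivity)
  have hX : (((2 * w) ^ 96 : ℕ) : ℝ) = 2 ^ 96 * (w : ℝ) ^ 96 := by push_cast; rw [mul_pow]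
  have h2 : ((Nat.log 2 ((2 * w) ^ 96) : ℕ) : ℝ) + 1 ≤ 961 * r := by
    have e1 : ((Nat.log 2 ((2 * w) ^ 96) : ℕ) : ℝ) ≤ Real.logb 2 ((2 * w) ^ 96 : ℕ) := Real.natLog_le_logb _ _
    have e2 : Real.logb 2 ((2 * w) ^ 96 : ℕ) = 96 * (1 + Real.log w / Real.log 2) := by
      have : Real.log 2 ≠ 0 := (Real.log_pos (by norm_num)).ne'
      push_cast
      rw [Real.logb, Real.log_pow, Real.log_mul (by norm_num) hw0.ne']
      field_simp; norm_num
    have e3 : Real.log w / Real.log 2 ≤ 2 * Real.log w := by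
      have := Real.log_two_gt_d9
      rw [div_le_iff₀ (by linarith)]
      nlinarith
    rw [e2] at e1
    linarith
  have h3 : (((2 * w) ^ 96 : ℕ) : ℝ) * (8 * (((2 * w) ^ 96 : ℕ) : ℝ) ^ 2 * (((2 * w) ^ 96 : ℕ) : ℝ) ^ 2 / ((N : ℝ) + 1) ^ 20) ≤ 8 * 2 ^ 480 := by
    rw [hX, ← mul_div_assoc, div_le_iff₀ (by positivity)]
    have hN' : (w : ℝ) ^ 28 ≤ N + 1 := by
      have : (w : ℝ) ^ 28 ≤ N := by exact_mod_cast hN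
      linarith
    have e4 : (w : ℝ) ^ 480 ≤ (N + 1 : ℝ) ^ 20 := by
      calc (w : ℝ) ^ 480 ≤ (w : ℝ) ^ 560 := pow_le_pow_right₀ hw1 (by norm_num)
        _ = ((w : ℝ) ^ 28) ^ 20 := by rw [← pow_mul]
        _ ≤ _ := by gcongr
    have e5 : 2 ^ 96 * (w : ℝ) ^ 96 * (8 * (2 ^ 96 * (w : ℝ) ^ 96) ^ 2 * (2 ^ 96 * (w : ℝ) ^ 96) ^ 2) = 8 * 2 ^ 480 * (w : ℝ) ^ 480 := by
      rw [show (2 : ℝ) ^ 480 = (2 ^ 96) ^ 5 by rw [← pow_mul]]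
      generalize (2 : ℝ) ^ 96 = u; ring
    rw [e5]
    exact mul_le_mul_of_nonneg_left e4 (by positivity)
  have hR : ((Nat.log 2 ((2 * w) ^ 96) : ℕ) + 1 : ℝ) * (1 + Real.log ((w ^ 200) ^ 20 : ℕ)) + (((2 * w) ^ 96 : ℕ) : ℝ) * (8 * (((2 * w) ^ 96 : ℕ) : ℝ) ^ 2 * (((2 * w) ^ 96 : ℕ) : ℝ) ^ 2 / ((N : ℝ) + 1) ^ 20)
      ≤ (961 * 16001 + 8 * 2 ^ 480) * r ^ 2 := by
    have e6 := mul_le_mul h2 h1 h1' (by positivity)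
    have e7 : (1 : ℝ) ≤ r ^ 2 := one_le_pow₀ hr1
    have e8 : (8 * 2 ^ 480 : ℝ) ≤ 8 * 2 ^ 480 * r ^ 2 := le_mul_of_one_le_right (by positivity) e7
    have e9 : 961 * r * (16001 * r) = 961 * 16001 * r ^ 2 := by ring
    rw [e9] at e6
    rw [add_mul (961 * 16001 : ℝ)]
    exact add_le_add e6 (h3.trans e8)
  refine (mul_le_mul hQ hR (by positivity) (by positivity)).trans (le_of_eq ?_)
  rw [← hr4]; ring

lemma T_meansq : ∃ C : ℝ, 0 ≤ C ∧ ∀ w : ℕ, 1 ≤ w → ∀ N : ℕ, w ^ 28 ≤ N → N ≤ w ^ 200 →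
    ∑ n ∈ Ioc 2 ((2 * w) ^ 96), TJ n N ^ 2 ≤ C * (w : ℝ) ^ 92 := by
  obtain ⟨C, hC, hm⟩ := moment40
  refine ⟨2 * (C + 2 ^ 96) + 2 * (2 ^ 96 * (8 * 2 ^ 192) ^ 2), by positivity, fun w hw N hN hN2 => ?_⟩
  have hw1 : (1 : ℝ) ≤ w := by exact_mod_cast hw
  have hw0 : (0 : ℝ) < w := by linarith
  have hX : (((2 * w) ^ 96 : ℕ) : ℝ) = 2 ^ 96 * (w : ℝ) ^ 96 := by push_cast; rw [mul_pow]
  have hpt : ∀ n ∈ Ioc 2 ((2 * w) ^ 96), TJ n N ^ 2 ≤ 2 * (1 / (w : ℝ) ^ 4 + VJ n N (w ^ 200) ^ 40 * (w : ℝ) ^ 76) + 2 * (8 * 2 ^ 192 / (w : ℝ) ^ 4) ^ 2 := by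
    intro n hn
    rw [mem_Ioc] at hn
    have h1 : |TJ n N - VJ n N (w ^ 200)| ≤ 8 * 2 ^ 192 / (w : ℝ) ^ 4 := by
      have e0 := LJ_spec hn.1 (w ^ 200)
      have e1 : TJ n N - VJ n N (w ^ 200) = LJ n - ∑ m ∈ Ioc 0 (w ^ 200), fJ n m / m := by
        rw [TJ, VJ, ← Finset.sum_Ioc_consecutive _ (Nat.zero_le N) hN2]; ring
      rw [e1]
      refine e0.trans ?_
      have hn' : (n : ℝ) ≤ 2 ^ 96 * (w : ℝ) ^ 96 := by rw [← hX]; exact_mod_cast hn.2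
      rw [div_le_div_iff₀ (by positivity) (by positivity)]
      push_cast
      calc 2 * (4 * (n : ℝ) ^ 2) * (w : ℝ) ^ 4 ≤ 2 * (4 * (2 ^ 96 * (w : ℝ) ^ 96) ^ 2) * (w : ℝ) ^ 4 := by gcongr
        _ = 8 * 2 ^ 192 * (w : ℝ) ^ 196 := by ring
        _ ≤ 8 * 2 ^ 192 * (w : ℝ) ^ 200 := by gcongr <;> norm_num
        _ ≤ _ := by gcongr; linarith
    set V := VJ n N (w ^ 200)
    have h2 : V ^ 2 ≤ 1 / (w : ℝ) ^ 4 + V ^ 40 * (w : ℝ) ^ 76 := by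
      rcases le_total (V ^ 2) (1 / (w : ℝ) ^ 4) with h | h
      · have : 0 ≤ V ^ 40 * (w : ℝ) ^ 76 := by positivity
        linarith
      · have e1 : 1 ≤ V ^ 2 * (w : ℝ) ^ 4 := by rwa [div_le_iff₀ (by positivity)] at h
        have e2 : 1 ≤ (V ^ 2 * (w : ℝ) ^ 4) ^ 19 := one_le_pow₀ e1
        have e3 : V ^ 40 * (w : ℝ) ^ 76 = V ^ 2 * (V ^ 2 * (w : ℝ) ^ 4) ^ 19 := by ring
        rw [e3]
        have : V ^ 2 ≤ V ^ 2 * (V ^ 2 * (w : ℝ) ^ 4) ^ 19 := le_mul_of_one_le_right (sq_nonneg _) e2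
        have : 0 ≤ 1 / (w : ℝ) ^ 4 := by positivity
        linarith
    have h3 : (TJ n N - V) ^ 2 ≤ (8 * 2 ^ 192 / (w : ℝ) ^ 4) ^ 2 := by
      rw [← sq_abs]; gcongr
    nlinarith [sq_nonneg (TJ n N - 2 * V), sq_nonneg (TJ n N - V - V)]
  refine (sum_le_sum hpt).trans ?_
  rw [Finset.sum_add_distrib, ← mul_sum, Finset.sum_add_distrib, Finset.sum_const, Finset.sum_const, ← Finset.sum_mul, nsmul_eq_mul, nsmul_eq_mul]
  have hcard : ((Ioc 2 ((2 * w) ^ 96)).card : ℝ) ≤ 2 ^ 96 * (w : ℝ) ^ 96 := by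
    rw [← hX, Nat.card_Ioc]; exact_mod_cast Nat.sub_le _ _
  have e1 : ((Ioc 2 ((2 * w) ^ 96)).card : ℝ) * (1 / (w : ℝ) ^ 4) ≤ 2 ^ 96 * (w : ℝ) ^ 92 := by
    rw [mul_one_div, div_le_iff₀ (by positivity)]
    refine hcard.trans (le_of_eq (by ring))
  have e2 : (∑ i ∈ Ioc 2 ((2 * w) ^ 96), VJ i N (w ^ 200) ^ 40) * (w : ℝ) ^ 76 ≤ C * (w : ℝ) ^ 92 := by
    calc _ ≤ C * w * (w : ℝ) ^ 76 := by gcongr; exact hm w hw N hN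
      _ = C * (w : ℝ) ^ 77 := by ring
      _ ≤ _ := by gcongr <;> norm_num
  have e3 : ((Ioc 2 ((2 * w) ^ 96)).card : ℝ) * (2 * (8 * 2 ^ 192 / (w : ℝ) ^ 4) ^ 2) ≤ 2 * (2 ^ 96 * (8 * 2 ^ 192) ^ 2) * (w : ℝ) ^ 92 := by
    calc _ ≤ 2 ^ 96 * (w : ℝ) ^ 96 * (2 * (8 * 2 ^ 192 / (w : ℝ) ^ 4) ^ 2) := by gcongr
      _ = 2 * (2 ^ 96 * (8 * 2 ^ 192) ^ 2) * (w : ℝ) ^ 88 := by rw [div_pow, ← pow_mul]; field_simp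
      _ ≤ _ := by gcongr <;> norm_num
  rw [add_mul]
  refine add_le_add ?_ e3
  rw [mul_assoc, add_mul]
  linarith

theorem A_sub_A1_meansq : ∃ C : ℝ, 0 ≤ C ∧ ∀ w : ℕ, 1 ≤ w →
    ∑ n ∈ Ioc 2 ((2 * w) ^ 96), (ampA n - A1 n (w ^ 29)) ^ 2 ≤ C * (w : ℝ) ^ (96 - 1 / 4 : ℝ) := by
  obtain ⟨C1, hC1, hT⟩ := T_meansq
  obtain ⟨C2, hC2, hb⟩ := bA_pow_bound
  obtain ⟨C3, hC3, hbs⟩ := bA_sum (ε := 1 / 1536) (by norm_num)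
  set C4 : ℝ := C3 * (18 + 4 / (1 / 1536)) with hC4
  have hC40 : 0 ≤ C4 := by positivity
  refine ⟨2 * (C2 ^ 2 * C1) + 2 * (C4 ^ 2 * 2 * 2 ^ 96), by positivity, fun w hw => ?_⟩
  have hw1 : (1 : ℝ) ≤ w := by exact_mod_cast hw
  have hw0 : (0 : ℝ) < w := by linarith
  have hX : (((2 * w) ^ 96 : ℕ) : ℝ) = 2 ^ 96 * (w : ℝ) ^ 96 := by push_cast; rw [mul_pow]
  have hpt : ∀ n ∈ Ioc 2 ((2 * w) ^ 96), (ampA n - A1 n (w ^ 29)) ^ 2 ≤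
      2 * (C2 ^ 2 * w * ∑ s ∈ Ioc 0 w, TJ n (w ^ 29 / s) ^ 2) + 2 * (C4 ^ 2 * 2 * (w : ℝ) ^ (-(1 / 4) : ℝ)) := by
    intro n hn
    rw [mem_Ioc] at hn
    have hn0 : (0 : ℝ) < n := by exact_mod_cast (by omega : 0 < n)
    rw [A_sub_A1 hn.1]
    set f : ℕ → ℝ := fun s => (bA n s : ℝ) / s * TJ n (w ^ 29 / s) with hf
    have hTb : ∀ N, |TJ n N| ≤ (18 + 4 / (1 / 1536)) * (n : ℝ) ^ (1 / 1536 : ℝ) := fun N => (TJ_le hn.1).trans (log_le_pow (by norm_num) hn.1)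
    set B := (18 + 4 / (1 / 1536)) * (n : ℝ) ^ (1 / 1536 : ℝ) with hB
    have hB0 : 0 ≤ B := by positivity
    have hfs : Summable f := by
      apply Summable.of_abs
      refine Summable.of_nonneg_of_le (fun _ => abs_nonneg _) (fun s => ?_) ((bA_summable hn.1).mul_right B)
      rw [hf, abs_mul]; gcongr; exact hTb _
    have hsplit : ∑' s, f s = ∑ s ∈ Ioc 0 w, f s + ∑' s, (if s ∈ Ioc 0 w then 0 else f s) := by
      have e1 : ∀ s, f s = (if s ∈ Ioc 0 w then f s else 0) + (if s ∈ Ioc 0 w then 0 else f s) := by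
        intro s; split_ifs <;> simp
      have s1 : Summable (fun s => if s ∈ Ioc 0 w then f s else 0) := summable_of_ne_finset_zero (s := Ioc 0 w) (fun s hs => if_neg hs)
      have s2 : Summable (fun s => if s ∈ Ioc 0 w then 0 else f s) := by
        have := hfs.sub s1
        refine this.congr fun s => ?_
        split_ifs <;> simp
      rw [tsum_congr e1, s1.tsum_add s2]
      congr 1
      rw [tsum_eq_sum (s := Ioc 0 w) (fun s hs => if_neg hs)]
      exact sum_congr rfl fun s hs => if_pos hs
    have hsmall : (∑ s ∈ Ioc 0 w, f s) ^ 2 ≤ C2 ^ 2 * w * ∑ s ∈ Ioc 0 w, TJ n (w ^ 29 / s) ^ 2 := by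
      refine (Finset.sum_mul_sq_le_sq_mul_sq _ _ _).trans ?_
      apply mul_le_mul_of_nonneg_right _ (Finset.sum_nonneg fun _ _ => sq_nonneg _)
      refine (Finset.sum_le_card_nsmul _ _ (C2 ^ 2) fun s hs => ?_).trans (by simp [mul_comm])
      rw [mem_Ioc] at hs
      have hs1 : (1 : ℝ) ≤ s := by exact_mod_cast hs.1
      rw [← sq_abs]
      gcongr
      rw [abs_div, Nat.abs_cast, div_le_iff₀ (by positivity)]
      refine (hb n s).trans ?_
      gcongr
      calc (s : ℝ) ^ (5 / 8 : ℝ) ≤ (s : ℝ) ^ (1 : ℝ) := Real.rpow_le_rpow_of_exponent_le hs1 (by norm_num)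
        _ = s := Real.rpow_one _
    have hlarge : |∑' s, (if s ∈ Ioc 0 w then 0 else f s)| ≤ C4 * (w : ℝ) ^ (-(1 / 4) : ℝ) * (n : ℝ) ^ (1 / 768 : ℝ) := by
      have hterm : ∀ s : ℕ, ‖(if s ∈ Ioc 0 w then 0 else f s)‖ ≤ |(bA n s : ℝ)| * (s : ℝ) ^ (-(3 / 4) : ℝ) * ((w : ℝ) ^ (-(1 / 4) : ℝ) * B) := by
        intro s
        split_ifs with h
        · simp; positivity
        · rcases Nat.eq_zero_or_pos s with rfl | h0
          · simp [hf]
          have hs : w ≤ s := by rw [mem_Ioc] at h; omega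
          have hs0 : (0 : ℝ) < s := by exact_mod_cast h0
          rw [Real.norm_eq_abs, hf, abs_mul, abs_div, Nat.abs_cast, ← mul_assoc]
          refine mul_le_mul ?_ (hTb _) (abs_nonneg _) (by positivity)
          rw [div_eq_mul_inv, mul_assoc]
          gcongr
          calc (s : ℝ)⁻¹ = (s : ℝ) ^ (-(3 / 4) : ℝ) * (s : ℝ) ^ (-(1 / 4) : ℝ) := by
                rw [← Real.rpow_add hs0, ← Real.rpow_neg_one]; norm_num
            _ ≤ _ := by
                gcongr ?_ * ?_
                exact Real.rpow_le_rpow_of_nonpos hw0 (by exact_mod_cast hs) (by norm_num)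
      have hsum := (hbs n hn.1).1.mul_right ((w : ℝ) ^ (-(1 / 4) : ℝ) * B)
      have := tsum_of_norm_bounded hsum.hasSum hterm
      rw [Real.norm_eq_abs, tsum_mul_right] at this
      refine this.trans ?_
      calc _ ≤ C3 * (n : ℝ) ^ (1 / 1536 : ℝ) * ((w : ℝ) ^ (-(1 / 4) : ℝ) * B) := by
            gcongr; exact (hbs n hn.1).2
        _ = C4 * (w : ℝ) ^ (-(1 / 4) : ℝ) * ((n : ℝ) ^ (1 / 1536 : ℝ) * (n : ℝ) ^ (1 / 1536 : ℝ)) := by rw [hB, hC4]; ring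
        _ = _ := by rw [← Real.rpow_add hn0]; norm_num
    have hlarge2 : (∑' s, (if s ∈ Ioc 0 w then 0 else f s)) ^ 2 ≤ C4 ^ 2 * 2 * (w : ℝ) ^ (-(1 / 4) : ℝ) := by
      rw [← sq_abs]
      calc _ ≤ (C4 * (w : ℝ) ^ (-(1 / 4) : ℝ) * (n : ℝ) ^ (1 / 768 : ℝ)) ^ 2 := by gcongr
        _ ≤ (C4 * (w : ℝ) ^ (-(1 / 4) : ℝ) * ((2 * w : ℝ) ^ 96) ^ (1 / 768 : ℝ)) ^ 2 := by
            gcongr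
            exact_mod_cast hn.2
        _ = C4 ^ 2 * (2 : ℝ) ^ (1 / 4 : ℝ) * (w : ℝ) ^ (-(1 / 4) : ℝ) := by
            rw [mul_pow, mul_pow, ← Real.rpow_natCast (2 * (w : ℝ)), ← Real.rpow_mul (by positivity), ← Real.rpow_natCast ((2 * (w : ℝ)) ^ _), ← Real.rpow_mul (by positivity), Real.mul_rpow (by norm_num) hw0.le, ← Real.rpow_natCast ((w : ℝ) ^ _), ← Real.rpow_mul (by positivity)]
            norm_num
            rw [show (-(1 / 4) : ℝ) = -(1 / 2) + 1 / 4 by norm_num, Real.rpow_add hw0]; ring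
        _ ≤ C4 ^ 2 * 2 * (w : ℝ) ^ (-(1 / 4) : ℝ) := by
            gcongr
            calc (2 : ℝ) ^ (1 / 4 : ℝ) ≤ 2 ^ (1 : ℝ) := Real.rpow_le_rpow_of_exponent_le (by norm_num) (by norm_num)
              _ = 2 := Real.rpow_one _
    rw [hsplit]
    nlinarith [sq_nonneg (∑ s ∈ Ioc 0 w, f s - ∑' s, (if s ∈ Ioc 0 w then 0 else f s))]
  refine (sum_le_sum hpt).trans ?_
  rw [Finset.sum_add_distrib, ← mul_sum, ← mul_sum, Finset.sum_comm, Finset.sum_const, nsmul_eq_mul]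
  have hcard : ((Ioc 2 ((2 * w) ^ 96)).card : ℝ) ≤ 2 ^ 96 * (w : ℝ) ^ 96 := by
    rw [← hX, Nat.card_Ioc]; exact_mod_cast Nat.sub_le _ _
  have e0 : (w : ℝ) ^ (96 - 1 / 4 : ℝ) = (w : ℝ) ^ 96 * (w : ℝ) ^ (-(1 / 4) : ℝ) := by
    rw [← Real.rpow_natCast, ← Real.rpow_add hw0]; norm_num
  have e1 : ∑ s ∈ Ioc 0 w, ∑ n ∈ Ioc 2 ((2 * w) ^ 96), TJ n (w ^ 29 / s) ^ 2 ≤ w * (C1 * (w : ℝ) ^ 92) := by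
    refine (Finset.sum_le_card_nsmul _ _ (C1 * (w : ℝ) ^ 92) fun s hs => ?_).trans (by simp)
    rw [mem_Ioc] at hs
    apply hT w hw
    · rw [Nat.le_div_iff_mul_le hs.1]
      calc w ^ 28 * s ≤ w ^ 28 * w := Nat.mul_le_mul_left _ hs.2
        _ = w ^ 29 := by ring
    · exact (Nat.div_le_self _ _).trans (Nat.pow_le_pow_right hw (by norm_num))
  have e2 : (w : ℝ) ^ 94 ≤ (w : ℝ) ^ (96 - 1 / 4 : ℝ) := by
    rw [← Real.rpow_natCast]; exact Real.rpow_le_rpow_of_exponent_le hw1 (by norm_num)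
  rw [add_mul]
  apply add_le_add
  · calc _ ≤ 2 * (C2 ^ 2 * w * (w * (C1 * (w : ℝ) ^ 92))) := by gcongr
      _ = 2 * (C2 ^ 2 * C1) * (w : ℝ) ^ 94 := by ring
      _ ≤ _ := by gcongr
  · calc _ ≤ 2 ^ 96 * (w : ℝ) ^ 96 * (2 * (C4 ^ 2 * 2 * (w : ℝ) ^ (-(1 / 4) : ℝ))) := by gcongr
      _ = _ := by rw [e0]; ring

/-- mean over a period -/
noncomputable def mn (Q : ℕ) (f : ℕ → ℝ) : ℝ := (∑ n ∈ range Q, f n) / Q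

lemma mn_mul {Q : ℕ} {f : ℕ → ℝ} (hf : ∀ n, f (n + Q) = f n) {k : ℕ} (hk : 0 < k) : mn (Q * k) f = mn Q f := by
  unfold mn
  rw [sum_range_periodic f Q hf k, nsmul_eq_mul]
  push_cast
  have : (k : ℝ) ≠ 0 := by exact_mod_cast hk.ne'
  rw [mul_comm (Q : ℝ), mul_div_mul_left _ _ this]

lemma per_mod {f : ℕ → ℝ} {Q : ℕ} (hf : ∀ n, f (n + Q) = f n) (n : ℕ) : f (n % Q) = f n := by
  have : ∀ k m, f (m + Q * k) = f m := by
    intro k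
    induction k with
    | zero => simp
    | succ k ih => intro m; rw [Nat.mul_succ, ← add_assoc, hf, ih]
  conv_rhs => rw [← Nat.mod_add_div n Q, this]

lemma mn_dvd {Q R : ℕ} {f : ℕ → ℝ} (hf : ∀ n, f (n + Q) = f n) (h : Q ∣ R) (hR : 0 < R) : mn R f = mn Q f := by
  obtain ⟨k, rfl⟩ := h
  exact mn_mul hf (Nat.pos_of_mul_pos_left hR)

lemma mn_crt {Q R : ℕ} (hQ : 0 < Q) (hR : 0 < R) (hc : Nat.Coprime Q R) {f h : ℕ → ℝ} (hf : ∀ n, f (n + Q) = f n) (hh : ∀ n, h (n + R) = h n) :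
    mn (Q * R) (fun n => f n * h n) = mn Q f * mn R h := by
  unfold mn
  rw [div_mul_div_comm, Finset.sum_mul_sum, ← Finset.sum_product']
  push_cast
  congr 1
  refine Finset.sum_nbij' (fun n => (n % Q, n % R)) (fun x => (Nat.chineseRemainder hc x.1 x.2 : ℕ)) ?_ ?_ ?_ ?_ ?_
  · intro n _
    simp only [Finset.mem_product, mem_range]
    exact ⟨Nat.mod_lt _ hQ, Nat.mod_lt _ hR⟩
  · intro x _
    rw [mem_range]
    exact Nat.chineseRemainder_lt_mul hc _ _ hQ.ne' hR.ne'
  · intro n hn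
    rw [mem_range] at hn
    have h1 := (Nat.chineseRemainder hc (n % Q) (n % R)).2
    have h2 := Nat.chineseRemainder_lt_mul hc (n % Q) (n % R) hQ.ne' hR.ne'
    have h3 : (Nat.chineseRemainder hc (n % Q) (n % R) : ℕ) ≡ n [MOD Q * R] :=
      (Nat.modEq_and_modEq_iff_modEq_mul hc).mp ⟨h1.1.trans (Nat.mod_modEq _ _), h1.2.trans (Nat.mod_modEq _ _)⟩
    exact Nat.ModEq.eq_of_lt_of_lt h3 h2 hn
  · intro x hx
    simp only [Finset.mem_product, mem_range] at hx
    have h1 := (Nat.chineseRemainder hc x.1 x.2).2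
    ext
    · exact (show _ % Q = x.1 % Q from h1.1).trans (Nat.mod_eq_of_lt hx.1)
    · exact (show _ % R = x.2 % R from h1.2).trans (Nat.mod_eq_of_lt hx.2)
  · intro n _
    simp only
    rw [per_mod hf, per_mod hh]

lemma rho_per {n m d : ℕ} (h : m ∣ d) : rho (n + d) m = rho n m := by
  unfold rho
  congr 1
  apply Finset.filter_congr
  intro x _
  have : x ^ 2 + (n + d) * x + 1 = (x ^ 2 + n * x + 1) + d * x := by ring
  rw [this, Nat.dvd_add_left (h.mul_right x)]

lemma aA_per {n q d : ℕ} (h : q ∣ d) : aA (n + d) q = aA n q := by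
  rw [aA, aA, mul_apply, mul_apply]
  refine sum_congr rfl fun x hx => ?_
  rw [Nat.mem_divisorsAntidiagonal] at hx
  rw [rhoA_apply, rhoA_apply, rho_per]
  exact (Dvd.intro_left _ hx.1).trans h

lemma exact_val {p w : ℕ} (hp : p.Prime) {m : ℕ} (h : ¬ p ^ (m + 1) ∣ w) : ∃ v ≤ m, p ^ v ∣ w ∧ ¬ p ^ (v + 1) ∣ w := by
  induction m with
  | zero => exact ⟨0, le_rfl, by simp, h⟩
  | succ m ih =>
    by_cases h2 : p ^ (m + 1) ∣ w
    · exact ⟨m + 1, le_rfl, h2, h⟩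
    · obtain ⟨v, h3, h4⟩ := ih h2
      exact ⟨v, by omega, h4⟩

lemma cnt_congr {p : ℕ} (hp : p.Prime) {i w w' : ℕ} (h : ∀ s ≤ i, (p ^ s ∣ w ↔ p ^ s ∣ w')) : cnt p i w = cnt p i w' := by
  by_cases hb : p ^ ((i + 1) / 2) ∣ w
  · rw [cnt_big hp hb, cnt_big hp ((h _ (by omega)).mp hb)]
  · have hi : (i + 1) / 2 ≠ 0 := by intro h0; rw [h0] at hb; simp at hb
    obtain ⟨m, hm⟩ := Nat.exists_eq_succ_of_ne_zero hi
    rw [hm] at hb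
    obtain ⟨v, h1, h2, h3⟩ := exact_val hp hb
    rw [cnt_small hp h2 h3 (by omega), cnt_small hp ((h v (by omega)).mp h2) (by rw [← h (v + 1) (by omega)]; exact h3) (by omega)]

lemma corr_sum {p : ℕ} (hp : p.Prime) {i j : ℕ} (hij : i ≤ j) (hj : 1 ≤ j) :
    ∑ n ∈ range (p ^ j), ((rho n (p ^ i) * rho n (p ^ j) : ℕ) : ℤ)
      = ∑ z ∈ range (p ^ j), if p ∣ z + 1 then 0 else (cnt p i (z * (z + 2)) : ℤ) := by
  set Q := p ^ j with hQ
  have hQ0 : 0 < Q := pow_pos hp.pos _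
  have hpQ : p ∣ Q := dvd_pow_self p (by omega)
  have hiQ : p ^ i ∣ Q := pow_dvd_pow p hij
  set F : ℕ → ℤ := fun y => ∑ n ∈ range Q, if Q ∣ y ^ 2 + n * y + 1 then (rho n (p ^ i) : ℤ) else 0 with hF
  have h1 : ∑ n ∈ range Q, ((rho n (p ^ i) * rho n Q : ℕ) : ℤ) = ∑ y ∈ range Q, F y := by
    simp only [hF]
    rw [Finset.sum_comm]
    refine sum_congr rfl fun n _ => ?_
    rw [← Finset.sum_filter, Finset.sum_const, nsmul_eq_mul]
    push_cast; rw [mul_comm]; rfl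
  have hper : ∀ y, F (y + Q) = F y := by
    intro y
    refine sum_congr rfl fun n _ => ?_
    have : (y + Q) ^ 2 + n * (y + Q) + 1 = (y ^ 2 + n * y + 1) + Q * (2 * y + Q + n) := by ring
    rw [this]
    simp only [Nat.dvd_add_left (Dvd.intro _ rfl : Q ∣ Q * (2 * y + Q + n))]
  rw [h1, ← sum_range_shift F Q hper 1]
  refine sum_congr rfl fun z _ => ?_
  split_ifs with hz
  · apply Finset.sum_eq_zero
    intro n _
    rw [if_neg]
    intro hd
    have h2 : p ∣ (z + 1) ^ 2 + n * (z + 1) + 1 := hpQ.trans hd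
    have h3 : p ∣ (z + 1) ^ 2 + n * (z + 1) := by
      have : (z + 1) ^ 2 + n * (z + 1) = (z + 1) * (z + 1 + n) := by ring
      rw [this]; exact hz.mul_right _
    exact hp.one_lt.ne' (Nat.dvd_one.mp ((Nat.dvd_add_right h3).mp h2))
  · have hcop : Nat.Coprime (z + 1) Q := ((Nat.Prime.coprime_iff_not_dvd hp).mpr hz).symm.pow_right j
    have h2 : ∀ n ∈ range Q, (if Q ∣ (z + 1) ^ 2 + n * (z + 1) + 1 then (rho n (p ^ i) : ℤ) else 0)
        = (if Q ∣ (z + 1) ^ 2 + n * (z + 1) + 1 then (1 : ℤ) else 0) * (cnt p i (z * (z + 2)) : ℤ) := by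
      intro n _
      split_ifs with hd
      · rw [one_mul]
        congr 1
        have hd' : p ^ i ∣ (z + 1) ^ 2 + n * (z + 1) + 1 := hiQ.trans hd
        rw [rho_of_root hd']
        change cnt p i _ = _
        apply cnt_congr hp
        intro s hs
        have hd'' : p ^ s ∣ (z + 1) ^ 2 + n * (z + 1) + 1 := (pow_dvd_pow p hs).trans hd'
        have hc : Nat.Coprime (p ^ s) (z + 1) := ((Nat.Prime.coprime_iff_not_dvd hp).mpr hz).pow_left s
        have e : (z + 1) * (2 * (z + 1) + n) = z * (z + 2) + ((z + 1) ^ 2 + n * (z + 1) + 1) := by ring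
        rw [← hc.dvd_mul_left, e, Nat.dvd_add_left hd'']
      · simp
    simp only [hF]
    rw [sum_congr rfl h2, ← Finset.sum_mul, ← card_filter_eq_sum]
    have hQ1 : 1 < Q := lt_of_lt_of_le hp.one_lt (Nat.le_of_dvd hQ0 hpQ)
    obtain ⟨u, _, hu⟩ := Nat.exists_mul_mod_eq_one_of_coprime hcop hQ1
    have hcu : Nat.Coprime Q u := by
      have h5 : Nat.gcd Q u ∣ 1 := by
        have h6 : Nat.gcd Q u ∣ (z + 1) * u % Q := 
          (Nat.dvd_mod_iff (Nat.gcd_dvd_left Q u)).mpr ((Nat.gcd_dvd_right Q u).mul_left _)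
        rwa [hu] at h6
      exact Nat.dvd_one.mp h5
    have h3 : ((range Q).filter (fun n => Q ∣ (z + 1) ^ 2 + n * (z + 1) + 1)).card = 1 := by
      have h4 := card_mult_shift Q 1 (u * ((z + 1) ^ 2 + 1)) hQ0
      rw [mul_one] at h4
      refine Eq.trans ?_ h4
      congr 1
      apply Finset.filter_congr
      intro n _
      obtain ⟨k, hk⟩ : Q ∣ (z + 1) * u - 1 := by
        rw [← Nat.modEq_iff_dvd' (by
          by_contra h0
          have : (z + 1) * u = 0 := by omega
          rw [this] at hu; simp at hu)]
        change 1 % Q = _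
        rw [hu, Nat.mod_eq_of_lt hQ1]
      have hk' : (z + 1) * u = 1 + Q * k := by
        have : (z + 1) * u ≠ 0 := by
          intro h0
          rw [h0] at hu; simp at hu
        omega
      rw [← hcu.dvd_mul_left]
      have e2 : u * ((z + 1) ^ 2 + n * (z + 1) + 1) = n + u * ((z + 1) ^ 2 + 1) + Q * (k * n) := by
        have : u * ((z + 1) ^ 2 + n * (z + 1) + 1) = n * ((z + 1) * u) + u * ((z + 1) ^ 2 + 1) := by ring
        rw [this, hk']; ring
      rw [e2, Nat.dvd_add_left (Dvd.intro _ rfl)]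
    rw [h3]; simp

lemma tel_layer {p w : ℕ} {v c : ℕ} (hv : v ≤ c) (h1 : p ^ v ∣ w) (h2 : ∀ s, v ≤ s → s < c → ¬ p ^ (s + 1) ∣ w) :
    ∑ s ∈ range c, (if p ^ (s + 1) ∣ w then 2 * (p : ℤ) ^ (s + 1) - 2 * (p : ℤ) ^ s else 0) = 2 * (p : ℤ) ^ v - 2 := by
  rw [← Finset.sum_subset (s₁ := range v) (Finset.range_mono hv)]
  · rw [sum_congr rfl (g := fun s => 2 * (p : ℤ) ^ (s + 1) - 2 * (p : ℤ) ^ s), Finset.sum_range_sub (fun s => 2 * (p : ℤ) ^ s)]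
    · simp
    · intro s hs
      rw [mem_range] at hs
      rw [if_pos ((pow_dvd_pow p (by omega)).trans h1)]
  · intro s hs hs'
    rw [mem_range] at hs hs'
    rw [if_neg (h2 s (by omega) hs)]

lemma cnt_layer {p : ℕ} (hp : p.Prime) {i c : ℕ} (hi : i = 2 * c + 1 ∨ i = 2 * c + 2) (w : ℕ) :
    (cnt p i w : ℤ) = 2 + ∑ s ∈ range c, (if p ^ (s + 1) ∣ w then 2 * (p : ℤ) ^ (s + 1) - 2 * (p : ℤ) ^ s else 0)
      + (if p ^ (c + 1) ∣ w then (p : ℤ) ^ (i / 2) - 2 * (p : ℤ) ^ c else 0) := by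
  have hc : (i + 1) / 2 = c + 1 := by omega
  by_cases hb : p ^ (c + 1) ∣ w
  · rw [if_pos hb, cnt_big hp (by rw [hc]; exact hb), tel_layer le_rfl ((pow_dvd_pow p (by omega)).trans hb) (by intros; omega)]
    push_cast; ring
  · rw [if_neg hb]
    obtain ⟨v, h1, h2, h3⟩ := exact_val hp hb
    rw [tel_layer h1 h2, cnt_small hp h2 h3 (by omega)]
    · push_cast; ring
    · intro s hs _ h
      exact h3 ((pow_dvd_pow p (by omega)).trans h)

lemma mn_add (Q : ℕ) (f h : ℕ → ℝ) : mn Q (fun n => f n + h n) = mn Q f + mn Q h := by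
  unfold mn; rw [Finset.sum_add_distrib, add_div]
lemma mn_cmul (Q : ℕ) (c : ℝ) (f : ℕ → ℝ) : mn Q (fun n => c * f n) = c * mn Q f := by
  unfold mn; rw [← mul_sum, mul_div_assoc]
lemma mn_sum {ι : Type*} (Q : ℕ) (s : Finset ι) (f : ι → ℕ → ℝ) : mn Q (fun n => ∑ i ∈ s, f i n) = ∑ i ∈ s, mn Q (f i) := by
  unfold mn; rw [Finset.sum_comm, Finset.sum_div]

lemma mn_unit {p : ℕ} (hp : p.Prime) {j : ℕ} (hj : 1 ≤ j) :
    mn (p ^ j) (fun z => if p ∣ z + 1 then 0 else 1) = 1 - 1 / p := by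
  have hp0 : (p : ℝ) ≠ 0 := by exact_mod_cast hp.ne_zero
  have h1 := card_mult_shift p 1 1 hp.pos
  have h2 := card_filter_eq_sum (p * 1) (fun x => p ∣ x + 1)
  rw [h1, mul_one] at h2
  rw [mn_dvd (Q := p) _ (dvd_pow_self p (by omega)) (pow_pos hp.pos _)]
  · unfold mn
    have h3 : ∑ z ∈ range p, (if p ∣ z + 1 then (0 : ℝ) else 1) = p - 1 := by
      have : ∀ z ∈ range p, (if p ∣ z + 1 then (0 : ℝ) else 1) = 1 - ((if p ∣ z + 1 then (1 : ℤ) else 0 : ℤ) : ℝ) := by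
        intro z _; split_ifs <;> simp
      rw [sum_congr rfl this, Finset.sum_sub_distrib, ← Int.cast_sum, ← h2]
      simp
    rw [h3]; field_simp
  · intro n
    have : n + p + 1 = (n + 1) + p := by ring
    simp only [this, Nat.dvd_add_self_right]

lemma mn_lay {p : ℕ} (hp : p.Prime) {s j : ℕ} (hs : 1 ≤ s) (hj : s ≤ j) :
    mn (p ^ j) (fun z => if p ∣ z + 1 then 0 else if p ^ s ∣ z * (z + 2) then 1 else 0) = cnt p s 2 / (p : ℝ) ^ s := by
  have h0 : (fun z : ℕ => if p ∣ z + 1 then (0 : ℝ) else if p ^ s ∣ z * (z + 2) then 1 else 0) = fun z => if p ^ s ∣ z * (z + 2) then 1 else 0 := by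
    funext z
    by_cases h : p ∣ z + 1
    · rw [if_pos h, if_neg]
      intro h2
      have h3 : p ∣ z * (z + 2) := (dvd_pow_self p (by omega)).trans h2
      have h4 : p ∣ z * (z + 2) + 1 := by
        have : z * (z + 2) + 1 = (z + 1) * (z + 1) := by ring
        rw [this]; exact h.mul_right _
      exact hp.one_lt.ne' (Nat.dvd_one.mp ((Nat.dvd_add_right h3).mp h4))
    · rw [if_neg h]
  rw [h0, mn_dvd (Q := p ^ s) _ (pow_dvd_pow p hj) (pow_pos hp.pos _)]
  · unfold mn cnt
    rw [Finset.card_filter]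
    push_cast
    rfl
  · intro n
    have : (n + p ^ s) * (n + p ^ s + 2) = n * (n + 2) + p ^ s * (2 * n + 2 + p ^ s) := by ring
    rw [this]
    simp only [Nat.dvd_add_left (Dvd.intro _ rfl : p ^ s ∣ p ^ s * (2 * n + 2 + p ^ s))]

/-- mean value of the local correlation -/
noncomputable def ee (p i : ℕ) : ℝ :=
  2 * (1 - 1 / p) + ∑ s ∈ range ((i - 1) / 2), 2 * (1 - 1 / (p : ℝ)) * cnt p (s + 1) 2
    + ((p : ℝ) ^ (i / 2) - 2 * (p : ℝ) ^ ((i - 1) / 2)) * (cnt p ((i - 1) / 2 + 1) 2 / (p : ℝ) ^ ((i - 1) / 2 + 1))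

lemma mn_cnt {p : ℕ} (hp : p.Prime) {i j : ℕ} (hi : 1 ≤ i) (hj : i ≤ j) :
    mn (p ^ j) (fun z => if p ∣ z + 1 then 0 else (cnt p i (z * (z + 2)) : ℝ)) = ee p i := by
  have hp0 : (p : ℝ) ≠ 0 := by exact_mod_cast hp.ne_zero
  set c := (i - 1) / 2 with hc
  have hi' : i = 2 * c + 1 ∨ i = 2 * c + 2 := by omega
  have h : (fun z : ℕ => if p ∣ z + 1 then 0 else (cnt p i (z * (z + 2)) : ℝ)) = fun z =>
      (2 * (if p ∣ z + 1 then 0 else 1) + ∑ s ∈ range c, (2 * (p : ℝ) ^ (s + 1) - 2 * (p : ℝ) ^ s) * (if p ∣ z + 1 then 0 else if p ^ (s + 1) ∣ z * (z + 2) then 1 else 0))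
      + ((p : ℝ) ^ (i / 2) - 2 * (p : ℝ) ^ c) * (if p ∣ z + 1 then 0 else if p ^ (c + 1) ∣ z * (z + 2) then 1 else 0) := by
    funext z
    have h1 := congrArg (fun t : ℤ => (t : ℝ)) (cnt_layer hp hi' (z * (z + 2)))
    by_cases hz : p ∣ z + 1
    · simp [hz]
    · simp only [hz, if_false]
      simp only [Int.cast_natCast] at h1
      rw [h1]
      push_cast
      simp only [mul_ite, mul_one, mul_zero]
  rw [h, mn_add, mn_add, mn_cmul, mn_unit hp (by omega), mn_sum, mn_cmul, mn_lay hp (by omega) (by omega), ee, ← hc]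
  congr 2
  refine sum_congr rfl fun s hs => ?_
  rw [mem_range] at hs
  rw [mn_cmul, mn_lay hp (by omega) (by omega)]
  field_simp
  ring

noncomputable def ep (p i j : ℕ) : ℝ := mn (p ^ (i + j)) (fun n => (rho n (p ^ i) : ℝ) * rho n (p ^ j))

lemma ep_comm (p i j : ℕ) : ep p i j = ep p j i := by
  unfold ep; rw [add_comm]; congr 1; funext n; ring

lemma ep_eq {p : ℕ} (hp : p.Prime) {i j : ℕ} (hij : i ≤ j) (hj : 1 ≤ j) :
    ep p i j = mn (p ^ j) (fun z => if p ∣ z + 1 then 0 else (cnt p i (z * (z + 2)) : ℝ)) := by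
  have h1 := congrArg (fun t : ℤ => (t : ℝ)) (corr_sum hp hij hj)
  rw [ep, mn_dvd (Q := p ^ j) _ (pow_dvd_pow p (by omega)) (pow_pos hp.pos _)]
  · unfold mn
    congr 1
    push_cast at h1
    rw [h1]
  · intro n
    rw [rho_per (pow_dvd_pow p hij), rho_per dvd_rfl]

lemma ep_pos {p : ℕ} (hp : p.Prime) (i j : ℕ) : ep p (i + 1) (j + 1) = ee p (min i j + 1) := by
  rcases le_total i j with h | h
  · rw [ep_eq hp (by omega) (by omega), mn_cnt hp (by omega) (by omega), min_eq_left h]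
  · rw [ep_comm, ep_eq hp (by omega) (by omega), mn_cnt hp (by omega) (by omega), min_eq_right h]

lemma ep_zero {p : ℕ} (hp : p.Prime) (j : ℕ) : ep p 0 (j + 1) = 1 - 1 / p := by
  rw [ep_eq hp (by omega) (by omega), ← mn_unit hp (j := j + 1) (by omega)]
  have : ∀ w, cnt p 0 w = 1 := fun w => by rw [cnt_big hp (by simp)]; simp
  simp only [this, Nat.cast_one]

lemma ep_zz (p : ℕ) : ep p 0 0 = 1 := by
  simp [ep, mn, rho]

lemma ee_one (p c : ℕ) (hp : (p : ℝ) ≠ 0) : ee p (2 * c + 1) = 2 * (1 - 1 / p) + ∑ s ∈ range c, 2 * (1 - 1 / (p : ℝ)) * cnt p (s + 1) 2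
    - 1 / p * cnt p (c + 1) 2 := by
  rw [ee, show (2 * c + 1) / 2 = c by omega, show (2 * c + 1 - 1) / 2 = c by omega]
  field_simp
  ring

lemma ee_two (p c : ℕ) (hp : (p : ℝ) ≠ 0) : ee p (2 * c + 2) = 2 * (1 - 1 / p) + ∑ s ∈ range c, 2 * (1 - 1 / (p : ℝ)) * cnt p (s + 1) 2
    + (1 - 2 / p) * cnt p (c + 1) 2 := by
  rw [ee, show (2 * c + 2) / 2 = c + 1 by omega, show (2 * c + 2 - 1) / 2 = c by omega]
  field_simp
  ring

lemma cnt_odd {p : ℕ} (hp : p.Prime) (h2 : p ≠ 2) (s : ℕ) : cnt p (s + 1) 2 = 2 := by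
  rw [cnt_small hp (s := 0) (by simp) _ (by omega)]
  · simp
  · rw [zero_add, pow_one]
    intro h
    exact h2 ((Nat.prime_dvd_prime_iff_eq hp Nat.prime_two).mp h)

lemma cnt_two (s : ℕ) : cnt 2 (s + 3) 2 = 4 := by
  rw [cnt_small Nat.prime_two (s := 1) (by simp) (by norm_num) (by omega)]; norm_num

lemma cnt_two1 : cnt 2 1 2 = 1 := by rw [cnt_big Nat.prime_two (by norm_num)]; norm_num
lemma cnt_two2 : cnt 2 2 2 = 2 := by rw [cnt_big Nat.prime_two (by norm_num)]; norm_num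

lemma cnt_le4 {p : ℕ} (hp : p.Prime) (s : ℕ) : cnt p (s + 1) 2 ≤ 4 := by
  by_cases h2 : p = 2
  · subst h2
    rcases s with _ | _ | s
    · rw [cnt_two1]; norm_num
    · rw [cnt_two2]; norm_num
    · rw [cnt_two]
  · rw [cnt_odd hp h2]; norm_num

lemma ee_abs {p : ℕ} (hp : p.Prime) (m : ℕ) : |ee p (m + 1)| ≤ 8 * (m + 1) := by
  have hp0 : (p : ℝ) ≠ 0 := by exact_mod_cast hp.ne_zero
  have hp2 : (2 : ℝ) ≤ p := by exact_mod_cast hp.two_le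
  have hy : 0 < 1 / (p : ℝ) := by positivity
  have hy2 : 1 / (p : ℝ) ≤ 1 / 2 := by gcongr
  set y := 1 / (p : ℝ) with hyd
  have hc4 : ∀ s, (cnt p (s + 1) 2 : ℝ) ≤ 4 := fun s => by exact_mod_cast cnt_le4 hp s
  have hs0 : ∀ c, 0 ≤ ∑ s ∈ range c, 2 * (1 - y) * (cnt p (s + 1) 2 : ℝ) := fun c =>
    Finset.sum_nonneg fun s _ => mul_nonneg (by linarith) (Nat.cast_nonneg _)
  have hs : ∀ c, ∑ s ∈ range c, 2 * (1 - y) * (cnt p (s + 1) 2 : ℝ) ≤ 8 * c := by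
    intro c
    have := Finset.sum_le_card_nsmul (range c) (fun s => 2 * (1 - y) * (cnt p (s + 1) 2 : ℝ)) 8 (fun s _ => by
      have h1 := hc4 s
      have h2 : (0 : ℝ) ≤ cnt p (s + 1) 2 := Nat.cast_nonneg _
      nlinarith)
    rw [Finset.card_range, nsmul_eq_mul] at this
    linarith
  obtain ⟨c, hc | hc⟩ : ∃ c, m = 2 * c ∨ m = 2 * c + 1 := ⟨m / 2, by omega⟩
  · subst hc
    have h1 := hs c
    have h1' := hs0 c
    have h2 : (0 : ℝ) ≤ cnt p (c + 1) 2 := Nat.cast_nonneg _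
    have h3 := hc4 c
    rw [ee_one p c hp0, ← hyd, abs_le]
    push_cast
    have hc0 : (0 : ℝ) ≤ c := Nat.cast_nonneg _
    constructor <;> nlinarith
  · subst hc
    have h1 := hs c
    have h1' := hs0 c
    have h2 : (0 : ℝ) ≤ cnt p (c + 1) 2 := Nat.cast_nonneg _
    have h3 := hc4 c
    have e : (2 : ℝ) / p = 2 * y := by rw [hyd]; ring
    rw [show 2 * c + 1 + 1 = 2 * c + 2 by ring, ee_two p c hp0, e, ← hyd, abs_le]
    push_cast
    have hc0 : (0 : ℝ) ≤ c := Nat.cast_nonneg _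
    constructor <;> nlinarith

lemma ee_odd_rec {p : ℕ} (hp : p.Prime) (h2 : p ≠ 2) (m : ℕ) : ee p (m + 2 + 1) = ee p (m + 1) + 4 * (1 - 1 / p) := by
  have hp0 : (p : ℝ) ≠ 0 := by exact_mod_cast hp.ne_zero
  obtain ⟨c, hc | hc⟩ : ∃ c, m = 2 * c ∨ m = 2 * c + 1 := ⟨m / 2, by omega⟩
  · subst hc
    rw [show 2 * c + 2 + 1 = 2 * (c + 1) + 1 by ring, ee_one p _ hp0, ee_one p _ hp0, sum_range_succ, cnt_odd hp h2, cnt_odd hp h2]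
    push_cast; ring
  · subst hc
    rw [show 2 * c + 1 + 2 + 1 = 2 * (c + 1) + 2 by ring, show 2 * c + 1 + 1 = 2 * c + 2 by ring, ee_two p _ hp0, ee_two p _ hp0, sum_range_succ, cnt_odd hp h2, cnt_odd hp h2]
    push_cast; ring

lemma ee_odd_1 {p : ℕ} (hp : p.Prime) (h2 : p ≠ 2) : ee p 1 = 2 - 4 / p := by
  have hp0 : (p : ℝ) ≠ 0 := by exact_mod_cast hp.ne_zero
  have := ee_one p 0 hp0
  rw [cnt_odd hp h2] at this; simp at this; rw [this]; ring

lemma ee_odd_2 {p : ℕ} (hp : p.Prime) (h2 : p ≠ 2) : ee p 2 = 4 - 6 / p := by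
  have hp0 : (p : ℝ) ≠ 0 := by exact_mod_cast hp.ne_zero
  have := ee_two p 0 hp0
  rw [cnt_odd hp h2] at this; simp at this; rw [this]; ring

lemma ee_2_rec (m : ℕ) : ee 2 (m + 4 + 2 + 1) = ee 2 (m + 4 + 1) + 4 := by
  have hp0 : ((2 : ℕ) : ℝ) ≠ 0 := by norm_num
  obtain ⟨c, hc | hc⟩ : ∃ c, m = 2 * c ∨ m = 2 * c + 1 := ⟨m / 2, by omega⟩
  · subst hc
    rw [show 2 * c + 4 + 2 + 1 = 2 * (c + 3) + 1 by ring, show 2 * c + 4 + 1 = 2 * (c + 2) + 1 by ring, ee_one 2 _ hp0, ee_one 2 _ hp0, sum_range_succ _ (c + 2), show c + 3 + 1 = (c + 1) + 3 by ring, show c + 2 + 1 = c + 3 by ring, cnt_two, cnt_two]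
    push_cast; ring
  · subst hc
    rw [show 2 * c + 1 + 4 + 2 + 1 = 2 * (c + 3) + 2 by ring, show 2 * c + 1 + 4 + 1 = 2 * (c + 2) + 2 by ring, ee_two 2 _ hp0, ee_two 2 _ hp0, sum_range_succ _ (c + 2), show c + 3 + 1 = (c + 1) + 3 by ring, show c + 2 + 1 = c + 3 by ring, cnt_two, cnt_two]
    push_cast; ring

lemma ee_2_vals : ee 2 1 = 1 / 2 ∧ ee 2 2 = 1 ∧ ee 2 3 = 1 ∧ ee 2 4 = 2 ∧ ee 2 5 = 2 ∧ ee 2 6 = 4 := by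
  have hp0 : ((2 : ℕ) : ℝ) ≠ 0 := by norm_num
  have h1 := ee_one 2 0 hp0
  have h2 := ee_two 2 0 hp0
  have h3 := ee_one 2 1 hp0
  have h4 := ee_two 2 1 hp0
  have h5 := ee_one 2 2 hp0
  have h6 := ee_two 2 2 hp0
  have c3 := cnt_two 0
  simp only [sum_range_succ, Finset.sum_range_zero, mul_zero, zero_add, mul_one, Nat.reduceAdd, Nat.reduceMul, cnt_two1, cnt_two2] at h1 h2 h3 h4 h5 h6 c3
  rw [c3] at h5 h6
  rw [h1, h2, h3, h4, h5, h6]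
  norm_num

lemma summ_poly {y : ℝ} (h0 : 0 < y) (h1 : y < 1) (d : ℕ) : Summable (fun k : ℕ => ((k : ℝ) + 1) ^ d * y ^ k) := by
  have h := summable_pow_mul_geometric_of_norm_lt_one (R := ℝ) d (r := y) (by rw [Real.norm_eq_abs, abs_of_pos h0]; exact h1)
  have h2 := ((summable_nat_add_iff 1).mpr h).mul_left y⁻¹
  refine h2.congr fun k => ?_
  push_cast
  field_simp
  ring

noncomputable def RR (f : ℕ → ℝ) (k : ℕ) : ℝ := ∑ x ∈ Finset.HasAntidiagonal.antidiagonal k, f (min x.1 x.2)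
noncomputable def TT (y : ℝ) (f : ℕ → ℝ) : ℝ := ∑' k, RR f k * y ^ k

lemma RR_abs {f : ℕ → ℝ} {B : ℝ} (hf : ∀ m : ℕ, |f m| ≤ B * (m + 1)) (k : ℕ) : |RR f k| ≤ B * ((k : ℝ) + 1) ^ 2 := by
  have hB : 0 ≤ B := by have := (abs_nonneg _).trans (hf 0); simpa using this
  unfold RR
  refine (abs_sum_le_sum_abs _ _).trans ?_
  refine (Finset.sum_le_card_nsmul _ _ (B * ((k : ℝ) + 1)) fun x hx => ?_).trans (le_of_eq ?_)
  · rw [Finset.HasAntidiagonal.mem_antidiagonal] at hx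
    refine (hf _).trans ?_
    have : ((min x.1 x.2 : ℕ) : ℝ) ≤ k := by exact_mod_cast (min_le_left _ _).trans (by omega)
    gcongr
  · rw [Finset.Nat.card_antidiagonal, nsmul_eq_mul]; push_cast; ring

lemma RR_summable {y : ℝ} (h0 : 0 < y) (h1 : y < 1) {f : ℕ → ℝ} {B : ℝ} (hf : ∀ m : ℕ, |f m| ≤ B * (m + 1)) :
    Summable (fun k => RR f k * y ^ k) := by
  refine Summable.of_norm_bounded ((summ_poly h0 h1 2).mul_left B) fun k => ?_
  rw [Real.norm_eq_abs, abs_mul, abs_of_pos (pow_pos h0 k), ← mul_assoc]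
  exact mul_le_mul_of_nonneg_right (RR_abs hf k) (pow_pos h0 k).le

lemma RR_succ (f : ℕ → ℝ) (k : ℕ) : RR f (k + 2) = 2 * f 0 + RR (fun m => f (m + 1)) k := by
  unfold RR
  rw [Finset.Nat.antidiagonal_succ_succ', Finset.sum_cons, Finset.sum_cons, Finset.sum_map]
  simp [Nat.succ_min_succ]
  ring

lemma TT_rec {y : ℝ} (h0 : 0 < y) (h1 : y < 1) {f : ℕ → ℝ} {B : ℝ} (hf : ∀ m : ℕ, |f m| ≤ B * (m + 1)) :
    TT y f = f 0 * (1 + y) / (1 - y) + y ^ 2 * TT y (fun m => f (m + 1)) := by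
  have hB : 0 ≤ B := by have := (abs_nonneg _).trans (hf 0); simpa using this
  have hf' : ∀ m : ℕ, |(fun m => f (m + 1)) m| ≤ (2 * B) * (m + 1) := fun m => by
    refine (hf (m + 1)).trans ?_
    push_cast
    have : (0 : ℝ) ≤ m := Nat.cast_nonneg _
    nlinarith
  have hs := RR_summable h0 h1 hf
  have hs' := RR_summable h0 h1 hf'
  have hg := hasSum_geometric_of_lt_one h0.le h1
  unfold TT
  rw [← hs.sum_add_tsum_nat_add 2]
  have e : ∀ k, RR f (k + 2) * y ^ (k + 2) = 2 * f 0 * y ^ 2 * y ^ k + y ^ 2 * (RR (fun m => f (m + 1)) k * y ^ k) := by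
    intro k; rw [RR_succ]; ring
  simp only [e]
  rw [Summable.tsum_add (hg.summable.mul_left _) (hs'.mul_left _), tsum_mul_left, tsum_mul_left, hg.tsum_eq]
  have r0 : RR f 0 = f 0 := by simp [RR]
  have r1 : RR f 1 = 2 * f 0 := by simp [RR, Finset.Nat.antidiagonal_succ]; ring
  rw [sum_range_succ, Finset.sum_range_one, r0, r1]
  have : 1 - y ≠ 0 := by linarith
  field_simp
  ring

lemma TT_addc {y : ℝ} (h0 : 0 < y) (h1 : y < 1) {f : ℕ → ℝ} {B : ℝ} (hf : ∀ m : ℕ, |f m| ≤ B * (m + 1)) (c : ℝ) :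
    TT y (fun m => f m + c) = TT y f + c / (1 - y) ^ 2 := by
  have hs := RR_summable h0 h1 hf
  have hc : ∀ m : ℕ, |(fun _ => c : ℕ → ℝ) m| ≤ |c| * (m + 1) := fun m => by
    have : (0 : ℝ) ≤ m := Nat.cast_nonneg _
    simp only
    nlinarith [abs_nonneg c]
  have hsc := RR_summable h0 h1 hc
  have e : TT y (fun m => f m + c) = TT y f + TT y (fun _ => c) := by
    unfold TT
    rw [← Summable.tsum_add hs hsc]
    congr 1; funext k
    unfold RR
    rw [Finset.sum_add_distrib]; ring
  rw [e]
  have h3 := TT_rec h0 h1 hc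
  have : 1 - y ≠ 0 := by linarith
  have h4 : 1 + y ≠ 0 := by linarith
  congr 1
  rw [eq_div_iff (by positivity)]
  field_simp at h3
  have h5 : (1 - y) * (1 + y) * TT y (fun _ => c) = c * (1 + y) / (1 - y) := by
    rw [eq_div_iff this]; linear_combination h3
  field_simp at h5
  linear_combination h5

noncomputable def EE (q r : ℕ) : ℝ := mn (q * r) (fun n => (aA n q : ℝ) * aA n r)

lemma EE_of_dvd {q r Q : ℕ} (hQ : 0 < Q) (hd : q * r ∣ Q) : EE q r = mn Q (fun n => (aA n q : ℝ) * aA n r) := by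
  unfold EE
  rw [mn_dvd _ hd hQ]
  intro n
  rw [aA_per (Dvd.intro _ rfl), aA_per (Dvd.intro_left _ rfl)]

lemma ep_of_dvd {p i j Q : ℕ} (hQ : 0 < Q) (hd : p ^ (i + j) ∣ Q) : ep p i j = mn Q (fun n => (rho n (p ^ i) : ℝ) * rho n (p ^ j)) := by
  unfold ep
  rw [mn_dvd _ hd hQ]
  intro n
  rw [rho_per (pow_dvd_pow p (by omega)), rho_per (pow_dvd_pow p (by omega))]

lemma ep_abs {p : ℕ} (hp : p.Prime) (i j : ℕ) : |ep p i j| ≤ 8 * ((i : ℝ) + j + 1) := by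
  have hp2 : (2 : ℝ) ≤ p := by exact_mod_cast hp.two_le
  have hy : 0 < 1 / (p : ℝ) := by positivity
  have hy2 : 1 / (p : ℝ) ≤ 1 / 2 := by gcongr
  have h0 : ∀ j : ℕ, |ep p 0 j| ≤ 8 * ((j : ℝ) + 1) := by
    intro j
    rcases j with _ | j
    · rw [ep_zz]; norm_num
    · rw [ep_zero hp, abs_le]
      have : (0 : ℝ) ≤ j := Nat.cast_nonneg _
      push_cast
      constructor <;> linarith
  rcases i with _ | i
  · simpa using h0 j
  rcases j with _ | j
  · rw [ep_comm]; simpa using h0 (i + 1)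
  rw [ep_pos hp]
  refine (ee_abs hp _).trans ?_
  have : ((min i j : ℕ) : ℝ) ≤ i := by exact_mod_cast min_le_left _ _
  push_cast
  push_cast at this
  have : (0 : ℝ) ≤ j := Nat.cast_nonneg _
  linarith

lemma aA_alt (n : ℕ) {p : ℕ} (hp : p.Prime) (k : ℕ) :
    (aA n (p ^ k) : ℝ) = ∑ s ∈ range (k + 1), (-1 : ℝ) ^ (k + s) * rho n (p ^ s) := by
  induction k with
  | zero => simp [aA_one, rho]
  | succ k ih =>
    rw [aA_pp_succ n hp k, sum_range_succ]
    push_cast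
    rw [ih]
    have : ∀ s, (-1 : ℝ) ^ (k + 1 + s) * (rho n (p ^ s) : ℝ) = -((-1 : ℝ) ^ (k + s) * rho n (p ^ s)) := by
      intro s; ring
    simp only [this, Finset.sum_neg_distrib]
    have hm : (-1 : ℝ) ^ (2 * k + 1) = -1 := by rw [pow_succ, pow_mul]; simp
    rw [show k + (k + 1) = 2 * k + 1 by ring, hm]
    ring

lemma EE_pp_abs {p : ℕ} (hp : p.Prime) (i j : ℕ) : |EE (p ^ i) (p ^ j)| ≤ 8 * ((i : ℝ) + j + 1) ^ 3 := by
  have hQ : 0 < p ^ (i + j) := pow_pos hp.pos _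
  have h1 : EE (p ^ i) (p ^ j) = ∑ s ∈ range (i + 1), ∑ t ∈ range (j + 1), (-1 : ℝ) ^ (i + s) * (-1 : ℝ) ^ (j + t) * ep p s t := by
    rw [EE_of_dvd hQ (by rw [← pow_add])]
    have : (fun n => (aA n (p ^ i) : ℝ) * aA n (p ^ j)) = fun n => ∑ s ∈ range (i + 1), ∑ t ∈ range (j + 1),
        ((-1 : ℝ) ^ (i + s) * (-1 : ℝ) ^ (j + t)) * (rho n (p ^ s) * rho n (p ^ t)) := by
      funext n
      rw [aA_alt n hp, aA_alt n hp, Finset.sum_mul_sum]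
      refine sum_congr rfl fun s _ => sum_congr rfl fun t _ => by ring
    rw [this, mn_sum]
    refine sum_congr rfl fun s hs => ?_
    rw [mn_sum]
    refine sum_congr rfl fun t ht => ?_
    rw [mem_range] at hs ht
    rw [mn_cmul, ← ep_of_dvd hQ (pow_dvd_pow p (by omega))]
  rw [h1]
  have hb : ∀ s ∈ range (i + 1), ∀ t ∈ range (j + 1), |(-1 : ℝ) ^ (i + s) * (-1 : ℝ) ^ (j + t) * ep p s t| ≤ 8 * ((i : ℝ) + j + 1) := by
    intro s hs t ht
    rw [mem_range] at hs ht
    rw [abs_mul, abs_mul, abs_pow, abs_pow, abs_neg, abs_one, one_pow, one_pow, one_mul, one_mul]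
    refine (ep_abs hp s t).trans ?_
    have h1 : (s : ℝ) ≤ i := by exact_mod_cast Nat.lt_succ_iff.mp hs
    have h2 : (t : ℝ) ≤ j := by exact_mod_cast Nat.lt_succ_iff.mp ht
    linarith
  calc _ ≤ ∑ s ∈ range (i + 1), ∑ t ∈ range (j + 1), 8 * ((i : ℝ) + j + 1) := by
        refine (abs_sum_le_sum_abs _ _).trans (sum_le_sum fun s hs => ?_)
        exact (abs_sum_le_sum_abs _ _).trans (sum_le_sum fun t ht => hb s hs t ht)
    _ = ((i : ℝ) + 1) * (((j : ℝ) + 1) * (8 * ((i : ℝ) + j + 1))) := by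
        simp [Finset.sum_const, nsmul_eq_mul]
    _ ≤ (((i : ℝ) + j + 1)) * (((i : ℝ) + j + 1) * (8 * ((i : ℝ) + j + 1))) := by
        have h1 : (0 : ℝ) ≤ i := Nat.cast_nonneg _
        have h2 : (0 : ℝ) ≤ j := Nat.cast_nonneg _
        gcongr <;> linarith
    _ = _ := by ring

lemma EE_comm (q r : ℕ) : EE q r = EE r q := by
  unfold EE; rw [mul_comm]; congr 1; funext n; ring

lemma EE_one_p {p : ℕ} (hp : p.Prime) : EE 1 p = - (1 / p) := by
  have h := ep_zero hp 0
  have h2 : (fun n => (aA n 1 : ℝ) * aA n p) = fun n => ((rho n (p ^ 0) : ℝ) * rho n (p ^ 1)) + (-1) * 1 := by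
    funext n
    have h3 := aA_pp_succ n hp 0
    rw [zero_add, pow_one, pow_zero, aA_one] at h3
    rw [aA_one, h3]
    simp [rho]
    ring
  have hp0 : (p : ℝ) ≠ 0 := by exact_mod_cast hp.ne_zero
  rw [EE, h2, mn_add, mn_cmul, one_mul]
  have h4 : mn p (fun n => (rho n (p ^ 0) : ℝ) * rho n (p ^ 1)) = 1 - 1 / p := by
    rw [← h, ep]; simp
  have h5 : mn p (fun _ => 1) = 1 := by unfold mn; simp [hp0]
  rw [h4, h5]; ring

noncomputable def cv (u : ℕ → ℝ) (k : ℕ) : ℝ := ∑ x ∈ Finset.HasAntidiagonal.antidiagonal k, u x.1 * u x.2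

lemma cv_coeff (u : ℕ → ℝ) (k : ℕ) : cv u k = PowerSeries.coeff k (PowerSeries.mk u * PowerSeries.mk u) := by
  rw [PowerSeries.coeff_mul]
  simp only [PowerSeries.coeff_mk]; rfl

lemma cv_rel {a r : ℕ → ℝ} (h0 : r 0 = a 0) (h : ∀ k, r (k + 1) = a (k + 1) + a k) :
    cv r 0 = cv a 0 ∧ cv r 1 = cv a 1 + 2 * cv a 0 ∧ ∀ k, cv r (k + 2) = cv a (k + 2) + 2 * cv a (k + 1) + cv a k := by
  have hr : PowerSeries.mk r = PowerSeries.mk a + PowerSeries.X * PowerSeries.mk a := by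
    ext k
    rcases k with _ | k
    · simp [h0]
    · rw [map_add, PowerSeries.coeff_succ_X_mul]; simp [h]
  have e : PowerSeries.mk r * PowerSeries.mk r = PowerSeries.mk a * PowerSeries.mk a + PowerSeries.X * (PowerSeries.mk a * PowerSeries.mk a)
     + PowerSeries.X * (PowerSeries.mk a * PowerSeries.mk a) + PowerSeries.X * (PowerSeries.X * (PowerSeries.mk a * PowerSeries.mk a)) := by
    rw [hr]; ring
  have e1 : ∀ k, cv r (k + 1) = cv a (k + 1) + cv a k + cv a k + PowerSeries.coeff k (PowerSeries.X * (PowerSeries.mk a * PowerSeries.mk a)) := by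
    intro k
    rw [cv_coeff, e, map_add, map_add, map_add, PowerSeries.coeff_succ_X_mul, PowerSeries.coeff_succ_X_mul, ← cv_coeff, ← cv_coeff]
  refine ⟨by simp [cv, h0], ?_, fun k => ?_⟩
  · rw [e1, PowerSeries.coeff_zero_X_mul]; ring
  · rw [e1, PowerSeries.coeff_succ_X_mul, ← cv_coeff]; ring

noncomputable def R2 (p k : ℕ) : ℝ := ∑ x ∈ Finset.HasAntidiagonal.antidiagonal k, ep p x.1 x.2
noncomputable def G2 (p k : ℕ) : ℝ := ∑ x ∈ Finset.HasAntidiagonal.antidiagonal k, EE (p ^ x.1) (p ^ x.2)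

lemma R2_mn {p : ℕ} (hp : p.Prime) {k K : ℕ} (h : k ≤ K) : R2 p k = mn (p ^ K) (fun n => cv (fun i => (rho n (p ^ i) : ℝ)) k) := by
  unfold R2 cv
  rw [mn_sum]
  refine sum_congr rfl fun x hx => ?_
  rw [Finset.HasAntidiagonal.mem_antidiagonal] at hx
  exact ep_of_dvd (pow_pos hp.pos _) (pow_dvd_pow p (by omega))

lemma G2_mn {p : ℕ} (hp : p.Prime) {k K : ℕ} (h : k ≤ K) : G2 p k = mn (p ^ K) (fun n => cv (fun i => (aA n (p ^ i) : ℝ)) k) := by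
  unfold G2 cv
  rw [mn_sum]
  refine sum_congr rfl fun x hx => ?_
  rw [Finset.HasAntidiagonal.mem_antidiagonal] at hx
  exact EE_of_dvd (pow_pos hp.pos _) (by rw [← pow_add]; exact pow_dvd_pow p (by omega))

lemma R2_G2 {p : ℕ} (hp : p.Prime) : R2 p 0 = G2 p 0 ∧ R2 p 1 = G2 p 1 + 2 * G2 p 0 ∧ ∀ k, R2 p (k + 2) = G2 p (k + 2) + 2 * G2 p (k + 1) + G2 p k := by
  have hrel := fun n => cv_rel (a := fun i => (aA n (p ^ i) : ℝ)) (r := fun i => (rho n (p ^ i) : ℝ)) (by simp [aA_one, rho])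
    (fun k => by have := aA_pp_succ n hp k; rw [this]; push_cast; ring)
  refine ⟨?_, ?_, fun k => ?_⟩
  · rw [R2_mn hp le_rfl, G2_mn hp le_rfl]
    simp only [(hrel _).1]
  · rw [R2_mn hp le_rfl, G2_mn hp le_rfl, G2_mn hp (k := 0) zero_le_one, ← mn_cmul, ← mn_add]
    simp only [(hrel _).2.1]
  · rw [R2_mn hp le_rfl, G2_mn hp (le_refl (k + 2)), G2_mn hp (show k + 1 ≤ k + 2 by omega), G2_mn hp (show k ≤ k + 2 by omega), ← mn_cmul, ← mn_add, ← mn_add]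
    simp only [(hrel _).2.2]

lemma G2abs {p : ℕ} (hp : p.Prime) (k : ℕ) : ∑ x ∈ Finset.HasAntidiagonal.antidiagonal k, |EE (p ^ x.1) (p ^ x.2)| ≤ 8 * ((k : ℝ) + 1) ^ 4 := by
  refine (Finset.sum_le_card_nsmul _ _ (8 * ((k : ℝ) + 1) ^ 3) fun x hx => ?_).trans (le_of_eq ?_)
  · rw [Finset.HasAntidiagonal.mem_antidiagonal] at hx
    refine (EE_pp_abs hp _ _).trans (le_of_eq ?_)
    rw [← hx]; push_cast; ring
  · rw [Finset.Nat.card_antidiagonal, nsmul_eq_mul]; push_cast; ring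

lemma G2_summable {p : ℕ} (hp : p.Prime) {y : ℝ} (h0 : 0 < y) (h1 : y < 1) : Summable (fun k => G2 p k * y ^ k) := by
  refine Summable.of_norm_bounded ((summ_poly h0 h1 4).mul_left 8) fun k => ?_
  rw [Real.norm_eq_abs, abs_mul, abs_of_pos (pow_pos h0 k), ← mul_assoc]
  exact mul_le_mul_of_nonneg_right ((abs_sum_le_sum_abs _ _).trans (G2abs hp k)) (pow_pos h0 k).le

lemma G2_tsum {p : ℕ} (hp : p.Prime) {y : ℝ} (hy : y = 1 / (p : ℝ)) :
    (1 + y) ^ 2 * ∑' k, G2 p k * y ^ k = 1 + 2 * y + y ^ 2 * TT y (fun m => ee p (m + 1)) := by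
  have hp2 : (2 : ℝ) ≤ p := by exact_mod_cast hp.two_le
  have h0 : 0 < y := by rw [hy]; positivity
  have h12 : y ≤ 1 / 2 := by rw [hy]; gcongr
  have h1 : y < 1 := by linarith
  have hs := G2_summable hp h0 h1
  have hrr := RR_summable h0 h1 (f := fun m => ee p (m + 1)) (ee_abs hp)
  obtain ⟨e0, e1, e2⟩ := R2_G2 hp
  have r0 : R2 p 0 = 1 := by simp [R2, ep_zz]
  have r1 : R2 p 1 = 2 * (1 - y) := by
    have := ep_zero hp 0
    rw [zero_add] at this
    simp only [R2, Finset.Nat.antidiagonal_succ]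
    simp [this, ep_comm p 1 0, hy]; ring
  have r2 : ∀ k, R2 p (k + 2) = 2 * (1 - y) + RR (fun m => ee p (m + 1)) k := by
    intro k
    unfold R2 RR
    rw [Finset.Nat.antidiagonal_succ_succ', Finset.sum_cons, Finset.sum_cons, Finset.sum_map]
    simp only [Function.Embedding.prodMap, Function.Embedding.coeFn_mk, Prod.map_fst, Prod.map_snd, Nat.succ_eq_add_one, ep_pos hp, ep_comm p (k + 2) 0, ep_zero hp (k + 1), hy]
    ring
  have hg := hasSum_geometric_of_lt_one h0.le h1
  have hs1 := (summable_nat_add_iff 1).mpr hs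
  have hs2 := (summable_nat_add_iff 2).mpr hs
  have t2 : ∑' k, G2 p (k + 2) * y ^ (k + 2) = ∑' k, G2 p k * y ^ k - G2 p 0 - G2 p 1 * y := by
    have := hs.sum_add_tsum_nat_add 2
    rw [sum_range_succ, Finset.sum_range_one] at this
    linear_combination this
  have t1 : ∑' k, G2 p (k + 1) * y ^ (k + 1) = ∑' k, G2 p k * y ^ k - G2 p 0 := by
    have := hs.sum_add_tsum_nat_add 1
    rw [Finset.sum_range_one] at this
    linear_combination this
  have key : ∑' k, (G2 p (k + 2) * y ^ (k + 2) + 2 * y * (G2 p (k + 1) * y ^ (k + 1)) + y ^ 2 * (G2 p k * y ^ k))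
      = ∑' k, (2 * (1 - y) * y ^ 2 * y ^ k + y ^ 2 * (RR (fun m => ee p (m + 1)) k * y ^ k)) := by
    congr 1; funext k
    have h3 := e2 k
    rw [r2] at h3
    linear_combination (-y ^ (k + 2)) * h3
  rw [Summable.tsum_add (hs2.add (hs1.mul_left _)) (hs.mul_left _), Summable.tsum_add hs2 (hs1.mul_left _), tsum_mul_left, tsum_mul_left,
    Summable.tsum_add (hg.summable.mul_left _) (hrr.mul_left _), tsum_mul_left, tsum_mul_left, hg.tsum_eq, t1, t2] at key
  have h5 : 2 * (1 - y) * y ^ 2 * (1 - y)⁻¹ = 2 * y ^ 2 := by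
    have : 1 - y ≠ 0 := by linarith
    field_simp
  rw [h5] at key
  unfold TT
  rw [r0] at e0
  rw [r1] at e1
  linear_combination key - (1 + 2 * y) * e0 - y * e1 + 2 * y * e0

lemma local_odd {p : ℕ} (hp : p.Prime) (h2 : p ≠ 2) :
    ∑' k, G2 p k * (1 / (p : ℝ)) ^ k = 1 + ((p : ℝ) ^ 4 - 2 * (p : ℝ) ^ 3 + 1) / ((p : ℝ) ^ 2 - 1) ^ 3 := by
  have hp2 : (2 : ℝ) ≤ p := by exact_mod_cast hp.two_le
  set y := 1 / (p : ℝ) with hy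
  have h0 : 0 < y := by rw [hy]; positivity
  have h12 : y ≤ 1 / 2 := by rw [hy]; gcongr
  have h1 : y < 1 := by linarith
  have hG := G2_tsum hp hy
  have hb : ∀ m : ℕ, |(fun m => ee p (m + 1)) m| ≤ 8 * (m + 1) := ee_abs hp
  have hb1 : ∀ m : ℕ, |(fun m => ee p (m + 1 + 1)) m| ≤ 16 * (m + 1) := fun m => by
    refine (ee_abs hp (m + 1)).trans ?_
    push_cast
    have : (0 : ℝ) ≤ m := Nat.cast_nonneg _
    linarith
  have t1 := TT_rec h0 h1 hb
  have t2 := TT_rec h0 h1 hb1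
  have t3 := TT_addc h0 h1 hb (4 * (1 - y))
  have e3 : (fun m => ee p (m + 1 + 1 + 1)) = fun m => ee p (m + 1) + 4 * (1 - y) := by
    funext m; exact ee_odd_rec hp h2 m
  simp only [e3] at t2
  rw [t3] at t2
  simp only [zero_add] at t1 t2
  rw [show 1 + 1 = 2 from rfl, ee_odd_2 hp h2] at t2
  rw [ee_odd_1 hp h2] at t1
  set S := TT y (fun m => ee p (m + 1))
  rw [t2] at t1
  have hpy : (p : ℝ) = 1 / y := by rw [hy]; field_simp
  rw [hpy] at t1 ⊢
  have n1 : 1 - y ≠ 0 := by linarith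
  have n2 : 1 + y ≠ 0 := by linarith
  have n3 : y ≠ 0 := h0.ne'
  have n4 : 1 - y ^ 4 ≠ 0 := by
    have : y ^ 4 < 1 := pow_lt_one₀ h0.le h1 (by norm_num)
    linarith
  have n5 : 1 - y ^ 2 ≠ 0 := by
    have : y ^ 2 < 1 := pow_lt_one₀ h0.le h1 (by norm_num)
    linarith
  have hS : S = ((2 - 4 * y) * (1 + y) + y ^ 2 * (4 - 6 * y) * (1 + y) + 4 * y ^ 4) / ((1 - y) * (1 - y ^ 4)) := by
    rw [eq_div_iff (by positivity)]
    have : S * (1 - y ^ 4) = (2 - 4 * y) * (1 + y) / (1 - y) + y ^ 2 * ((4 - 6 * y) * (1 + y) / (1 - y)) + y ^ 4 * (4 / (1 - y)) := by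
      have e4 : 4 * (1 - y) / (1 - y) ^ 2 = 4 / (1 - y) := by field_simp
      rw [e4] at t1
      have e5 : 4 / (1 / y) = 4 * y := by field_simp
      have e6 : 6 / (1 / y) = 6 * y := by field_simp
      rw [e5, e6] at t1
      linear_combination t1
    rw [mul_comm (1 - y), ← mul_assoc, this]
    field_simp
  have hG' : ∑' k, G2 p k * y ^ k = (1 + 2 * y + y ^ 2 * S) / (1 + y) ^ 2 := by
    rw [eq_div_iff (by positivity)]; linear_combination hG
  rw [hG', hS]
  have n6 : (1 / y) ^ 2 - 1 = (1 - y ^ 2) / y ^ 2 := by field_simp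
  have n7 : 1 + y ^ 2 ≠ 0 := by positivity
  rw [n6]
  rw [show 1 - y ^ 4 = (1 - y) * (1 + y) * (1 + y ^ 2) by ring, show 1 - y ^ 2 = (1 - y) * (1 + y) by ring]
  field_simp
  ring

lemma local_two : ∑' k, G2 2 k * (1 / ((2 : ℕ) : ℝ)) ^ k = 1015 / 864 := by
  have hp := Nat.prime_two
  have hG := G2_tsum hp (y := 1 / ((2 : ℕ) : ℝ)) rfl
  set y := 1 / ((2 : ℕ) : ℝ) with hy
  have hy2 : y = 1 / 2 := by rw [hy]; norm_num
  clear_value y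
  clear hy
  have h0 : 0 < y := by rw [hy2]; positivity
  have h1 : y < 1 := by rw [hy2]; norm_num
  have hb : ∀ j m : ℕ, |(fun m => ee 2 (m + j + 1)) m| ≤ (8 * ((j : ℝ) + 1)) * (m + 1) := fun j m => by
    refine (ee_abs hp (m + j)).trans ?_
    push_cast
    have : (0 : ℝ) ≤ m := Nat.cast_nonneg _
    have : (0 : ℝ) ≤ j := Nat.cast_nonneg _
    nlinarith
  have t : ∀ j : ℕ, TT y (fun m => ee 2 (m + j + 1)) = ee 2 (j + 1) * (1 + y) / (1 - y) + y ^ 2 * TT y (fun m => ee 2 (m + (j + 1) + 1)) := by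
    intro j
    have := TT_rec h0 h1 (hb j)
    simp only [zero_add] at this
    rw [this]
    congr 4
    funext m
    congr 1
    ring
  have t3 := TT_addc h0 h1 (hb 4) 4
  have e3 : (fun m => ee 2 (m + 6 + 1)) = fun m => ee 2 (m + 4 + 1) + 4 := by
    funext m; rw [← ee_2_rec m]
  obtain ⟨v1, v2, v3, v4, v5, v6⟩ := ee_2_vals
  have a0 := t 0
  have a1 := t 1
  have a2 := t 2
  have a3 := t 3
  have a4 := t 4
  have a5 := t 5
  norm_num only at a0 a1 a2 a3 a4 a5
  simp only [add_zero] at a0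
  rw [e3, t3] at a5
  rw [v1] at a0
  rw [v2] at a1
  rw [v3] at a2
  rw [v4] at a3
  rw [v5] at a4
  rw [v6] at a5
  generalize TT y (fun m => ee 2 (m + 1)) = s0 at *
  generalize TT y (fun m => ee 2 (m + 1 + 1)) = s1 at *
  generalize TT y (fun m => ee 2 (m + 2 + 1)) = s2 at *
  generalize TT y (fun m => ee 2 (m + 3 + 1)) = s3 at *
  generalize TT y (fun m => ee 2 (m + 4 + 1)) = s4 at *
  generalize TT y (fun m => ee 2 (m + 5 + 1)) = s5 at *
  generalize ∑' k, G2 2 k * y ^ k = g at *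
  clear t t3 e3 hb
  subst hy2
  norm_num at hG a0 a1 a2 a3 a4 a5
  linarith

lemma EE_mul {q r q' r' : ℕ} (hq : 0 < q * r) (hq' : 0 < q' * r') (hc : Nat.Coprime (q * r) (q' * r')) :
    EE (q * q') (r * r') = EE q r * EE q' r' := by
  unfold EE
  rw [show q * q' * (r * r') = (q * r) * (q' * r') by ring, ← mn_crt hq hq' hc]
  · congr 1; funext n
    rw [(aA_isMult n).map_mul_of_coprime (hc.coprime_mul_right.coprime_mul_right_right),
      (aA_isMult n).map_mul_of_coprime (hc.coprime_mul_left.coprime_mul_left_right)]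
    push_cast; ring
  · intro n
    rw [aA_per (Dvd.intro _ rfl), aA_per (Dvd.intro_left _ rfl)]
  · intro n
    rw [aA_per (Dvd.intro _ rfl), aA_per (Dvd.intro_left _ rfl)]

lemma antidiag_mul {F : ℕ → ℕ → ℝ} (hF : ∀ q r q' r' : ℕ, 0 < q * r → 0 < q' * r' → Nat.Coprime (q * r) (q' * r') → F (q * q') (r * r') = F q r * F q' r')
    {m n : ℕ} (cop : Nat.Coprime m n) :
    ∑ x ∈ (m * n).divisorsAntidiagonal, F x.1 x.2 = (∑ x ∈ m.divisorsAntidiagonal, F x.1 x.2) * ∑ x ∈ n.divisorsAntidiagonal, F x.1 x.2 := by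
  rw [Finset.sum_mul_sum, ← Finset.sum_product']
  symm
  apply Finset.sum_nbij' (fun x => (x.1.1 * x.2.1, x.1.2 * x.2.2)) (fun b => ((b.1.gcd m, b.2.gcd m), (b.1.gcd n, b.2.gcd n)))
  · rintro ⟨⟨a1, a2⟩, ⟨b1, b2⟩⟩ h
    simp only [Nat.mem_divisorsAntidiagonal, Ne, Finset.mem_product] at h
    rcases h with ⟨⟨rfl, ha⟩, ⟨rfl, hb⟩⟩
    simp only [Nat.mem_divisorsAntidiagonal, Ne]
    constructor
    · ring
    · exact mul_ne_zero ha hb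
  · rintro ⟨b1, b2⟩ h
    simp only [Nat.mem_divisorsAntidiagonal, Ne, Finset.mem_product] at h ⊢
    have h2 := h.2
    rw [mul_eq_zero, not_or] at h2
    refine ⟨⟨Nat.gcd_mul_gcd_of_coprime_of_mul_eq_mul cop h.1, h2.1⟩, ⟨Nat.gcd_mul_gcd_of_coprime_of_mul_eq_mul cop.symm (by rw [h.1, mul_comm]), h2.2⟩⟩
  · rintro ⟨⟨a1, a2⟩, ⟨b1, b2⟩⟩ h
    simp only [Nat.mem_divisorsAntidiagonal, Ne, Finset.mem_product] at h
    rcases h with ⟨⟨rfl, ha⟩, ⟨rfl, hb⟩⟩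
    have c11 := cop.coprime_mul_right.coprime_mul_right_right
    have c12 := cop.coprime_mul_right.coprime_mul_left_right
    have c21 := cop.coprime_mul_left.coprime_mul_right_right
    have c22 := cop.coprime_mul_left.coprime_mul_left_right
    simp only [Prod.mk.injEq]
    refine ⟨⟨?_, ?_⟩, ⟨?_, ?_⟩⟩
    · rw [Nat.gcd_mul_left, c21.symm.gcd_eq_one, mul_one]
    · rw [mul_comm a1, Nat.gcd_mul_left, c12.symm.gcd_eq_one, mul_one]
    · rw [mul_comm a1, Nat.gcd_mul_left, c12.gcd_eq_one, mul_one]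
    · rw [Nat.gcd_mul_right, c21.gcd_eq_one, one_mul]
  · rintro ⟨b1, b2⟩ h
    simp only [Nat.mem_divisorsAntidiagonal, Ne] at h
    have e1 : b1.gcd m * b1.gcd n = b1 := by
      rw [← cop.gcd_mul]; exact Nat.gcd_eq_left (Dvd.intro _ h.1)
    have e2 : b2.gcd m * b2.gcd n = b2 := by
      rw [← cop.gcd_mul]; exact Nat.gcd_eq_left (Dvd.intro_left _ h.1)
    simp only [e1, e2]
  · rintro ⟨⟨a1, a2⟩, ⟨b1, b2⟩⟩ h
    simp only [Nat.mem_divisorsAntidiagonal, Ne, Finset.mem_product] at h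
    rcases h with ⟨⟨rfl, ha⟩, ⟨rfl, hb⟩⟩
    exact (hF _ _ _ _ (Nat.pos_of_ne_zero ha) (Nat.pos_of_ne_zero hb) cop).symm

noncomputable def GS (N : ℕ) : ℝ := ∑ x ∈ N.divisorsAntidiagonal, EE x.1 x.2
noncomputable def GA (N : ℕ) : ℝ := ∑ x ∈ N.divisorsAntidiagonal, |EE x.1 x.2|

lemma GS_mul {m n : ℕ} (cop : Nat.Coprime m n) : GS (m * n) = GS m * GS n :=
  antidiag_mul (F := EE) (fun _ _ _ _ h1 h2 h3 => EE_mul h1 h2 h3) cop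
lemma GA_mul {m n : ℕ} (cop : Nat.Coprime m n) : GA (m * n) = GA m * GA n :=
  antidiag_mul (F := fun a b => |EE a b|) (fun _ _ _ _ h1 h2 h3 => by rw [EE_mul h1 h2 h3, abs_mul]) cop
lemma GA_nonneg (N : ℕ) : 0 ≤ GA N := Finset.sum_nonneg fun _ _ => abs_nonneg _
lemma GS_abs (N : ℕ) : |GS N| ≤ GA N := abs_sum_le_sum_abs _ _
lemma EE_11 : EE 1 1 = 1 := by simp [EE, mn, aA_one]
lemma GS_one : GS 1 = 1 := by simp [GS, EE_11]
lemma GA_one : GA 1 = 1 := by simp [GA, EE_11]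
lemma GS_zero : GS 0 = 0 := by simp [GS]
lemma GA_zero : GA 0 = 0 := by simp [GA]

lemma antidiag_pp {p : ℕ} (hp : p.Prime) (k : ℕ) (F : ℕ → ℕ → ℝ) :
    ∑ x ∈ (p ^ k).divisorsAntidiagonal, F x.1 x.2 = ∑ x ∈ Finset.HasAntidiagonal.antidiagonal k, F (p ^ x.1) (p ^ x.2) := by
  rw [Nat.sum_divisorsAntidiagonal F, Nat.sum_divisors_prime_pow hp, Finset.Nat.sum_antidiagonal_eq_sum_range_succ (fun i j => F (p ^ i) (p ^ j))]
  apply sum_congr rfl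
  intro i hi
  rw [mem_range] at hi
  rw [Nat.pow_div (by omega) hp.pos]

lemma GS_pp {p : ℕ} (hp : p.Prime) (k : ℕ) : GS (p ^ k) = G2 p k := antidiag_pp hp k EE
lemma GA_pp_le {p : ℕ} (hp : p.Prime) (k : ℕ) : GA (p ^ k) ≤ 8 * ((k : ℝ) + 1) ^ 4 := by
  unfold GA; rw [antidiag_pp hp k (fun a b => |EE a b|)]; exact G2abs hp k
lemma GA_p {p : ℕ} (hp : p.Prime) : GA p = 2 / p := by
  have := antidiag_pp hp 1 (fun a b => |EE a b|)
  rw [pow_one] at this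
  unfold GA
  rw [this]
  have hp0 : (0 : ℝ) < p := by exact_mod_cast hp.pos
  have e1 := EE_one_p hp
  simp only [Finset.Nat.antidiagonal_succ]
  simp [EE_comm p 1, e1, abs_of_pos hp0]
  ring

noncomputable def fA (N : ℕ) : ℝ := GA N * (N : ℝ) ^ (-(3 / 4) : ℝ)

lemma fA_nonneg (N : ℕ) : 0 ≤ fA N := mul_nonneg (GA_nonneg N) (by positivity)

lemma fA_mul {m n : ℕ} (cop : Nat.Coprime m n) : fA (m * n) = fA m * fA n := by
  unfold fA
  rw [GA_mul cop]
  push_cast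
  rw [Real.mul_rpow (by positivity) (by positivity)]
  ring

lemma fA_local : ∃ C : ℝ, 0 ≤ C ∧ ∀ p : ℕ, p.Prime → Summable (fun k => fA (p ^ k)) ∧ ∑' k, fA (p ^ k) ≤ 1 + C * (p : ℝ) ^ (-(3 / 2) : ℝ) := by
  set z2 : ℝ := (2 : ℝ) ^ (-(3 / 4) : ℝ) with hz2
  have h20 : 0 < z2 := by positivity
  have h21 : z2 < 1 := Real.rpow_lt_one_of_one_lt_of_neg (by norm_num) (by norm_num)
  have hsp := summ_poly h20 h21 4
  have hs3 := (summable_nat_add_iff 2).mpr hsp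
  have hs3' : Summable (fun k : ℕ => 8 * (((k : ℝ) + 3) ^ 4 * z2 ^ k)) := by
    refine (hs3.mul_left (8 * (z2 ^ 2)⁻¹)).congr fun k => ?_
    push_cast
    field_simp
    ring
  refine ⟨2 + ∑' k : ℕ, 8 * (((k : ℝ) + 3) ^ 4 * z2 ^ k), add_nonneg (by norm_num) (tsum_nonneg fun k => by positivity), fun p hp => ?_⟩
  have hp0 : (0 : ℝ) < p := by exact_mod_cast hp.pos
  have hp2 : (2 : ℝ) ≤ p := by exact_mod_cast hp.two_le
  set z : ℝ := (p : ℝ) ^ (-(3 / 4) : ℝ) with hz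
  have hz0 : 0 < z := by positivity
  have hz1 : z ≤ z2 := Real.rpow_le_rpow_of_nonpos (by norm_num) hp2 (by norm_num)
  have hzz : z ^ 2 = (p : ℝ) ^ (-(3 / 2) : ℝ) := by
    rw [hz, ← Real.rpow_natCast, ← Real.rpow_mul hp0.le]; norm_num
  have hpp : ∀ k, fA (p ^ k) = GA (p ^ k) * z ^ k := by
    intro k
    unfold fA
    push_cast
    rw [hz, ← Real.rpow_natCast, ← Real.rpow_natCast, ← Real.rpow_mul hp0.le, ← Real.rpow_mul hp0.le, mul_comm (k : ℝ)]
  have hb : ∀ k : ℕ, fA (p ^ (k + 2)) ≤ z ^ 2 * (8 * (((k : ℝ) + 3) ^ 4 * z2 ^ k)) := by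
    intro k
    rw [hpp]
    have h1 := GA_pp_le hp (k + 2)
    push_cast at h1
    calc GA (p ^ (k + 2)) * z ^ (k + 2) ≤ (8 * ((k : ℝ) + 3) ^ 4) * z ^ (k + 2) := by
          gcongr; refine h1.trans (le_of_eq (by ring))
      _ = z ^ 2 * (8 * (((k : ℝ) + 3) ^ 4 * z ^ k)) := by ring
      _ ≤ _ := by gcongr
  have hs2 : Summable (fun k => fA (p ^ (k + 2))) := Summable.of_nonneg_of_le (fun k => fA_nonneg _) hb (hs3'.mul_left _)
  have hs : Summable (fun k => fA (p ^ k)) := (summable_nat_add_iff 2).mp hs2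
  refine ⟨hs, ?_⟩
  rw [← hs.sum_add_tsum_nat_add 2, sum_range_succ, Finset.sum_range_one]
  have e0 : fA (p ^ 0) = 1 := by rw [hpp]; simp [GA_one]
  have e1 : fA (p ^ 1) ≤ 2 * z ^ 2 := by
    rw [hpp, pow_one, pow_one, GA_p hp]
    have h4 : 1 / (p : ℝ) ≤ z := by
      rw [hz, one_div, ← Real.rpow_neg_one]
      exact Real.rpow_le_rpow_of_exponent_le (by linarith) (by norm_num)
    calc 2 / (p : ℝ) * z = 2 * (1 / p) * z := by ring
      _ ≤ 2 * z * z := by gcongr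
      _ = _ := by ring
  have e2 := Summable.tsum_le_tsum hb hs2 (hs3'.mul_left _)
  rw [tsum_mul_left] at e2
  rw [e0, ← hzz]
  nlinarith

lemma fA_summable : Summable fA := by
  obtain ⟨C, hC, h⟩ := fA_local
  have hs : Summable (fun n : ℕ => C * (n : ℝ) ^ (-(3 / 2) : ℝ)) := (Real.summable_nat_rpow.mpr (by norm_num)).mul_left C
  refine summable_of_sum_range_le (c := exp (∑' n : ℕ, C * (n : ℝ) ^ (-(3 / 2) : ℝ))) fA_nonneg fun K => ?_
  have h1 := (EulerProduct.summable_and_hasSum_smoothNumbers_prod_primesBelow_tsum (f := fA) (by simp [fA, GA_one]) (fun {m n} cop => fA_mul cop)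
    (fun {p} hp => by simpa [abs_of_nonneg (fA_nonneg _)] using (h p hp).1) K).2
  have h2 := (hasSum_subtype_iff_indicator (f := fA) (s := K.smoothNumbers)).mp h1
  have h3 := sum_le_hasSum (range K) (fun i _ => Set.indicator_nonneg (fun x _ => fA_nonneg x) i) h2
  have h4 : ∑ N ∈ range K, fA N = ∑ N ∈ range K, Set.indicator (K.smoothNumbers) fA N := by
    refine sum_congr rfl fun N hN => ?_
    rw [mem_range] at hN
    rcases Nat.eq_zero_or_pos N with rfl | hN0
    · have : fA 0 = 0 := by simp [fA, GA_zero]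
      by_cases h : (0:ℕ) ∈ K.smoothNumbers
      · rw [Set.indicator_of_mem h]
      · rw [Set.indicator_of_notMem h, this]
    · rw [Set.indicator_of_mem (Nat.mem_smoothNumbers_of_lt hN0 hN)]
  rw [h4]
  refine h3.trans ?_
  calc ∏ p ∈ K.primesBelow, ∑' n : ℕ, fA (p ^ n) ≤ ∏ p ∈ K.primesBelow, exp (C * (p : ℝ) ^ (-(3 / 2) : ℝ)) := by
        refine Finset.prod_le_prod (fun p _ => tsum_nonneg fun _ => fA_nonneg _) fun p hp => ?_
        refine ((h p (Nat.prime_of_mem_primesBelow hp)).2).trans ?_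
        rw [add_comm]; exact Real.add_one_le_exp _
    _ = exp (∑ p ∈ K.primesBelow, C * (p : ℝ) ^ (-(3 / 2) : ℝ)) := (Real.exp_sum _ _).symm
    _ ≤ _ := by
        apply Real.exp_le_exp.mpr
        exact hs.sum_le_tsum _ (fun n _ => by positivity)

lemma GA_div_le (N : ℕ) : GA N / N ≤ fA N := by
  rcases Nat.eq_zero_or_pos N with rfl | hN
  · simp [GA_zero, fA]
  · unfold fA
    rw [div_eq_mul_inv, ← Real.rpow_neg_one]
    refine mul_le_mul_of_nonneg_left (Real.rpow_le_rpow_of_exponent_le ?_ (by norm_num)) (GA_nonneg N)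
    exact_mod_cast hN

lemma GS_summable : Summable (fun N : ℕ => ‖GS N / N‖) := by
  refine Summable.of_nonneg_of_le (fun _ => norm_nonneg _) (fun N => ?_) fA_summable
  rw [norm_div, Real.norm_natCast, Real.norm_eq_abs]
  exact (div_le_div_of_nonneg_right (GS_abs N) (Nat.cast_nonneg N)).trans (GA_div_le N)

lemma kappa_eq : ∑' N : ℕ, GS N / N = kappa := by
  have hE := EulerProduct.eulerProduct_hasProd_mulIndicator (f := fun N : ℕ => GS N / N) (by simp [GS_one])
    (fun {m n} cop => by rw [GS_mul cop]; push_cast; rw [mul_div_mul_comm]) GS_summable (by simp)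
  set c : ℕ → ℝ := fun p => ((p : ℝ) ^ 4 - 2 * (p : ℝ) ^ 3 + 1) / ((p : ℝ) ^ 2 - 1) ^ 3 with hc
  have hsum : Summable (fun p : {p : ℕ // p.Prime ∧ p ≠ 2} => c p.1) := by
    have h1 : Summable (fun n : ℕ => 3 * (1 / (n : ℝ) ^ 2)) := (Real.summable_one_div_nat_pow.mpr (by norm_num)).mul_left 3
    refine Summable.of_norm_bounded (h1.comp_injective (Subtype.val_injective (p := fun p : ℕ => p.Prime ∧ p ≠ 2))) fun p => ?_
    have hp2 : (2 : ℝ) ≤ p.1 := by exact_mod_cast p.2.1.two_le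
    simp only [hc, Function.comp]
    generalize (p.1 : ℝ) = x at *
    have d0 : 0 < x ^ 2 - 1 := by nlinarith
    have d1 : 3 / 4 * x ^ 2 ≤ x ^ 2 - 1 := by nlinarith
    have d2 : (3 / 4 * x ^ 2) ^ 3 ≤ (x ^ 2 - 1) ^ 3 := by gcongr
    have n0 : 0 ≤ x ^ 4 - 2 * x ^ 3 + 1 := by
      have : 0 ≤ x ^ 3 * (x - 2) := mul_nonneg (by positivity) (by linarith)
      nlinarith
    have n1 : x ^ 4 - 2 * x ^ 3 + 1 ≤ x ^ 4 := by
      have : 1 ≤ x ^ 3 := one_le_pow₀ (by linarith)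
      linarith
    rw [Real.norm_eq_abs, abs_of_nonneg (by positivity)]
    calc (x ^ 4 - 2 * x ^ 3 + 1) / (x ^ 2 - 1) ^ 3 ≤ x ^ 4 / (3 / 4 * x ^ 2) ^ 3 := by gcongr
      _ = 64 / 27 * (1 / x ^ 2) := by field_simp; norm_num
      _ ≤ 3 * (1 / x ^ 2) := by gcongr; norm_num
  have hP := (Real.multipliable_one_add_of_summable hsum).hasProd
  have hP2 := (hasProd_subtype_iff_mulIndicator (f := fun p : ℕ => 1 + c p) (s := {p | p.Prime ∧ p ≠ 2})).mp hP
  have hP3 : HasProd (fun n : ℕ => if n = 2 then (1015 / 864 : ℝ) else 1) (1015 / 864) := hasProd_ite_eq 2 _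
  have hP4 := hP3.mul hP2
  have loc : ∀ p : ℕ, p.Prime → ∑' e : ℕ, GS (p ^ e) / ((p ^ e : ℕ) : ℝ) = ∑' k, G2 p k * (1 / (p : ℝ)) ^ k := by
    intro p hp
    congr 1; funext k
    rw [GS_pp hp]; push_cast; rw [one_div, inv_pow]; rfl
  have hfe : (Set.mulIndicator {p : ℕ | Nat.Prime p} fun p => ∑' e : ℕ, GS (p ^ e) / ((p ^ e : ℕ) : ℝ)) = fun p => (if p = 2 then (1015 / 864 : ℝ) else 1) * Set.mulIndicator {p | p.Prime ∧ p ≠ 2} (fun p : ℕ => 1 + c p) p := by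
   funext p
   by_cases h2 : p = 2
   · subst h2
     rw [Set.mulIndicator_of_mem (by exact Nat.prime_two), Set.mulIndicator_of_notMem (by simp), if_pos rfl, loc 2 Nat.prime_two, local_two]
     simp
   · rw [if_neg h2, one_mul]
     by_cases hp : p.Prime
     · rw [Set.mulIndicator_of_mem (by exact hp), Set.mulIndicator_of_mem (by exact ⟨hp, h2⟩), loc p hp, local_odd hp h2]
     · rw [Set.mulIndicator_of_notMem (by exact hp), Set.mulIndicator_of_notMem (by exact fun h => hp h.1)]
  exact hE.unique (by rw [hfe]; exact hP4)

lemma kappa_trunc : ∃ C : ℝ, 0 ≤ C ∧ ∀ M : ℕ, 1 ≤ M →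
    |∑ q ∈ Ioc 0 M, ∑ r ∈ Ioc 0 M, EE q r / ((q : ℝ) * r) - kappa| ≤ C * (M : ℝ) ^ (-(1 / 4) : ℝ) := by
  refine ⟨∑' N, fA N, tsum_nonneg fA_nonneg, fun M hM => ?_⟩
  have hM0 : (0 : ℝ) < M := by exact_mod_cast hM
  set P : ℕ → ℝ := fun N => ∑ x ∈ N.divisorsAntidiagonal, (if x.1 ≤ M ∧ x.2 ≤ M then EE x.1 x.2 / N else 0) with hP
  have h1 : ∑ q ∈ Ioc 0 M, ∑ r ∈ Ioc 0 M, EE q r / ((q : ℝ) * r) = ∑ N ∈ Ioc 0 (M * M), P N := by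
    rw [← Finset.sum_product', ← Finset.sum_fiberwise_of_maps_to (g := fun x : ℕ × ℕ => x.1 * x.2) (t := Ioc 0 (M * M))]
    · refine sum_congr rfl fun N hN => ?_
      rw [mem_Ioc] at hN
      simp only [hP]; rw [← Finset.sum_filter]
      refine sum_congr ?_ ?_
      · ext ⟨a, b⟩
        simp only [mem_filter, Finset.mem_product, mem_Ioc, Nat.mem_divisorsAntidiagonal]
        constructor
        · rintro ⟨⟨⟨h1, h2⟩, h3, h4⟩, h5⟩
          exact ⟨⟨h5, by omega⟩, h2, h4⟩
        · rintro ⟨⟨h5, h6⟩, h2, h4⟩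
          refine ⟨⟨⟨?_, h2⟩, ?_, h4⟩, h5⟩
          · rcases Nat.eq_zero_or_pos a with rfl | h
            · simp at h5; omega
            · exact h
          · rcases Nat.eq_zero_or_pos b with rfl | h
            · simp at h5; omega
            · exact h
      · rintro ⟨a, b⟩ hx
        simp only [mem_filter, Nat.mem_divisorsAntidiagonal] at hx
        rw [← hx.1.1]; push_cast; rfl
    · rintro ⟨a, b⟩ hx
      simp only [Finset.mem_product, mem_Ioc] at hx ⊢
      exact ⟨Nat.mul_pos hx.1.1 hx.2.1, Nat.mul_le_mul hx.1.2 hx.2.2⟩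
  have hPabs : ∀ N, |P N| ≤ GA N / N := by
    intro N
    simp only [hP]; rw [GA, Finset.sum_div]
    refine (abs_sum_le_sum_abs _ _).trans (sum_le_sum fun x _ => ?_)
    split_ifs
    · rw [abs_div, Nat.abs_cast]
    · rw [abs_zero]; positivity
  have hPs : Summable P := Summable.of_norm_bounded fA_summable fun N => by
    rw [Real.norm_eq_abs]; exact (hPabs N).trans (GA_div_le N)
  have h2 : ∑ N ∈ Ioc 0 (M * M), P N = ∑' N, P N := by
    symm
    apply tsum_eq_sum
    intro N hN
    rw [mem_Ioc, not_and_or] at hN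
    apply Finset.sum_eq_zero
    rintro ⟨a, b⟩ hx
    rw [Nat.mem_divisorsAntidiagonal] at hx
    rw [if_neg]
    rintro ⟨h3, h4⟩
    have := Nat.mul_le_mul h3 h4
    simp only at hx this
    omega
  have hGs := GS_summable.of_norm
  rw [h1, h2, ← kappa_eq, ← Summable.tsum_sub hPs hGs]
  have hterm : ∀ N, ‖P N - GS N / N‖ ≤ (M : ℝ) ^ (-(1 / 4) : ℝ) * fA N := by
    intro N
    rw [Real.norm_eq_abs]
    rcases Nat.eq_zero_or_pos N with rfl | hN0
    · simp [hP, GS_zero, fA, GA_zero]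
    have hN0' : (0 : ℝ) < N := by exact_mod_cast hN0
    rcases le_or_gt N M with hNM | hNM
    · have : P N = GS N / N := by
        simp only [hP]; rw [GS, Finset.sum_div]
        refine sum_congr rfl fun x hx => ?_
        rw [Nat.mem_divisorsAntidiagonal] at hx
        rw [if_pos]
        exact ⟨(Nat.le_of_dvd hN0 (Dvd.intro _ hx.1)).trans hNM, (Nat.le_of_dvd hN0 (Dvd.intro_left _ hx.1)).trans hNM⟩
      rw [this, sub_self, abs_zero]
      exact mul_nonneg (by positivity) (fA_nonneg N)
    · have h5 : |P N - GS N / N| ≤ GA N / N := by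
        have e : P N - GS N / N = ∑ x ∈ N.divisorsAntidiagonal, (if x.1 ≤ M ∧ x.2 ≤ M then 0 else - (EE x.1 x.2 / N)) := by
          simp only [hP]; rw [GS, Finset.sum_div, ← Finset.sum_sub_distrib]
          refine sum_congr rfl fun x _ => ?_
          split_ifs <;> ring
        rw [e, GA, Finset.sum_div]
        refine (abs_sum_le_sum_abs _ _).trans (sum_le_sum fun x _ => ?_)
        split_ifs
        · rw [abs_zero]; positivity
        · rw [abs_neg, abs_div, Nat.abs_cast]
      refine h5.trans ?_
      have h6 : GA N / N = (N : ℝ) ^ (-(1 / 4) : ℝ) * fA N := by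
        unfold fA
        rw [mul_comm, mul_assoc, ← Real.rpow_add hN0', div_eq_mul_inv, ← Real.rpow_neg_one]
        norm_num
      rw [h6]
      refine mul_le_mul_of_nonneg_right ?_ (fA_nonneg N)
      exact Real.rpow_le_rpow_of_nonpos hM0 (by exact_mod_cast hNM.le) (by norm_num)
  have h7 := tsum_of_norm_bounded (fA_summable.mul_left ((M : ℝ) ^ (-(1 / 4) : ℝ))).hasSum hterm
  rw [tsum_mul_left, Real.norm_eq_abs] at h7
  rw [mul_comm]; exact h7

lemma mn_abs {Q : ℕ} (hQ : 0 < Q) {f : ℕ → ℝ} {K : ℝ} (hK : ∀ n, |f n| ≤ K) : |mn Q f| ≤ K := by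
  unfold mn
  have hQ' : (0 : ℝ) < Q := by exact_mod_cast hQ
  rw [abs_div, Nat.abs_cast, div_le_iff₀ hQ']
  refine (abs_sum_le_sum_abs _ _).trans ((sum_le_sum fun n _ => hK n).trans ?_)
  rw [Finset.sum_const, Finset.card_range, nsmul_eq_mul, mul_comm]

lemma periodic_sum {Q : ℕ} (hQ : 0 < Q) {f : ℕ → ℝ} (hf : ∀ n, f (n + Q) = f n) {K : ℝ} (hK : ∀ n, |f n| ≤ K) (x : ℕ) :
    |∑ n ∈ range x, f n - x * mn Q f| ≤ 2 * Q * K := by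
  have hK0 : 0 ≤ K := (abs_nonneg _).trans (hK 0)
  have hQ' : (0 : ℝ) < Q := by exact_mod_cast hQ
  have hm : ∑ n ∈ range Q, f n = Q * mn Q f := by unfold mn; field_simp
  induction x using Nat.strong_induction_on with
  | _ x ih =>
    rcases lt_or_ge x Q with h | h
    · have h1 : |∑ n ∈ range x, f n| ≤ x * K := by
        refine (abs_sum_le_sum_abs _ _).trans ((sum_le_sum fun n _ => hK n).trans ?_)
        rw [Finset.sum_const, Finset.card_range, nsmul_eq_mul]
      have h2 : |(x : ℝ) * mn Q f| ≤ x * K := by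
        rw [abs_mul, Nat.abs_cast]; gcongr; exact mn_abs hQ hK
      have h3 : (x : ℝ) * K ≤ Q * K := by gcongr
      have := abs_sub (∑ n ∈ range x, f n) ((x : ℝ) * mn Q f)
      linarith
    · obtain ⟨y, rfl⟩ : ∃ y, x = Q + y := ⟨x - Q, by omega⟩
      have := ih y (by omega)
      rw [Finset.sum_range_add, hm]
      have e : ∑ i ∈ range y, f (Q + i) = ∑ i ∈ range y, f i :=
        sum_congr rfl fun i _ => by rw [add_comm]; exact hf i
      rw [e]; push_cast
      rw [show (Q : ℝ) * mn Q f + ∑ i ∈ range y, f i - (Q + y) * mn Q f = ∑ i ∈ range y, f i - y * mn Q f by ring]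
      exact this

lemma sum_Ioc2 (f : ℕ → ℝ) {x : ℕ} (hx : 2 ≤ x) : ∑ n ∈ range x, f n = f 0 + f 1 + f 2 + ∑ n ∈ Ioc 2 x, f n - f x := by
  have h1 := sum_range_succ f x
  have h2 : ∑ n ∈ range (x + 1), f n = ∑ n ∈ range 3, f n + ∑ n ∈ Ioc 2 x, f n := by
    rw [Finset.range_eq_Ico, Finset.range_eq_Ico, ← Finset.sum_Ico_consecutive f (Nat.zero_le 3) (by omega : 3 ≤ x + 1)]
    congr 1
  rw [h2, sum_range_succ, sum_range_succ, Finset.sum_range_one] at h1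
  linarith

lemma aA_58 : ∃ C : ℝ, 1 ≤ C ∧ ∀ n q : ℕ, q ≠ 0 → |(aA n q : ℝ)| ≤ C * (q : ℝ) ^ (5 / 8 : ℝ) := by
  obtain ⟨C, hC, h⟩ := divisor_bound (ε := 1 / 16) (by norm_num)
  refine ⟨C ^ 2, one_le_pow₀ hC, fun n q hq => (aA_abs_le n hq).trans ?_⟩
  have hq0 : (0 : ℝ) < q := by exact_mod_cast Nat.pos_of_ne_zero hq
  have h1 := h q hq
  calc (q.divisors.card : ℝ) ^ 2 * √(q : ℝ) ≤ (C * (q : ℝ) ^ (1 / 16 : ℝ)) ^ 2 * √(q : ℝ) := by gcongr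
    _ = C ^ 2 * (q : ℝ) ^ (5 / 8 : ℝ) := by
      rw [mul_pow, ← Real.rpow_natCast ((q : ℝ) ^ (1 / 16 : ℝ)), ← Real.rpow_mul hq0.le, Real.sqrt_eq_rpow, mul_assoc, ← Real.rpow_add hq0]
      norm_num

lemma aA_corr : ∃ C : ℝ, 0 ≤ C ∧ ∀ q r x : ℕ, 0 < q → 0 < r → 2 ≤ x →
    |∑ n ∈ Ioc 2 x, (aA n q : ℝ) * aA n r - x * EE q r| ≤ C * ((q : ℝ) * r) ^ (13 / 8 : ℝ) := by
  obtain ⟨C, hC, h⟩ := aA_58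
  refine ⟨6 * C ^ 2, by positivity, fun q r x hq hr hx => ?_⟩
  have hq' : (1 : ℝ) ≤ q := by exact_mod_cast hq
  have hr' : (1 : ℝ) ≤ r := by exact_mod_cast hr
  set f : ℕ → ℝ := fun n => (aA n q : ℝ) * aA n r with hf
  set K : ℝ := C ^ 2 * ((q : ℝ) * r) ^ (5 / 8 : ℝ) with hKd
  have hK0 : 0 ≤ K := by positivity
  have hK : ∀ n, |f n| ≤ K := by
    intro n
    rw [hf, hKd]
    simp only [abs_mul]
    rw [Real.mul_rpow (by positivity) (by positivity)]
    calc |(aA n q : ℝ)| * |(aA n r : ℝ)| ≤ (C * (q : ℝ) ^ (5 / 8 : ℝ)) * (C * (r : ℝ) ^ (5 / 8 : ℝ)) := by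
          gcongr
          · exact h n q hq.ne'
          · exact h n r hr.ne'
      _ = _ := by ring
  have hper : ∀ n, f (n + q * r) = f n := by
    intro n
    simp only [hf]
    rw [aA_per (dvd_mul_right q r), aA_per (dvd_mul_left r q)]
  have h1 := periodic_sum (Nat.mul_pos hq hr) hper hK x
  rw [sum_Ioc2 f hx] at h1
  have hEE : mn (q * r) f = EE q r := rfl
  rw [hEE] at h1
  have hQ : (1 : ℝ) ≤ (q : ℝ) * r := by nlinarith
  have e : ((q : ℝ) * r) ^ (13 / 8 : ℝ) = (q * r) * ((q : ℝ) * r) ^ (5 / 8 : ℝ) := by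
    rw [show (13 / 8 : ℝ) = 1 + 5 / 8 by norm_num, Real.rpow_add (by positivity), Real.rpow_one]
  have e2 : 6 * C ^ 2 * ((q : ℝ) * r) ^ (13 / 8 : ℝ) = 6 * (q * r) * K := by rw [e, hKd]; ring
  rw [e2]
  push_cast at h1
  have k0 := abs_le.mp (hK 0)
  have k1 := abs_le.mp (hK 1)
  have k2 := abs_le.mp (hK 2)
  have k3 := abs_le.mp (hK x)
  have h2 := abs_le.mp h1
  have h3 : K ≤ (q * r) * K := le_mul_of_one_le_left hK0 hQ
  rw [abs_le]
  constructor <;> nlinarith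

lemma A1_sq_mean : ∃ C : ℝ, 0 ≤ C ∧ ∀ M x : ℕ, 1 ≤ M → 2 ≤ x →
    |∑ n ∈ Ioc 2 x, A1 n M ^ 2 - kappa * x| ≤ C * ((M : ℝ) ^ (13 / 4 : ℝ) + x * (M : ℝ) ^ (-(1 / 4) : ℝ)) := by
  obtain ⟨C, hC, h⟩ := aA_corr
  obtain ⟨D, hD, hk⟩ := kappa_trunc
  refine ⟨C + D, by positivity, fun M x hM hx => ?_⟩
  have hM0 : (0 : ℝ) < M := by exact_mod_cast hM
  have e1 : ∑ n ∈ Ioc 2 x, A1 n M ^ 2 = ∑ q ∈ Ioc 0 M, ∑ r ∈ Ioc 0 M, (∑ n ∈ Ioc 2 x, (aA n q : ℝ) * aA n r) / ((q : ℝ) * r) := by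
    simp only [A1, sq, Finset.sum_mul_sum, Finset.sum_div]
    rw [Finset.sum_comm]
    refine sum_congr rfl fun q _ => ?_
    rw [Finset.sum_comm]
    refine sum_congr rfl fun r _ => sum_congr rfl fun n _ => ?_
    rw [div_mul_div_comm]
  have e2 : ∑ n ∈ Ioc 2 x, A1 n M ^ 2 - kappa * x =
      ∑ q ∈ Ioc 0 M, ∑ r ∈ Ioc 0 M, ((∑ n ∈ Ioc 2 x, (aA n q : ℝ) * aA n r - x * EE q r) / ((q : ℝ) * r))
      + x * (∑ q ∈ Ioc 0 M, ∑ r ∈ Ioc 0 M, EE q r / ((q : ℝ) * r) - kappa) := by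
    rw [e1, mul_sub, mul_sum]
    simp only [mul_sum, sub_div, Finset.sum_sub_distrib]
    simp only [mul_div_assoc]
    ring
  have b1 : |∑ q ∈ Ioc 0 M, ∑ r ∈ Ioc 0 M, ((∑ n ∈ Ioc 2 x, (aA n q : ℝ) * aA n r - x * EE q r) / ((q : ℝ) * r))| ≤ C * (M : ℝ) ^ (13 / 4 : ℝ) := by
    have t : ∀ q ∈ Ioc 0 M, ∀ r ∈ Ioc 0 M, |(∑ n ∈ Ioc 2 x, (aA n q : ℝ) * aA n r - x * EE q r) / ((q : ℝ) * r)| ≤ C * (M : ℝ) ^ (5 / 4 : ℝ) := by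
      intro q hq r hr
      rw [mem_Ioc] at hq hr
      have hq' : (1 : ℝ) ≤ q := by exact_mod_cast hq.1
      have hr' : (1 : ℝ) ≤ r := by exact_mod_cast hr.1
      have hqM : (q : ℝ) ≤ M := by exact_mod_cast hq.2
      have hrM : (r : ℝ) ≤ M := by exact_mod_cast hr.2
      rw [abs_div, abs_of_pos (by positivity : (0 : ℝ) < (q : ℝ) * r), div_le_iff₀ (by positivity)]
      refine (h q r x hq.1 hr.1 hx).trans ?_
      rw [show (13 / 8 : ℝ) = 5 / 8 + 1 by norm_num, Real.rpow_add (by positivity), Real.rpow_one, ← mul_assoc]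
      gcongr
      calc ((q : ℝ) * r) ^ (5 / 8 : ℝ) ≤ ((M : ℝ) * M) ^ (5 / 8 : ℝ) := by gcongr
        _ = _ := by rw [Real.mul_rpow hM0.le hM0.le, ← Real.rpow_add hM0]; norm_num
    calc _ ≤ ∑ q ∈ Ioc 0 M, ∑ r ∈ Ioc 0 M, C * (M : ℝ) ^ (5 / 4 : ℝ) := by
          refine (abs_sum_le_sum_abs _ _).trans (sum_le_sum fun q hq => ?_)
          exact (abs_sum_le_sum_abs _ _).trans (sum_le_sum fun r hr => t q hq r hr)
      _ = C * (M : ℝ) ^ (13 / 4 : ℝ) := by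
          simp only [Finset.sum_const, Nat.card_Ioc, nsmul_eq_mul, Nat.sub_zero]
          rw [show (13 / 4 : ℝ) = 1 + 1 + 5 / 4 by norm_num, Real.rpow_add hM0, Real.rpow_add hM0, Real.rpow_one]
          ring
  have b2 : |(x : ℝ) * (∑ q ∈ Ioc 0 M, ∑ r ∈ Ioc 0 M, EE q r / ((q : ℝ) * r) - kappa)| ≤ x * (D * (M : ℝ) ^ (-(1 / 4) : ℝ)) := by
    rw [abs_mul, Nat.abs_cast]
    exact mul_le_mul_of_nonneg_left (hk M hM) (Nat.cast_nonneg _)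
  rw [e2]
  refine (abs_add_le _ _).trans ((add_le_add b1 b2).trans ?_)
  have p1 : 0 ≤ (M : ℝ) ^ (13 / 4 : ℝ) := by positivity
  have p2 : 0 ≤ (x : ℝ) * (M : ℝ) ^ (-(1 / 4) : ℝ) := by positivity
  nlinarith

lemma root96 {x : ℕ} (hx : 1 ≤ x) : ∃ w : ℕ, 1 ≤ w ∧ w ^ 96 ≤ x ∧ x ≤ (2 * w) ^ 96 := by
  set w := Nat.findGreatest (fun w => w ^ 96 ≤ x) x with hw
  have h1 : 1 ≤ w := Nat.le_findGreatest hx (by simpa using hx)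
  have h2 : w ^ 96 ≤ x := Nat.findGreatest_spec (P := fun w => w ^ 96 ≤ x) hx (by simpa using hx)
  refine ⟨w, h1, h2, ?_⟩
  clear_value w
  have h3 : x ≤ (w + 1) ^ 96 := by
    by_contra h
    push Not at h
    have h4 : w + 1 ≤ x := (Nat.le_self_pow (by norm_num) _).trans h.le
    have := Nat.le_findGreatest (P := fun w => w ^ 96 ≤ x) h4 h.le
    omega
  exact h3.trans (Nat.pow_le_pow_left (by omega) 96)

/-- Mean square of the amplitudes with power saving. -/
lemma I2 : ∃ C δ : ℝ, 0 ≤ C ∧ 0 < δ ∧ δ < 1 ∧ ∀ x : ℕ, 1 ≤ x →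
    |∑ n ∈ Ioc 2 x, ampA n ^ 2 - kappa * x| ≤ C * (x : ℝ) ^ (1 - δ) := by
  obtain ⟨C, hC, h⟩ := A_sub_A1_meansq
  obtain ⟨D, hD, hA⟩ := A1_sq_mean
  set Z : ℝ := 2 ^ 96 with hZ
  have hZ1 : 1 ≤ Z := by rw [hZ]; exact one_le_pow₀ (by norm_num)
  clear_value Z
  refine ⟨|kappa| + (D * (1 + Z) + |kappa| * Z + D * (1 + Z) + 2 * C), 1 / 768, by positivity, by norm_num, by norm_num, fun x hx => ?_⟩
  have hx1 : (1 : ℝ) ≤ x := by exact_mod_cast hx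
  rcases eq_or_lt_of_le hx with rfl | hx2
  · simp
    have : 0 ≤ D * (1 + Z) + |kappa| * Z + D * (1 + Z) + 2 * C := by positivity
    linarith
  obtain ⟨w, hw, h1, h2⟩ := root96 hx
  have hw1 : (1 : ℝ) ≤ w := by exact_mod_cast hw
  have hw0 : (0 : ℝ) < w := by linarith
  have h1' : (w : ℝ) ^ (96 : ℝ) ≤ x := by
    rw [show (96 : ℝ) = ((96 : ℕ) : ℝ) by norm_num, Real.rpow_natCast]; exact_mod_cast h1
  have h2' : (x : ℝ) ≤ Z * (w : ℝ) ^ (96 : ℝ) := by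
    rw [show (96 : ℝ) = ((96 : ℕ) : ℝ) by norm_num, Real.rpow_natCast, hZ, ← mul_pow]; exact_mod_cast h2
  have hM : 1 ≤ w ^ 29 := Nat.one_le_pow _ _ hw
  have a1 := hA (w ^ 29) x hM hx2
  have mm : ∀ a : ℝ, ((w ^ 29 : ℕ) : ℝ) ^ a = (w : ℝ) ^ (29 * a) := by
    intro a
    rw [Real.rpow_mul hw0.le]; norm_cast
  rw [mm, mm] at a1
  set W : ℝ := (w : ℝ) ^ (96 - 1 / 8 : ℝ) with hW
  have hW0 : 0 ≤ W := by positivity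
  have hWx : W ≤ (x : ℝ) ^ (1 - 1 / 768 : ℝ) := by
    calc W = ((w : ℝ) ^ (96 : ℝ)) ^ (1 - 1 / 768 : ℝ) := by rw [hW, ← Real.rpow_mul hw0.le]; norm_num
      _ ≤ _ := by gcongr
  have r1 : (w : ℝ) ^ (29 * (13 / 4) : ℝ) ≤ W := Real.rpow_le_rpow_of_exponent_le hw1 (by norm_num)
  have r2 : (x : ℝ) * (w : ℝ) ^ (29 * -(1 / 4) : ℝ) ≤ Z * W := by
    calc _ ≤ (Z * (w : ℝ) ^ (96 : ℝ)) * (w : ℝ) ^ (29 * -(1 / 4) : ℝ) := by gcongr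
      _ = Z * (w : ℝ) ^ (96 + 29 * -(1 / 4) : ℝ) := by rw [Real.rpow_add hw0]; ring
      _ ≤ Z * W := by
        gcongr
        exact Real.rpow_le_rpow_of_exponent_le hw1 (by norm_num)
  have a2 : |∑ n ∈ Ioc 2 x, A1 n (w ^ 29) ^ 2 - kappa * x| ≤ D * (1 + Z) * W := by
    refine a1.trans ?_
    rw [mul_assoc]
    gcongr
    linarith
  set t : ℝ := (w : ℝ) ^ (-(1 / 8) : ℝ) with ht
  have ht0 : 0 < t := by positivity
  have ht1 : t ≤ 1 := Real.rpow_le_one_of_one_le_of_nonpos hw1 (by norm_num)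
  have a3 : ∑ n ∈ Ioc 2 x, (ampA n - A1 n (w ^ 29)) ^ 2 ≤ C * (w : ℝ) ^ (96 - 1 / 4 : ℝ) := by
    refine (Finset.sum_le_sum_of_subset_of_nonneg (Finset.Ioc_subset_Ioc_right h2) fun _ _ _ => sq_nonneg _).trans (h w hw)
  set S0 := ∑ n ∈ Ioc 2 x, ampA n ^ 2
  set S1 := ∑ n ∈ Ioc 2 x, A1 n (w ^ 29) ^ 2 with hS1
  set S2 := ∑ n ∈ Ioc 2 x, (ampA n - A1 n (w ^ 29)) ^ 2 with hS2
  have a4 : |S0 - S1| ≤ t * S1 + (1 + t⁻¹) * S2 := by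
    rw [← Finset.sum_sub_distrib, hS1, hS2, mul_sum, mul_sum, ← Finset.sum_add_distrib]
    refine (abs_sum_le_sum_abs _ _).trans (sum_le_sum fun n _ => ?_)
    set a := A1 n (w ^ 29)
    set b := ampA n - a with hb
    have e : ampA n ^ 2 - a ^ 2 = 2 * a * b + b ^ 2 := by rw [hb]; ring
    rw [e]
    have q1 : 0 ≤ t⁻¹ * (t * a - b) ^ 2 := by positivity
    have q2 : 0 ≤ t⁻¹ * (t * a + b) ^ 2 := by positivity
    have e1 : t⁻¹ * (t * a - b) ^ 2 = t * a ^ 2 - 2 * a * b + t⁻¹ * b ^ 2 := by field_simp; ring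
    have e2 : t⁻¹ * (t * a + b) ^ 2 = t * a ^ 2 + 2 * a * b + t⁻¹ * b ^ 2 := by field_simp; ring
    rw [abs_le]
    constructor <;> nlinarith [sq_nonneg b]
  have a5 : S1 ≤ |kappa| * Z * (w : ℝ) ^ (96 : ℝ) + D * (1 + Z) * W := by
    have := (abs_le.mp a2).2
    have k1 : kappa * x ≤ |kappa| * (Z * (w : ℝ) ^ (96 : ℝ)) := by
      refine (mul_le_mul_of_nonneg_right (le_abs_self _) (by positivity)).trans ?_
      gcongr
    linarith
  have a6 : t * S1 ≤ (|kappa| * Z + D * (1 + Z)) * W := by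
    have e : t * (w : ℝ) ^ (96 : ℝ) = W := by rw [ht, hW, ← Real.rpow_add hw0]; norm_num
    calc t * S1 ≤ t * (|kappa| * Z * (w : ℝ) ^ (96 : ℝ) + D * (1 + Z) * W) := by gcongr
      _ = |kappa| * Z * (t * (w : ℝ) ^ (96 : ℝ)) + D * (1 + Z) * (t * W) := by ring
      _ ≤ |kappa| * Z * W + D * (1 + Z) * (1 * W) := by rw [e]; gcongr
      _ = _ := by ring
  have a7 : (1 + t⁻¹) * S2 ≤ 2 * C * W := by
    have e : t⁻¹ * (w : ℝ) ^ (96 - 1 / 4 : ℝ) = W := by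
      rw [ht, hW, ← Real.rpow_neg hw0.le, ← Real.rpow_add hw0]; norm_num
    have i1 : 1 ≤ t⁻¹ := (one_le_inv₀ ht0).mpr ht1
    calc (1 + t⁻¹) * S2 ≤ (2 * t⁻¹) * (C * (w : ℝ) ^ (96 - 1 / 4 : ℝ)) := by
          gcongr
          linarith
      _ = 2 * C * (t⁻¹ * (w : ℝ) ^ (96 - 1 / 4 : ℝ)) := by ring
      _ = _ := by rw [e]
  have a8 : |S0 - kappa * x| ≤ (D * (1 + Z) + |kappa| * Z + D * (1 + Z) + 2 * C) * W := by
    have := abs_sub_le S0 S1 (kappa * x)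
    linarith
  calc |S0 - kappa * x| ≤ (D * (1 + Z) + |kappa| * Z + D * (1 + Z) + 2 * C) * W := a8
    _ ≤ (|kappa| + (D * (1 + Z) + |kappa| * Z + D * (1 + Z) + 2 * C)) * (x : ℝ) ^ (1 - 1 / 768 : ℝ) := by
      refine mul_le_mul ?_ hWx hW0 (by positivity)
      linarith [abs_nonneg kappa]

noncomputable def ev (n : ℕ) : ℝ := ((n : ℝ) + Real.sqrt ((n : ℝ) ^ 2 - 4)) / 2

lemma ev_sqrt_nonneg {n : ℕ} (hn : 2 < n) : (0 : ℝ) ≤ (n : ℝ) ^ 2 - 4 := by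
  have : (2 : ℝ) < n := by exact_mod_cast hn
  nlinarith

lemma ev_ge {n : ℕ} : (n : ℝ) / 2 ≤ ev n := by
  unfold ev; have := Real.sqrt_nonneg ((n : ℝ) ^ 2 - 4); linarith

lemma ev_gt {n : ℕ} (hn : 2 < n) : 1 < ev n := by
  have : (2 : ℝ) < n := by exact_mod_cast hn
  have := ev_ge (n := n); linarith

lemma ev_pos {n : ℕ} (hn : 2 < n) : 0 < ev n := by linarith [ev_gt hn]

lemma ev_le {n : ℕ} : ev n ≤ n := by
  unfold ev
  have : Real.sqrt ((n : ℝ) ^ 2 - 4) ≤ n := by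
    apply Real.sqrt_le_iff.mpr; constructor
    · positivity
    · linarith
  linarith

lemma ev_quad {n : ℕ} (hn : 2 < n) : ev n * (n - ev n) = 1 := by
  unfold ev
  have := Real.sq_sqrt (ev_sqrt_nonneg hn)
  nlinarith

lemma ev_inv {n : ℕ} (hn : 2 < n) : (ev n)⁻¹ = ((n : ℝ) - Real.sqrt ((n : ℝ) ^ 2 - 4)) / 2 := by
  rw [inv_eq_of_mul_eq_one_right (ev_quad hn)]
  unfold ev; ring

lemma log_Nnorm (n : ℕ) : Real.log (Nnorm n) = 2 * Real.log (ev n) := by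
  unfold Nnorm ev; rw [Real.log_pow]; norm_num

abbrev QB := AlgebraicClosure ℚ

instance qb1 : Algebra.IsAlgebraic ℚ QB := AlgebraicClosure.isAlgebraic ℚ
instance qb3 : IsAlgClosure ℚ QB := ⟨inferInstance, qb1⟩
instance qb2 : IsGalois ℚ QB := IsAlgClosure.isGalois ℚ QB

noncomputable def phiE : QB →ₐ[ℚ] ℂ := IsAlgClosed.lift

lemma rr_exists (n : ℕ) (hn : 2 < n) : ∃ r : QB, phiE r = ((Real.sqrt ((n : ℝ) ^ 2 - 4) : ℝ) : ℂ) ∧ r ^ 2 = (n : QB) ^ 2 - 4 := by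
  obtain ⟨r, hr⟩ := IsAlgClosed.exists_pow_nat_eq ((n : QB) ^ 2 - 4) (n := 2) (by norm_num)
  have h1 : (phiE r) ^ 2 = (((Real.sqrt ((n : ℝ) ^ 2 - 4) : ℝ) : ℂ)) ^ 2 := by
    rw [← map_pow, hr, ← Complex.ofReal_pow, Real.sq_sqrt (ev_sqrt_nonneg hn)]
    rw [map_sub, map_pow, map_natCast, map_ofNat phiE 4]
    simp
  rcases sq_eq_sq_iff_eq_or_eq_neg.mp h1 with h | h
  · exact ⟨r, h, hr⟩
  · exact ⟨-r, by rw [map_neg, h, neg_neg], by rw [neg_sq, hr]⟩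

noncomputable def rr (n : ℕ) : QB := if h : 2 < n then (rr_exists n h).choose else 1

lemma rr_phi {n : ℕ} (hn : 2 < n) : phiE (rr n) = ((Real.sqrt ((n : ℝ) ^ 2 - 4) : ℝ) : ℂ) := by
  rw [rr, dif_pos hn]; exact (rr_exists n hn).choose_spec.1

lemma rr_sq {n : ℕ} (hn : 2 < n) : rr n ^ 2 = (n : QB) ^ 2 - 4 := by
  rw [rr, dif_pos hn]; exact (rr_exists n hn).choose_spec.2

lemma rr_ne {n : ℕ} : rr n ≠ 0 := by
  by_cases hn : 2 < n
  · intro h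
    have h1 := rr_phi hn
    rw [h, _root_.map_zero] at h1
    have h2 : Real.sqrt ((n : ℝ) ^ 2 - 4) = 0 := by exact_mod_cast h1.symm
    have h3 : (2 : ℝ) < n := by exact_mod_cast hn
    rw [Real.sqrt_eq_zero (ev_sqrt_nonneg hn)] at h2
    nlinarith
  · rw [rr, dif_neg hn]; exact one_ne_zero

lemma rr_conj (n : ℕ) (σ : QB ≃ₐ[ℚ] QB) : σ (rr n) = rr n ∨ σ (rr n) = - rr n := by
  by_cases hn : 2 < n
  · apply sq_eq_sq_iff_eq_or_eq_neg.mp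
    rw [← map_pow, rr_sq hn, map_sub, map_pow, map_natCast, map_ofNat σ 4]
  · left; rw [rr, dif_neg hn, map_one]

lemma neg_rr_ne (n : ℕ) : - rr n ≠ rr n := fun h => rr_ne (self_eq_neg.mp h.symm)

open Classical in
noncomputable def chi (n : ℕ) : (QB ≃ₐ[ℚ] QB) →* ℝ where
  toFun σ := if σ (rr n) = rr n then 1 else -1
  map_one' := by simp
  map_mul' σ τ := by
    rcases rr_conj n σ with h1 | h1 <;> rcases rr_conj n τ with h2 | h2 <;>
      simp [AlgEquiv.mul_apply, h1, h2, neg_rr_ne]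

lemma chi_cases (n : ℕ) (σ : QB ≃ₐ[ℚ] QB) : (σ (rr n) = rr n ∧ chi n σ = 1) ∨ (σ (rr n) = - rr n ∧ chi n σ = -1) := by
  rcases rr_conj n σ with h | h
  · left; exact ⟨h, by simp [chi, h]⟩
  · right; exact ⟨h, by simp [chi, h, neg_rr_ne]⟩

lemma chi_eq_iff {a b : ℕ} (ha : 2 < a) (hb : 2 < b) : chi a = chi b ↔ IsSquare ((a ^ 2 - 4) * (b ^ 2 - 4) : ℕ) := by
  have ha4 : 4 ≤ a ^ 2 := by nlinarith
  have hb4 : 4 ≤ b ^ 2 := by nlinarith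
  have hsq : (rr a * rr b) ^ 2 = (((a ^ 2 - 4) * (b ^ 2 - 4) : ℕ) : QB) := by
    rw [mul_pow, rr_sq ha, rr_sq hb]; push_cast [ha4, hb4]; ring
  constructor
  · intro h
    have hfix : ∀ σ : QB ≃ₐ[ℚ] QB, σ (rr a * rr b) = rr a * rr b := by
      intro σ
      have hσ : chi a σ = chi b σ := by rw [h]
      rw [map_mul]
      rcases chi_cases a σ with ⟨h1, h2⟩ | ⟨h1, h2⟩ <;> rcases chi_cases b σ with ⟨h3, h4⟩ | ⟨h3, h4⟩
      · rw [h1, h3]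
      · rw [h2, h4] at hσ; norm_num at hσ
      · rw [h2, h4] at hσ; norm_num at hσ
      · rw [h1, h3]; ring
    obtain ⟨q, hq⟩ := (InfiniteGalois.mem_range_algebraMap_iff_fixed (k := ℚ) (rr a * rr b)).mpr hfix
    rw [← Rat.isSquare_natCast_iff]
    refine ⟨q, ?_⟩
    apply (algebraMap ℚ QB).injective
    rw [map_mul, hq, ← sq, hsq]; simp
  · rintro ⟨k, hk⟩
    have h1 : (rr a * rr b) ^ 2 = ((k : QB)) ^ 2 := by rw [hsq, hk]; push_cast; ring
    have hfix : ∀ σ : QB ≃ₐ[ℚ] QB, σ (rr a * rr b) = rr a * rr b := by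
      intro σ
      rcases sq_eq_sq_iff_eq_or_eq_neg.mp h1 with h | h <;> rw [h] <;> simp
    ext σ
    have := hfix σ
    rw [map_mul] at this
    have hne : rr a * rr b ≠ 0 := mul_ne_zero rr_ne rr_ne
    rcases chi_cases a σ with ⟨h1, h2⟩ | ⟨h1, h2⟩ <;> rcases chi_cases b σ with ⟨h3, h4⟩ | ⟨h3, h4⟩
    · rw [h2, h4]
    · rw [h1, h3, mul_neg] at this; exact absurd (self_eq_neg.mp this.symm) hne
    · rw [h1, h3, neg_mul] at this; exact absurd (self_eq_neg.mp this.symm) hne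
    · rw [h2, h4]

noncomputable def ebar (n : ℕ) : QB := ((n : QB) + rr n) / 2

lemma phi_conj {n : ℕ} (hn : 2 < n) (σ : QB ≃ₐ[ℚ] QB) : phiE (σ (ebar n)) = ((exp (chi n σ * Real.log (ev n)) : ℝ) : ℂ) := by
  have e : σ (ebar n) = ((n : QB) + σ (rr n)) / 2 := by
    unfold ebar; rw [map_div₀, map_add, map_natCast, map_ofNat σ 2]
  have hexp := Real.exp_log (ev_pos hn)
  rw [e]
  rcases chi_cases n σ with ⟨h1, h2⟩ | ⟨h1, h2⟩
  · rw [h1, h2, one_mul, hexp, map_div₀, map_add, rr_phi hn, map_natCast, map_ofNat phiE 2]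
    simp [ev]
  · rw [h1, h2, neg_one_mul, Real.exp_neg, hexp, ev_inv hn, map_div₀, map_add, map_neg, rr_phi hn, map_natCast, map_ofNat phiE 2]
    simp [sub_eq_add_neg]

lemma phi_prod {ι : Type*} (I : Finset ι) (n : ι → ℕ) (hn : ∀ i ∈ I, 2 < n i) (s : ι → ℤ) (σ : QB ≃ₐ[ℚ] QB) :
    phiE (σ (∏ i ∈ I, ebar (n i) ^ s i)) = ((exp (∑ i ∈ I, s i * (chi (n i) σ * Real.log (ev (n i)))) : ℝ) : ℂ) := by
  rw [map_prod, map_prod, Real.exp_sum, Complex.ofReal_prod]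
  refine Finset.prod_congr rfl fun i hi => ?_
  rw [map_zpow₀, map_zpow₀, phi_conj (hn i hi), ← Complex.ofReal_zpow, ← Real.rpow_intCast, ← Real.exp_mul, mul_comm]

/-- Independence of logarithms of units of distinct quadratic fields. -/
lemma N1 {ι : Type*} (I : Finset ι) (n : ι → ℕ) (hn : ∀ i ∈ I, 2 < n i) (s : ι → ℤ)
    (h : ∑ i ∈ I, s i * Real.log (ev (n i)) = 0) (a : ℕ) (ha : 2 < a) :
    ∑ i ∈ I with IsSquare ((a ^ 2 - 4) * ((n i) ^ 2 - 4) : ℕ), s i * Real.log (ev (n i)) = 0 := by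
  classical
  have h1 : ∏ i ∈ I, ebar (n i) ^ s i = 1 := by
    apply phiE.toRingHom.injective
    have := phi_prod I n hn s 1
    simp only [map_one, mul_one, one_mul, h, Real.exp_zero, AlgEquiv.one_apply] at this
    rw [map_one]; exact_mod_cast this
  have h2 : ∀ σ : QB ≃ₐ[ℚ] QB, ∑ i ∈ I, s i * (chi (n i) σ * Real.log (ev (n i))) = 0 := by
    intro σ
    have := phi_prod I n hn s σ
    rw [h1, map_one, map_one] at this
    have h3 : exp (∑ i ∈ I, s i * (chi (n i) σ * Real.log (ev (n i)))) = 1 := by exact_mod_cast this.symm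
    exact Real.exp_eq_one_iff _ |>.mp h3
  have hli := linearIndependent_iff'.mp (linearIndependent_monoidHom (QB ≃ₐ[ℚ] QB) ℝ)
    (I.image fun i => chi (n i)) (fun c => ∑ i ∈ I with chi (n i) = c, s i * Real.log (ev (n i))) (by
      funext σ
      rw [Finset.sum_apply, Pi.zero_apply, ← h2 σ, ← Finset.sum_fiberwise_of_maps_to (g := fun i => chi (n i)) (t := I.image fun i => chi (n i)) (fun i hi => Finset.mem_image_of_mem _ hi)]
      refine sum_congr rfl fun c _ => ?_
      rw [Pi.smul_apply, smul_eq_mul, Finset.sum_mul]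
      refine sum_congr rfl fun i hi => ?_
      rw [(Finset.mem_filter.mp hi).2]; ring)
  have e : (I.filter fun i => IsSquare ((a ^ 2 - 4) * ((n i) ^ 2 - 4) : ℕ)) = I.filter fun i => chi (n i) = chi a := by
    refine Finset.filter_congr fun i hi => ?_
    rw [eq_comm, chi_eq_iff ha (hn i hi)]
  have goal : ∑ i ∈ I with chi (n i) = chi a, s i * Real.log (ev (n i)) = 0 := by
    by_cases hc : chi a ∈ I.image fun i => chi (n i)
    · exact hli _ hc
    · rw [Finset.filter_eq_empty_iff.mpr, Finset.sum_empty]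
      intro i hi h
      exact hc (Finset.mem_image.mpr ⟨i, hi, h⟩)
  convert goal using 2

lemma ebar_quad {n : ℕ} (hn : 2 < n) : ebar n * ((n : QB) - ebar n) = 1 := by
  have h := rr_sq hn
  unfold ebar
  have h2 : (2 : QB) ≠ 0 := two_ne_zero
  field_simp
  linear_combination -h

lemma ebar_integral {n : ℕ} (hn : 2 < n) : IsIntegral ℤ (ebar n) := by
  refine ⟨Polynomial.X ^ 2 - Polynomial.C (n : ℤ) * Polynomial.X + Polynomial.C 1, by monicity!, ?_⟩
  have := ebar_quad hn
  simp only [Polynomial.eval₂_add, Polynomial.eval₂_sub, Polynomial.eval₂_mul, Polynomial.eval₂_pow, Polynomial.eval₂_X, Polynomial.eval₂_C]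
  rw [map_one, map_natCast]
  linear_combination -this

lemma ebar_zpow_integral {n : ℕ} (hn : 2 < n) {s : ℤ} (hs : |s| ≤ 1) : IsIntegral ℤ (ebar n ^ s) := by
  rw [abs_le] at hs
  obtain h | h | h : s = -1 ∨ s = 0 ∨ s = 1 := by omega
  · rw [h, zpow_neg_one, inv_eq_of_mul_eq_one_right (ebar_quad hn)]
    exact (isIntegral_natCast (R := ℤ) n).sub (ebar_integral hn)
  · rw [h, zpow_zero]; exact isIntegral_one
  · rw [h, zpow_one]; exact ebar_integral hn

/-- Lower bound for nonzero combinations of logarithms of units. -/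
lemma N2 {j : ℕ} (n : Fin j → ℕ) (X : ℕ) (hn : ∀ i, 2 < n i) (hX : ∀ i, n i ≤ X) (hX1 : 1 ≤ X) (s : Fin j → ℤ) (hs : ∀ i, |s i| ≤ 1)
    (hne : ∑ i, s i * Real.log (ev (n i)) ≠ 0) :
    1 / (2 * (2 * (X : ℝ) ^ j) ^ (2 ^ j)) ≤ |∑ i, s i * Real.log (ev (n i))| := by
  classical
  set x : ℝ := ∑ i, s i * Real.log (ev (n i)) with hx
  have hX1' : (1 : ℝ) ≤ X := by exact_mod_cast hX1
  set B : ℝ := 2 * (X : ℝ) ^ j with hB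
  have hXj : (1 : ℝ) ≤ (X : ℝ) ^ j := one_le_pow₀ hX1'
  have hB1 : 1 ≤ B := by rw [hB]; linarith
  set a : QB := 1 - ∏ i, ebar (n i) ^ s i with ha
  have hphi : ∀ σ : QB ≃ₐ[ℚ] QB, phiE (σ a) = ((1 - exp (∑ i, s i * (chi (n i) σ * Real.log (ev (n i)))) : ℝ) : ℂ) := by
    intro σ
    rw [ha, map_sub, map_sub, map_one, map_one, phi_prod Finset.univ n (fun i _ => hn i) s σ]
    push_cast; rfl
  have hphia : phiE a = ((1 - exp x : ℝ) : ℂ) := by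
    have := hphi 1
    simpa [hx] using this
  have ha0 : a ≠ 0 := by
    intro h
    rw [h, _root_.map_zero] at hphia
    have h1 : 1 - exp x = 0 := by exact_mod_cast hphia.symm
    exact hne ((Real.exp_eq_one_iff _).mp (by linarith))
  have hbd : ∀ σ : QB ≃ₐ[ℚ] QB, ‖phiE (σ a)‖ ≤ B := by
    intro σ
    rw [hphi, Complex.norm_real, Real.norm_eq_abs]
    have h1 : exp (∑ i, s i * (chi (n i) σ * Real.log (ev (n i)))) ≤ (X : ℝ) ^ j := by
      rw [← Real.exp_log (by positivity : (0 : ℝ) < (X : ℝ) ^ j), Real.log_pow]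
      apply Real.exp_le_exp.mpr
      calc ∑ i, s i * (chi (n i) σ * Real.log (ev (n i))) ≤ ∑ i : Fin j, Real.log X := by
            refine sum_le_sum fun i _ => ?_
            have hl0 : 0 ≤ Real.log (ev (n i)) := Real.log_nonneg (ev_gt (hn i)).le
            have hl1 : Real.log (ev (n i)) ≤ Real.log X := Real.log_le_log (ev_pos (hn i)) (ev_le.trans (by exact_mod_cast hX i))
            have hs' : |(s i : ℝ)| ≤ 1 := by exact_mod_cast hs i
            have hc : |chi (n i) σ| = 1 := by rcases chi_cases (n i) σ with ⟨_, h⟩ | ⟨_, h⟩ <;> rw [h] <;> simp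
            refine (le_abs_self _).trans ?_
            rw [abs_mul, abs_mul, hc, one_mul, abs_of_nonneg hl0]
            nlinarith [abs_nonneg (s i : ℝ)]
        _ = j * Real.log X := by simp
    have h0 := Real.exp_pos (∑ i, s i * (chi (n i) σ * Real.log (ev (n i))))
    rw [abs_le]
    constructor <;> linarith
  have hint : IsIntegral ℤ a := by
    refine isIntegral_one.sub (IsIntegral.prod _ fun i _ => ebar_zpow_integral (hn i) (hs i))
  have hintQ : IsIntegral ℚ a := Algebra.IsIntegral.isIntegral a
  have hmp := minpoly.isIntegrallyClosed_eq_field_fractions' ℚ hint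
  set P := (minpoly ℚ a).map (algebraMap ℚ QB) with hP
  have hPm : P.Monic := (minpoly.monic hintQ).map _
  have hsep : P.Separable := (minpoly.irreducible hintQ).separable.map
  have hnd : P.roots.Nodup := Polynomial.nodup_roots hsep
  have hco := (IsAlgClosed.splits P).coeff_zero_eq_prod_roots_of_monic hPm
  set m : ℤ := (minpoly ℤ a).coeff 0 with hm
  have hPm0 : P.coeff 0 = (m : QB) := by
    rw [hP, hmp, Polynomial.map_map, Polynomial.coeff_map, ← hm]; simp
  have hm0 : m ≠ 0 := by
    intro h
    have := minpoly.coeff_zero_ne_zero hintQ ha0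
    rw [hmp, Polynomial.coeff_map, ← hm, h] at this
    simp at this
  have hRm : ∀ b ∈ P.roots.toFinset, ∃ σ : QB ≃ₐ[ℚ] QB, σ a = b := by
    intro b hb
    rw [Multiset.mem_toFinset, Polynomial.mem_roots hPm.ne_zero, hP, Polynomial.IsRoot, Polynomial.eval_map_algebraMap] at hb
    exact minpoly.exists_algEquiv_of_root' hintQ.isAlgebraic hb
  have hprod : 1 ≤ ∏ b ∈ P.roots.toFinset, ‖phiE b‖ := by
    have h1 : ∏ b ∈ P.roots.toFinset, phiE b = phiE (P.roots.prod) := by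
      rw [← map_prod]
      congr 1
      rw [Finset.prod, Multiset.toFinset_val, hnd.dedup, Multiset.map_id']
    rw [← norm_prod, h1]
    have h2 : ‖phiE P.roots.prod‖ = |(m : ℝ)| := by
      have h3 := congrArg (fun z => ‖phiE z‖) hco
      simp only [hPm0, map_mul, map_pow, map_neg, map_one, norm_mul, norm_pow, norm_neg, norm_one, one_pow, one_mul, map_intCast] at h3
      rw [← h3]
      rw [Complex.norm_intCast]
    rw [h2]
    exact_mod_cast Int.one_le_abs hm0
  have hcard : P.roots.toFinset.card ≤ 2 ^ j := by
    set S : Finset ℂ := (Finset.univ : Finset (Fin j → Bool)).image (fun u => ((1 - exp (∑ i, s i * ((if u i then (1 : ℝ) else -1) * Real.log (ev (n i)))) : ℝ) : ℂ))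
    have h1 : P.roots.toFinset.image phiE ⊆ S := by
      intro z hz
      obtain ⟨b, hb, rfl⟩ := Finset.mem_image.mp hz
      obtain ⟨σ, rfl⟩ := hRm b hb
      refine Finset.mem_image.mpr ⟨fun i => decide (chi (n i) σ = 1), Finset.mem_univ _, ?_⟩
      rw [hphi]
      congr 4
      funext i
      congr 2
      rcases chi_cases (n i) σ with ⟨_, h⟩ | ⟨_, h⟩ <;> norm_num [h]
    rw [← Finset.card_image_of_injective _ phiE.toRingHom.injective]
    refine (Finset.card_le_card h1).trans (Finset.card_image_le.trans ?_)
    simp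
  have haR : a ∈ P.roots.toFinset := by
    rw [Multiset.mem_toFinset, Polynomial.mem_roots hPm.ne_zero, hP, Polynomial.IsRoot, Polynomial.eval_map_algebraMap]
    exact minpoly.aeval ℚ a
  have hfin : 1 ≤ ‖phiE a‖ * B ^ (2 ^ j) := by
    rw [← Finset.mul_prod_erase _ _ haR] at hprod
    refine hprod.trans (mul_le_mul_of_nonneg_left ?_ (norm_nonneg _))
    calc ∏ b ∈ P.roots.toFinset.erase a, ‖phiE b‖ ≤ ∏ b ∈ P.roots.toFinset.erase a, B := by
          refine Finset.prod_le_prod (fun _ _ => norm_nonneg _) fun b hb => ?_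
          obtain ⟨σ, rfl⟩ := hRm b (Finset.mem_of_mem_erase hb)
          exact hbd σ
      _ = B ^ (P.roots.toFinset.erase a).card := by rw [Finset.prod_const]
      _ ≤ B ^ (2 ^ j) := pow_le_pow_right₀ hB1 ((Finset.card_le_card (Finset.erase_subset _ _)).trans hcard)
  have hBp : 1 ≤ B ^ (2 ^ j) := one_le_pow₀ hB1
  rcases le_or_gt |x| 1 with h1 | h1
  · have h2 : ‖phiE a‖ ≤ 2 * |x| := by
      rw [hphia, Complex.norm_real, Real.norm_eq_abs, abs_sub_comm]
      exact Real.abs_exp_sub_one_le h1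
    rw [div_le_iff₀ (by positivity)]
    nlinarith
  · refine le_trans ?_ h1.le
    rw [div_le_iff₀ (by positivity)]; linarith

noncomputable section KGsec
variable {ι : Type} [Fintype ι]

/-- Dual group of the group generated by the frequencies. -/
def KG (l : ι → ℝ) : Subgroup (ι → Circle) where
  carrier := {χ | ∀ k : ι → ℤ, ∑ i, k i * l i = 0 → ∏ i, χ i ^ k i = 1}
  one_mem' := by intro k _; simp
  mul_mem' := by
    intro a b ha hb k hk
    simp only [Pi.mul_apply, mul_zpow, Finset.prod_mul_distrib]
    rw [ha k hk, hb k hk, one_mul]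
  inv_mem' := by
    intro a ha k hk
    simp only [Pi.inv_apply, inv_zpow, Finset.prod_inv_distrib]
    rw [ha k hk, inv_one]

lemma KG_closed (l : ι → ℝ) : IsClosed (KG l : Set (ι → Circle)) := by
  have : (KG l : Set (ι → Circle)) = ⋂ k : ι → ℤ, ⋂ _ : ∑ i, k i * l i = 0, {χ | ∏ i, χ i ^ k i = 1} := by
    ext χ; simp [KG]
  rw [this]
  refine isClosed_iInter fun k => isClosed_iInter fun _ => isClosed_eq ?_ continuous_const
  exact continuous_finsetProd _ fun i _ => (continuous_apply i).zpow _

instance KG_compact (l : ι → ℝ) : CompactSpace (KG l) := isCompact_iff_compactSpace.mp (KG_closed l).isCompact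

instance KG_ms (l : ι → ℝ) : MeasurableSpace (KG l) := borel _
instance KG_bs (l : ι → ℝ) : BorelSpace (KG l) := ⟨rfl⟩

def KGmu (l : ι → ℝ) : Measure (KG l) := Measure.haarMeasure ⊤

instance KGmu_prob (l : ι → ℝ) : IsProbabilityMeasure (KGmu l) := by
  constructor
  have := Measure.haarMeasure_self (K₀ := (⊤ : TopologicalSpace.PositiveCompacts (KG l)))
  simpa [KGmu] using this

instance KGmu_inv (l : ι → ℝ) : (KGmu l).IsMulLeftInvariant := by unfold KGmu; infer_instance

lemma circle_prod (l : ι → ℝ) (t : ℝ) (k : ι → ℤ) : ∏ i, Circle.exp (t * l i) ^ k i = Circle.exp (t * ∑ i, k i * l i) := by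
  have h1 : ∀ S : Finset ι, ∏ i ∈ S, Circle.exp (t * l i) ^ k i = Circle.exp (t * ∑ i ∈ S, k i * l i) := by
    classical
    intro S
    induction S using Finset.induction_on with
    | empty => simp
    | insert a S ha ih =>
      rw [Finset.prod_insert ha, Finset.sum_insert ha, ih, mul_add, Circle.exp_add, ← Circle.exp_intCast_mul]
      congr 2; ring
  exact h1 _

lemma KG_flow (l : ι → ℝ) (t : ℝ) : (fun i => Circle.exp (t * l i)) ∈ KG l := by
  intro k hk
  rw [circle_prod, hk, mul_zero, Circle.exp_zero]

lemma KG_int (l : ι → ℝ) (k : ι → ℤ) : ∫ χ : KG l, ((∏ i, χ.1 i ^ k i : Circle) : ℂ) ∂(KGmu l) = if ∑ i, k i * l i = 0 then 1 else 0 := by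
  split_ifs with h
  · have : ∀ χ : KG l, ((∏ i, χ.1 i ^ k i : Circle) : ℂ) = 1 := by
      intro χ
      rw [χ.2 k h]; rfl
    simp [this]
  · set x := ∑ i, k i * l i with hx
    have h1 := integral_mul_left_eq_self (μ := KGmu l) (fun χ : KG l => ((∏ i, χ.1 i ^ k i : Circle) : ℂ)) ⟨_, KG_flow l (Real.pi / x)⟩
    have h2 : ∀ χ : KG l, (((∏ i, ((⟨_, KG_flow l (Real.pi / x)⟩ : KG l) * χ).1 i ^ k i : Circle)) : ℂ) = - ((∏ i, χ.1 i ^ k i : Circle) : ℂ) := by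
      intro χ
      have : ∏ i, ((⟨_, KG_flow l (Real.pi / x)⟩ : KG l) * χ).1 i ^ k i = Circle.exp Real.pi * ∏ i, χ.1 i ^ k i := by
        simp only [Subgroup.coe_mul, Pi.mul_apply, mul_zpow, Finset.prod_mul_distrib]
        rw [circle_prod, ← hx, div_mul_cancel₀ _ h]
      rw [this, Circle.coe_mul, Circle.coe_exp, Complex.exp_pi_mul_I]
      ring
    simp only [h2] at h1
    rw [integral_neg] at h1
    exact self_eq_neg.mp h1.symm

instance KG_sc (l : ι → ℝ) : SecondCountableTopology (KG l) := inferInstance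

end KGsec

noncomputable section

lemma taylor_I_nonneg (n : ℕ) : ∀ x : ℝ, 0 ≤ x → ‖Complex.exp (x * Complex.I) - ∑ j ∈ range n, ((x:ℂ) * Complex.I) ^ j / (j.factorial : ℂ)‖ ≤ x ^ n / n.factorial := by
  induction n with
  | zero =>
    intro x _
    simp [Complex.norm_exp_ofReal_mul_I]
  | succ n ih =>
    intro x hx
    have hd : ∀ y : ℝ, HasDerivAt (fun y : ℝ => Complex.exp (y * Complex.I) - ∑ j ∈ range (n+1), ((y:ℂ) * Complex.I) ^ j / (j.factorial : ℂ)) (Complex.I * (Complex.exp (y * Complex.I) - ∑ j ∈ range n, ((y:ℂ) * Complex.I) ^ j / (j.factorial : ℂ))) y := by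
      intro y
      have h0 : HasDerivAt (fun y : ℝ => (y:ℂ) * Complex.I) Complex.I y := by
        simpa using (Complex.ofRealCLM.hasDerivAt (x := y)).mul_const Complex.I
      have h1 := h0.cexp
      have h2 : HasDerivAt (fun y : ℝ => ∑ j ∈ range (n+1), ((y:ℂ) * Complex.I) ^ j / (j.factorial : ℂ)) (∑ j ∈ range (n+1), ((j:ℂ) * ((y:ℂ) * Complex.I) ^ (j-1) * Complex.I) / (j.factorial : ℂ)) y := by
        refine HasDerivAt.fun_sum fun j _ => ?_
        exact (h0.pow j).div_const _
      refine (h1.sub h2).congr_deriv ?_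
      rw [Finset.sum_range_succ']
      simp only [Nat.cast_zero, zero_mul, zero_div, add_zero, mul_sub, mul_sum]
      congr 1
      · ring
      · refine sum_congr rfl fun j _ => ?_
        rw [Nat.factorial_succ]
        have : (j.factorial : ℂ) ≠ 0 := by exact_mod_cast j.factorial_ne_zero
        have h3 : ((j:ℂ) + 1) ≠ 0 := by exact_mod_cast j.succ_ne_zero
        push_cast
        field_simp
    have hB : ∀ y : ℝ, HasDerivAt (fun y : ℝ => y ^ (n+1) / ((n+1).factorial : ℝ)) (y ^ n / n.factorial) y := by
      intro y
      refine ((hasDerivAt_pow (n+1) y).div_const _).congr_deriv ?_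
      rw [Nat.factorial_succ]
      have : (n.factorial : ℝ) ≠ 0 := by exact_mod_cast n.factorial_ne_zero
      have h3 : ((n:ℝ) + 1) ≠ 0 := by exact_mod_cast n.succ_ne_zero
      push_cast
      field_simp
    have := image_norm_le_of_norm_deriv_right_le_deriv_boundary (a := 0) (b := x) (f := fun y : ℝ => Complex.exp (y * Complex.I) - ∑ j ∈ range (n+1), ((y:ℂ) * Complex.I) ^ j / (j.factorial : ℂ)) (fun y _ => (hd y).continuousAt.continuousWithinAt) (fun y _ => (hd y).hasDerivWithinAt) (B := fun y : ℝ => y ^ (n+1) / ((n+1).factorial : ℝ)) (B' := fun y => y ^ n / n.factorial) ?_ hB ?_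
    · exact this (Set.right_mem_Icc.mpr hx)
    · rw [Finset.sum_range_succ']
      simp
    · intro y hy
      rw [norm_mul, Complex.norm_I, one_mul]
      exact ih y hy.1

lemma taylor_I (n : ℕ) (x : ℝ) : ‖Complex.exp (x * Complex.I) - ∑ j ∈ range n, ((x:ℂ) * Complex.I) ^ j / (j.factorial : ℂ)‖ ≤ |x| ^ n / n.factorial := by
  rcases le_total 0 x with h | h
  · rw [abs_of_nonneg h]; exact taylor_I_nonneg n x h
  · rw [abs_of_nonpos h]
    refine le_trans (le_of_eq ?_) (taylor_I_nonneg n (-x) (by linarith))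
    rw [← Complex.norm_conj]
    congr 1
    rw [map_sub, map_sum, ← Complex.exp_conj]
    simp

lemma pow_le_exp_sum (x : ℝ) (J : ℕ) : x ^ (2*J) / (2*J).factorial ≤ exp x + exp (-x) := by
  have h1 : x ^ (2*J) = |x| ^ (2*J) := by rw [pow_mul, pow_mul, sq_abs]
  rw [h1]
  refine (Real.pow_div_factorial_le_exp _ (abs_nonneg x) _).trans ?_
  rcases abs_cases x with h | h <;> rw [h.1] <;> linarith [Real.exp_pos x, Real.exp_pos (-x)]

lemma pow_bd {Ω : Type*} [MeasurableSpace Ω] {μ : Measure Ω} [IsProbabilityMeasure μ] {F : Ω → ℝ} {B : ℝ} (hF : Measurable F) (hB : ∀ ω, |F ω| ≤ B) (j : ℕ) : Integrable (fun ω => F ω ^ j) μ := by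
  refine Integrable.of_bound (hF.pow_const j).aestronglyMeasurable (B ^ j) (Eventually.of_forall fun ω => ?_)
  rw [Real.norm_eq_abs, abs_pow]
  exact pow_le_pow_left₀ (abs_nonneg _) (hB ω) _

lemma taylor_E {Ω : Type*} [MeasurableSpace Ω] {μ : Measure Ω} [IsProbabilityMeasure μ] {F : Ω → ℝ} {B : ℝ} (hF : Measurable F) (hB : ∀ ω, |F ω| ≤ B) (J : ℕ) (ξ : ℝ) :
    ‖∫ ω, Complex.exp ((ξ * F ω : ℝ) * Complex.I) ∂μ - ∑ j ∈ range (2*J), ((ξ:ℂ) * Complex.I) ^ j / (j.factorial : ℂ) * ((∫ ω, F ω ^ j ∂μ : ℝ) : ℂ)‖ ≤ ξ ^ (2*J) / (2*J).factorial * ∫ ω, F ω ^ (2*J) ∂μ := by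
  have h1 : ∑ j ∈ range (2*J), ((ξ:ℂ) * Complex.I) ^ j / (j.factorial : ℂ) * ((∫ ω, F ω ^ j ∂μ : ℝ) : ℂ) = ∫ ω, ∑ j ∈ range (2*J), (((ξ * F ω : ℝ):ℂ) * Complex.I) ^ j / (j.factorial : ℂ) ∂μ := by
    rw [integral_finsetSum]
    · refine sum_congr rfl fun j _ => ?_
      rw [← integral_complex_ofReal, ← integral_const_mul]
      congr 1; ext ω; push_cast; ring
    · intro j _
      have := ((pow_bd (μ := μ) hF hB j).ofReal (𝕜 := ℂ)).const_mul (((ξ:ℂ) * Complex.I) ^ j / (j.factorial : ℂ))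
      convert this using 2 with ω
      simp; ring
  have hi2 : Integrable (fun ω => ∑ j ∈ range (2*J), (((ξ * F ω : ℝ):ℂ) * Complex.I) ^ j / (j.factorial : ℂ)) μ := by
    refine integrable_finsetSum _ fun j _ => ?_
    have := ((pow_bd (μ := μ) hF hB j).ofReal (𝕜 := ℂ)).const_mul (((ξ:ℂ) * Complex.I) ^ j / (j.factorial : ℂ))
    refine this.congr (Eventually.of_forall fun ω => ?_)
    simp; ring
  have hi1 : Integrable (fun ω => Complex.exp ((ξ * F ω : ℝ) * Complex.I)) μ := by
    refine Integrable.of_bound (C := 1) ?_ (Eventually.of_forall fun ω => by rw [Complex.norm_exp_ofReal_mul_I])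
    exact (Complex.measurable_exp.comp ((Complex.measurable_ofReal.comp (hF.const_mul ξ)).mul_const _)).aestronglyMeasurable
  rw [h1, ← integral_sub hi1 hi2, ← integral_const_mul]
  refine norm_integral_le_of_norm_le ((pow_bd hF hB _).const_mul _) (Eventually.of_forall fun ω => ?_)
  refine (taylor_I (2*J) (ξ * F ω)).trans (le_of_eq ?_)
  have h1 : |ξ * F ω| ^ (2*J) = (ξ * F ω) ^ (2*J) := by rw [pow_mul, pow_mul, sq_abs]
  rw [h1, mul_pow]; ring

lemma mom_exp {Ω : Type*} [MeasurableSpace Ω] {μ : Measure Ω} [IsProbabilityMeasure μ] {F : Ω → ℝ} {B : ℝ} (hF : Measurable F) (hB : ∀ ω, |F ω| ≤ B) (J : ℕ) {l : ℝ} (hl : 0 < l) {M : ℝ} (h1 : ∫ ω, exp (l * F ω) ∂μ ≤ M) (h2 : ∫ ω, exp (-l * F ω) ∂μ ≤ M) :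
    (∫ ω, F ω ^ (2*J) ∂μ) / (2*J).factorial ≤ 2 * M / l ^ (2*J) := by
  rw [le_div_iff₀ (by positivity), div_mul_eq_mul_div, mul_comm, ← integral_const_mul, ← integral_div]
  have hi : ∀ c : ℝ, Integrable (fun ω => exp (c * F ω)) μ := by
    intro c
    refine Integrable.of_bound (C := exp (|c| * B)) (Real.measurable_exp.comp (hF.const_mul c)).aestronglyMeasurable (Eventually.of_forall fun ω => ?_)
    rw [Real.norm_eq_abs, abs_of_pos (Real.exp_pos _)]
    apply Real.exp_le_exp.mpr
    refine (le_abs_self _).trans ?_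
    rw [abs_mul]
    exact mul_le_mul_of_nonneg_left (hB ω) (abs_nonneg _)
  refine le_trans (integral_mono (((pow_bd hF hB _).const_mul _).div_const _) ((hi l).add (hi (-l))) (fun ω => ?_)) ?_
  · simp only [Pi.add_apply]
    rw [← mul_pow, neg_mul]
    exact pow_le_exp_sum _ _
  · rw [integral_add' (hi _) (hi _)]
    linarith

/-- comparison of characteristic functions through moments -/
lemma mom_compare {Ω Ω' : Type*} [MeasurableSpace Ω] [MeasurableSpace Ω'] {μ : Measure Ω} [IsProbabilityMeasure μ] {ν : Measure Ω'} [IsProbabilityMeasure ν] {F : Ω → ℝ} {X : Ω' → ℝ} {B B' : ℝ} (hF : Measurable F) (hB : ∀ ω, |F ω| ≤ B) (hX : Measurable X) (hB' : ∀ ω, |X ω| ≤ B') (J : ℕ) (ξ : ℝ) {M δ : ℝ} (hδ0 : 0 ≤ δ) (h1 : ∫ ω, exp ((2 * (|ξ| + 1)) * X ω) ∂ν ≤ M) (h2 : ∫ ω, exp (-(2 * (|ξ| + 1)) * X ω) ∂ν ≤ M)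
    (hδ : ∀ j ≤ 2*J, |∫ ω, F ω ^ j ∂μ - ∫ ω, X ω ^ j ∂ν| ≤ δ) :
    ‖∫ ω, Complex.exp ((ξ * F ω : ℝ) * Complex.I) ∂μ - ∫ ω, Complex.exp ((ξ * X ω : ℝ) * Complex.I) ∂ν‖ ≤ 2 * δ * exp |ξ| + 4 * M / 2 ^ (2*J) := by
  have hM0 : 0 ≤ M := le_trans (integral_nonneg fun _ => (Real.exp_pos _).le) h1
  have t1 := taylor_E (μ := μ) hF hB J ξ
  have t2 := taylor_E (μ := ν) hX hB' J ξ
  have m := mom_exp (μ := ν) hX hB' J (l := 2 * (|ξ| + 1)) (by positivity) h1 h2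
  set a := ∫ ω, Complex.exp ((ξ * F ω : ℝ) * Complex.I) ∂μ
  set b := ∫ ω, Complex.exp ((ξ * X ω : ℝ) * Complex.I) ∂ν
  set sa := ∑ j ∈ range (2*J), ((ξ:ℂ) * Complex.I) ^ j / (j.factorial : ℂ) * ((∫ ω, F ω ^ j ∂μ : ℝ) : ℂ) with hsa
  set sb := ∑ j ∈ range (2*J), ((ξ:ℂ) * Complex.I) ^ j / (j.factorial : ℂ) * ((∫ ω, X ω ^ j ∂ν : ℝ) : ℂ) with hsb
  have t3 : ‖sa - sb‖ ≤ δ * exp |ξ| := by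
    rw [hsa, hsb, ← Finset.sum_sub_distrib]
    refine (norm_sum_le _ _).trans ?_
    have : ∀ j ∈ range (2*J), ‖((ξ:ℂ) * Complex.I) ^ j / (j.factorial : ℂ) * ((∫ ω, F ω ^ j ∂μ : ℝ) : ℂ) - ((ξ:ℂ) * Complex.I) ^ j / (j.factorial : ℂ) * ((∫ ω, X ω ^ j ∂ν : ℝ) : ℂ)‖ ≤ δ * (|ξ| ^ j / j.factorial) := by
      intro j hj
      rw [← mul_sub, norm_mul, ← Complex.ofReal_sub, Complex.norm_real, norm_div, norm_pow, norm_mul, Complex.norm_I, mul_one, Complex.norm_real, Complex.norm_natCast, mul_comm, Real.norm_eq_abs, Real.norm_eq_abs]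
      exact mul_le_mul_of_nonneg_right (hδ j (Finset.mem_range.mp hj).le) (by positivity)
    refine (sum_le_sum this).trans ?_
    rw [← mul_sum]
    exact mul_le_mul_of_nonneg_left (Real.sum_le_exp_of_nonneg (abs_nonneg _) _) hδ0
  have hd := (abs_le.mp (hδ (2*J) le_rfl)).2
  set mF := ∫ ω, F ω ^ (2*J) ∂μ
  set mX := ∫ ω, X ω ^ (2*J) ∂ν
  have hq : ξ ^ (2*J) = |ξ| ^ (2*J) := by rw [pow_mul, pow_mul, sq_abs]
  have h3 : ξ ^ (2*J) / (2*J).factorial ≤ exp |ξ| := by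
    rw [hq]; exact Real.pow_div_factorial_le_exp _ (abs_nonneg _) _
  have h30 : 0 ≤ ξ ^ (2*J) / (2*J).factorial := by rw [hq]; positivity
  have h4 : ξ ^ (2*J) / (2*J).factorial * mX ≤ 2 * M / 2 ^ (2*J) := by
    calc ξ ^ (2*J) / (2*J).factorial * mX = |ξ| ^ (2*J) * (mX / (2*J).factorial) := by rw [hq]; ring
      _ ≤ |ξ| ^ (2*J) * (2 * M / (2 * (|ξ| + 1)) ^ (2*J)) := mul_le_mul_of_nonneg_left m (by positivity)
      _ ≤ (|ξ| + 1) ^ (2*J) * (2 * M / (2 * (|ξ| + 1)) ^ (2*J)) := by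
        refine mul_le_mul_of_nonneg_right (pow_le_pow_left₀ (abs_nonneg _) (by linarith) _) (by positivity)
      _ = 2 * M / 2 ^ (2*J) := by
        rw [mul_pow]
        have : (|ξ| + 1) ^ (2*J) ≠ 0 := by positivity
        field_simp
  have h5 : ξ ^ (2*J) / (2*J).factorial * mF ≤ 2 * M / 2 ^ (2*J) + δ * exp |ξ| := by
    have : ξ ^ (2*J) / (2*J).factorial * mF ≤ ξ ^ (2*J) / (2*J).factorial * (mX + δ) := mul_le_mul_of_nonneg_left (by linarith) h30
    nlinarith [mul_le_mul_of_nonneg_right h3 hδ0]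
  have h6 : a - b = (a - sa) + (sa - sb) - (b - sb) := by ring
  rw [h6]
  have e1 := norm_sub_le (a - sa + (sa - sb)) (b - sb)
  have e2 := norm_add_le (a - sa) (sa - sb)
  have e3 : 4 * M / 2 ^ (2*J) = 2 * M / 2 ^ (2*J) + 2 * M / 2 ^ (2*J) := by ring
  rw [e3]; linarith

end

noncomputable section
section indep
variable {D E : Type} [Fintype D] [MeasurableSpace E] {m : Measure E} [IsProbabilityMeasure m]

lemma prod_diff_le (S : Finset D) (a b : D → ℂ) (ha : ∀ d, ‖a d‖ ≤ 1) (hb : ∀ d, ‖b d‖ ≤ 1) : ‖∏ d ∈ S, a d - ∏ d ∈ S, b d‖ ≤ ∑ d ∈ S, ‖a d - b d‖ := by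
  classical
  induction S using Finset.induction_on with
  | empty => simp
  | insert x S hx ih =>
    rw [Finset.prod_insert hx, Finset.prod_insert hx, Finset.sum_insert hx]
    have h1 : a x * ∏ d ∈ S, a d - b x * ∏ d ∈ S, b d = (a x - b x) * ∏ d ∈ S, a d + b x * (∏ d ∈ S, a d - ∏ d ∈ S, b d) := by ring
    rw [h1]
    refine (norm_add_le _ _).trans ?_
    rw [norm_mul, norm_mul]
    have h2 : ‖∏ d ∈ S, a d‖ ≤ 1 := by
      rw [norm_prod]
      exact Finset.prod_le_one (fun _ _ => norm_nonneg _) (fun d _ => ha d)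
    have h3 : ‖a x - b x‖ * ‖∏ d ∈ S, a d‖ ≤ ‖a x - b x‖ := mul_le_of_le_one_right (norm_nonneg _) h2
    have h4 : ‖b x‖ * ‖∏ d ∈ S, a d - ∏ d ∈ S, b d‖ ≤ ‖∏ d ∈ S, a d - ∏ d ∈ S, b d‖ := mul_le_of_le_one_left (norm_nonneg _) (hb x)
    linarith

lemma exp_neg_taylor {y : ℝ} (hy : 0 ≤ y) : |exp (-y) - (1 - y)| ≤ y ^ 2 := by
  have h1 := Real.add_one_le_exp (-y)
  rw [abs_of_nonneg (by linarith)]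
  rcases le_total y 1 with h | h
  · have := Real.abs_exp_sub_one_sub_id_le (x := -y) (by rw [abs_neg, abs_of_nonneg hy]; exact h)
    have := (abs_le.mp this).2
    nlinarith
  · have : exp (-y) ≤ 1 := Real.exp_le_one_iff.mpr (by linarith)
    nlinarith

lemma single_char {X : E → ℝ} {b v : ℝ} (hX : Measurable X) (hb : ∀ ω, |X ω| ≤ b) (h0 : ∫ ω, X ω ∂m = 0) (h2 : ∫ ω, X ω ^ 2 ∂m = v) (ξ : ℝ) :
    ‖∫ ω, Complex.exp ((ξ * X ω : ℝ) * Complex.I) ∂m - Complex.exp ((-(ξ ^ 2 * v / 2) : ℝ) : ℂ)‖ ≤ |ξ| ^ 3 * b ^ 3 + ξ ^ 4 * v ^ 2 := by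
  have hv : 0 ≤ v := by rw [← h2]; exact integral_nonneg fun _ => sq_nonneg _
  have e1 : ∫ ω, (1 + ((ξ * X ω : ℝ) : ℂ) * Complex.I - ((ξ ^ 2 / 2 * X ω ^ 2 : ℝ) : ℂ)) ∂m = ((1 - ξ ^ 2 * v / 2 : ℝ) : ℂ) := by
    have i1 : Integrable (fun ω => ((ξ * X ω : ℝ) : ℂ)) m := by
      have := (pow_bd (μ := m) hX hb 1).const_mul ξ
      simp only [pow_one] at this
      exact this.ofReal
    have i2 : Integrable (fun ω => ((ξ ^ 2 / 2 * X ω ^ 2 : ℝ) : ℂ)) m := ((pow_bd (μ := m) hX hb 2).const_mul _).ofReal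
    have i3 : Integrable (fun ω => 1 + ((ξ * X ω : ℝ) : ℂ) * Complex.I) m := (integrable_const _).add (i1.mul_const _)
    rw [integral_sub i3 i2, integral_add (integrable_const _) (i1.mul_const _), integral_mul_const, integral_complex_ofReal, integral_complex_ofReal, integral_const_mul, integral_const_mul, h0, h2]
    simp; ring
  have e2 : ‖∫ ω, Complex.exp ((ξ * X ω : ℝ) * Complex.I) ∂m - ((1 - ξ ^ 2 * v / 2 : ℝ) : ℂ)‖ ≤ |ξ| ^ 3 * b ^ 3 := by
    rw [← e1, ← integral_sub]
    · refine (norm_integral_le_of_norm_le (integrable_const (|ξ| ^ 3 * b ^ 3)) (Eventually.of_forall fun ω => ?_)).trans (by simp)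
      have := taylor_I 3 (ξ * X ω)
      rw [sum_range_succ, sum_range_succ, Finset.sum_range_one] at this
      have e3 : (1 + ((ξ * X ω : ℝ) : ℂ) * Complex.I - ((ξ ^ 2 / 2 * X ω ^ 2 : ℝ) : ℂ)) = (((ξ * X ω : ℝ) : ℂ) * Complex.I) ^ 0 / (Nat.factorial 0 : ℂ) + (((ξ * X ω : ℝ) : ℂ) * Complex.I) ^ 1 / (Nat.factorial 1 : ℂ) + (((ξ * X ω : ℝ) : ℂ) * Complex.I) ^ 2 / (Nat.factorial 2 : ℂ) := by
        rw [mul_pow _ _ 2, Complex.I_sq]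
        simp [Nat.factorial]; ring
      rw [e3]
      refine this.trans ?_
      rw [abs_mul, mul_pow]
      have h5 : |X ω| ^ 3 ≤ b ^ 3 := pow_le_pow_left₀ (abs_nonneg _) (hb ω) _
      have h6 : |ξ| ^ 3 * |X ω| ^ 3 ≤ |ξ| ^ 3 * b ^ 3 := mul_le_mul_of_nonneg_left h5 (by positivity)
      refine (div_le_self (by positivity) ?_).trans h6
      norm_num [Nat.factorial]
    · refine Integrable.of_bound (C := 1) ?_ (Eventually.of_forall fun ω => by rw [Complex.norm_exp_ofReal_mul_I])
      exact (Complex.measurable_exp.comp ((Complex.measurable_ofReal.comp (hX.const_mul ξ)).mul_const _)).aestronglyMeasurable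
    · have i1 : Integrable (fun ω => ((ξ * X ω : ℝ) : ℂ)) m := by
        have := (pow_bd (μ := m) hX hb 1).const_mul ξ
        simp only [pow_one] at this
        exact this.ofReal
      have i2 : Integrable (fun ω => ((ξ ^ 2 / 2 * X ω ^ 2 : ℝ) : ℂ)) m := ((pow_bd (μ := m) hX hb 2).const_mul _).ofReal
      exact ((integrable_const _).add (i1.mul_const _)).sub i2
  have e4 : ‖((1 - ξ ^ 2 * v / 2 : ℝ) : ℂ) - Complex.exp ((-(ξ ^ 2 * v / 2) : ℝ) : ℂ)‖ ≤ ξ ^ 4 * v ^ 2 := by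
    rw [← Complex.ofReal_exp, ← Complex.ofReal_sub, Complex.norm_real, Real.norm_eq_abs, abs_sub_comm]
    refine (exp_neg_taylor (by positivity)).trans ?_
    have : 0 ≤ ξ ^ 4 * v ^ 2 := by positivity
    nlinarith
  have e5 := norm_sub_le_norm_sub_add_norm_sub (∫ ω, Complex.exp ((ξ * X ω : ℝ) * Complex.I) ∂m) ((1 - ξ ^ 2 * v / 2 : ℝ) : ℂ) (Complex.exp ((-(ξ ^ 2 * v / 2) : ℝ) : ℂ))
  linarith

lemma pi_char {X : D → E → ℝ} {b v : D → ℝ} (hX : ∀ d, Measurable (X d)) (hb : ∀ d ω, |X d ω| ≤ b d) (h0 : ∀ d, ∫ ω, X d ω ∂m = 0) (h2 : ∀ d, ∫ ω, X d ω ^ 2 ∂m = v d) (ξ : ℝ) :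
    ‖∫ ω : D → E, Complex.exp ((ξ * ∑ d, X d (ω d) : ℝ) * Complex.I) ∂(Measure.pi fun _ => m) - Complex.exp ((-(ξ ^ 2 * (∑ d, v d) / 2) : ℝ) : ℂ)‖ ≤ ∑ d, (|ξ| ^ 3 * b d ^ 3 + ξ ^ 4 * v d ^ 2) := by
  have e1 : ∀ ω : D → E, Complex.exp ((ξ * ∑ d, X d (ω d) : ℝ) * Complex.I) = ∏ d, Complex.exp ((ξ * X d (ω d) : ℝ) * Complex.I) := by
    intro ω
    rw [← Complex.exp_sum, mul_sum]; push_cast; rw [Finset.sum_mul]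
  have e2 : Complex.exp ((-(ξ ^ 2 * (∑ d, v d) / 2) : ℝ) : ℂ) = ∏ d, Complex.exp ((-(ξ ^ 2 * v d / 2) : ℝ) : ℂ) := by
    rw [← Complex.exp_sum, mul_sum, Finset.sum_div]; push_cast; rw [Finset.sum_neg_distrib]
  simp_rw [e1]
  rw [integral_fintype_prod_eq_prod (fun d ω => Complex.exp ((ξ * X d ω : ℝ) * Complex.I)), e2]
  refine (prod_diff_le _ _ _ ?_ ?_).trans (sum_le_sum fun d _ => single_char (hX d) (hb d) (h0 d) (h2 d) ξ)
  · intro d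
    refine (norm_integral_le_of_norm_le (integrable_const (1:ℝ)) (Eventually.of_forall fun ω => ?_)).trans (by simp)
    rw [Complex.norm_exp_ofReal_mul_I]
  · intro d
    rw [← Complex.ofReal_exp, Complex.norm_real, Real.norm_eq_abs, abs_of_pos (Real.exp_pos _), Real.exp_le_one_iff]
    have : 0 ≤ v d := by rw [← h2]; exact integral_nonneg fun _ => sq_nonneg _
    have : 0 ≤ ξ ^ 2 * v d / 2 := by positivity
    linarith

lemma exp_quad (x : ℝ) : exp x ≤ 1 + x + x ^ 2 * exp |x| := by
  have := Complex.norm_exp_sub_sum_le_norm_mul_exp (x:ℂ) 2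
  rw [sum_range_succ, Finset.sum_range_one, Complex.norm_real, Real.norm_eq_abs, sq_abs] at this
  have e : Complex.exp (x:ℂ) - ((x:ℂ) ^ 0 / (Nat.factorial 0 : ℂ) + (x:ℂ) ^ 1 / (Nat.factorial 1 : ℂ)) = ((exp x - (1 + x) : ℝ) : ℂ) := by
    simp [Nat.factorial]
  rw [e, Complex.norm_real, Real.norm_eq_abs] at this
  linarith [(abs_le.mp this).2]

lemma single_mgf {X : E → ℝ} {b v : ℝ} (hX : Measurable X) (hb : ∀ ω, |X ω| ≤ b) (h0 : ∫ ω, X ω ∂m = 0) (h2 : ∫ ω, X ω ^ 2 ∂m = v) (l : ℝ) :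
    ∫ ω, exp (l * X ω) ∂m ≤ exp (l ^ 2 * v * exp (|l| * b)) := by
  have i1 : Integrable (fun ω => l * X ω) m := by
    have := (pow_bd (μ := m) hX hb 1).const_mul l
    simpa only [pow_one] using this
  have i2 : Integrable (fun ω => l ^ 2 * exp (|l| * b) * X ω ^ 2) m := (pow_bd (μ := m) hX hb 2).const_mul _
  have h : ∀ ω, exp (l * X ω) ≤ 1 + l * X ω + l ^ 2 * exp (|l| * b) * X ω ^ 2 := by
    intro ω
    refine (exp_quad _).trans ?_
    have h3 : exp |l * X ω| ≤ exp (|l| * b) := by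
      apply Real.exp_le_exp.mpr
      rw [abs_mul]
      exact mul_le_mul_of_nonneg_left (hb ω) (abs_nonneg _)
    have := mul_le_mul_of_nonneg_left h3 (sq_nonneg (l * X ω))
    nlinarith
  have h4 : ∫ ω, exp (l * X ω) ∂m ≤ ∫ ω, (1 + l * X ω + l ^ 2 * exp (|l| * b) * X ω ^ 2) ∂m := by
    refine integral_mono_of_nonneg (Eventually.of_forall fun ω => (Real.exp_pos _).le) (((integrable_const _).add i1).add i2) (Eventually.of_forall h)
  refine h4.trans ?_
  have i3 : Integrable (fun ω => 1 + l * X ω) m := (integrable_const _).add i1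
  rw [integral_add i3 i2, integral_add (integrable_const _) i1, integral_const_mul, integral_const_mul, h0, h2]
  have := Real.add_one_le_exp (l ^ 2 * v * exp (|l| * b))
  simp
  nlinarith

lemma pi_mgf {X : D → E → ℝ} {b v : D → ℝ} (hX : ∀ d, Measurable (X d)) (hb : ∀ d ω, |X d ω| ≤ b d) (h0 : ∀ d, ∫ ω, X d ω ∂m = 0) (h2 : ∀ d, ∫ ω, X d ω ^ 2 ∂m = v d) {β : ℝ} (hβ : ∀ d, b d ≤ β) (l : ℝ) :
    ∫ ω : D → E, exp (l * ∑ d, X d (ω d)) ∂(Measure.pi fun _ => m) ≤ exp (l ^ 2 * (∑ d, v d) * exp (|l| * β)) := by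
  have e1 : ∀ ω : D → E, exp (l * ∑ d, X d (ω d)) = ∏ d, exp (l * X d (ω d)) := by
    intro ω
    rw [← Real.exp_sum, mul_sum]
  simp_rw [e1]
  rw [integral_fintype_prod_eq_prod (fun d ω => exp (l * X d ω)), mul_sum, Finset.sum_mul, Real.exp_sum]
  refine Finset.prod_le_prod (fun d _ => integral_nonneg fun _ => (Real.exp_pos _).le) (fun d _ => ?_)
  refine (single_mgf (hX d) (fun ω => (hb d ω).trans (hβ d)) (h0 d) (h2 d) l)

end indep
end

noncomputable section
section model
variable {ι : Type} [Fintype ι] [DecidableEq ι]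

lemma zpow_sum_aux {G I : Type*} [CommGroup G] (S : Finset I) (x : G) (s : I → ℤ) : ∏ i ∈ S, x ^ s i = x ^ (∑ i ∈ S, s i) := by
  classical
  induction S using Finset.induction_on with
  | empty => simp
  | insert a S ha ih => rw [Finset.prod_insert ha, Finset.sum_insert ha, ih, zpow_add]

lemma KG_int_tuple (l : ι → ℝ) {I : Type} (S : Finset I) (p : I → ι) (s : I → ℤ) :
    ∫ χ : KG l, ((∏ i ∈ S, χ.1 (p i) ^ s i : Circle) : ℂ) ∂(KGmu l) = if ∑ i ∈ S, (s i : ℝ) * l (p i) = 0 then 1 else 0 := by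
  have h1 : ∀ χ : KG l, ∏ i ∈ S, χ.1 (p i) ^ s i = ∏ n, χ.1 n ^ (∑ i ∈ S with p i = n, s i) := by
    intro χ
    rw [← Finset.prod_fiberwise S p]
    refine Finset.prod_congr rfl fun n _ => ?_
    rw [← zpow_sum_aux]
    refine Finset.prod_congr rfl fun i hi => ?_
    rw [(Finset.mem_filter.mp hi).2]
  have h2 : ∑ i ∈ S, (s i : ℝ) * l (p i) = ∑ n, ((∑ i ∈ S with p i = n, s i : ℤ) : ℝ) * l n := by
    rw [← Finset.sum_fiberwise S p]
    refine sum_congr rfl fun n _ => ?_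
    push_cast
    rw [Finset.sum_mul]
    refine sum_congr rfl fun i hi => ?_
    rw [(Finset.mem_filter.mp hi).2]
  simp_rw [h1]
  rw [KG_int, h2]

lemma circle_cont : Continuous (fun z : Circle => (z : ℂ)) := continuous_induced_dom

lemma circle_coe_prod {I : Type*} (S : Finset I) (f : I → Circle) : ((∏ i ∈ S, f i : Circle) : ℂ) = ∏ i ∈ S, (f i : ℂ) := map_prod Circle.coeHom f S

def sg (b : Bool) : ℤ := if b then 1 else -1

/-- linear statistic on the compact group -/
def YY {l : ι → ℝ} (c : ι → ℝ) (χ : KG l) : ℝ := ∑ n, c n * (2 * ((χ.1 n : Circle) : ℂ).re)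

lemma circle_two_re (z : Circle) : ((2 * (z : ℂ).re : ℝ) : ℂ) = ((z ^ sg true : Circle) : ℂ) + ((z ^ sg false : Circle) : ℂ) := by
  simp [sg, -Circle.coe_inv, Circle.coe_inv_eq_conj, Complex.add_conj]

lemma YY_complex {l : ι → ℝ} (c : ι → ℝ) (χ : KG l) : ((YY c χ : ℝ) : ℂ) = ∑ a : ι × Bool, (c a.1 : ℂ) * ((χ.1 a.1 ^ sg a.2 : Circle) : ℂ) := by
  rw [Fintype.sum_prod_type]
  simp only [YY, Complex.ofReal_sum, Complex.ofReal_mul (c _), circle_two_re, Fintype.sum_bool, mul_add]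

lemma YY_cont {l : ι → ℝ} (c : ι → ℝ) : Continuous (YY (l := l) c) := by
  unfold YY
  refine continuous_finsetSum _ fun n _ => continuous_const.mul (continuous_const.mul (Complex.continuous_re.comp ?_))
  exact circle_cont.comp ((continuous_apply n).comp continuous_subtype_val)

lemma YY_meas {l : ι → ℝ} (c : ι → ℝ) : Measurable (YY (l := l) c) := (YY_cont c).measurable

lemma YY_le {l : ι → ℝ} (c : ι → ℝ) (χ : KG l) : |YY c χ| ≤ 2 * ∑ n, |c n| := by
  unfold YY
  refine (abs_sum_le_sum_abs _ _).trans ?_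
  rw [mul_sum]
  refine sum_le_sum fun n _ => ?_
  rw [abs_mul, abs_mul, abs_two]
  have := Complex.abs_re_le_norm ((χ.1 n : Circle) : ℂ)
  rw [Circle.norm_coe] at this
  nlinarith [abs_nonneg (c n)]

lemma char_integrable {l : ι → ℝ} {I : Type} (S : Finset I) (p : I → ι) (s : I → ℤ) : Integrable (fun χ : KG l => ((∏ i ∈ S, χ.1 (p i) ^ s i : Circle) : ℂ)) (KGmu l) := by
  refine Integrable.of_bound (C := 1) (Continuous.aestronglyMeasurable ?_) (Eventually.of_forall fun χ => by rw [Circle.norm_coe])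
  refine circle_cont.comp (continuous_finsetProd _ fun i _ => Continuous.zpow ((continuous_apply (p i)).comp continuous_subtype_val) _)

lemma YY_mean {l : ι → ℝ} (hl : ∀ n, 0 < l n) (c : ι → ℝ) : ∫ χ : KG l, YY c χ ∂(KGmu l) = 0 := by
  have h : ((∫ χ : KG l, YY c χ ∂(KGmu l) : ℝ) : ℂ) = 0 := by
    rw [← integral_complex_ofReal]
    simp_rw [YY_complex]
    have e : ∀ (a : ι × Bool) (χ : KG l), ((χ.1 a.1 ^ sg a.2 : Circle) : ℂ) = ((∏ i ∈ ({0} : Finset (Fin 1)), χ.1 ((fun _ => a.1) i) ^ ((fun _ => sg a.2) i) : Circle) : ℂ) := by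
      intro a χ; simp
    simp_rw [e]
    rw [integral_finsetSum _ fun a _ => (char_integrable _ _ _).const_mul _]
    refine Finset.sum_eq_zero fun a _ => ?_
    rw [integral_const_mul, KG_int_tuple, if_neg, mul_zero]
    rw [Finset.sum_singleton]
    have := (hl a.1).ne'
    rcases a with ⟨n, b⟩
    cases b <;> simpa [sg] using this
  exact_mod_cast h

lemma YY_var {l : ι → ℝ} (hl : ∀ n, 0 < l n) (hinj : Function.Injective l) (c : ι → ℝ) : ∫ χ : KG l, YY c χ ^ 2 ∂(KGmu l) = 2 * ∑ n, c n ^ 2 := by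
  have h : ((∫ χ : KG l, YY c χ ^ 2 ∂(KGmu l) : ℝ) : ℂ) = ((2 * ∑ n, c n ^ 2 : ℝ) : ℂ) := by
    rw [← integral_complex_ofReal]
    have e : ∀ (χ : KG l), ((YY c χ ^ 2 : ℝ) : ℂ) = ∑ a : ι × Bool, ∑ b : ι × Bool, ((c a.1 * c b.1 : ℝ) : ℂ) * ((∏ i ∈ (Finset.univ : Finset Bool), χ.1 ((fun i => if i then a.1 else b.1) i) ^ ((fun i => if i then sg a.2 else sg b.2) i) : Circle) : ℂ) := by
      intro χ
      rw [Complex.ofReal_pow, YY_complex, sq, Finset.sum_mul_sum]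
      refine sum_congr rfl fun a _ => sum_congr rfl fun b _ => ?_
      simp; ring
    simp_rw [e]
    rw [integral_finsetSum _ fun a _ => integrable_finsetSum _ fun b _ => (char_integrable _ _ _).const_mul _]
    have e2 : ∀ a : ι × Bool, ∫ χ : KG l, ∑ b : ι × Bool, ((c a.1 * c b.1 : ℝ) : ℂ) * ((∏ i ∈ (Finset.univ : Finset Bool), χ.1 ((fun i => if i then a.1 else b.1) i) ^ ((fun i => if i then sg a.2 else sg b.2) i) : Circle) : ℂ) ∂(KGmu l) = ((c a.1 ^ 2 : ℝ) : ℂ) := by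
      intro a
      rw [integral_finsetSum _ fun b _ => (char_integrable _ _ _).const_mul _, Finset.sum_eq_single (a.1, !a.2)]
      · rw [integral_const_mul, KG_int_tuple, if_pos, mul_one, sq]
        rcases a with ⟨n, b⟩
        cases b <;> simp [sg]
      · intro b _ hb
        rw [integral_const_mul, KG_int_tuple, if_neg, mul_zero]
        intro h0
        apply hb
        rcases a with ⟨n, x⟩
        rcases b with ⟨n', y⟩
        have p1 := hl n
        have p2 := hl n'
        cases x <;> cases y <;> simp [sg] at h0 ⊢
        · linarith
        · exact hinj (by linarith)
        · exact hinj (by linarith)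
        · linarith
      · intro h; exact absurd (Finset.mem_univ _) h
    simp_rw [e2]
    rw [Fintype.sum_prod_type]
    simp [mul_sum]
  exact_mod_cast h

/-- product statistic -/
def XX {l : ι → ℝ} (c : ι → ℝ) (cl : ι → ι) (ω : ι → KG l) : ℝ := ∑ d, YY (fun n => if cl n = d then c n else 0) (ω d)

lemma XX_complex {l : ι → ℝ} (c : ι → ℝ) (cl : ι → ι) (ω : ι → KG l) : ((XX c cl ω : ℝ) : ℂ) = ∑ a : ι × Bool, (c a.1 : ℂ) * (((ω (cl a.1)).1 a.1 ^ sg a.2 : Circle) : ℂ) := by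
  unfold XX
  rw [Complex.ofReal_sum]
  simp_rw [YY_complex]
  rw [Finset.sum_comm]
  refine sum_congr rfl fun a _ => ?_
  rw [Finset.sum_eq_single (cl a.1)]
  · simp
  · intro d _ hd; simp [hd.symm]
  · intro h; exact absurd (Finset.mem_univ _) h

lemma pi_char_int {l : ι → ℝ} (cl : ι → ι) {j : ℕ} (p : Fin j → ι) (s : Fin j → ℤ)
    (H : ∑ i, (s i : ℝ) * l (p i) = 0 → ∀ d, ∑ i with cl (p i) = d, (s i : ℝ) * l (p i) = 0) :
    ∫ ω : ι → KG l, ((∏ i, (ω (cl (p i))).1 (p i) ^ s i : Circle) : ℂ) ∂(Measure.pi fun _ => KGmu l) = if ∑ i, (s i : ℝ) * l (p i) = 0 then 1 else 0 := by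
  have h1 : ∀ ω : ι → KG l, ((∏ i, (ω (cl (p i))).1 (p i) ^ s i : Circle) : ℂ) = ∏ d, ((∏ i with cl (p i) = d, (ω d).1 (p i) ^ s i : Circle) : ℂ) := by
    intro ω
    rw [← Finset.prod_fiberwise Finset.univ (fun i => cl (p i)), circle_coe_prod]
    refine Finset.prod_congr rfl fun d _ => ?_
    congr 1
    refine Finset.prod_congr rfl fun i hi => ?_
    rw [(Finset.mem_filter.mp hi).2]
  simp_rw [h1]
  rw [integral_fintype_prod_eq_prod (fun d (χ : KG l) => ((∏ i with cl (p i) = d, χ.1 (p i) ^ s i : Circle) : ℂ))]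
  simp_rw [KG_int_tuple]
  split_ifs with h
  · exact Finset.prod_eq_one fun d _ => if_pos (H h d)
  · obtain ⟨d, hd⟩ : ∃ d, ∑ i with cl (p i) = d, (s i : ℝ) * l (p i) ≠ 0 := by
      by_contra hc
      push Not at hc
      apply h
      rw [← Finset.sum_fiberwise Finset.univ (fun i => cl (p i))]
      exact Finset.sum_eq_zero fun d _ => hc d
    exact Finset.prod_eq_zero (Finset.mem_univ d) (if_neg hd)

lemma XX_moment {l : ι → ℝ} (c : ι → ℝ) (cl : ι → ι) (j : ℕ)
    (H : ∀ (p : Fin j → ι) (s : Fin j → ℤ), (∀ i, |s i| ≤ 1) → ∑ i, (s i : ℝ) * l (p i) = 0 → ∀ d, ∑ i with cl (p i) = d, (s i : ℝ) * l (p i) = 0) :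
    ((∫ ω : ι → KG l, XX c cl ω ^ j ∂(Measure.pi fun _ => KGmu l) : ℝ) : ℂ) = ∑ p : Fin j → ι × Bool, (∏ i, (c (p i).1 : ℂ)) * (if ∑ i, (sg (p i).2 : ℝ) * l (p i).1 = 0 then 1 else 0) := by
  have e : ∀ ω : ι → KG l, ((XX c cl ω ^ j : ℝ) : ℂ) = ∑ p : Fin j → ι × Bool, (∏ i, (c (p i).1 : ℂ)) * ((∏ i, (ω (cl (p i).1)).1 (p i).1 ^ sg (p i).2 : Circle) : ℂ) := by
    intro ω
    rw [Complex.ofReal_pow, XX_complex, Fintype.sum_pow]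
    refine sum_congr rfl fun p _ => ?_
    rw [Finset.prod_mul_distrib, circle_coe_prod]
  rw [← integral_complex_ofReal]
  simp_rw [e]
  rw [integral_finsetSum]
  · refine sum_congr rfl fun p _ => ?_
    rw [integral_const_mul, pi_char_int cl (fun i => (p i).1) (fun i => sg (p i).2)]
    refine H _ _ fun i => ?_
    cases (p i).2 <;> simp [sg]
  · intro p _
    refine Integrable.const_mul (Integrable.of_bound (C := 1) (Continuous.aestronglyMeasurable ?_) (Eventually.of_forall fun χ => by rw [Circle.norm_coe])) _
    refine circle_cont.comp (continuous_finsetProd _ fun i _ => Continuous.zpow ?_ _)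
    exact (continuous_apply _).comp (continuous_subtype_val.comp (continuous_apply _))

/-- the almost periodic polynomial -/
def PP (l c : ι → ℝ) (τ : ℝ) : ℝ := ∑ n, c n * (2 * Real.cos (τ * l n))

lemma PP_complex (l c : ι → ℝ) (τ : ℝ) : ((PP l c τ : ℝ) : ℂ) = ∑ a : ι × Bool, (c a.1 : ℂ) * Complex.exp ((τ * ((sg a.2 : ℝ) * l a.1) : ℝ) * Complex.I) := by
  rw [Fintype.sum_prod_type]
  simp only [PP, Complex.ofReal_sum, Complex.ofReal_mul (c _), Fintype.sum_bool, ← mul_add]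
  refine sum_congr rfl fun n _ => ?_
  congr 1
  rw [Complex.ofReal_mul, Complex.ofReal_cos, Complex.ofReal_ofNat, Complex.two_cos]
  simp [sg]

lemma PP_pow (l c : ι → ℝ) (τ : ℝ) (j : ℕ) : ((PP l c τ ^ j : ℝ) : ℂ) = ∑ p : Fin j → ι × Bool, (∏ i, (c (p i).1 : ℂ)) * Complex.exp ((τ * (∑ i, (sg (p i).2 : ℝ) * l (p i).1) : ℝ) * Complex.I) := by
  rw [Complex.ofReal_pow, PP_complex, Fintype.sum_pow]
  refine sum_congr rfl fun p _ => ?_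
  rw [Finset.prod_mul_distrib, ← Complex.exp_sum, ← Finset.sum_mul, mul_sum, Complex.ofReal_sum]

lemma PP_le (l c : ι → ℝ) (τ : ℝ) : |PP l c τ| ≤ 2 * ∑ n, |c n| := by
  unfold PP
  refine (abs_sum_le_sum_abs _ _).trans ?_
  rw [mul_sum]
  refine sum_le_sum fun n _ => ?_
  rw [abs_mul, abs_mul, abs_two]
  have := Real.abs_cos_le_one (τ * l n)
  nlinarith [abs_nonneg (c n)]

lemma PP_cont (l c : ι → ℝ) : Continuous (PP l c) := by
  unfold PP; fun_prop

lemma moment_diff {l : ι → ℝ} (c : ι → ℝ) (cl : ι → ι) (j : ℕ)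
    (H : ∀ (p : Fin j → ι) (s : Fin j → ℤ), (∀ i, |s i| ≤ 1) → ∑ i, (s i : ℝ) * l (p i) = 0 → ∀ d, ∑ i with cl (p i) = d, (s i : ℝ) * l (p i) = 0)
    {q R : ℝ} (hq : 0 < q) (hR : 0 ≤ R)
    (hsep : ∀ (p : Fin j → ι) (s : Fin j → ℤ), (∀ i, |s i| ≤ 1) → ∑ i, (s i : ℝ) * l (p i) ≠ 0 → q ≤ |∑ i, (s i : ℝ) * l (p i)|)
    {μ : Measure ℝ} [IsProbabilityMeasure μ]
    (hμ : ∀ x : ℝ, x ≠ 0 → ‖∫ τ, Complex.exp ((τ * x : ℝ) * Complex.I) ∂μ‖ ≤ R / |x|) :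
    |∫ τ, PP l c τ ^ j ∂μ - ∫ ω : ι → KG l, XX c cl ω ^ j ∂(Measure.pi fun _ => KGmu l)| ≤ (2 * ∑ n, |c n|) ^ j * (R / q) := by
  have e1 : ((∫ τ, PP l c τ ^ j ∂μ : ℝ) : ℂ) = ∑ p : Fin j → ι × Bool, (∏ i, (c (p i).1 : ℂ)) * ∫ τ, Complex.exp ((τ * (∑ i, (sg (p i).2 : ℝ) * l (p i).1) : ℝ) * Complex.I) ∂μ := by
    rw [← integral_complex_ofReal]
    simp_rw [PP_pow]
    rw [integral_finsetSum]
    · simp_rw [integral_const_mul]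
    · intro p _
      refine Integrable.const_mul (Integrable.of_bound (C := 1) (Continuous.aestronglyMeasurable (by fun_prop)) (Eventually.of_forall fun ω => by rw [Complex.norm_exp_ofReal_mul_I])) _
  have e2 : (2 * ∑ n, |c n|) ^ j = ∑ p : Fin j → ι × Bool, ∏ i, |c (p i).1| := by
    rw [← Fintype.sum_pow (fun a : ι × Bool => |c a.1|), Fintype.sum_prod_type]
    simp [mul_sum, two_mul, Finset.sum_add_distrib]
  rw [← Real.norm_eq_abs, ← Complex.norm_real, Complex.ofReal_sub, e1, XX_moment c cl j H, ← Finset.sum_sub_distrib, e2, Finset.sum_mul]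
  refine (norm_sum_le _ _).trans (sum_le_sum fun p _ => ?_)
  rw [← mul_sub, norm_mul, norm_prod]
  simp only [Complex.norm_real, Real.norm_eq_abs]
  refine mul_le_mul_of_nonneg_left ?_ (Finset.prod_nonneg fun _ _ => abs_nonneg _)
  have hs1 : ∀ i, |sg (p i).2| ≤ 1 := fun i => by cases (p i).2 <;> simp [sg]
  split_ifs with h
  · simp only [h]
    simp; positivity
  · rw [sub_zero]
    refine (hμ _ h).trans (div_le_div_of_nonneg_left hR hq (hsep _ _ hs1 h))

end model
end

noncomputable section
section combine
variable {ι : Type} [Fintype ι] [DecidableEq ι]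

lemma char_bound {l : ι → ℝ} (hl : ∀ n, 0 < l n) (hinj : Function.Injective l) (c : ι → ℝ) (cl : ι → ι) (J : ℕ)
    (H : ∀ j, ∀ (p : Fin j → ι) (s : Fin j → ℤ), (∀ i, |s i| ≤ 1) → ∑ i, (s i : ℝ) * l (p i) = 0 → ∀ d, ∑ i with cl (p i) = d, (s i : ℝ) * l (p i) = 0)
    {q R : ℝ} (hq : 0 < q) (hR : 0 ≤ R)
    (hsep : ∀ j ≤ 2 * J, ∀ (p : Fin j → ι) (s : Fin j → ℤ), (∀ i, |s i| ≤ 1) → ∑ i, (s i : ℝ) * l (p i) ≠ 0 → q ≤ |∑ i, (s i : ℝ) * l (p i)|)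
    {μ : Measure ℝ} [IsProbabilityMeasure μ]
    (hμ : ∀ x : ℝ, x ≠ 0 → ‖∫ τ, Complex.exp ((τ * x : ℝ) * Complex.I) ∂μ‖ ≤ R / |x|)
    {Q γ V B : ℝ} (hQ : ∀ d, ((Finset.univ.filter (fun n => cl n = d)).card : ℝ) ≤ Q) (hγ : ∀ n, |c n| ≤ γ) (hγ0 : 0 ≤ γ) (hV : 2 * ∑ n, c n ^ 2 = V) (hB : 2 * ∑ n, |c n| ≤ B) (hB1 : 1 ≤ B) (ξ : ℝ) :
    ‖∫ τ, Complex.exp ((ξ * PP l c τ : ℝ) * Complex.I) ∂μ - Complex.exp ((-(ξ ^ 2 * V / 2) : ℝ) : ℂ)‖ ≤ 2 * (B ^ (2 * J) * (R / q)) * exp |ξ| + 4 * exp ((2 * (|ξ| + 1)) ^ 2 * V * exp ((2 * (|ξ| + 1)) * (2 * Q * γ))) / 2 ^ (2 * J) + (|ξ| ^ 3 * ((2 * Q * γ) * (2 * Q)) + ξ ^ 4 * (2 * Q * γ) ^ 2) * V := by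
  set cd : ι → ι → ℝ := fun d n => if cl n = d then c n else 0 with hcd
  have hsum : ∀ d, ∑ n, |cd d n| = ∑ n with cl n = d, |c n| := by
    intro d
    rw [Finset.sum_filter]
    refine sum_congr rfl fun n _ => ?_
    simp only [hcd]; split_ifs <;> simp
  have hsq : ∀ d, ∑ n, cd d n ^ 2 = ∑ n with cl n = d, c n ^ 2 := by
    intro d
    rw [Finset.sum_filter]
    refine sum_congr rfl fun n _ => ?_
    simp only [hcd]; split_ifs <;> simp
  have hQ0 : ∀ d : ι, 0 ≤ Q := fun d => le_trans (Nat.cast_nonneg _) (hQ d)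
  have hb1 : ∀ d, 2 * ∑ n, |cd d n| ≤ 2 * Q * γ := by
    intro d
    rw [hsum]
    have := Finset.sum_le_card_nsmul (Finset.univ.filter (fun n => cl n = d)) (fun n => |c n|) γ (fun n _ => hγ n)
    rw [nsmul_eq_mul] at this
    nlinarith [mul_le_mul_of_nonneg_right (hQ d) hγ0]
  have hb2 : ∀ d, (2 * ∑ n, |cd d n|) ^ 2 ≤ 2 * Q * (2 * ∑ n, cd d n ^ 2) := by
    intro d
    rw [hsum, hsq]
    have := sq_sum_le_card_mul_sum_sq (s := Finset.univ.filter (fun n => cl n = d)) (f := fun n => |c n|)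
    simp only [sq_abs] at this
    have h0 : 0 ≤ ∑ n with cl n = d, c n ^ 2 := Finset.sum_nonneg fun _ _ => sq_nonneg _
    nlinarith [mul_le_mul_of_nonneg_right (hQ d) h0]
  have hvb : ∀ d, 2 * ∑ n, cd d n ^ 2 ≤ (2 * ∑ n, |cd d n|) ^ 2 := by
    intro d
    have h1 : ∑ n, cd d n ^ 2 ≤ (∑ n, |cd d n|) ^ 2 := by
      rw [sq (∑ n, |cd d n|), Finset.sum_mul]
      refine sum_le_sum fun n _ => ?_
      rw [← sq_abs, sq]
      exact mul_le_mul_of_nonneg_left (Finset.single_le_sum (f := fun n => |cd d n|) (fun _ _ => abs_nonneg _) (Finset.mem_univ n)) (abs_nonneg _)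
    nlinarith [sq_nonneg (∑ n, |cd d n|)]
  have hVs : ∑ d, (2 * ∑ n, cd d n ^ 2) = V := by
    rw [← mul_sum]
    simp_rw [hsq]
    rw [Finset.sum_fiberwise Finset.univ cl (fun n => c n ^ 2), hV]
  have hV0 : 0 ≤ V := by rw [← hV]; exact mul_nonneg (by norm_num) (Finset.sum_nonneg fun _ _ => sq_nonneg _)
  have hmeas : ∀ d, Measurable (YY (l := l) (cd d)) := fun d => YY_meas _
  have hchar := pi_char (m := KGmu l) (X := fun d => YY (l := l) (cd d)) (b := fun d => 2 * ∑ n, |cd d n|) (v := fun d => 2 * ∑ n, cd d n ^ 2) hmeas (fun d => YY_le _) (fun d => YY_mean hl _) (fun d => YY_var hl hinj _) ξ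
  have hmgf := pi_mgf (m := KGmu l) (X := fun d => YY (l := l) (cd d)) (b := fun d => 2 * ∑ n, |cd d n|) (v := fun d => 2 * ∑ n, cd d n ^ 2) hmeas (fun d => YY_le _) (fun d => YY_mean hl _) (fun d => YY_var hl hinj _) hb1
  simp only [hVs] at hchar hmgf
  have hXm : Measurable (XX (l := l) c cl) := by
    unfold XX
    exact Finset.measurable_fun_sum _ fun d _ => (YY_meas _).comp (measurable_pi_apply d)
  have hXb : ∀ ω, |XX (l := l) c cl ω| ≤ ∑ d, 2 * ∑ n, |cd d n| := by
    intro ω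
    unfold XX
    exact (abs_sum_le_sum_abs _ _).trans (sum_le_sum fun d _ => YY_le _ _)
  have hB0 : 0 ≤ 2 * ∑ n, |c n| := mul_nonneg (by norm_num) (Finset.sum_nonneg fun _ _ => abs_nonneg _)
  have hlam : |2 * (|ξ| + 1)| = 2 * (|ξ| + 1) := abs_of_nonneg (by positivity)
  have m1 := hmgf (2 * (|ξ| + 1))
  have m2 := hmgf (-(2 * (|ξ| + 1)))
  rw [hlam] at m1
  rw [abs_neg, hlam, neg_sq] at m2
  have hcomp := mom_compare (μ := μ) (ν := Measure.pi fun _ : ι => KGmu l) (F := PP l c) (X := XX (l := l) c cl) (PP_cont l c).measurable (PP_le l c) hXm hXb J ξ (M := exp ((2 * (|ξ| + 1)) ^ 2 * V * exp ((2 * (|ξ| + 1)) * (2 * Q * γ)))) (δ := B ^ (2 * J) * (R / q)) (by positivity) m1 m2 ?_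
  · have herr : ∑ d, (|ξ| ^ 3 * (2 * ∑ n, |cd d n|) ^ 3 + ξ ^ 4 * (2 * ∑ n, cd d n ^ 2) ^ 2) ≤ (|ξ| ^ 3 * ((2 * Q * γ) * (2 * Q)) + ξ ^ 4 * (2 * Q * γ) ^ 2) * V := by
      rw [← hVs, mul_sum]
      refine sum_le_sum fun d _ => ?_
      have b0 : 0 ≤ 2 * ∑ n, |cd d n| := mul_nonneg (by norm_num) (Finset.sum_nonneg fun _ _ => abs_nonneg _)
      have v0 : 0 ≤ 2 * ∑ n, cd d n ^ 2 := mul_nonneg (by norm_num) (Finset.sum_nonneg fun _ _ => sq_nonneg _)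
      have k1 := hb1 d
      have k2 := hb2 d
      have k3 := hvb d
      have q0 := hQ0 d
      generalize 2 * ∑ n, |cd d n| = b at *
      generalize 2 * ∑ n, cd d n ^ 2 = v at *
      have a1 : b ^ 3 ≤ (2 * Q * γ) * (2 * Q) * v := by
        calc b ^ 3 = b * b ^ 2 := by ring
          _ ≤ (2 * Q * γ) * (2 * Q * v) := mul_le_mul k1 k2 (by positivity) (by positivity)
          _ = _ := by ring
      have a2 : v ^ 2 ≤ (2 * Q * γ) ^ 2 * v := by
        have : b ^ 2 ≤ (2 * Q * γ) ^ 2 := pow_le_pow_left₀ b0 k1 2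
        nlinarith [mul_le_mul_of_nonneg_right (k3.trans this) v0]
      have a3 := mul_le_mul_of_nonneg_left a1 (show 0 ≤ |ξ| ^ 3 by positivity)
      have a4 := mul_le_mul_of_nonneg_left a2 (show 0 ≤ ξ ^ 4 by positivity)
      nlinarith
    have hchar' := hchar.trans herr
    have tri := norm_sub_le_norm_sub_add_norm_sub (∫ τ, Complex.exp ((ξ * PP l c τ : ℝ) * Complex.I) ∂μ) (∫ ω : ι → KG l, Complex.exp ((ξ * XX c cl ω : ℝ) * Complex.I) ∂(Measure.pi fun _ => KGmu l)) (Complex.exp ((-(ξ ^ 2 * V / 2) : ℝ) : ℂ))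
    have e0 : ∫ ω : ι → KG l, Complex.exp ((ξ * XX c cl ω : ℝ) * Complex.I) ∂(Measure.pi fun _ => KGmu l) = ∫ ω : ι → KG l, Complex.exp ((ξ * ∑ d, YY (cd d) (ω d) : ℝ) * Complex.I) ∂(Measure.pi fun _ => KGmu l) := rfl
    rw [e0] at tri hcomp
    linarith
  · intro j hj
    refine (moment_diff c cl j (H j) hq hR (hsep j hj) hμ).trans ?_
    refine mul_le_mul_of_nonneg_right ?_ (by positivity)
    exact (pow_le_pow_left₀ hB0 hB j).trans (pow_le_pow_right₀ hB1 hj)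

end combine

lemma ev_strictMono {a b : ℕ} (ha : 2 < a) (hab : a < b) : ev a < ev b := by
  unfold ev
  have h1 : (a:ℝ) < b := by exact_mod_cast hab
  have h2 : Real.sqrt ((a:ℝ) ^ 2 - 4) ≤ Real.sqrt ((b:ℝ) ^ 2 - 4) := Real.sqrt_le_sqrt (by nlinarith [(Nat.cast_nonneg a : (0:ℝ) ≤ a)])
  linarith

lemma log_ev_inj {a b : ℕ} (ha : 2 < a) (hb : 2 < b) (h : Real.log (ev a) = Real.log (ev b)) : a = b := by
  have h1 := Real.log_injOn_pos (Set.mem_Ioi.mpr (lt_trans one_pos (ev_gt ha))) (Set.mem_Ioi.mpr (lt_trans one_pos (ev_gt hb))) h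
  rcases lt_trichotomy a b with h2 | h2 | h2
  · exact absurd h1 (ev_strictMono ha h2).ne
  · exact h2
  · exact absurd h1 (ev_strictMono hb h2).ne.symm

/-- main quantitative bound for the characteristic function -/
lemma char_bound_X (X : ℕ) (hX : 1 ≤ X) (c : ℕ → ℝ) (J : ℕ) {R : ℝ} (hR : 0 ≤ R)
    {μ : Measure ℝ} [IsProbabilityMeasure μ]
    (hμ : ∀ x : ℝ, x ≠ 0 → ‖∫ τ, Complex.exp ((τ * x : ℝ) * Complex.I) ∂μ‖ ≤ R / |x|)
    {Q γ V : ℝ} (hQ : ((Nat.log 2 X + 1 : ℕ) : ℝ) ≤ Q) (hγ : ∀ n ∈ Ioc 2 X, |c n| ≤ γ) (hγ0 : 0 ≤ γ) (hV : 2 * ∑ n ∈ Ioc 2 X, c n ^ 2 = V) (ξ : ℝ) :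
    ‖∫ τ, Complex.exp ((ξ * ∑ n ∈ Ioc 2 X, c n * (2 * Real.cos (τ * Real.log (Nnorm n))) : ℝ) * Complex.I) ∂μ - Complex.exp ((-(ξ ^ 2 * V / 2) : ℝ) : ℂ)‖ ≤ 2 * ((1 + 2 * X * γ) ^ (2 * J) * (R * (2 * (2 * (X:ℝ) ^ (2 * J)) ^ (2 ^ (2 * J))))) * exp |ξ| + 4 * exp ((2 * (|ξ| + 1)) ^ 2 * V * exp ((2 * (|ξ| + 1)) * (2 * Q * γ))) / 2 ^ (2 * J) + (|ξ| ^ 3 * ((2 * Q * γ) * (2 * Q)) + ξ ^ 4 * (2 * Q * γ) ^ 2) * V := by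
  classical
  have hm : ∀ n : Ioc 2 X, 2 < n.1 := fun n => (Finset.mem_Ioc.mp n.2).1
  have hm2 : ∀ n : Ioc 2 X, n.1 ≤ X := fun n => (Finset.mem_Ioc.mp n.2).2
  have hpos : ∀ n : Ioc 2 X, 0 < n.1 ^ 2 - 4 := fun n => by
    have := hm n
    have : 2 ^ 2 < n.1 ^ 2 := Nat.pow_lt_pow_left this (by norm_num)
    omega
  let st : Setoid (Ioc 2 X) :=
    { r := fun a b => IsSquare ((a.1 ^ 2 - 4) * (b.1 ^ 2 - 4) : ℕ)
      iseqv := ⟨fun a => ⟨_, rfl⟩, fun {a b} h => by rw [mul_comm]; exact h, fun {a b c} h1 h2 => isSquare_trans (hpos b) h1 h2⟩ }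
  let cl : Ioc 2 X → Ioc 2 X := fun n => (Quotient.mk st n).out
  have hcl : ∀ a b, cl a = cl b ↔ IsSquare ((a.1 ^ 2 - 4) * (b.1 ^ 2 - 4) : ℕ) := by
    intro a b
    simp only [cl]
    rw [Quotient.out_inj, Quotient.eq]
    exact Iff.rfl
  set l : Ioc 2 X → ℝ := fun n => 2 * Real.log (ev n.1) with hl
  have hq : (0:ℝ) < 1 / (2 * (2 * (X:ℝ) ^ (2 * J)) ^ (2 ^ (2 * J))) := by
    have : (0:ℝ) < X := by exact_mod_cast hX
    positivity
  have hX1 : (1:ℝ) ≤ X := by exact_mod_cast hX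
  have hB1 : 1 ≤ 1 + 2 * (X:ℝ) * γ := by nlinarith [mul_nonneg (zero_le_one.trans hX1) hγ0]
  have key := char_bound (l := l) (fun n => ?_) (fun a b hab => ?_) (fun n => c n.1) cl J ?_ hq hR ?_ hμ (Q := Q) (γ := γ) (V := V) (B := 1 + 2 * X * γ) ?_ (fun n => hγ n.1 n.2) hγ0 ?_ ?_ hB1 ξ
  · have e : ∀ τ, PP l (fun n : Ioc 2 X => c n.1) τ = ∑ n ∈ Ioc 2 X, c n * (2 * Real.cos (τ * Real.log (Nnorm n))) := by
      intro τ
      unfold PP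
      rw [← Finset.sum_coe_sort (Ioc 2 X)]
      refine sum_congr rfl fun n _ => ?_
      rw [log_Nnorm]
    simp_rw [e] at key
    rw [div_div_eq_mul_div, div_one] at key
    exact key
  · have := Real.log_pos (ev_gt (hm n))
    simp only [hl]; linarith
  · refine Subtype.ext (log_ev_inj (hm a) (hm b) ?_)
    simp only [hl] at hab; linarith
  · intro j p s hs h0 d
    by_cases hd : ∃ i, cl (p i) = d
    · obtain ⟨i0, hi0⟩ := hd
      have h1 : ∑ i, (s i : ℝ) * Real.log (ev (p i).1) = 0 := by
        have : ∑ i, (s i : ℝ) * l (p i) = 2 * ∑ i, (s i : ℝ) * Real.log (ev (p i).1) := by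
          rw [mul_sum]; refine sum_congr rfl fun i _ => ?_
          simp only [hl]; ring
        linarith
      have h2 := N1 Finset.univ (fun i => (p i).1) (fun i _ => hm _) s h1 (p i0).1 (hm _)
      have h3 : ∑ i with cl (p i) = d, (s i : ℝ) * l (p i) = 2 * ∑ i with IsSquare (((p i0).1 ^ 2 - 4) * ((p i).1 ^ 2 - 4) : ℕ), (s i : ℝ) * Real.log (ev (p i).1) := by
        rw [mul_sum]
        refine sum_congr ?_ fun i _ => ?_
        · ext i
          simp only [mem_filter, Finset.mem_univ, true_and]
          rw [← hi0, ← hcl, eq_comm]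
        · simp only [hl]; ring
      rw [h3]
      have h4 : ∑ i with IsSquare (((p i0).1 ^ 2 - 4) * ((p i).1 ^ 2 - 4) : ℕ), (s i : ℝ) * Real.log (ev (p i).1) = 0 := by
        convert h2 using 2
      rw [h4, mul_zero]
    · push Not at hd
      refine Finset.sum_eq_zero fun i hi => absurd (Finset.mem_filter.mp hi).2 (hd i)
  · intro j hj p s hs hne
    have e : ∑ i, (s i : ℝ) * l (p i) = 2 * ∑ i, (s i : ℝ) * Real.log (ev (p i).1) := by
      rw [mul_sum]; refine sum_congr rfl fun i _ => ?_
      simp only [hl]; ring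
    rw [e] at hne ⊢
    have h1 := N2 (fun i => (p i).1) X (fun i => hm _) (fun i => hm2 _) hX s hs (fun h => hne (by rw [h, mul_zero]))
    rw [abs_mul, abs_two]
    have h2 : (2 * (X:ℝ) ^ j) ^ (2 ^ j) ≤ (2 * (X:ℝ) ^ (2 * J)) ^ (2 ^ (2 * J)) := by
      have a1 : (2 * (X:ℝ) ^ j) ≤ (2 * (X:ℝ) ^ (2 * J)) := mul_le_mul_of_nonneg_left (pow_le_pow_right₀ hX1 hj) (by norm_num)
      have a2 : 1 ≤ (2 * (X:ℝ) ^ (2 * J)) := by nlinarith [one_le_pow₀ (n := 2 * J) hX1]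
      exact (pow_le_pow_left₀ (by positivity) a1 _).trans (pow_le_pow_right₀ a2 (Nat.pow_le_pow_right (by norm_num) hj))
    have h3 : 1 / (2 * (2 * (X:ℝ) ^ (2 * J)) ^ (2 ^ (2 * J))) ≤ 1 / (2 * (2 * (X:ℝ) ^ j) ^ (2 ^ j)) := by
      apply one_div_le_one_div_of_le
      · have : (0:ℝ) < X := by linarith
        positivity
      · linarith
    linarith [abs_nonneg (∑ i, (s i : ℝ) * Real.log (ev (p i).1))]
  · intro d
    refine le_trans ?_ hQ
    have := same_field_count X (F := (Finset.univ.filter (fun n => cl n = d)).image Subtype.val) ?_ ?_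
    · rw [Finset.card_image_of_injective _ Subtype.val_injective] at this
      exact_mod_cast this
    · intro a ha
      obtain ⟨n, _, rfl⟩ := Finset.mem_image.mp ha
      exact ⟨hm n, hm2 n⟩
    · intro a ha b hb
      obtain ⟨n, hn, rfl⟩ := Finset.mem_image.mp ha
      obtain ⟨m, hmm, rfl⟩ := Finset.mem_image.mp hb
      rw [← hcl, (Finset.mem_filter.mp hn).2, (Finset.mem_filter.mp hmm).2]
  · rw [← hV, ← Finset.sum_coe_sort (Ioc 2 X)]
  · rw [Finset.sum_coe_sort (Ioc 2 X) (fun n => |c n|)]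
    have := Finset.sum_le_card_nsmul (Ioc 2 X) (fun n => |c n|) γ hγ
    rw [nsmul_eq_mul, Nat.card_Ioc] at this
    have h2 : ((X - 2 : ℕ) : ℝ) ≤ X := by exact_mod_cast Nat.sub_le _ _
    nlinarith [mul_le_mul_of_nonneg_right h2 hγ0]

end

noncomputable section

lemma kappa_pos : 0 < kappa := by
  unfold kappa
  refine mul_pos (by norm_num) ?_
  have hf : ∀ p : {p : ℕ // p.Prime ∧ p ≠ 2}, 1 ≤ (1 + ((p.1 : ℝ) ^ 4 - 2 * (p.1 : ℝ) ^ 3 + 1) / ((p.1 : ℝ) ^ 2 - 1) ^ 3) := by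
    intro p
    have h2 : (2:ℝ) ≤ p.1 := by exact_mod_cast p.2.1.two_le
    have h3 : 0 ≤ (p.1 : ℝ) ^ 4 - 2 * (p.1 : ℝ) ^ 3 + 1 := by
      have : (p.1 : ℝ) ^ 4 - 2 * (p.1 : ℝ) ^ 3 = (p.1 : ℝ) ^ 3 * (p.1 - 2) := by ring
      rw [this]
      have := mul_nonneg (pow_nonneg (by linarith : (0:ℝ) ≤ p.1) 3) (sub_nonneg.mpr h2)
      linarith
    have h4 : 0 ≤ (p.1 : ℝ) ^ 2 - 1 := by nlinarith
    have := div_nonneg h3 (pow_nonneg h4 3)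
    linarith
  by_cases hm : Multipliable (fun p : {p : ℕ // p.Prime ∧ p ≠ 2} => (1 + ((p.1 : ℝ) ^ 4 - 2 * (p.1 : ℝ) ^ 3 + 1) / ((p.1 : ℝ) ^ 2 - 1) ^ 3))
  · have := hm.hasProd
    refine lt_of_lt_of_le one_pos (ge_of_tendsto this (Eventually.of_forall fun s => ?_))
    classical
    induction s using Finset.induction_on with
    | empty => simp
    | insert a s ha ih => rw [Finset.prod_insert ha]; exact one_le_mul_of_one_le_of_one_le (hf a) ih
  · rw [tprod_eq_one_of_not_multipliable hm]; exact one_pos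

lemma le_ev_add_one {n : ℕ} (hn : 2 < n) : (n:ℝ) ≤ ev n + 1 := by
  have h1 := ev_quad hn
  have h2 := ev_gt hn
  by_contra hc
  push Not at hc
  nlinarith

lemma M_bound : ∃ C δ : ℝ, 0 ≤ C ∧ 0 < δ ∧ δ < 1 ∧ ∀ (E : ℝ) (X : ℕ), 1 ≤ E → (∀ n : ℕ, 2 < n → ev n ≤ E → n ≤ X) →
    |∑ n ∈ Ioc 2 X with ev n ≤ E, ampA n ^ 2 - kappa * E| ≤ C * E ^ (1 - δ) := by
  obtain ⟨C, δ, hC, hδ, hδ1, h⟩ := I2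
  refine ⟨kappa + 2 * C, δ, by have := kappa_pos; positivity, hδ, hδ1, fun E X hE hX => ?_⟩
  have hk := kappa_pos
  set m := ⌊E⌋₊ with hm
  have hmE : (m:ℝ) ≤ E := Nat.floor_le (by linarith)
  have hEm : E < m + 1 := Nat.lt_floor_add_one E
  have hm1 : 1 ≤ m := Nat.le_floor (by exact_mod_cast hE)
  have hm1' : (1:ℝ) ≤ m := by exact_mod_cast hm1
  have hlo : ∑ n ∈ Ioc 2 m, ampA n ^ 2 ≤ ∑ n ∈ Ioc 2 X with ev n ≤ E, ampA n ^ 2 := by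
    refine Finset.sum_le_sum_of_subset_of_nonneg (fun n hn => ?_) fun _ _ _ => sq_nonneg _
    obtain ⟨h2, h3⟩ := Finset.mem_Ioc.mp hn
    have h4 : ev n ≤ E := ev_le.trans (le_trans (by exact_mod_cast h3) hmE)
    exact Finset.mem_filter.mpr ⟨Finset.mem_Ioc.mpr ⟨h2, hX n h2 h4⟩, h4⟩
  have hhi : ∑ n ∈ Ioc 2 X with ev n ≤ E, ampA n ^ 2 ≤ ∑ n ∈ Ioc 2 (m+1), ampA n ^ 2 := by
    refine Finset.sum_le_sum_of_subset_of_nonneg (fun n hn => ?_) fun _ _ _ => sq_nonneg _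
    obtain ⟨h2, h4⟩ := Finset.mem_filter.mp hn
    obtain ⟨h2, h3⟩ := Finset.mem_Ioc.mp h2
    have h5 := le_ev_add_one h2
    have h6 : (n:ℝ) < (m + 1 + 1 : ℕ) := by push_cast; linarith
    have h7 : n < m + 1 + 1 := by exact_mod_cast h6
    exact Finset.mem_Ioc.mpr ⟨h2, by omega⟩
  have a1 := (abs_le.mp (h m hm1)).1
  have a2 := (abs_le.mp (h (m+1) (by omega))).2
  have b1 : (m:ℝ) ^ (1 - δ) ≤ E ^ (1 - δ) := Real.rpow_le_rpow (by linarith) hmE (by linarith)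
  have b2 : ((m + 1 : ℕ):ℝ) ^ (1 - δ) ≤ 2 * E ^ (1 - δ) := by
    calc ((m + 1 : ℕ):ℝ) ^ (1 - δ) ≤ (2 * E) ^ (1 - δ) := Real.rpow_le_rpow (by positivity) (by push_cast; linarith) (by linarith)
      _ = 2 ^ (1 - δ) * E ^ (1 - δ) := Real.mul_rpow (by norm_num) (by linarith)
      _ ≤ 2 * E ^ (1 - δ) := by
        refine mul_le_mul_of_nonneg_right ?_ (by positivity)
        calc (2:ℝ) ^ (1 - δ) ≤ 2 ^ (1:ℝ) := Real.rpow_le_rpow_of_exponent_le (by norm_num) (by linarith)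
          _ = 2 := Real.rpow_one 2
  have b3 : 1 ≤ E ^ (1 - δ) := Real.one_le_rpow hE (by linarith)
  have c1 := mul_le_mul_of_nonneg_left b1 hC
  have c2 := mul_le_mul_of_nonneg_left b2 hC
  have c3 := mul_le_mul_of_nonneg_left b3 hk.le
  have c4 : kappa * E ≤ kappa * (m + 1) := mul_le_mul_of_nonneg_left hEm.le hk.le
  have c5 : kappa * m ≤ kappa * E := mul_le_mul_of_nonneg_left hmE hk.le
  have c6 : 0 ≤ C * E ^ (1 - δ) := by positivity
  push_cast at a2 b2 c2
  rw [abs_le]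
  constructor <;> nlinarith

lemma V_asymp (g : ℝ → ℝ) (hg : ContDiff ℝ 1 g) (hg0 : g 0 = 1) (hg1 : ∀ u, 1 ≤ u → g u = 0) :
    ∃ C δ : ℝ, 0 ≤ C ∧ 0 < δ ∧ δ < 1 ∧ ∀ (a : ℝ) (X : ℕ), 0 < a → (∀ n : ℕ, 2 < n → ev n ≤ exp a → n ≤ X) →
    |∑ n ∈ Ioc 2 X, ampA n ^ 2 * g (Real.log (ev n) / a) ^ 2 - kappa * (1 + a * ∫ u in (0:ℝ)..1, g u ^ 2 * exp (a * u))| ≤ C * exp (a * (1 - δ)) := by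
  obtain ⟨C, δ, hC, hδ, hδ1, hM⟩ := M_bound
  set G : ℝ → ℝ := fun u => g u ^ 2 with hG
  have hGc : ContDiff ℝ 1 G := hg.pow 2
  set G' := deriv G with hG'
  have hG'c : Continuous G' := hGc.continuous_deriv le_rfl
  have hGd : ∀ x, HasDerivAt G (G' x) x := fun x => (hGc.differentiable (by norm_num) x).hasDerivAt
  have hG1 : ∀ u, 1 ≤ u → G u = 0 := fun u hu => by simp only [hG, hg1 u hu]; norm_num
  have hG0 : G 0 = 1 := by simp only [hG, hg0]; norm_num
  refine ⟨C * ∫ t in (0:ℝ)..1, |G' t|, δ, mul_nonneg hC (intervalIntegral.integral_nonneg (by norm_num) fun _ _ => abs_nonneg _), hδ, hδ1, fun a X ha hX => ?_⟩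
  have hint : ∀ f : ℝ → ℝ, Continuous f → IntegrableOn f (Set.Ioc 0 1) := fun f hf => (hf.intervalIntegrable 0 1).1
  -- single term
  have hterm : ∀ n ∈ Ioc 2 X, G (Real.log (ev n) / a) = - ∫ t in Set.Ioc (0:ℝ) 1, if ev n ≤ exp (a * t) then G' t else 0 := by
    intro n hn
    have h2 := (Finset.mem_Ioc.mp hn).1
    set u := Real.log (ev n) / a with hu
    have hu0 : 0 < u := div_pos (Real.log_pos (ev_gt h2)) ha
    have hiff : ∀ t, ev n ≤ exp (a * t) ↔ u ≤ t := by
      intro t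
      rw [← Real.log_le_iff_le_exp (ev_pos h2), hu, div_le_iff₀ ha, mul_comm]
    simp_rw [hiff]
    have e1 : (fun t => if u ≤ t then G' t else 0) = (Set.Ici u).indicator G' := by
      ext t; simp [Set.indicator_apply]
    rw [e1, setIntegral_indicator measurableSet_Ici]
    rcases le_or_gt u 1 with h | h
    · have e2 : Set.Ioc (0:ℝ) 1 ∩ Set.Ici u = Set.Icc u 1 := by
        ext t; simp only [Set.mem_inter_iff, Set.mem_Ioc, Set.mem_Ici, Set.mem_Icc]
        constructor
        · rintro ⟨⟨_, h1⟩, h2⟩; exact ⟨h2, h1⟩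
        · rintro ⟨h1, h2⟩; exact ⟨⟨by linarith, h2⟩, h1⟩
      rw [e2, integral_Icc_eq_integral_Ioc, ← intervalIntegral.integral_of_le h, intervalIntegral.integral_eq_sub_of_hasDerivAt (fun x _ => hGd x) (hG'c.intervalIntegrable _ _), hG1 1 le_rfl]
      ring
    · have e2 : Set.Ioc (0:ℝ) 1 ∩ Set.Ici u = ∅ := by
        ext t; simp only [Set.mem_inter_iff, Set.mem_Ioc, Set.mem_Ici, Set.mem_empty_iff_false, iff_false]
        rintro ⟨⟨_, h1⟩, h2⟩; linarith
      rw [e2, hG1 u h.le]; simp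
  have hsplit : ∀ n, IntegrableOn (fun t => if ev n ≤ exp (a * t) then G' t else 0) (Set.Ioc 0 1) := by
    intro n
    have e1 : (fun t => if ev n ≤ exp (a * t) then G' t else 0) = ({t | ev n ≤ exp (a * t)}).indicator G' := by
      ext t; simp [Set.indicator_apply]
    rw [e1]
    exact (hint _ hG'c).indicator (measurableSet_le measurable_const (by fun_prop))
  have hsum : ∑ n ∈ Ioc 2 X, ampA n ^ 2 * g (Real.log (ev n) / a) ^ 2 = - ∫ t in Set.Ioc (0:ℝ) 1, (∑ n ∈ Ioc 2 X with ev n ≤ exp (a * t), ampA n ^ 2) * G' t := by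
    calc ∑ n ∈ Ioc 2 X, ampA n ^ 2 * g (Real.log (ev n) / a) ^ 2 = ∑ n ∈ Ioc 2 X, - ∫ t in Set.Ioc (0:ℝ) 1, ampA n ^ 2 * (if ev n ≤ exp (a * t) then G' t else 0) := by
          refine sum_congr rfl fun n hn => ?_
          have := hterm n hn
          rw [integral_const_mul]
          simp only [hG] at this ⊢
          rw [this]; ring
      _ = - ∫ t in Set.Ioc (0:ℝ) 1, ∑ n ∈ Ioc 2 X, ampA n ^ 2 * (if ev n ≤ exp (a * t) then G' t else 0) := by
          rw [Finset.sum_neg_distrib, integral_finsetSum _ fun n _ => (hsplit n).const_mul _]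
      _ = _ := by
          congr 1
          refine integral_congr_ae (Eventually.of_forall fun t => ?_)
          simp only
          rw [Finset.sum_filter, Finset.sum_mul]
          refine sum_congr rfl fun n _ => ?_
          split_ifs <;> simp
  have hmain : kappa * (1 + a * ∫ u in (0:ℝ)..1, g u ^ 2 * exp (a * u)) = - ∫ t in Set.Ioc (0:ℝ) 1, kappa * exp (a * t) * G' t := by
    have hE : ∀ t : ℝ, HasDerivAt (fun t => exp (a * t)) (a * exp (a * t)) t := by
      intro t
      have := ((hasDerivAt_id t).const_mul a).exp
      simp only [id, mul_one] at this
      rw [mul_comm]; exact this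
    have ibp := intervalIntegral.integral_mul_deriv_eq_deriv_mul (a := 0) (b := 1) (fun t _ => hE t) (fun t _ => hGd t) (Continuous.intervalIntegrable (by fun_prop) _ _) (hG'c.intervalIntegrable _ _)
    rw [hG1 1 le_rfl, hG0] at ibp
    simp_rw [mul_assoc]
    rw [integral_const_mul, ← intervalIntegral.integral_of_le zero_le_one, ibp]
    have e : ∫ x in (0:ℝ)..1, a * exp (a * x) * G x = a * ∫ u in (0:ℝ)..1, g u ^ 2 * exp (a * u) := by
      rw [← intervalIntegral.integral_const_mul]
      refine intervalIntegral.integral_congr fun x _ => ?_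
      simp only [hG]; ring
    rw [e]
    simp; ring
  rw [hsum, hmain]
  have hi1 : IntegrableOn (fun t => (∑ n ∈ Ioc 2 X with ev n ≤ exp (a * t), ampA n ^ 2) * G' t) (Set.Ioc 0 1) := by
    have : (fun t => (∑ n ∈ Ioc 2 X with ev n ≤ exp (a * t), ampA n ^ 2) * G' t) = fun t => ∑ n ∈ Ioc 2 X, ampA n ^ 2 * (if ev n ≤ exp (a * t) then G' t else 0) := by
      ext t
      rw [Finset.sum_filter, Finset.sum_mul]
      refine sum_congr rfl fun n _ => ?_
      split_ifs <;> simp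
    rw [this]
    exact integrable_finsetSum _ fun n _ => (hsplit n).const_mul _
  have hi2 : IntegrableOn (fun t => kappa * exp (a * t) * G' t) (Set.Ioc 0 1) := hint _ (by fun_prop)
  rw [neg_sub_neg, ← integral_sub hi2 hi1, intervalIntegral.integral_of_le zero_le_one, mul_assoc, mul_comm (∫ t in Set.Ioc (0:ℝ) 1, |G' t|), ← mul_assoc, ← integral_const_mul]
  rw [← Real.norm_eq_abs]
  refine norm_integral_le_of_norm_le ((hint _ hG'c.abs).const_mul _) ?_
  refine (ae_restrict_iff' measurableSet_Ioc).mpr (Eventually.of_forall fun t ht => ?_)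
  rw [← sub_mul, norm_mul, Real.norm_eq_abs, Real.norm_eq_abs, abs_sub_comm]
  refine mul_le_mul_of_nonneg_right ?_ (abs_nonneg _)
  have hat : 0 ≤ a * t := mul_nonneg ha.le ht.1.le
  refine (hM (exp (a * t)) X (Real.one_le_exp hat) fun n h2 h3 => hX n h2 (h3.trans (Real.exp_le_exp.mpr ?_))).trans ?_
  · nlinarith [ht.2]
  · refine mul_le_mul_of_nonneg_left ?_ hC
    rw [← Real.exp_mul]
    apply Real.exp_le_exp.mpr
    refine mul_le_mul_of_nonneg_right ?_ (by linarith)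
    nlinarith [ht.2]

end

noncomputable section

lemma g_vanish {g : ℝ → ℝ} (hc : Continuous g) (hs : HasCompactSupport g)
    (hsup : sSup {r : ℝ | ∃ ξ : ℝ, g ξ ≠ 0 ∧ |ξ| = r} = 1) : ∀ u, 1 ≤ u → g u = 0 := by
  have hb : BddAbove {r : ℝ | ∃ ξ : ℝ, g ξ ≠ 0 ∧ |ξ| = r} := by
    obtain ⟨B, hB⟩ := hs.isCompact.isBounded.exists_norm_le
    refine ⟨B, ?_⟩
    rintro r ⟨ξ, h1, rfl⟩
    exact hB ξ (subset_tsupport _ h1)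
  have h1 : ∀ u ∈ Set.Ioi (1:ℝ), g u = 0 := by
    intro u hu
    by_contra hne
    have := le_csSup hb (show |u| ∈ {r : ℝ | ∃ ξ : ℝ, g ξ ≠ 0 ∧ |ξ| = r} from ⟨u, hne, rfl⟩)
    rw [hsup] at this
    have h3 : (1:ℝ) < u := hu
    linarith [le_abs_self u]
  intro u hu
  have h2 : Set.EqOn g (fun _ => 0) (closure (Set.Ioi (1:ℝ))) := Set.EqOn.closure (fun u hu => h1 u hu) hc continuous_const
  rw [closure_Ioi] at h2
  exact h2 hu

lemma I_lower {g : ℝ → ℝ} (hc : Continuous g) (he : ∀ ξ, g (-ξ) = g ξ) (h1 : ∀ u, 1 ≤ u → g u = 0)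
    (hsup : sSup {r : ℝ | ∃ ξ : ℝ, g ξ ≠ 0 ∧ |ξ| = r} = 1) {η : ℝ} (hη : 0 < η) (hη1 : η < 1) :
    ∃ c : ℝ, 0 < c ∧ ∀ a : ℝ, 0 ≤ a → c * exp (a * (1 - η)) ≤ ∫ u in (0:ℝ)..1, g u ^ 2 * exp (a * u) := by
  have hne : {r : ℝ | ∃ ξ : ℝ, g ξ ≠ 0 ∧ |ξ| = r}.Nonempty := by
    by_contra hn
    rw [Set.not_nonempty_iff_eq_empty] at hn
    rw [hn, Real.sSup_empty] at hsup
    norm_num at hsup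
  obtain ⟨r, ⟨ξ, h2, rfl⟩, h3⟩ := exists_lt_of_lt_csSup hne (show 1 - η < _ by rw [hsup]; linarith)
  have h4 : g |ξ| ≠ 0 := by
    rcases abs_choice ξ with h | h <;> rw [h]
    · exact h2
    · rwa [he]
  have h5 : |ξ| ≤ 1 := by
    by_contra hcon
    exact h4 (h1 _ (by linarith))
  have hpos : 0 < ∫ u in (1-η)..1, g u ^ 2 :=
    intervalIntegral.integral_pos (by linarith) (by fun_prop) (fun _ _ => sq_nonneg _) ⟨|ξ|, ⟨h3.le, h5⟩, by positivity⟩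
  refine ⟨_, hpos, fun a ha => ?_⟩
  have e1 : ∫ u in (1-η)..1, g u ^ 2 * exp (a * u) ≤ ∫ u in (0:ℝ)..1, g u ^ 2 * exp (a * u) := by
    refine intervalIntegral.integral_mono_interval (by linarith) (by linarith) le_rfl (Eventually.of_forall fun u => by positivity) (Continuous.intervalIntegrable (by fun_prop) _ _)
  refine le_trans ?_ e1
  rw [← intervalIntegral.integral_mul_const]
  refine intervalIntegral.integral_mono_on (by linarith) (Continuous.intervalIntegrable (by fun_prop) _ _) (Continuous.intervalIntegrable (by fun_prop) _ _) fun u hu => ?_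
  refine mul_le_mul_of_nonneg_left (Real.exp_le_exp.mpr (mul_le_mul_of_nonneg_left hu.1 ha)) (sq_nonneg _)

/-- the variance integral on the unit interval -/
def II (g : ℝ → ℝ) (a : ℝ) : ℝ := ∫ u in (0:ℝ)..1, g u ^ 2 * exp (a * u)
/-- normalisation -/
def ss (g : ℝ → ℝ) (a : ℝ) : ℝ := Real.sqrt (2 * kappa * a * II g a)
/-- normalised coefficients -/
def cc (g : ℝ → ℝ) (a : ℝ) (n : ℕ) : ℝ := ampA n * g (Real.log (ev n) / a) / ss g a
/-- cutoff -/
def Xcut (a : ℝ) : ℕ := ⌊2 * exp a⌋₊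

lemma Xcut_le (a : ℝ) : (Xcut a : ℝ) ≤ 2 * exp a := Nat.floor_le (by positivity)

lemma le_Xcut {a : ℝ} {n : ℕ} (hn : 2 < n) (h : ev n ≤ exp a) : n ≤ Xcut a := by
  apply Nat.le_floor
  have := ev_ge (n := n)
  linarith

lemma one_le_Xcut {a : ℝ} (ha : 0 ≤ a) : 1 ≤ Xcut a := by
  apply Nat.le_floor
  have := Real.one_le_exp ha
  push_cast; linarith

lemma sigma_eq {g : ℝ → ℝ} (h1 : ∀ u, 1 ≤ u → g u = 0) {L : ℝ} (hL : 0 < L) :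
    Real.pi * L * Real.sqrt (sigmaSq g L) = ss g (Real.pi * L) := by
  have ha : 0 < Real.pi * L := by positivity
  unfold sigmaSq ss II
  have e : ∫ u in Set.Ioi (0 : ℝ), g u ^ 2 * exp (Real.pi * L * u) = ∫ u in (0:ℝ)..1, g u ^ 2 * exp (Real.pi * L * u) := by
    rw [intervalIntegral.integral_of_le zero_le_one]
    refine setIntegral_eq_of_subset_of_forall_sdiff_eq_zero measurableSet_Ioi (fun u hu => hu.1) fun u hu => ?_
    have : 1 ≤ u := by
      by_contra hcon
      exact hu.2 ⟨hu.1, by linarith⟩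
    rw [h1 u this]; simp
  rw [e]
  set a := Real.pi * L
  set I := ∫ u in (0:ℝ)..1, g u ^ 2 * exp (a * u)
  rw [show 2 * kappa * a * I = a ^ 2 * (2 * kappa / a * I) by field_simp, Real.sqrt_mul (sq_nonneg a), Real.sqrt_sq ha.le]

lemma SL_eq {g : ℝ → ℝ} (h1 : ∀ u, 1 ≤ u → g u = 0) {L : ℝ} (hL : 0 < L) (τ : ℝ) :
    SL g L τ / Real.sqrt (sigmaSq g L) = ∑ n ∈ Ioc 2 (Xcut (Real.pi * L)), cc g (Real.pi * L) n * (2 * Real.cos (τ * Real.log (Nnorm n))) := by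
  have ha : 0 < Real.pi * L := by positivity
  unfold SL
  rw [tsum_eq_sum (s := Ioc 2 (Xcut (Real.pi * L)))]
  · unfold cc
    rw [← sigma_eq h1 hL, mul_sum, Finset.sum_div]
    refine sum_congr rfl fun n hn => ?_
    have h2 := (Finset.mem_Ioc.mp hn).1
    rw [if_pos h2]
    have : Real.log (Nnorm n) / (2 * Real.pi * L) = Real.log (ev n) / (Real.pi * L) := by
      rw [log_Nnorm n]; field_simp
    rw [this]
    simp only [div_eq_mul_inv, mul_inv, one_mul]
    ring
  · intro n hn
    split_ifs with h2
    · have h3 : 1 ≤ Real.log (Nnorm n) / (2 * Real.pi * L) := by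
        have h4 : ¬ ev n ≤ exp (Real.pi * L) := fun h => hn (Finset.mem_Ioc.mpr ⟨h2, le_Xcut h2 h⟩)
        push Not at h4
        have h5 := (Real.lt_log_iff_exp_lt (ev_pos h2)).mpr h4
        rw [log_Nnorm n, le_div_iff₀ (by positivity)]
        linarith
      rw [h1 _ h3]; simp
    · rfl

lemma logX_le {a : ℝ} (ha : 0 ≤ a) : ((Nat.log 2 (Xcut a) + 1 : ℕ) : ℝ) ≤ 2 * a + 3 := by
  have h0 := one_le_Xcut ha
  have h1 : 2 ^ Nat.log 2 (Xcut a) ≤ Xcut a := Nat.pow_log_le_self 2 (by omega)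
  have h2 : (2:ℝ) ^ Nat.log 2 (Xcut a) ≤ 2 * exp a := le_trans (by exact_mod_cast h1) (Xcut_le a)
  have h3 := Real.log_le_log (by positivity) h2
  rw [Real.log_pow, Real.log_mul (by norm_num) (by positivity), Real.log_exp] at h3
  have h4 := Real.log_two_gt_d9
  have h5 := Real.log_two_lt_d9
  push_cast
  have h6 : (0:ℝ) ≤ (Nat.log 2 (Xcut a) : ℝ) := by positivity
  nlinarith

lemma gamma_bound {g : ℝ → ℝ} (hc : Continuous g) (hs : HasCompactSupport g) (he : ∀ ξ, g (-ξ) = g ξ) (h1 : ∀ u, 1 ≤ u → g u = 0)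
    (hsup : sSup {r : ℝ | ∃ ξ : ℝ, g ξ ≠ 0 ∧ |ξ| = r} = 1) :
    ∃ D : ℝ, 0 ≤ D ∧ ∀ a, 1 ≤ a → ∀ n ∈ Ioc 2 (Xcut a), |cc g a n| ≤ D * exp (-(a / 8)) := by
  obtain ⟨C, hC, hA⟩ := ampA_le (ε := 1/4) (by norm_num)
  obtain ⟨c, hc0, hI⟩ := I_lower hc he h1 hsup (η := 1/4) (by norm_num) (by norm_num)
  obtain ⟨B, hB⟩ := hc.bounded_above_of_compact_support hs
  have hB0 : 0 ≤ B := (norm_nonneg _).trans (hB 0)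
  have hk := kappa_pos
  refine ⟨C * 2 * B / Real.sqrt (2 * kappa * c), by positivity, fun a ha n hn => ?_⟩
  obtain ⟨h2, h3⟩ := Finset.mem_Ioc.mp hn
  have h4 : (n:ℝ) ≤ 2 * exp a := le_trans (by exact_mod_cast h3) (Xcut_le a)
  have h5 : (n:ℝ) ^ (1/4:ℝ) ≤ 2 * exp (a / 4) := by
    calc (n:ℝ) ^ (1/4:ℝ) ≤ (2 * exp a) ^ (1/4:ℝ) := Real.rpow_le_rpow (by positivity) h4 (by norm_num)
      _ = 2 ^ (1/4:ℝ) * exp (a / 4) := by rw [Real.mul_rpow (by norm_num) (by positivity), ← Real.exp_mul]; ring_nf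
      _ ≤ 2 * exp (a / 4) := by
        refine mul_le_mul_of_nonneg_right ?_ (by positivity)
        calc (2:ℝ) ^ (1/4:ℝ) ≤ 2 ^ (1:ℝ) := Real.rpow_le_rpow_of_exponent_le (by norm_num) (by norm_num)
          _ = 2 := Real.rpow_one 2
  have h6 : Real.sqrt (2 * kappa * c) * exp (3 * a / 8) ≤ ss g a := by
    unfold ss
    apply Real.le_sqrt_of_sq_le
    rw [mul_pow, Real.sq_sqrt (by positivity), ← Real.exp_nat_mul]
    have h7 := hI a (by linarith)
    have h8 : exp ((2:ℕ) * (3 * a / 8)) = exp (a * (1 - 1/4)) := by congr 1; push_cast; ring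
    rw [h8]
    have h9 : c * exp (a * (1 - 1/4)) ≤ a * II g a := by
      have : 0 ≤ II g a := le_trans (by positivity) h7
      unfold II at this ⊢
      nlinarith
    calc 2 * kappa * c * exp (a * (1 - 1/4)) = 2 * kappa * (c * exp (a * (1 - 1/4))) := by ring
      _ ≤ 2 * kappa * (a * II g a) := mul_le_mul_of_nonneg_left h9 (by positivity)
      _ = _ := by ring
  have hss : 0 < ss g a := lt_of_lt_of_le (by positivity) h6
  unfold cc
  rw [abs_div, abs_of_pos hss, abs_mul, div_le_iff₀ hss]
  calc |ampA n| * |g (Real.log (ev n) / a)| ≤ (C * (2 * exp (a / 4))) * B :=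
        mul_le_mul ((hA n h2).trans (mul_le_mul_of_nonneg_left h5 (by linarith))) (hB _) (abs_nonneg _) (by positivity)
    _ = C * 2 * B / Real.sqrt (2 * kappa * c) * exp (-(a / 8)) * (Real.sqrt (2 * kappa * c) * exp (3 * a / 8)) := by
        have e : exp (a / 4) = exp (-(a / 8)) * exp (3 * a / 8) := by rw [← Real.exp_add]; congr 1; ring
        have : Real.sqrt (2 * kappa * c) ≠ 0 := by positivity
        rw [e]; field_simp
    _ ≤ _ := mul_le_mul_of_nonneg_left h6 (by positivity)

lemma V_tendsto {g : ℝ → ℝ} (hg : ContDiff ℝ 1 g) (hg0 : g 0 = 1) (he : ∀ ξ, g (-ξ) = g ξ) (h1 : ∀ u, 1 ≤ u → g u = 0)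
    (hsup : sSup {r : ℝ | ∃ ξ : ℝ, g ξ ≠ 0 ∧ |ξ| = r} = 1) :
    Tendsto (fun a => 2 * ∑ n ∈ Ioc 2 (Xcut a), cc g a n ^ 2) atTop (nhds 1) := by
  obtain ⟨C, δ, hC, hδ, hδ1, hV⟩ := V_asymp g hg hg0 h1
  obtain ⟨c, hc0, hI⟩ := I_lower hg.continuous he h1 hsup (η := δ/2) (by linarith) (by linarith)
  have hk := kappa_pos
  rw [tendsto_iff_norm_sub_tendsto_zero]
  have hlim : Tendsto (fun a : ℝ => (kappa + C) / (kappa * c) * exp (-(a * (δ / 2)))) atTop (nhds 0) := by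
    rw [← mul_zero ((kappa + C) / (kappa * c))]
    refine Tendsto.const_mul _ ?_
    refine Real.tendsto_exp_neg_atTop_nhds_zero.comp ?_
    exact tendsto_id.atTop_mul_const (by linarith)
  refine squeeze_zero' (Eventually.of_forall fun _ => norm_nonneg _) ?_ hlim
  filter_upwards [eventually_ge_atTop (1:ℝ)] with a ha
  have h7 := hI a (by linarith)
  have hv := hV a (Xcut a) (by linarith) fun n h2 h3 => le_Xcut h2 h3
  have hIp : 0 < II g a := lt_of_lt_of_le (by positivity) h7
  have hden : 0 < kappa * a * II g a := by positivity
  have e1 : 2 * ∑ n ∈ Ioc 2 (Xcut a), cc g a n ^ 2 = (∑ n ∈ Ioc 2 (Xcut a), ampA n ^ 2 * g (Real.log (ev n) / a) ^ 2) / (kappa * a * II g a) := by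
    have : ∀ n, cc g a n ^ 2 = ampA n ^ 2 * g (Real.log (ev n) / a) ^ 2 / (2 * kappa * a * II g a) := by
      intro n
      unfold cc ss
      rw [div_pow, Real.sq_sqrt (by positivity), mul_pow]
    simp_rw [this]
    rw [← Finset.sum_div]
    field_simp
  rw [e1, Real.norm_eq_abs]
  set S := ∑ n ∈ Ioc 2 (Xcut a), ampA n ^ 2 * g (Real.log (ev n) / a) ^ 2
  have e2 : S / (kappa * a * II g a) - 1 = (S - kappa * a * II g a) / (kappa * a * II g a) := by field_simp
  rw [e2, abs_div, abs_of_pos hden, div_le_iff₀ hden]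
  have h8 : |S - kappa * a * II g a| ≤ (kappa + C) * exp (a * (1 - δ)) := by
    have hE : 1 ≤ exp (a * (1 - δ)) := Real.one_le_exp (mul_nonneg (by linarith) (by linarith))
    have e3 : S - kappa * a * II g a = (S - kappa * (1 + a * II g a)) + kappa := by ring
    rw [e3]
    refine (abs_add_le _ _).trans ?_
    rw [abs_of_pos hk]
    have : |S - kappa * (1 + a * II g a)| ≤ C * exp (a * (1 - δ)) := hv
    nlinarith
  refine h8.trans ?_
  have h9 : c * exp (a * (1 - δ / 2)) ≤ a * II g a := by
    have h7' : c * exp (a * (1 - δ / 2)) ≤ II g a := h7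
    nlinarith
  calc (kappa + C) * exp (a * (1 - δ)) = (kappa + C) / (kappa * c) * exp (-(a * (δ / 2))) * (kappa * (c * exp (a * (1 - δ / 2)))) := by
        have e : exp (a * (1 - δ)) = exp (-(a * (δ / 2))) * exp (a * (1 - δ / 2)) := by rw [← Real.exp_add]; congr 1; ring
        rw [e]; field_simp
    _ ≤ (kappa + C) / (kappa * c) * exp (-(a * (δ / 2))) * (kappa * (a * II g a)) :=
        mul_le_mul_of_nonneg_left (mul_le_mul_of_nonneg_left h9 hk.le) (by positivity)
    _ = _ := by ring

end

noncomputable section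

/-- the smooth averaging measure -/
def muT (w : ℝ → ℝ) (T : ℝ) : Measure ℝ := volume.withDensity fun τ => ENNReal.ofReal ((1 / T) * w (τ / T))

lemma muT_prob {w : ℝ → ℝ} (hc : Continuous w) (hw0 : ∀ t, 0 ≤ w t) (hs : HasCompactSupport w) (h1 : ∫ t, w t = 1)
    {T : ℝ} (hT : 0 < T) : IsProbabilityMeasure (muT w T) := by
  refine ⟨?_⟩
  unfold muT
  rw [withDensity_apply _ MeasurableSet.univ, Measure.restrict_univ, ← ofReal_integral_eq_lintegral_ofReal]
  · rw [integral_const_mul, Measure.integral_comp_div (fun t => w t), h1, abs_of_pos hT]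
    simp [hT.ne']
  · have := (hc.integrable_of_hasCompactSupport hs).comp_div hT.ne'
    exact this.const_mul _
  · exact Eventually.of_forall fun t => mul_nonneg (by positivity) (hw0 _)

lemma muT_integral {w : ℝ → ℝ} (hc : Continuous w) (hw0 : ∀ t, 0 ≤ w t) {T : ℝ} (hT : 0 < T) (f : ℝ → ℂ) :
    ∫ τ, f τ ∂(muT w T) = ∫ τ, (((1 / T) * w (τ / T) : ℝ) : ℂ) * f τ := by
  unfold muT
  rw [integral_withDensity_eq_integral_toReal_smul (by fun_prop) (Eventually.of_forall fun _ => ENNReal.ofReal_lt_top)]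
  refine integral_congr_ae (Eventually.of_forall fun τ => ?_)
  simp only
  rw [ENNReal.toReal_ofReal (mul_nonneg (by positivity) (hw0 _)), Complex.real_smul]

lemma fourier_bound {v : ℝ → ℝ} (hv : ContDiff ℝ 1 v) (hs : HasCompactSupport v) {x : ℝ} (hx : x ≠ 0) :
    ‖∫ τ : ℝ, (v τ : ℂ) * Complex.exp ((τ * x : ℝ) * Complex.I)‖ ≤ (∫ τ, |deriv v τ|) / |x| := by
  have hc := hv.continuous
  have hc' : Continuous (deriv v) := hv.continuous_deriv le_rfl
  have hs' : HasCompactSupport (deriv v) := hs.deriv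
  have hxI : (x:ℂ) * Complex.I ≠ 0 := mul_ne_zero (by exact_mod_cast hx) Complex.I_ne_zero
  have hd : ∀ τ : ℝ, HasDerivAt (fun τ : ℝ => Complex.exp ((τ * x : ℝ) * Complex.I) / ((x:ℂ) * Complex.I)) (Complex.exp ((τ * x : ℝ) * Complex.I)) τ := by
    intro τ
    have e1 : HasDerivAt (fun τ : ℝ => ((τ * x : ℝ) : ℂ) * Complex.I) (((1 * x : ℝ) : ℂ) * Complex.I) τ :=
      (((hasDerivAt_id τ).mul_const x).ofReal_comp).mul_const _
    have e2 := (e1.cexp).div_const ((x:ℂ) * Complex.I)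
    rw [one_mul, mul_div_assoc, div_self hxI, mul_one] at e2
    exact e2
  have hvd : ∀ τ : ℝ, HasDerivAt (fun τ => (v τ : ℂ)) ((deriv v τ : ℝ) : ℂ) τ := fun τ =>
    ((hv.differentiable (by norm_num) τ).hasDerivAt).ofReal_comp
  have hsC : HasCompactSupport (fun τ => (v τ : ℂ)) := hs.comp_left (g := fun r : ℝ => (r:ℂ)) (by simp)
  have hsC' : HasCompactSupport (fun τ => ((deriv v τ : ℝ) : ℂ)) := hs'.comp_left (g := fun r : ℝ => (r:ℂ)) (by simp)
  have key := integral_mul_deriv_eq_deriv_mul_of_integrable (fun τ _ => hvd τ) (fun τ _ => hd τ)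
    (Continuous.integrable_of_hasCompactSupport (by simp only [Pi.mul_def]; fun_prop) hsC.mul_right)
    (Continuous.integrable_of_hasCompactSupport (by simp only [Pi.mul_def]; fun_prop) hsC'.mul_right)
    (Continuous.integrable_of_hasCompactSupport (by simp only [Pi.mul_def]; fun_prop) hsC.mul_right)
  rw [key, norm_neg, ← integral_div]
  refine norm_integral_le_of_norm_le ?_ (Eventually.of_forall fun τ => ?_)
  · exact (hc'.abs.integrable_of_hasCompactSupport (hs'.comp_left (g := fun r => |r|) abs_zero)).div_const _
  · rw [norm_mul, norm_div, Complex.norm_exp_ofReal_mul_I, norm_mul, Complex.norm_I, Complex.norm_real, Complex.norm_real, Real.norm_eq_abs, Real.norm_eq_abs]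
    apply le_of_eq; ring

lemma muT_fourier {w : ℝ → ℝ} (hw : ContDiff ℝ 1 w) (hw0 : ∀ t, 0 ≤ w t) (hs : HasCompactSupport w)
    {T : ℝ} (hT : 0 < T) (x : ℝ) (hx : x ≠ 0) :
    ‖∫ τ, Complex.exp ((τ * x : ℝ) * Complex.I) ∂(muT w T)‖ ≤ ((∫ t, |deriv w t|) / T) / |x| := by
  rw [muT_integral hw.continuous hw0 hT]
  have hs1 : HasCompactSupport (fun τ => 1 / T * w (τ / T)) := by
    have : HasCompactSupport (fun τ => w (τ / T)) := by
      have := hs.comp_homeomorph (Homeomorph.mulRight₀ T⁻¹ (inv_ne_zero hT.ne'))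
      simpa [Function.comp_def, div_eq_mul_inv] using this
    exact this.mul_left
  refine (fourier_bound (v := fun τ => 1 / T * w (τ / T)) (contDiff_const.mul (hw.comp (by fun_prop))) hs1 hx).trans (le_of_eq ?_)
  congr 1
  have hd : ∀ τ, deriv (fun τ => 1 / T * w (τ / T)) τ = 1 / T * (1 / T * deriv w (τ / T)) := by
    intro τ
    have h1 := (hw.differentiable (by norm_num) (τ / T)).hasDerivAt
    have h2 : HasDerivAt (fun τ => τ / T) (1 / T) τ := (hasDerivAt_id τ).div_const T
    have h3 := (h1.comp τ h2).const_mul (1 / T)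
    have h4 := h3.deriv
    simp only [Function.comp_def] at h4
    rw [h4]; ring
  have e : ∀ τ, |deriv (fun τ => 1 / T * w (τ / T)) τ| = 1 / T * (1 / T) * |deriv w (τ / T)| := by
    intro τ
    rw [hd, abs_mul, abs_mul, abs_of_pos (by positivity : 0 < 1 / T)]; ring
  simp_rw [e]
  rw [integral_const_mul, Measure.integral_comp_div (fun t => |deriv w t|), abs_of_pos hT, smul_eq_mul]
  field_simp

lemma muT_apply {w : ℝ → ℝ} (hc : Continuous w) (hw0 : ∀ t, 0 ≤ w t) (hs : HasCompactSupport w)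
    {T : ℝ} (hT : 0 < T) {A : Set ℝ} (hA : MeasurableSet A) :
    (muT w T A).toReal = (1 / T) * ∫ τ in A, w (τ / T) := by
  unfold muT
  have hi : Integrable (fun τ => 1 / T * w (τ / T)) := ((hc.integrable_of_hasCompactSupport hs).comp_div hT.ne').const_mul _
  rw [withDensity_apply _ hA, ← ofReal_integral_eq_lintegral_ofReal hi.integrableOn
    (Eventually.of_forall fun t => mul_nonneg (by positivity) (hw0 _)), integral_const_mul, ENNReal.toReal_ofReal]
  exact mul_nonneg (by positivity) (integral_nonneg fun _ => hw0 _)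

end

noncomputable section

lemma Qg_tendsto (k : ℕ) (D : ℝ) : Tendsto (fun a : ℝ => (2 * a + 3) ^ k * (D * exp (-(a / 8)))) atTop (nhds 0) := by
  have h1 : Tendsto (fun a : ℝ => (2 * a + 3) / 16) atTop atTop :=
    ((tendsto_id.const_mul_atTop (by norm_num : (0:ℝ) < 2)).atTop_add tendsto_const_nhds).atTop_div_const (by norm_num)
  have h2 := ((Real.tendsto_pow_mul_exp_neg_atTop_nhds_zero k).comp h1).const_mul (D * 16 ^ k * exp (3 / 16))
  rw [mul_zero] at h2
  refine h2.congr fun a => ?_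
  simp only [Function.comp_def]
  have e : exp (-(a / 8)) = exp (3 / 16) * exp (-((2 * a + 3) / 16)) := by
    rw [← Real.exp_add]; congr 1; ring
  rw [e, div_pow]
  have : (16:ℝ) ^ k ≠ 0 := by positivity
  field_simp

lemma exp_div_tendsto {L : ℝ → ℝ} (hL_log : Tendsto (fun T => L T / Real.log T) atTop (nhds 0)) (k : ℕ) (K : ℝ) :
    Tendsto (fun T => K * (exp (Real.pi * L T)) ^ k / T) atTop (nhds 0) := by
  have h1 : Tendsto (fun T => Real.log T * (1 - k * Real.pi * (L T / Real.log T))) atTop atTop := by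
    refine Real.tendsto_log_atTop.atTop_mul_pos (C := 1 - k * Real.pi * 0) (by norm_num) ?_
    exact tendsto_const_nhds.sub (hL_log.const_mul _)
  have h2 := (Real.tendsto_exp_neg_atTop_nhds_zero.comp h1).const_mul K
  rw [mul_zero] at h2
  refine h2.congr' ?_
  filter_upwards [eventually_gt_atTop (1:ℝ)] with T hT
  have hl := Real.log_pos hT
  simp only [Function.comp_def]
  have e : -(Real.log T * (1 - k * Real.pi * (L T / Real.log T))) = k * (Real.pi * L T) - Real.log T := by
    field_simp; ring
  rw [e, Real.exp_sub, Real.exp_log (by linarith), Real.exp_nat_mul, mul_div_assoc]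

lemma char_conv (g : ℝ → ℝ) (hg : ContDiff ℝ 1 g) (hg_even : ∀ ξ, g (-ξ) = g ξ)
    (hg_supp : HasCompactSupport g) (hg_zero : g 0 = 1)
    (hg_sup : sSup {r : ℝ | ∃ ξ : ℝ, g ξ ≠ 0 ∧ |ξ| = r} = 1)
    (w : ℝ → ℝ) (hw : ContDiff ℝ 1 w) (hw0 : ∀ t, 0 ≤ w t)
    (hw_supp : HasCompactSupport w) (hw_mass : ∫ t : ℝ, w t = 1)
    (L : ℝ → ℝ) (hL_pos : ∀ T : ℝ, 0 < T → 0 < L T)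
    (hL_inf : Tendsto L atTop atTop)
    (hL_log : Tendsto (fun T => L T / Real.log T) atTop (nhds 0)) (ξ : ℝ) :
    Tendsto (fun T => ∫ τ, Complex.exp ((ξ * (SL g (L T) τ / Real.sqrt (sigmaSq g (L T))) : ℝ) * Complex.I) ∂(muT w T))
      atTop (nhds (Complex.exp ((-(ξ ^ 2 / 2) : ℝ) : ℂ))) := by
  have h1 := g_vanish hg.continuous hg_supp hg_sup
  obtain ⟨D, hD, hγ⟩ := gamma_bound hg.continuous hg_supp hg_even h1 hg_sup
  have hVt := V_tendsto hg hg_zero hg_even h1 hg_sup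
  have hat : Tendsto (fun T => Real.pi * L T) atTop atTop := hL_inf.const_mul_atTop Real.pi_pos
  set R0 := ∫ t, |deriv w t| with hR0
  have hR0n : 0 ≤ R0 := integral_nonneg fun _ => abs_nonneg _
  set V : ℝ → ℝ := fun a => 2 * ∑ n ∈ Ioc 2 (Xcut a), cc g a n ^ 2 with hV
  set γ : ℝ → ℝ := fun a => D * exp (-(a / 8)) with hγd
  have hQ1 : Tendsto (fun a : ℝ => (2 * a + 3) * γ a) atTop (nhds 0) := by simpa using Qg_tendsto 1 D
  have hQ2 : Tendsto (fun a : ℝ => (2 * a + 3) ^ 2 * γ a) atTop (nhds 0) := Qg_tendsto 2 D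
  -- second error
  have hE2 : ∀ J : ℕ, Tendsto (fun a => 4 * exp ((2 * (|ξ| + 1)) ^ 2 * V a * exp ((2 * (|ξ| + 1)) * (2 * (2 * a + 3) * γ a))) / 2 ^ (2 * J)) atTop
      (nhds (4 * exp ((2 * (|ξ| + 1)) ^ 2 * 1 * exp ((2 * (|ξ| + 1)) * (2 * 0))) / 2 ^ (2 * J))) := by
    intro J
    have hQ1' : Tendsto (fun a : ℝ => 2 * (2 * a + 3) * γ a) atTop (nhds (2 * 0)) :=
      (hQ1.const_mul 2).congr fun a => by ring
    exact (((Real.continuous_exp.tendsto _).comp ((hVt.const_mul _).mul ((Real.continuous_exp.tendsto _).comp (hQ1'.const_mul _)))).const_mul 4).div_const _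
  have hE3 : Tendsto (fun a => (|ξ| ^ 3 * ((2 * (2 * a + 3) * γ a) * (2 * (2 * a + 3))) + ξ ^ 4 * (2 * (2 * a + 3) * γ a) ^ 2) * V a) atTop (nhds 0) := by
    have := (((hQ2.const_mul (|ξ| ^ 3 * 4)).add ((hQ1.pow 2).const_mul (ξ ^ 4 * 4))).mul hVt)
    simp only [mul_zero, ne_eq, OfNat.ofNat_ne_zero, not_false_eq_true, zero_pow, add_zero, zero_mul] at this
    refine this.congr fun a => ?_
    ring
  have hE4 : Tendsto (fun a => ‖Complex.exp ((-(ξ ^ 2 * V a / 2) : ℝ) : ℂ) - Complex.exp ((-(ξ ^ 2 / 2) : ℝ) : ℂ)‖) atTop (nhds 0) := by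
    rw [← tendsto_iff_norm_sub_tendsto_zero]
    have e : Tendsto (fun a => -(ξ ^ 2 * V a / 2)) atTop (nhds (-(ξ ^ 2 / 2))) := by
      have := ((hVt.const_mul (ξ ^ 2)).div_const 2).neg
      rwa [mul_one] at this
    exact (Complex.continuous_exp.tendsto _).comp ((Complex.continuous_ofReal.tendsto _).comp e)
  have hE1 : ∀ J : ℕ, ∃ (K : ℝ) (k : ℕ), ∀ a, 1 ≤ a → ∀ T, 0 < T → 2 * ((1 + 2 * (Xcut a) * γ a) ^ (2 * J) * ((R0 / T) * (2 * (2 * (Xcut a : ℝ) ^ (2 * J)) ^ (2 ^ (2 * J))))) * exp |ξ| ≤ K * (exp a) ^ k / T := by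
    intro J
    refine ⟨2 * ((1 + 4 * D) ^ (2 * J) * (R0 * (2 * (2 * 2 ^ (2 * J)) ^ (2 ^ (2 * J))))) * exp |ξ|, 2 * J + 2 * J * 2 ^ (2 * J), fun a ha T hT => ?_⟩
    have hX := Xcut_le a
    have hexp : 1 ≤ exp a := Real.one_le_exp (by linarith)
    have hγ0 : 0 ≤ γ a := by simp only [hγd]; positivity
    have hγD : γ a ≤ D := by
      simp only [hγd]
      have : exp (-(a / 8)) ≤ 1 := Real.exp_le_one_iff.mpr (by linarith)
      nlinarith
    have hb1 : 1 + 2 * (Xcut a) * γ a ≤ (1 + 4 * D) * exp a := by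
      have : (Xcut a : ℝ) * γ a ≤ 2 * exp a * D := mul_le_mul hX hγD hγ0 (by positivity)
      nlinarith
    calc 2 * ((1 + 2 * (Xcut a) * γ a) ^ (2 * J) * ((R0 / T) * (2 * (2 * (Xcut a : ℝ) ^ (2 * J)) ^ (2 ^ (2 * J))))) * exp |ξ|
        ≤ 2 * (((1 + 4 * D) * exp a) ^ (2 * J) * ((R0 / T) * (2 * (2 * (2 * exp a) ^ (2 * J)) ^ (2 ^ (2 * J))))) * exp |ξ| := by
          gcongr
      _ = _ := by
          generalize 2 ^ (2 * J) = M
          simp only [mul_pow, pow_add, ← pow_mul]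
          ring
  rw [tendsto_iff_norm_sub_tendsto_zero, Metric.tendsto_nhds]
  intro ε hε
  obtain ⟨J, hJ⟩ : ∃ J : ℕ, 4 * exp ((2 * (|ξ| + 1)) ^ 2 * 1 * exp ((2 * (|ξ| + 1)) * (2 * 0))) / 2 ^ (2 * J) < ε := by
    set Y := 4 * exp ((2 * (|ξ| + 1)) ^ 2 * 1 * exp ((2 * (|ξ| + 1)) * (2 * 0)))
    have : Tendsto (fun J : ℕ => Y / (4:ℝ) ^ J) atTop (nhds 0) :=
      tendsto_const_nhds.div_atTop (tendsto_pow_atTop_atTop_of_one_lt (by norm_num))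
    obtain ⟨J, hJ⟩ := (this.eventually_lt_const hε).exists
    refine ⟨J, ?_⟩
    rw [pow_mul]; norm_num at hJ ⊢; exact hJ
  obtain ⟨K, k, hK⟩ := hE1 J
  have htot := (((exp_div_tendsto hL_log k K).add ((hE2 J).comp hat)).add (hE3.comp hat)).add (hE4.comp hat)
  rw [zero_add, add_zero, add_zero] at htot
  have hev := htot.eventually_lt_const hJ
  filter_upwards [hev, eventually_gt_atTop (0:ℝ), hat.eventually_ge_atTop 1] with T hT hT0 ha
  rw [dist_zero_right, norm_norm]
  refine lt_of_le_of_lt ?_ hT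
  simp only [Function.comp_def]
  haveI := muT_prob hw.continuous hw0 hw_supp hw_mass hT0
  simp_rw [SL_eq h1 (hL_pos T hT0)]
  set a := Real.pi * L T with hadef
  have hγ0 : 0 ≤ γ a := by simp only [hγd]; positivity
  have key := char_bound_X (Xcut a) (one_le_Xcut (by linarith)) (cc g a) J (R := R0 / T) (by positivity)
    (μ := muT w T) (fun x hx => muT_fourier hw hw0 hw_supp hT0 x hx) (Q := 2 * a + 3) (γ := γ a) (V := V a)
    (logX_le (by linarith)) (hγ a ha) hγ0 rfl ξ
  refine (norm_sub_le_norm_sub_add_norm_sub _ (Complex.exp ((-(ξ ^ 2 * V a / 2) : ℝ) : ℂ)) _).trans ?_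
  refine add_le_add_left (key.trans ?_) _
  exact add_le_add_left (add_le_add_left (hK a ha T hT0) _) _

end

noncomputable section

lemma gauss_cdf (x : ℝ) : (ProbabilityTheory.gaussianReal 0 1 (Set.Iio x)).toReal = (1 / Real.sqrt (2 * Real.pi)) * ∫ u in Set.Iic x, exp (-u ^ 2 / 2) := by
  rw [ProbabilityTheory.gaussianReal_apply_eq_integral 0 one_ne_zero, ENNReal.toReal_ofReal (integral_nonneg fun _ => ProbabilityTheory.gaussianPDFReal_nonneg _ _ _), ← integral_Iic_eq_integral_Iio, ← integral_const_mul]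
  refine integral_congr_ae (Eventually.of_forall fun u => ?_)
  simp [ProbabilityTheory.gaussianPDFReal]

theorem clt_main
    (g : ℝ → ℝ) (hg : ContDiff ℝ 1 g) (hg_even : ∀ ξ, g (-ξ) = g ξ)
    (hg_supp : HasCompactSupport g) (hg_zero : g 0 = 1)
    (hg_sup : sSup {r : ℝ | ∃ ξ : ℝ, g ξ ≠ 0 ∧ |ξ| = r} = 1)
    (w : ℝ → ℝ) (hw : ContDiff ℝ 1 w) (hw0 : ∀ t, 0 ≤ w t)
    (hw_supp : HasCompactSupport w) (hw_mass : ∫ t : ℝ, w t = 1)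
    (L : ℝ → ℝ) (hL_pos : ∀ T : ℝ, 0 < T → 0 < L T)
    (hL_inf : Tendsto L atTop atTop)
    (hL_log : Tendsto (fun T => L T / Real.log T) atTop (nhds 0)) (x : ℝ) :
    Tendsto (fun T : ℝ =>
        (1 / T) * ∫ τ in {τ : ℝ | SL g (L T) τ / Real.sqrt (sigmaSq g (L T)) < x}, w (τ / T))
      atTop
      (nhds ((1 / Real.sqrt (2 * Real.pi)) * ∫ u in Set.Iic x, exp (-u ^ 2 / 2))) := by
  have h1 := g_vanish hg.continuous hg_supp hg_sup
  have hchar := char_conv g hg hg_even hg_supp hg_zero hg_sup w hw hw0 hw_supp hw_mass L hL_pos hL_inf hL_log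
  set Y : ℝ → ℝ → ℝ := fun T τ => SL g (L T) τ / Real.sqrt (sigmaSq g (L T)) with hY
  have hYc : ∀ T, 0 < T → Continuous (Y T) := by
    intro T hT
    have : Y T = fun τ => ∑ n ∈ Ioc 2 (Xcut (Real.pi * L T)), cc g (Real.pi * L T) n * (2 * Real.cos (τ * Real.log (Nnorm n))) := by
      ext τ; exact SL_eq h1 (hL_pos T hT) τ
    rw [this]; fun_prop
  refine tendsto_of_seq_tendsto fun u hu => ?_
  -- positive modification of the sequence
  set T : ℕ → ℝ := fun k => max (u k) 1 with hTd
  have hT0 : ∀ k, 0 < T k := fun k => lt_of_lt_of_le one_pos (le_max_right _ _)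
  have hTe : ∀ᶠ k in atTop, T k = u k := by
    filter_upwards [hu.eventually_ge_atTop 1] with k hk
    exact max_eq_left hk
  have hTt : Tendsto T atTop atTop := hu.congr' (hTe.mono fun k h => h.symm)
  have hpr : ∀ k, IsProbabilityMeasure ((muT w (T k)).map (Y (T k))) := fun k => by
    haveI := muT_prob hw.continuous hw0 hw_supp hw_mass (hT0 k)
    exact Measure.isProbabilityMeasure_map (hYc _ (hT0 k)).aemeasurable
  let ν : ℕ → ProbabilityMeasure ℝ := fun k => ⟨(muT w (T k)).map (Y (T k)), hpr k⟩
  let ν0 : ProbabilityMeasure ℝ := ⟨ProbabilityTheory.gaussianReal 0 1, inferInstance⟩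
  have hν : Tendsto ν atTop (nhds ν0) := by
    rw [ProbabilityMeasure.tendsto_iff_tendsto_charFun]
    intro ξ
    have e0 : charFun (ν0 : Measure ℝ) ξ = Complex.exp ((-(ξ ^ 2 / 2) : ℝ) : ℂ) := by
      change charFun (ProbabilityTheory.gaussianReal 0 1) ξ = _
      rw [ProbabilityTheory.charFun_gaussianReal]
      congr 1; push_cast; ring
    rw [e0]
    refine ((hchar ξ).comp hTt).congr fun k => ?_
    change _ = charFun ((muT w (T k)).map (Y (T k))) ξ
    rw [charFun_apply_real, integral_map (hYc _ (hT0 k)).aemeasurable (by fun_prop)]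
    simp only [Function.comp_def, hY]
    refine integral_congr_ae (Eventually.of_forall fun τ => ?_)
    simp only; push_cast; rfl
  have hfr : (ν0 : Measure ℝ) (frontier (Set.Iio x)) = 0 := by
    rw [frontier_Iio]
    change ProbabilityTheory.gaussianReal 0 1 {x} = 0
    exact ProbabilityTheory.gaussianReal_absolutelyContinuous 0 one_ne_zero (by simp)
  have hm := ProbabilityMeasure.tendsto_measure_of_null_frontier_of_tendsto' hν hfr
  have hm2 := (ENNReal.tendsto_toReal (measure_ne_top _ _)).comp hm
  have e1 : ((ν0 : Measure ℝ) (Set.Iio x)).toReal = (1 / Real.sqrt (2 * Real.pi)) * ∫ u in Set.Iic x, exp (-u ^ 2 / 2) := gauss_cdf x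
  rw [e1] at hm2
  refine hm2.congr' ?_
  filter_upwards [hTe] with k hk
  simp only [Function.comp_def]
  rw [← hk]
  change ((muT w (T k)).map (Y (T k)) (Set.Iio x)).toReal = _
  rw [Measure.map_apply (hYc _ (hT0 k)).measurable measurableSet_Iio, muT_apply hw.continuous hw0 hw_supp (hT0 k) ((hYc _ (hT0 k)).measurable measurableSet_Iio)]
  rfl

end

end CMD

/-- **CLT with smooth averaging** (Theorem 7, `main thm with weights`):
if `L(T) → ∞` and `L(T)/log T → 0`, then for every real `x`,
`(1/T)·∫_{{τ : S_{L(T)}(τ)/σ_{L(T)} < x}} w(τ/T) dτ` tends to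
`(1/√(2π))·∫_{−∞}^x e^{−u²/2} du`. -/
theorem clt_modular_domain_weighted
    (g : ℝ → ℝ) (hg_smooth : ContDiff ℝ (⊤ : ℕ∞) g) (hg_even : ∀ ξ, g (-ξ) = g ξ)
    (hg_supp : HasCompactSupport g) (hg_zero : g 0 = 1)
    (hg_sup : sSup {r : ℝ | ∃ ξ : ℝ, g ξ ≠ 0 ∧ |ξ| = r} = 1)
    (w : ℝ → ℝ) (hw_smooth : ContDiff ℝ (⊤ : ℕ∞) w) (hw_nonneg : ∀ t, 0 ≤ w t)
    (hw_supp : HasCompactSupport w) (hw_pos_supp : tsupport w ⊆ Set.Ioi 0)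
    (hw_mass : ∫ t : ℝ, w t = 1)
    (L : ℝ → ℝ) (hL_pos : ∀ T : ℝ, 0 < T → 0 < L T)
    (hL_inf : Tendsto L atTop atTop)
    (hL_log : Tendsto (fun T => L T / Real.log T) atTop (nhds 0))
    (x : ℝ) :
    Tendsto (fun T : ℝ =>
        (1 / T) * ∫ τ in {τ : ℝ | SL g (L T) τ / Real.sqrt (sigmaSq g (L T)) < x}, w (τ / T))
      atTop
      (nhds ((1 / Real.sqrt (2 * Real.pi)) * ∫ u in Set.Iic x, Real.exp (-u ^ 2 / 2))) := by
  exact CMD.clt_main g (hg_smooth.of_le (by exact_mod_cast le_top)) hg_even hg_supp hg_zero hg_sup w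
    (hw_smooth.of_le (by exact_mod_cast le_top)) hw_nonneg hw_supp hw_mass L hL_pos hL_inf hL_log x
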